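/- There is an absolute constant L > 0 with the following property: for every pair of coprime integers a and q with q ≥ 2 and every positive integer n, the n-th smallest rational prime p satisfying p ≡ a (mod q) exists and satisfies p ≤ q^L · n·log(2n). -/

import Mathlib

namespace Linnik

open Finset ArithmeticFunction Real
open scoped BigOperators

/-- Legendre's formula for the logarithm of the factorial. -/
theorem log_factorial_eq_sum_vonMangoldt (N : ℕ) :
    Real.log (N.factorial : ℝ) = ∑ n ∈ Icc 1 N, vonMangoldt n * ((N / n : ℕ) : ℝ) := by
  have h1 : Real.log (N.factorial : ℝ) = ∑ m ∈ Icc 1 N, Real.log m := by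
    induction N with
    | zero => simp
    | succ k ih =>
      rw [Nat.factorial_succ, Nat.cast_mul, Real.log_mul (by positivity) (by positivity), ih,
        Finset.sum_Icc_succ_top (by omega)]
      ring
  rw [h1]
  have h2 : ∀ m ∈ Icc 1 N, Real.log m = ∑ n ∈ Icc 1 N, if n ∣ m then vonMangoldt n else 0 := by
    intro m hm
    rw [mem_Icc] at hm
    rw [← vonMangoldt_sum, ← Finset.sum_filter]
    refine Finset.sum_congr ?_ fun _ _ => rfl
    ext d
    simp only [Nat.mem_divisors, mem_filter, mem_Icc]
    constructor
    · rintro ⟨h, h'⟩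
      exact ⟨⟨Nat.pos_of_dvd_of_pos h (by omega), (Nat.le_of_dvd (by omega) h).trans hm.2⟩, h⟩
    · rintro ⟨_, h⟩
      exact ⟨h, by omega⟩
  rw [Finset.sum_congr rfl h2, Finset.sum_comm]
  refine Finset.sum_congr rfl fun n hn => ?_
  rw [mem_Icc] at hn
  rw [← Finset.sum_filter, Finset.sum_const, nsmul_eq_mul, mul_comm]
  congr 2
  rw [← Nat.Ioc_filter_dvd_card_eq_div]
  rfl

theorem log_factorial_le (N : ℕ) : Real.log (N.factorial : ℝ) ≤ N * Real.log N := by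
  rcases Nat.eq_zero_or_pos N with rfl | hN
  · simp
  rw [← Real.log_pow]
  exact Real.log_le_log (by positivity) (by exact_mod_cast Nat.factorial_le_pow N)

theorem le_log_factorial (N : ℕ) : N * Real.log N - N ≤ Real.log (N.factorial : ℝ) := by
  rcases Nat.eq_zero_or_pos N with rfl | hN
  · simp
  have h : (N : ℝ) ^ N / N.factorial ≤ Real.exp N := Real.pow_div_factorial_le_exp _ (by positivity) N
  have h2 := Real.log_le_log (by positivity) h
  rw [Real.log_exp, Real.log_div (by positivity) (by positivity), Real.log_pow] at h2
  linarith

theorem sum_vonMangoldt_le (N : ℕ) : ∑ n ∈ Icc 1 N, vonMangoldt n ≤ 6 * N := by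
  have h := Chebyshev.psi_le_const_mul_self (x := N) (by positivity)
  have h4 : Real.log 4 ≤ 2 := by
    rw [show (4 : ℝ) = 2 ^ 2 by norm_num, Real.log_pow]
    have := Real.log_two_lt_d9
    push_cast; linarith
  have h' : Chebyshev.psi N = ∑ n ∈ Icc 1 N, vonMangoldt n := by
    simp [Chebyshev.psi]; rfl
  rw [h'] at h
  have : (0 : ℝ) ≤ N := by positivity
  nlinarith

/-- Mertens' first theorem with an explicit constant. -/
theorem abs_sum_vonMangoldt_div_sub_log_le (N : ℕ) (hN : 1 ≤ N) :
    |∑ n ∈ Icc 1 N, vonMangoldt n / n - Real.log N| ≤ 6 := by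
  have hN' : (0 : ℝ) < N := by exact_mod_cast hN
  have hpsi := sum_vonMangoldt_le N
  have hL := log_factorial_eq_sum_vonMangoldt N
  have hle := log_factorial_le N
  have hge := le_log_factorial N
  have up : ∑ n ∈ Icc 1 N, vonMangoldt n * ((N : ℝ) / n) ≤
      ∑ n ∈ Icc 1 N, vonMangoldt n * ((N / n : ℕ) : ℝ) + ∑ n ∈ Icc 1 N, vonMangoldt n := by
    rw [← Finset.sum_add_distrib]
    refine Finset.sum_le_sum fun n hn => ?_
    have := Nat.lt_floor_add_one ((N : ℝ) / n)
    rw [Nat.floor_div_eq_div] at this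
    have h0 : 0 ≤ vonMangoldt n := vonMangoldt_nonneg
    nlinarith
  have lo : ∑ n ∈ Icc 1 N, vonMangoldt n * ((N / n : ℕ) : ℝ) ≤
      ∑ n ∈ Icc 1 N, vonMangoldt n * ((N : ℝ) / n) := by
    refine Finset.sum_le_sum fun n hn => ?_
    exact mul_le_mul_of_nonneg_left Nat.cast_div_le vonMangoldt_nonneg
  have e : ∑ n ∈ Icc 1 N, vonMangoldt n * ((N : ℝ) / n) =
      N * ∑ n ∈ Icc 1 N, vonMangoldt n / n := by
    rw [Finset.mul_sum]
    refine Finset.sum_congr rfl fun n _ => by ring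
  rw [e] at up lo
  rw [abs_le]
  constructor
  · by_contra! hh
    nlinarith
  · by_contra! hh
    nlinarith

/-- The reciprocals of the primes between `y` and `y ^ 2` have bounded sum. -/
theorem sum_inv_primes_le (P : Finset ℕ) (hP : ∀ p ∈ P, p.Prime) (y z : ℝ) (hy : 0 ≤ y)
    (hz : z ≤ y ^ 2) (hPy : ∀ p ∈ P, y < p ∧ (p : ℝ) ≤ z) : ∑ p ∈ P, (1 : ℝ) / p ≤ 26 := by
  rcases P.eq_empty_or_nonempty with rfl | ⟨p0, hp0⟩
  · simp
  have hz2 : 2 ≤ z := le_trans (by exact_mod_cast (hP p0 hp0).two_le) (hPy p0 hp0).2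
  have hlz : Real.log 2 ≤ Real.log z := Real.log_le_log (by norm_num) hz2
  have hl2 := Real.log_two_gt_d9
  have h1 : ∀ p ∈ P, (1 : ℝ) / p ≤ 2 / Real.log z * (vonMangoldt p / p) := by
    intro p hp
    have hpp := hP p hp
    have hp0 : (0 : ℝ) < p := by exact_mod_cast hpp.pos
    rw [vonMangoldt_apply_prime hpp]
    have : Real.log z ≤ 2 * Real.log p := by
      have hh : z ≤ (p : ℝ) ^ 2 := hz.trans (pow_le_pow_left₀ hy (hPy p hp).1.le 2)
      have := Real.log_le_log (by linarith) hh
      rwa [Real.log_pow] at this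
    have hz0 : 0 < Real.log z := by linarith
    rw [div_mul_div_comm, div_le_div_iff₀ hp0 (by positivity)]
    nlinarith
  have hsub : P ⊆ Icc 1 ⌊z⌋₊ := by
    intro p hp
    rw [mem_Icc]
    exact ⟨(hP p hp).one_le, Nat.le_floor (hPy p hp).2⟩
  have hfl : 1 ≤ ⌊z⌋₊ := Nat.le_floor (by norm_num; linarith)
  calc ∑ p ∈ P, (1 : ℝ) / p ≤ ∑ p ∈ P, 2 / Real.log z * (vonMangoldt p / p) := sum_le_sum h1
    _ ≤ ∑ p ∈ Icc 1 ⌊z⌋₊, 2 / Real.log z * (vonMangoldt p / p) := by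
        refine sum_le_sum_of_subset_of_nonneg hsub fun i _ _ => ?_
        have : 0 ≤ vonMangoldt i := vonMangoldt_nonneg
        have : 0 < Real.log z := by linarith
        positivity
    _ = 2 / Real.log z * ∑ p ∈ Icc 1 ⌊z⌋₊, vonMangoldt p / p := by rw [mul_sum]
    _ ≤ 2 / Real.log z * (Real.log z + 6) := by
        have h := (abs_le.1 (abs_sum_vonMangoldt_div_sub_log_le _ hfl)).2
        have h' : Real.log ⌊z⌋₊ ≤ Real.log z :=
          Real.log_le_log (by exact_mod_cast hfl) (Nat.floor_le (by linarith))
        have : 0 < Real.log z := by linarith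
        gcongr
        linarith
    _ ≤ 26 := by
        have : 0 < Real.log z := by linarith
        rw [div_mul_eq_mul_div, div_le_iff₀ this]
        nlinarith

/-- The sum of the reciprocals of the primes up to `2 ^ 2 ^ j` is `O(j)`. -/
theorem sum_inv_primes_le_of_le_two_pow (j : ℕ) (P : Finset ℕ) (hP : ∀ p ∈ P, p.Prime)
    (h : ∀ p ∈ P, (p : ℝ) ≤ 2 ^ 2 ^ j) : ∑ p ∈ P, (1 : ℝ) / p ≤ 26 * j + 1 := by
  induction j generalizing P with
  | zero =>
    have : P ⊆ {2} := by
      intro p hp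
      have h1 := h p hp
      have h2 := (hP p hp).two_le
      norm_num at h1
      have : p ≤ 2 := by exact_mod_cast h1
      rw [mem_singleton]; omega
    calc ∑ p ∈ P, (1 : ℝ) / p ≤ ∑ p ∈ ({2} : Finset ℕ), (1 : ℝ) / p :=
          sum_le_sum_of_subset_of_nonneg this fun _ _ _ => by positivity
      _ ≤ _ := by norm_num
  | succ j ih =>
    rw [← sum_filter_add_sum_filter_not P (fun p : ℕ => (p : ℝ) ≤ 2 ^ 2 ^ j)]
    have h1 := ih (P.filter (fun p : ℕ => (p : ℝ) ≤ 2 ^ 2 ^ j))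
      (fun p hp => hP p (mem_filter.1 hp).1) (fun p hp => (mem_filter.1 hp).2)
    have h2 := sum_inv_primes_le (P.filter (fun p : ℕ => ¬ (p : ℝ) ≤ 2 ^ 2 ^ j))
      (fun p hp => hP p (mem_filter.1 hp).1) (2 ^ 2 ^ j) (2 ^ 2 ^ (j + 1)) (by positivity)
      (by rw [← pow_mul, pow_succ])
      (fun p hp => ⟨not_le.1 (mem_filter.1 hp).2, h p (mem_filter.1 hp).1⟩)
    push_cast
    linarith

theorem exists_two_pow_two_pow (z : ℝ) (hz : 2 ≤ z) :
    ∃ j : ℕ, z ≤ 2 ^ 2 ^ j ∧ (2 : ℝ) ^ j ≤ 4 * Real.log z := by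
  have hl2 := Real.log_two_gt_d9
  have hl2' := Real.log_two_lt_d9
  have hlz : Real.log 2 ≤ Real.log z := Real.log_le_log (by norm_num) hz
  have hz0 : 0 < Real.log z := by linarith
  have h1 : (1 : ℝ) ≤ Real.log z / Real.log 2 := by rw [le_div_iff₀ (by linarith)]; linarith
  obtain ⟨n, hn1, hn2⟩ := exists_nat_pow_near h1 (by norm_num : (1 : ℝ) < 2)
  refine ⟨n + 1, ?_, ?_⟩
  · rw [div_lt_iff₀ (by linarith)] at hn2
    have : Real.log z ≤ Real.log (2 ^ 2 ^ (n + 1)) := by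
      rw [Real.log_pow]; push_cast; linarith
    exact (Real.log_le_log_iff (by linarith) (by positivity)).1 this
  · rw [le_div_iff₀ (by linarith)] at hn1
    rw [pow_succ]
    have : (0 : ℝ) < 2 ^ n := by positivity
    nlinarith

theorem exp_neg_two_mul_le (x : ℝ) (h0 : 0 ≤ x) (h1 : x ≤ 3 / 4) : Real.exp (-(2 * x)) ≤ 1 - x := by
  have hc := convexOn_exp.2 (Set.mem_univ (0 : ℝ)) (Set.mem_univ (-(3 / 2 : ℝ)))
    (show 0 ≤ 1 - 4 / 3 * x by linarith) (show 0 ≤ 4 / 3 * x by linarith) (by ring)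
  simp only [smul_eq_mul, mul_zero, zero_add, Real.exp_zero, mul_one] at hc
  have he : Real.exp (-(3 / 2 : ℝ)) ≤ 1 / 4 := by
    rw [Real.exp_neg, one_div]
    refine inv_anti₀ (by norm_num) ?_
    have h1 := Real.exp_one_gt_d9
    have h2 : Real.exp (3 / 2) ^ 2 = Real.exp 1 ^ 3 := by
      rw [← Real.exp_nat_mul, ← Real.exp_nat_mul]; norm_num
    have h3 : (2.7 : ℝ) ^ 3 ≤ Real.exp 1 ^ 3 := pow_le_pow_left₀ (by norm_num) (by linarith) 3
    by_contra! hh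
    have := Real.exp_pos (3 / 2)
    nlinarith
  rw [show (4 / 3 * x * -(3 / 2 : ℝ)) = -(2 * x) by ring] at hc
  nlinarith

theorem exp_neg_le_prod_one_sub (A : Finset ℕ) (g : ℕ → ℝ) (hg : ∀ p ∈ A, 0 ≤ g p ∧ g p ≤ 3 / 4)
    (L : ℝ) (hL : ∑ p ∈ A, g p ≤ L) : Real.exp (-(2 * L)) ≤ ∏ p ∈ A, (1 - g p) := by
  calc Real.exp (-(2 * L)) ≤ Real.exp (∑ p ∈ A, -(2 * g p)) := by
        rw [Real.exp_le_exp, sum_neg_distrib, neg_le_neg_iff, ← Finset.mul_sum]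
        linarith
    _ = ∏ p ∈ A, Real.exp (-(2 * g p)) := Real.exp_sum _ _
    _ ≤ _ := prod_le_prod (fun _ _ => (Real.exp_pos _).le)
        fun p hp => exp_neg_two_mul_le _ (hg p hp).1 (hg p hp).2

/-- A product of factors `1 - g p` with `g p = O(1 / p)` is at least a negative power of the
logarithm. -/
theorem le_prod_one_sub (P : Finset ℕ) (hP : ∀ p ∈ P, p.Prime) (z : ℝ) (hz : 2 ≤ z)
    (hPz : ∀ p ∈ P, (p : ℝ) ≤ z) (g : ℕ → ℝ) (hg0 : ∀ p ∈ P, 0 ≤ g p)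
    (hg1 : ∀ p ∈ P, g p ≤ 3 / 4) (hg2 : ∀ p ∈ P, g p ≤ 2 / p) :
    Real.exp (-4) * (4 * Real.log z) ^ (-(160 : ℝ)) ≤ ∏ p ∈ P, (1 - g p) := by
  obtain ⟨j, hj1, hj2⟩ := exists_two_pow_two_pow z hz
  have hS := sum_inv_primes_le_of_le_two_pow j P hP (fun p hp => (hPz p hp).trans hj1)
  have h1 : Real.exp (-(2 * (2 * (26 * j + 1)))) ≤ ∏ p ∈ P, (1 - g p) := by
    refine exp_neg_le_prod_one_sub P g (fun p hp => ⟨hg0 p hp, hg1 p hp⟩) _ ?_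
    have : ∑ p ∈ P, g p ≤ ∑ p ∈ P, 2 * ((1 : ℝ) / p) :=
      sum_le_sum fun p hp => (hg2 p hp).trans (by rw [mul_one_div])
    rw [← mul_sum] at this
    linarith
  refine le_trans ?_ h1
  have hlz : Real.log 2 ≤ Real.log z := Real.log_le_log (by norm_num) hz
  have hl2 := Real.log_two_gt_d9
  have hb : (0 : ℝ) < 4 * Real.log z := by linarith
  have h2 : (4 * Real.log z) ^ (-(160 : ℝ)) ≤ ((2 : ℝ) ^ j) ^ (-(160 : ℝ)) :=
    Real.rpow_le_rpow_of_nonpos (by positivity) hj2 (by norm_num)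
  have h3 : ((2 : ℝ) ^ j) ^ (-(160 : ℝ)) ≤ Real.exp (-(104 * j)) := by
    rw [Real.rpow_def_of_pos (by positivity), Real.log_pow, Real.exp_le_exp]
    have : (0 : ℝ) ≤ j := by positivity
    nlinarith
  calc _ ≤ Real.exp (-4) * Real.exp (-(104 * j)) := by gcongr; exact h2.trans h3
    _ = _ := by rw [← Real.exp_add]; ring_nf

/-- A lower bound for Mertens' product. -/
theorem prod_one_sub_inv_primes_le (N : ℕ) (hN : 2 ≤ N) :
    ∏ p ∈ (Icc 1 N).filter Nat.Prime, (1 - (1 : ℝ) / p) ≤ 1 / Real.log N := by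
  have hlog : 0 < Real.log N := Real.log_pos (by exact_mod_cast hN)
  let f : ℕ →* ℝ :=
    { toFun := fun n => (n : ℝ)⁻¹
      map_one' := by simp
      map_mul' := fun a b => by push_cast; rw [mul_inv] }
  have hf : ∀ {p : ℕ}, p.Prime → ‖f p‖ < 1 := by
    intro p hp
    change ‖(p : ℝ)⁻¹‖ < 1
    rw [norm_inv, RCLike.norm_natCast]
    exact inv_lt_one_of_one_lt₀ (by exact_mod_cast hp.one_lt)
  have hE := (EulerProduct.summable_and_hasSum_factoredNumbers_prod_filter_prime_geometric
    (f := f) hf (Icc 1 N)).2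
  have hE' := hasSum_subtype_iff_indicator.1 hE
  have h1 := sum_le_hasSum (Icc 1 N) (fun i _ => Set.indicator_nonneg
    (fun n _ => by change (0 : ℝ) ≤ (n : ℝ)⁻¹; positivity) i) hE'
  have h2 : Real.log N ≤ ∏ p ∈ (Icc 1 N).filter Nat.Prime, (1 - f p)⁻¹ := by
    refine le_trans ?_ h1
    have h3 := log_add_one_le_harmonic N
    rw [harmonic_eq_sum_Icc] at h3
    push_cast at h3
    refine le_trans (Real.log_le_log (by positivity) (by linarith)) (h3.trans (le_of_eq ?_))
    refine sum_congr rfl fun n hn => ?_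
    rw [mem_Icc] at hn
    rw [Set.indicator_of_mem]
    · rfl
    · rw [Nat.mem_factoredNumbers']
      intro p hp hpn
      exact mem_Icc.2 ⟨hp.one_le, (Nat.le_of_dvd hn.1 hpn).trans hn.2⟩
  rw [prod_inv_distrib] at h2
  have h4 : ∏ p ∈ (Icc 1 N).filter Nat.Prime, (1 - (1 : ℝ) / p) =
      ∏ p ∈ (Icc 1 N).filter Nat.Prime, (1 - f p) := by
    refine prod_congr rfl fun p _ => ?_
    rw [one_div]
    rfl
  rw [h4, one_div]
  exact (le_inv_comm₀ hlog (inv_pos.1 (hlog.trans_le h2))).1 h2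

/-- The elementary symmetric sum of degree `m` of the weights `w p`, `p ∈ A`. -/
noncomputable def esum (A : Finset ℕ) (m : ℕ) (w : ℕ → ℝ) : ℝ :=
  ∑ s ∈ A.powersetCard m, ∏ p ∈ s, w p

/-- The inclusion-exclusion expansion of `∏ p ∈ A, (1 - w p)` truncated to `b` terms. -/
noncomputable def bonferroni (A : Finset ℕ) (b : ℕ) (w : ℕ → ℝ) : ℝ :=
  ∑ i ∈ range b, (-1) ^ i * esum A i w

theorem esum_zero (A : Finset ℕ) (w : ℕ → ℝ) : esum A 0 w = 1 := by simp [esum]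

theorem esum_empty_succ (m : ℕ) (w : ℕ → ℝ) : esum ∅ (m + 1) w = 0 := by
  rw [esum, powersetCard_eq_empty.2 (by simp), sum_empty]

theorem esum_insert (A : Finset ℕ) (q : ℕ) (hq : q ∉ A) (m : ℕ) (w : ℕ → ℝ) :
    esum (insert q A) (m + 1) w = esum A (m + 1) w + w q * esum A m w := by
  unfold esum
  rw [powersetCard_succ_insert hq, sum_union, sum_image, mul_sum]
  · congr 1
    refine sum_congr rfl fun s hs => ?_
    rw [prod_insert]
    exact fun h => hq ((mem_powersetCard.1 hs).1 h)
  · intro s hs t ht h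
    have hs' : q ∉ s := fun h => hq ((mem_powersetCard.1 hs).1 h)
    have ht' : q ∉ t := fun h => hq ((mem_powersetCard.1 ht).1 h)
    rw [← erase_insert hs', ← erase_insert ht', h]
  · rw [disjoint_left]
    intro s hs hs'
    obtain ⟨t, _, rfl⟩ := mem_image.1 hs'
    exact hq ((mem_powersetCard.1 hs).1 (mem_insert_self q t))

theorem esum_nonneg (A : Finset ℕ) (m : ℕ) (w : ℕ → ℝ) (hw : ∀ p ∈ A, 0 ≤ w p) :
    0 ≤ esum A m w :=
  sum_nonneg fun _ hs => prod_nonneg fun p hp => hw p ((mem_powersetCard.1 hs).1 hp)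

theorem esum_mul_pow_le (A : Finset ℕ) (w : ℕ → ℝ) (hw : ∀ p ∈ A, 0 ≤ w p) (t : ℝ) (ht : 0 ≤ t)
    (m : ℕ) : esum A m w * t ^ m ≤ ∏ p ∈ A, (1 + t * w p) := by
  induction A using Finset.induction generalizing m with
  | empty =>
    rcases m with _ | m
    · simp [esum_zero]
    · simp [esum_empty_succ]
  | insert q A hq ih =>
    have hw' : ∀ p ∈ A, 0 ≤ w p := fun p hp => hw p (mem_insert_of_mem hp)
    have hq0 : 0 ≤ w q := hw q (mem_insert_self _ _)
    rw [prod_insert hq]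
    have h0 : (0 : ℝ) ≤ t * w q := by positivity
    rcases m with _ | m
    · have := ih hw' 0
      rw [esum_zero] at this ⊢
      nlinarith
    · rw [esum_insert A q hq]
      have h1 := ih hw' (m + 1)
      have h2 := mul_le_mul_of_nonneg_left (ih hw' m) h0
      rw [pow_succ] at h1 ⊢
      linarith

theorem sum_esum_le (A : Finset ℕ) (w : ℕ → ℝ) (hw : ∀ p ∈ A, 0 ≤ w p) (k : ℕ) :
    ∑ i ∈ range (k + 1), esum A i w ≤ (1 + ∑ p ∈ A, w p) ^ k := by
  induction A using Finset.induction generalizing k with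
  | empty => simp [sum_range_succ', esum_zero, esum_empty_succ]
  | insert q A hq ih =>
    have hw' : ∀ p ∈ A, 0 ≤ w p := fun p hp => hw p (mem_insert_of_mem hp)
    have hq0 : 0 ≤ w q := hw q (mem_insert_self _ _)
    have hS : 0 ≤ ∑ p ∈ A, w p := sum_nonneg hw'
    rcases k with _ | k
    · simp [esum_zero]
    · rw [sum_range_succ', sum_insert hq]
      simp_rw [esum_insert A q hq, esum_zero]
      rw [sum_add_distrib, ← mul_sum]
      have h1 := ih hw' (k + 1)
      rw [sum_range_succ', esum_zero] at h1
      have h2 := mul_le_mul_of_nonneg_left (ih hw' k) hq0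
      have h3 : (1 + ∑ p ∈ A, w p) ^ k ≤ (1 + (w q + ∑ p ∈ A, w p)) ^ k := by
        gcongr; linarith
      rw [pow_succ] at h1 ⊢
      nlinarith [mul_le_mul_of_nonneg_right h3
        (show 0 ≤ (1 + (w q + ∑ p ∈ A, w p)) by linarith)]

theorem bonferroni_insert (A : Finset ℕ) (q : ℕ) (hq : q ∉ A) (b : ℕ) (w : ℕ → ℝ) :
    bonferroni (insert q A) (b + 1) w = bonferroni A (b + 1) w - w q * bonferroni A b w := by
  unfold bonferroni
  rw [sum_range_succ', sum_range_succ']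
  simp_rw [esum_insert A q hq, esum_zero]
  simp_rw [mul_add]
  rw [sum_add_distrib, mul_sum]
  have : ∑ i ∈ range b, (-1 : ℝ) ^ (i + 1) * (w q * esum A i w) =
      - ∑ i ∈ range b, w q * ((-1) ^ i * esum A i w) := by
    rw [← sum_neg_distrib]
    exact sum_congr rfl fun i _ => by ring
  rw [this]
  ring

theorem bonferroni_sign (A : Finset ℕ) (w : ℕ → ℝ) (hw : ∀ p ∈ A, 0 ≤ w p ∧ w p ≤ 1) (b : ℕ) :
    0 ≤ (-1) ^ (b + 1) * (bonferroni A b w - ∏ p ∈ A, (1 - w p)) := by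
  induction A using Finset.induction generalizing b with
  | empty =>
    rcases b with _ | b
    · simp [bonferroni]
    · simp [bonferroni, sum_range_succ', esum_zero, esum_empty_succ]
  | insert q A hq ih =>
    have hw' : ∀ p ∈ A, 0 ≤ w p ∧ w p ≤ 1 := fun p hp => hw p (mem_insert_of_mem hp)
    have hq0 := hw q (mem_insert_self _ _)
    rw [prod_insert hq]
    rcases b with _ | b
    · have : 0 ≤ ∏ p ∈ A, (1 - w p) := prod_nonneg fun p hp => by linarith [(hw' p hp).2]
      simp only [bonferroni, range_zero, sum_empty, zero_add, pow_one]
      have := mul_nonneg (sub_nonneg.2 hq0.2) this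
      linarith
    · rw [bonferroni_insert A q hq]
      have h1 := ih hw' (b + 1)
      have h2 := mul_nonneg hq0.1 (ih hw' b)
      rw [pow_succ] at h1 ⊢
      nlinarith

/-- Bonferroni's inequalities for a truncation to an odd number of terms. -/
theorem bonferroni_bounds (A : Finset ℕ) (w : ℕ → ℝ) (hw : ∀ p ∈ A, 0 ≤ w p ∧ w p ≤ 1) (b : ℕ)
    (hb : Odd b) : ∏ p ∈ A, (1 - w p) ≤ bonferroni A b w ∧
      bonferroni A b w - esum A b w ≤ ∏ p ∈ A, (1 - w p) := by
  have h1 := bonferroni_sign A w hw b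
  have h2 := bonferroni_sign A w hw (b + 1)
  rw [hb.add_one.neg_one_pow] at h1
  rw [hb.add_one.add_one.neg_one_pow] at h2
  have h3 : bonferroni A (b + 1) w = bonferroni A b w - esum A b w := by
    unfold bonferroni
    rw [sum_range_succ, hb.neg_one_pow]
    ring
  rw [h3] at h2
  constructor <;> linarith

/-- The indicator of divisibility of `n` by `p`. -/
noncomputable def dvdInd (n p : ℕ) : ℝ := if p ∣ n then 1 else 0

theorem dvdInd_bounds (n p : ℕ) : 0 ≤ dvdInd n p ∧ dvdInd n p ≤ 1 := by
  unfold dvdInd; split_ifs <;> norm_num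

/-- `F` has density `M` along the sieve on the primes of `U`, with error `R`. -/
def HasLevel (N : Finset ℕ) (a : ℕ → ℝ) (X E : ℝ) (g : ℕ → ℝ) (U : Finset ℕ) (F : ℕ → ℝ)
    (M R : ℝ) : Prop :=
  ∀ s ⊆ U, |∑ n ∈ N, a n * F n * ∏ p ∈ s, dvdInd n p - X * M * ∏ p ∈ s, g p| ≤
    E * R * (∏ p ∈ s, (p : ℝ)) ^ 2

section
variable {N : Finset ℕ} {a : ℕ → ℝ} {X E : ℝ} {g : ℕ → ℝ} {U : Finset ℕ}

theorem HasLevel.mono {F : ℕ → ℝ} {M R R' : ℝ} (h : HasLevel N a X E g U F M R) (hE : 0 ≤ E)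
    (hR : R ≤ R') {U' : Finset ℕ} (hU : U' ⊆ U) : HasLevel N a X E g U' F M R' := by
  intro s hs
  refine (h s (hs.trans hU)).trans ?_
  gcongr

theorem HasLevel.sub {F F' : ℕ → ℝ} {M M' R R' : ℝ} (h : HasLevel N a X E g U F M R)
    (h' : HasLevel N a X E g U F' M' R') :
    HasLevel N a X E g U (fun n => F n - F' n) (M - M') (R + R') := by
  intro s hs
  have h1 := h s hs
  have h2 := h' s hs
  have : ∑ n ∈ N, a n * (F n - F' n) * ∏ p ∈ s, dvdInd n p - X * (M - M') * ∏ p ∈ s, g p =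
      (∑ n ∈ N, a n * F n * ∏ p ∈ s, dvdInd n p - X * M * ∏ p ∈ s, g p) -
      (∑ n ∈ N, a n * F' n * ∏ p ∈ s, dvdInd n p - X * M' * ∏ p ∈ s, g p) := by
    simp_rw [mul_sub, sub_mul]
    rw [sum_sub_distrib]
    ring
  rw [this]
  refine (abs_sub _ _).trans ?_
  linarith

theorem HasLevel.mul_sum {F : ℕ → ℝ} {M R : ℝ} (h : HasLevel N a X E g U F M R)
    (A U' : Finset ℕ) (hA : A ⊆ U) (hU' : U' ⊆ U) (hd : Disjoint A U') (T : Finset (Finset ℕ))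
    (hT : ∀ s ∈ T, s ⊆ A) (c : Finset ℕ → ℝ) (hc : ∀ s, |c s| ≤ 1) :
    HasLevel N a X E g U' (fun n => F n * ∑ t ∈ T, c t * ∏ p ∈ t, dvdInd n p)
      (M * ∑ t ∈ T, c t * ∏ p ∈ t, g p) (R * ∑ t ∈ T, (∏ p ∈ t, (p : ℝ)) ^ 2) := by
  intro s hs
  have hdis : ∀ t ∈ T, Disjoint t s := fun t ht => disjoint_of_subset_left (hT t ht)
    (disjoint_of_subset_right hs hd)
  have e : ∑ n ∈ N, a n * (F n * ∑ t ∈ T, c t * ∏ p ∈ t, dvdInd n p) * ∏ p ∈ s, dvdInd n p -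
      X * (M * ∑ t ∈ T, c t * ∏ p ∈ t, g p) * ∏ p ∈ s, g p =
      ∑ t ∈ T, c t * (∑ n ∈ N, a n * F n * ∏ p ∈ t ∪ s, dvdInd n p -
        X * M * ∏ p ∈ t ∪ s, g p) := by
    simp_rw [Finset.mul_sum, sum_mul, mul_sub, sum_sub_distrib, Finset.mul_sum]
    rw [sum_comm]
    congr 1
    · refine sum_congr rfl fun t ht => sum_congr rfl fun n _ => ?_
      rw [prod_union (hdis t ht)]
      ring
    · refine sum_congr rfl fun t ht => ?_
      rw [prod_union (hdis t ht)]
      ring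
  rw [e]
  refine (abs_sum_le_sum_abs _ _).trans ?_
  rw [Finset.mul_sum, Finset.mul_sum, sum_mul]
  refine sum_le_sum fun t ht => ?_
  rw [abs_mul]
  have h1 := h (t ∪ s) (union_subset ((hT t ht).trans hA) (hs.trans hU'))
  rw [prod_union (hdis t ht) (f := fun p : ℕ => (p : ℝ))] at h1
  calc _ ≤ 1 * _ := mul_le_mul_of_nonneg_right (hc t) (abs_nonneg _)
    _ ≤ _ := by rw [one_mul]; exact h1.trans (le_of_eq (by ring))

theorem HasLevel.mul_esum {F : ℕ → ℝ} {M R : ℝ} (h : HasLevel N a X E g U F M R)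
    (A U' : Finset ℕ) (hA : A ⊆ U) (hU' : U' ⊆ U) (hd : Disjoint A U') (b : ℕ) :
    HasLevel N a X E g U' (fun n => F n * esum A b (dvdInd n))
      (M * esum A b g) (R * esum A b (fun p => (p : ℝ) ^ 2)) := by
  have := h.mul_sum A U' hA hU' hd (A.powersetCard b) (fun s hs => (mem_powersetCard.1 hs).1)
    (fun _ => 1) (by simp)
  simpa [esum, prod_pow] using this

theorem HasLevel.mul_bonferroni {F : ℕ → ℝ} {M R : ℝ} (h : HasLevel N a X E g U F M R)
    (A U' : Finset ℕ) (hA : A ⊆ U) (hU' : U' ⊆ U) (hd : Disjoint A U') (b : ℕ) :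
    HasLevel N a X E g U' (fun n => F n * bonferroni A b (dvdInd n))
      (M * bonferroni A b g) (R * ∑ i ∈ range b, esum A i (fun p => (p : ℝ) ^ 2)) := by
  have hpd : ((range b : Finset ℕ) : Set ℕ).PairwiseDisjoint (fun i => A.powersetCard i) :=
    fun i _ j _ hij => pairwise_disjoint_powersetCard A hij
  have := h.mul_sum A U' hA hU' hd ((range b).biUnion fun i => A.powersetCard i)
    (fun s hs => by
      obtain ⟨i, _, hi⟩ := mem_biUnion.1 hs
      exact (mem_powersetCard.1 hi).1)
    (fun s => (-1) ^ s.card) (by simp)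
  have e : ∀ w : ℕ → ℝ, ∑ t ∈ (range b).biUnion (fun i => A.powersetCard i),
      (-1) ^ t.card * ∏ p ∈ t, w p = bonferroni A b w := by
    intro w
    rw [sum_biUnion hpd]
    unfold bonferroni esum
    refine sum_congr rfl fun i _ => ?_
    rw [Finset.mul_sum]
    refine sum_congr rfl fun s hs => ?_
    rw [(mem_powersetCard.1 hs).2]
  simp_rw [e] at this
  rw [sum_biUnion hpd] at this
  simpa [esum, prod_pow] using this

end

theorem esum_le_exp (A : Finset ℕ) (w : ℕ → ℝ) (hw : ∀ p ∈ A, 0 ≤ w p) (t L : ℝ) (ht : 0 < t)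
    (hL : ∑ p ∈ A, w p ≤ L) (m : ℕ) : esum A m w ≤ Real.exp (t * L) / t ^ m := by
  rw [le_div_iff₀ (by positivity)]
  refine (esum_mul_pow_le A w hw t ht.le m).trans ?_
  calc ∏ p ∈ A, (1 + t * w p) ≤ ∏ p ∈ A, Real.exp (t * w p) :=
        prod_le_prod (fun p hp => by have := hw p hp; positivity)
          fun p _ => by rw [add_comm]; exact Real.add_one_le_exp _
    _ = Real.exp (t * ∑ p ∈ A, w p) := by rw [← Real.exp_sum, Finset.mul_sum]
    _ ≤ _ := by rw [Real.exp_le_exp]; gcongr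

theorem sum_sq_le (A : Finset ℕ) (hA : ∀ p ∈ A, 2 ≤ p) (y : ℝ) (hy : 1 ≤ y)
    (hAy : ∀ p ∈ A, (p : ℝ) ≤ y) : 1 + ∑ p ∈ A, (p : ℝ) ^ 2 ≤ y ^ 3 := by
  have h1 : 1 ∉ A := fun h => by have := hA 1 h; omega
  have h2 : insert 1 A ⊆ Icc 1 ⌊y⌋₊ := by
    intro p hp
    rw [mem_insert] at hp
    rw [mem_Icc]
    rcases hp with rfl | hp
    · exact ⟨le_rfl, Nat.le_floor (by simpa using hy)⟩
    · exact ⟨by have := hA p hp; omega, Nat.le_floor (hAy p hp)⟩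
  have h3 : 1 + ∑ p ∈ A, (p : ℝ) ^ 2 = ∑ p ∈ insert 1 A, (p : ℝ) ^ 2 := by
    rw [sum_insert h1]; simp
  rw [h3]
  calc ∑ p ∈ insert 1 A, (p : ℝ) ^ 2 ≤ ∑ p ∈ Icc 1 ⌊y⌋₊, (p : ℝ) ^ 2 :=
        sum_le_sum_of_subset_of_nonneg h2 fun _ _ _ => by positivity
    _ ≤ ∑ p ∈ Icc 1 ⌊y⌋₊, y ^ 2 := by
        refine sum_le_sum fun p hp => ?_
        have : (p : ℝ) ≤ y := (Nat.le_floor_iff (by linarith)).1 (mem_Icc.1 hp).2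
        gcongr
    _ = ⌊y⌋₊ * y ^ 2 := by simp
    _ ≤ y ^ 3 := by
        have := Nat.floor_le (show 0 ≤ y by linarith)
        nlinarith [sq_nonneg y]

/-- One step of Hooley's induction over blocks of primes. -/
theorem sieve_main_step {V V' B e Mp Mm Pi d : ℝ} (hV : 0 ≤ V) (hV' : 0 ≤ V') (hd : 0 ≤ d)
    (hPi : 1 ≤ Pi) (hB1 : V' ≤ B) (hB2 : B ≤ V' * (1 + d)) (he0 : 0 ≤ e) (he : e ≤ V' * d)
    (hMp1 : V ≤ Mp) (hMp2 : Mp ≤ V * Pi) (hMm : V * (2 - Pi) ≤ Mm) :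
    V * V' ≤ Mp * B ∧ Mp * B ≤ V * V' * (Pi * (1 + 2 * d)) ∧
      V * V' * (2 - Pi * (1 + 2 * d)) ≤ Mm * B - Mp * e := by
  have hB0 : 0 ≤ B := hV'.trans hB1
  have hMp0 : 0 ≤ Mp := hV.trans hMp1
  have hVV : 0 ≤ V * V' := mul_nonneg hV hV'
  refine ⟨mul_le_mul hMp1 hB1 hV' hMp0, ?_, ?_⟩
  · calc Mp * B ≤ (V * Pi) * (V' * (1 + d)) := mul_le_mul hMp2 hB2 hB0 (by positivity)
      _ ≤ _ := by nlinarith [mul_nonneg (mul_nonneg hVV (zero_le_one.trans hPi)) hd]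
  · have h1 : Mp * e ≤ (V * Pi) * (V' * d) := mul_le_mul hMp2 he he0 (by positivity)
    have h2 : V * (2 - Pi) * B ≤ Mm * B := mul_le_mul_of_nonneg_right hMm hB0
    have h3 : V * V' * (2 - Pi - Pi * d) ≤ V * (2 - Pi) * B := by
      rcases le_total Pi 2 with h | h
      · have : V * (2 - Pi) * V' ≤ V * (2 - Pi) * B :=
          mul_le_mul_of_nonneg_left hB1 (mul_nonneg hV (by linarith))
        nlinarith [mul_nonneg (mul_nonneg hVV (zero_le_one.trans hPi)) hd]
      · have : V * (Pi - 2) * B ≤ V * (Pi - 2) * (V' * (1 + d)) :=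
          mul_le_mul_of_nonneg_left hB2 (mul_nonneg hV (by linarith))
        nlinarith [mul_nonneg hVV hd]
    nlinarith

/-- The points `z ^ (1 / 2 ^ j)` cutting the sieving range into blocks. -/
noncomputable def cutPoint (z : ℝ) (j : ℕ) : ℝ := Real.exp (Real.log z / 2 ^ j)

theorem cutPoint_zero {z : ℝ} (hz : 0 < z) : cutPoint z 0 = z := by
  simp [cutPoint, Real.exp_log hz]

theorem cutPoint_succ_sq (z : ℝ) (j : ℕ) : cutPoint z (j + 1) ^ 2 = cutPoint z j := by
  unfold cutPoint
  rw [← Real.exp_nat_mul]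
  congr 1
  rw [pow_succ]
  field_simp
  push_cast
  ring

theorem one_le_cutPoint {z : ℝ} (hz : 1 ≤ z) (j : ℕ) : 1 ≤ cutPoint z j :=
  Real.one_le_exp (div_nonneg (Real.log_nonneg hz) (by positivity))

theorem cutPoint_succ_le {z : ℝ} (hz : 1 ≤ z) (j : ℕ) : cutPoint z (j + 1) ≤ cutPoint z j := by
  have h1 := one_le_cutPoint hz (j + 1)
  have h2 := cutPoint_succ_sq z j
  nlinarith

theorem sum_esum_sq_le {z : ℝ} (hz : 1 ≤ z) (A : Finset ℕ) (k m : ℕ) (hA : ∀ p ∈ A, 2 ≤ p)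
    (hAz : ∀ p ∈ A, (p : ℝ) ≤ cutPoint z k) :
    ∑ i ∈ range (m + 1), esum A i (fun p => (p : ℝ) ^ 2) ≤
      Real.exp (3 * (m * (Real.log z / 2 ^ k))) := by
  have h1 := sum_esum_le A (fun p : ℕ => (p : ℝ) ^ 2) (fun p _ => by positivity) m
  have h2 := sum_sq_le A hA (cutPoint z k) (one_le_cutPoint hz k) hAz
  have h3 : (cutPoint z k ^ 3) ^ m = Real.exp (3 * (m * (Real.log z / 2 ^ k))) := by
    unfold cutPoint
    rw [← pow_mul, ← Real.exp_nat_mul]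
    congr 1
    push_cast
    ring
  rw [← h3]
  refine h1.trans (pow_le_pow_left₀ ?_ h2 m)
  have : 0 ≤ ∑ p ∈ A, (p : ℝ) ^ 2 := sum_nonneg fun p _ => by positivity
  linarith

section
variable {N : Finset ℕ} {a : ℕ → ℝ} {X E : ℝ} {g : ℕ → ℝ} {P : Finset ℕ} {z t : ℝ} {b : ℕ}

set_option maxHeartbeats 1000000 in
/-- The state of Hooley's induction after `k` blocks. -/
theorem exists_hooley_bounds (hz : 2 ≤ z) (hP : ∀ p ∈ P, p.Prime) (hPz : ∀ p ∈ P, (p : ℝ) ≤ z)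
    (hg : ∀ p ∈ P, 0 ≤ g p ∧ g p ≤ 3 / 4) (hg2 : ∀ p ∈ P, g p ≤ 2 / p) (ht : 2 ≤ t) (hE : 0 ≤ E)
    (h : HasLevel N a X E g P (fun _ => 1) 1 1) (k : ℕ) :
    ∃ (Fp Fm : ℕ → ℝ) (Mp Mm : ℝ),
      HasLevel N a X E g (P.filter (fun p : ℕ => (p : ℝ) ≤ cutPoint z k)) Fp Mp
        (Real.exp (3 * ∑ j ∈ range k, ((2 * b + 1 + 2 * j : ℕ) : ℝ) * (Real.log z / 2 ^ j))) ∧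
      HasLevel N a X E g (P.filter (fun p : ℕ => (p : ℝ) ≤ cutPoint z k)) Fm Mm ((k + 1) *
        Real.exp (3 * ∑ j ∈ range k, ((2 * b + 1 + 2 * j : ℕ) : ℝ) * (Real.log z / 2 ^ j))) ∧
      (∀ n, Fm n ≤ ∏ p ∈ P.filter (fun p : ℕ => ¬ (p : ℝ) ≤ cutPoint z k), (1 - dvdInd n p)) ∧
      (∀ n, ∏ p ∈ P.filter (fun p : ℕ => ¬ (p : ℝ) ≤ cutPoint z k), (1 - dvdInd n p) ≤ Fp n) ∧
      ∏ p ∈ P.filter (fun p : ℕ => ¬ (p : ℝ) ≤ cutPoint z k), (1 - g p) ≤ Mp ∧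
      Mp ≤ (∏ p ∈ P.filter (fun p : ℕ => ¬ (p : ℝ) ≤ cutPoint z k), (1 - g p)) *
        Real.exp (2 * (Real.exp (52 * t + 104) * ∑ j ∈ range k, 1 / t ^ (2 * b + 1 + 2 * j))) ∧
      (∏ p ∈ P.filter (fun p : ℕ => ¬ (p : ℝ) ≤ cutPoint z k), (1 - g p)) *
        (2 - Real.exp (2 * (Real.exp (52 * t + 104) *
          ∑ j ∈ range k, 1 / t ^ (2 * b + 1 + 2 * j)))) ≤ Mm := by
  induction k with
  | zero =>
    have e1 : P.filter (fun p : ℕ => (p : ℝ) ≤ cutPoint z 0) = P := by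
      rw [cutPoint_zero (by linarith)]
      exact filter_true_of_mem hPz
    have e2 : P.filter (fun p : ℕ => ¬ (p : ℝ) ≤ cutPoint z 0) = ∅ := by
      rw [cutPoint_zero (by linarith)]
      exact filter_false_of_mem fun p hp => not_not.2 (hPz p hp)
    rw [e1, e2]
    refine ⟨fun _ => 1, fun _ => 1, 1, 1, ?_, ?_, ?_⟩
    · simpa using h
    · simpa using h
    · norm_num
  | succ k ih =>
    obtain ⟨Fp, Fm, Mp, Mm, h1, h2, h3, h4, h5, h6, h7⟩ := ih
    set U := P.filter (fun p : ℕ => (p : ℝ) ≤ cutPoint z k) with hU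
    set U' := P.filter (fun p : ℕ => (p : ℝ) ≤ cutPoint z (k + 1)) with hU'
    set D := P.filter (fun p : ℕ => ¬ (p : ℝ) ≤ cutPoint z k) with hD
    set D' := P.filter (fun p : ℕ => ¬ (p : ℝ) ≤ cutPoint z (k + 1)) with hD'
    set A := U \ U' with hA
    have hle := cutPoint_succ_le (show 1 ≤ z by linarith) k
    have hUU : U' ⊆ U := fun p hp => by
      rw [hU', mem_filter] at hp
      rw [hU, mem_filter]
      exact ⟨hp.1, hp.2.trans hle⟩
    have hdis : Disjoint A U' := sdiff_disjoint
    have hAU : A ⊆ U := sdiff_subset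
    have hmA : ∀ p ∈ A, p ∈ P ∧ (p : ℝ) ≤ cutPoint z k ∧ cutPoint z (k + 1) < p := by
      intro p hp
      rw [hA, mem_sdiff, hU, hU', mem_filter, mem_filter] at hp
      exact ⟨hp.1.1, hp.1.2, not_le.1 fun h => hp.2 ⟨hp.1.1, h⟩⟩
    have hDA : D' = D ∪ A := by
      ext p
      simp only [hD', hD, hA, hU, hU', mem_union, mem_sdiff, mem_filter]
      constructor
      · rintro ⟨ha, hb⟩
        by_cases hc : (p : ℝ) ≤ cutPoint z k
        · exact Or.inr ⟨⟨ha, hc⟩, fun hh => hb hh.2⟩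
        · exact Or.inl ⟨ha, hc⟩
      · rintro (⟨ha, hb⟩ | ⟨⟨ha, hb⟩, hc⟩)
        · exact ⟨ha, fun hh => hb (hh.trans hle)⟩
        · exact ⟨ha, fun hh => hc ⟨ha, hh⟩⟩
    have hdis2 : Disjoint D A := by
      rw [disjoint_left]
      intro p hp hp'
      exact (mem_filter.1 hp).2 (hmA p hp').2.1
    have hprod : ∀ w : ℕ → ℝ, ∏ p ∈ D', w p = (∏ p ∈ D, w p) * ∏ p ∈ A, w p := fun w => by
      rw [hDA, prod_union hdis2]
    have hgA : ∀ p ∈ A, 0 ≤ g p ∧ g p ≤ 3 / 4 := fun p hp => hg p (hmA p hp).1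
    have hgA1 : ∀ p ∈ A, 0 ≤ g p ∧ g p ≤ 1 := fun p hp =>
      ⟨(hgA p hp).1, (hgA p hp).2.trans (by norm_num)⟩
    have hdA : ∀ n, ∀ p ∈ A, 0 ≤ dvdInd n p ∧ dvdInd n p ≤ 1 := fun n p _ => dvdInd_bounds n p
    have hsum : ∑ p ∈ A, g p ≤ 52 := by
      have hh := sum_inv_primes_le A (fun p hp => hP p (hmA p hp).1) (cutPoint z (k + 1))
        (cutPoint z k) (Real.exp_pos _).le (cutPoint_succ_sq z k).ge
        (fun p hp => ⟨(hmA p hp).2.2, (hmA p hp).2.1⟩)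
      have : ∑ p ∈ A, g p ≤ ∑ p ∈ A, 2 * ((1 : ℝ) / p) :=
        sum_le_sum fun p hp => (hg2 p (hmA p hp).1).trans (by rw [mul_one_div])
      rw [← Finset.mul_sum] at this
      linarith
    set m := 2 * b + 1 + 2 * k with hm
    have hodd : Odd m := ⟨b + k, by omega⟩
    obtain ⟨hB1, hB2⟩ := bonferroni_bounds A g hgA1 m hodd
    have hV0 : 0 ≤ ∏ p ∈ D, (1 - g p) :=
      prod_nonneg fun p hp => by have := (hg p (mem_filter.1 hp).1).2; linarith
    have hVl : Real.exp (-(2 * 52)) ≤ ∏ p ∈ A, (1 - g p) := exp_neg_le_prod_one_sub A g hgA _ hsum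
    have hV' : 0 ≤ ∏ p ∈ A, (1 - g p) := (Real.exp_pos _).le.trans hVl
    have he0 := esum_nonneg A m g fun p hp => (hgA p hp).1
    set d := Real.exp (52 * t + 104) * (1 / t ^ m) with hd
    have hd0 : 0 ≤ d := by positivity
    have he : esum A m g ≤ (∏ p ∈ A, (1 - g p)) * d := by
      calc esum A m g ≤ Real.exp (t * 52) / t ^ m :=
            esum_le_exp A g (fun p hp => (hgA p hp).1) t 52 (by linarith) hsum m
        _ = Real.exp (-(2 * 52)) * d := by
            rw [hd, ← mul_assoc, ← Real.exp_add, mul_one_div]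
            ring_nf
        _ ≤ _ := by gcongr
    have hPi0 : 0 ≤ Real.exp (52 * t + 104) * ∑ j ∈ range k, 1 / t ^ (2 * b + 1 + 2 * j) := by
      positivity
    obtain ⟨s1, s2, s3⟩ := sieve_main_step hV0 hV' hd0
      (Real.one_le_exp (x := 2 * (Real.exp (52 * t + 104) *
        ∑ j ∈ range k, 1 / t ^ (2 * b + 1 + 2 * j))) (by linarith)) hB1
      (by linarith) he0 he h5 h6 h7
    have hPi : Real.exp (2 * (Real.exp (52 * t + 104) *
        ∑ j ∈ range k, 1 / t ^ (2 * b + 1 + 2 * j))) * (1 + 2 * d) ≤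
        Real.exp (2 * (Real.exp (52 * t + 104) *
          ∑ j ∈ range (k + 1), 1 / t ^ (2 * b + 1 + 2 * j))) := by
      rw [sum_range_succ, mul_add (Real.exp (52 * t + 104)), mul_add (2 : ℝ),
        Real.exp_add (2 * _)]
      refine mul_le_mul_of_nonneg_left ?_ (Real.exp_pos _).le
      rw [add_comm]
      exact Real.add_one_le_exp _
    set w : ℕ → ℝ := fun p => (p : ℝ) ^ 2 with hw
    have hesum : ∑ i ∈ range (m + 1), esum A i w ≤ Real.exp (3 * (m * (Real.log z / 2 ^ k))) :=
      sum_esum_sq_le (by linarith) A k m (fun p hp => (hP p (hmA p hp).1).two_le)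
        (fun p hp => (hmA p hp).2.1)
    have hes0 : ∀ i, 0 ≤ esum A i w := fun i => esum_nonneg A i w fun p _ => by positivity
    have hes1 : esum A m w ≤ Real.exp (3 * (m * (Real.log z / 2 ^ k))) :=
      (single_le_sum (fun i _ => hes0 i) (self_mem_range_succ m)).trans hesum
    have hes2 : ∑ i ∈ range m, esum A i w ≤ Real.exp (3 * (m * (Real.log z / 2 ^ k))) := by
      rw [sum_range_succ] at hesum
      linarith [hes0 m]
    set R := Real.exp (3 * ∑ j ∈ range k, ((2 * b + 1 + 2 * j : ℕ) : ℝ) * (Real.log z / 2 ^ j))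
      with hR
    have hR' : Real.exp (3 * ∑ j ∈ range (k + 1),
        ((2 * b + 1 + 2 * j : ℕ) : ℝ) * (Real.log z / 2 ^ j)) =
        R * Real.exp (3 * (m * (Real.log z / 2 ^ k))) := by
      rw [sum_range_succ, mul_add, Real.exp_add]
    have hR0 : 0 < R := Real.exp_pos _
    rw [hR', hprod]
    simp_rw [hprod]
    have hFp0 : ∀ n, 0 ≤ ∏ p ∈ D, (1 - dvdInd n p) := fun n =>
      prod_nonneg fun p _ => by linarith [(dvdInd_bounds n p).2]
    have hFA0 : ∀ n, 0 ≤ ∏ p ∈ A, (1 - dvdInd n p) := fun n =>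
      prod_nonneg fun p _ => by linarith [(dvdInd_bounds n p).2]
    refine ⟨fun n => Fp n * bonferroni A m (dvdInd n),
      fun n => Fm n * bonferroni A m (dvdInd n) - Fp n * esum A m (dvdInd n),
      Mp * bonferroni A m g, Mm * bonferroni A m g - Mp * esum A m g, ?_, ?_, ?_, ?_, s1, ?_, ?_⟩
    · exact (h1.mul_bonferroni A U' hAU hUU hdis m).mono hE (by gcongr) subset_rfl
    · refine ((h2.mul_bonferroni A U' hAU hUU hdis m).sub
        (h1.mul_esum A U' hAU hUU hdis m)).mono hE ?_ subset_rfl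
      calc _ ≤ (k + 1) * R * Real.exp (3 * (m * (Real.log z / 2 ^ k))) +
            R * Real.exp (3 * (m * (Real.log z / 2 ^ k))) := by gcongr
        _ = _ := by push_cast; ring
    · intro n
      obtain ⟨q1, q2⟩ := bonferroni_bounds A (dvdInd n) (hdA n) m hodd
      have q3 := esum_nonneg A m (dvdInd n) fun p hp => (hdA n p hp).1
      have q4 : Fm n * bonferroni A m (dvdInd n) ≤
          (∏ p ∈ D, (1 - dvdInd n p)) * bonferroni A m (dvdInd n) :=
        mul_le_mul_of_nonneg_right (h3 n) ((hFA0 n).trans q1)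
      have q5 : (∏ p ∈ D, (1 - dvdInd n p)) * esum A m (dvdInd n) ≤
          Fp n * esum A m (dvdInd n) := mul_le_mul_of_nonneg_right (h4 n) q3
      have q6 := mul_le_mul_of_nonneg_left q2 (hFp0 n)
      linarith
    · intro n
      obtain ⟨q1, q2⟩ := bonferroni_bounds A (dvdInd n) (hdA n) m hodd
      exact mul_le_mul (h4 n) q1 (hFA0 n) ((hFp0 n).trans (h4 n))
    · exact s2.trans (by gcongr)
    · refine le_trans ?_ s3
      gcongr

end

theorem sum_div_two_pow_le (b k : ℕ) :
    ∑ j ∈ range k, ((2 * b + 1 + 2 * j : ℕ) : ℝ) / 2 ^ j ≤ 4 * b + 6 := by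
  have h : ∑ j ∈ range k, ((2 * b + 1 + 2 * j : ℕ) : ℝ) / 2 ^ j =
      4 * b + 6 - (4 * b + 6 + 4 * k) / 2 ^ k := by
    induction k with
    | zero => simp
    | succ k ih =>
      rw [sum_range_succ, ih, pow_succ]
      push_cast
      field_simp
      ring
  rw [h]
  have : (0 : ℝ) ≤ (4 * b + 6 + 4 * k) / 2 ^ k := by positivity
  linarith

theorem sum_one_div_pow_le {t : ℝ} (ht : 2 ≤ t) (b k : ℕ) :
    ∑ j ∈ range k, 1 / t ^ (2 * b + 1 + 2 * j) ≤ 1 / t ^ (2 * b) := by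
  have h : ∑ j ∈ range k, 1 / t ^ (2 * b + 1 + 2 * j) ≤
      1 / t ^ (2 * b) - 1 / t ^ (2 * b + 2 * k) := by
    induction k with
    | zero => simp
    | succ k ih =>
      rw [sum_range_succ]
      have e1 : 1 / t ^ (2 * b + 1 + 2 * k) = 1 / t ^ (2 * b + 2 * k) * (1 / t) := by
        rw [one_div_mul_one_div, ← pow_succ]; ring_nf
      have e2 : 1 / t ^ (2 * b + 2 * (k + 1)) = 1 / t ^ (2 * b + 2 * k) * ((1 / t) * (1 / t)) := by
        rw [one_div_mul_one_div, one_div_mul_one_div, ← pow_two, ← pow_add]; ring_nf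
      rw [e1, e2]
      have h1 : 1 / t ≤ 1 / 2 := one_div_le_one_div_of_le (by norm_num) ht
      have h2 : 0 < 1 / t := by positivity
      have h3 : 0 < 1 / t ^ (2 * b + 2 * k) := by positivity
      nlinarith [mul_pos h3 h2, mul_nonneg h3.le (show 0 ≤ 1 - 1 / t - 1 / t * (1 / t) by nlinarith)]
  have : 0 < 1 / t ^ (2 * b + 2 * k) := by positivity
  linarith

/-- The fundamental lemma of the sieve. -/
theorem fundamental_lemma (t : ℝ) (ht : 2 ≤ t) : ∃ C : ℝ, 0 < C ∧ ∀ (N : Finset ℕ) (a : ℕ → ℝ)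
    (X E : ℝ) (g : ℕ → ℝ) (P : Finset ℕ) (z : ℝ) (b : ℕ), (∀ n ∈ N, 0 ≤ a n) → 0 ≤ X → 0 ≤ E →
    2 ≤ z → (∀ p ∈ P, p.Prime) → (∀ p ∈ P, (p : ℝ) ≤ z) → (∀ p ∈ P, 0 ≤ g p ∧ g p ≤ 3 / 4) →
    (∀ p ∈ P, g p ≤ 2 / p) →
    (∀ s ⊆ P, |∑ n ∈ N with ∀ p ∈ s, p ∣ n, a n - X * ∏ p ∈ s, g p| ≤
      E * (∏ p ∈ s, (p : ℝ)) ^ 2) →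
    |∑ n ∈ N with ∀ p ∈ P, ¬ p ∣ n, a n - X * ∏ p ∈ P, (1 - g p)| ≤
      C / t ^ (2 * b) * (X * ∏ p ∈ P, (1 - g p)) + E * z ^ (12 * b + 22) := by
  refine ⟨2 * Real.exp (52 * t + 104) * Real.exp (2 * Real.exp (52 * t + 104)), by positivity, ?_⟩
  intro N a X E g P z b ha hX hE hz hP hPz hg hg2 hlev
  have hind : ∀ n : ℕ, ∀ s : Finset ℕ, ∏ p ∈ s, dvdInd n p = if ∀ p ∈ s, p ∣ n then 1 else 0 := by
    intro n s
    unfold dvdInd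
    exact prod_ite_zero (f := fun _ => (1 : ℝ)) |>.trans (by simp)
  have hind2 : ∀ n : ℕ, ∏ p ∈ P, (1 - dvdInd n p) = if ∀ p ∈ P, ¬ p ∣ n then 1 else 0 := by
    intro n
    have : ∀ p ∈ P, 1 - dvdInd n p = if ¬ p ∣ n then 1 else 0 := by
      intro p _
      unfold dvdInd
      split_ifs <;> simp_all
    rw [prod_congr rfl this]
    exact prod_ite_zero (f := fun _ => (1 : ℝ)) |>.trans (by simp)
  have hL : HasLevel N a X E g P (fun _ => 1) 1 1 := by
    intro s hs
    have h := hlev s hs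
    simp only [hind, mul_one, mul_ite, mul_zero]
    rwa [← sum_filter]
  obtain ⟨r, hr1, hr2⟩ := exists_two_pow_two_pow z hz
  obtain ⟨Fp, Fm, Mp, Mm, h1, h2, h3, h4, h5, h6, h7⟩ :=
    exists_hooley_bounds (b := b) hz hP hPz hg hg2 ht hE hL (r + 1)
  have hl2 := Real.log_two_gt_d9
  have hlz : Real.log 2 ≤ Real.log z := Real.log_le_log (by norm_num) hz
  have hcut : cutPoint z (r + 1) < 2 := by
    unfold cutPoint
    rw [← Real.lt_log_iff_exp_lt (by norm_num), div_lt_iff₀ (by positivity)]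
    have := Real.log_le_log (by linarith) hr1
    rw [Real.log_pow] at this
    push_cast at this
    have h0 : (0 : ℝ) < 2 ^ r := by positivity
    rw [pow_succ]
    nlinarith
  have eD : P.filter (fun p : ℕ => ¬ (p : ℝ) ≤ cutPoint z (r + 1)) = P := by
    refine filter_true_of_mem fun p hp => ?_
    have : (2 : ℝ) ≤ p := by exact_mod_cast (hP p hp).two_le
    linarith
  rw [eD] at h3 h4 h5 h6 h7
  set V := ∏ p ∈ P, (1 - g p) with hV
  have hV0 : 0 ≤ V := prod_nonneg fun p hp => by have := (hg p hp).2; linarith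
  set K := Real.exp (52 * t + 104) with hK
  have hK0 : 0 < K := Real.exp_pos _
  set x := 2 * (K * ∑ j ∈ range (r + 1), 1 / t ^ (2 * b + 1 + 2 * j)) with hx
  have ht0 : 0 < t := by linarith
  have hx1 : x ≤ 2 * K * (1 / t ^ (2 * b)) := by
    rw [hx, mul_assoc]
    have := sum_one_div_pow_le ht b (r + 1)
    gcongr
  have hx2 : x ≤ 2 * K := by
    refine hx1.trans ?_
    have : 1 / t ^ (2 * b) ≤ 1 := by
      rw [div_le_one (by positivity)]
      exact one_le_pow₀ (by linarith)
    nlinarith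
  have hexp : Real.exp x - 1 ≤ 2 * K * Real.exp (2 * K) / t ^ (2 * b) := by
    have e1 : Real.exp x - 1 ≤ x * Real.exp x := by
      have := Real.add_one_le_exp (-x)
      rw [Real.exp_neg] at this
      have h0 := Real.exp_pos x
      have := mul_le_mul_of_nonneg_right this h0.le
      rw [inv_mul_cancel₀ h0.ne'] at this
      linarith
    calc _ ≤ x * Real.exp x := e1
      _ ≤ 2 * K * (1 / t ^ (2 * b)) * Real.exp (2 * K) := by gcongr
      _ = _ := by ring
  set R := Real.exp (3 * ∑ j ∈ range (r + 1),
    ((2 * b + 1 + 2 * j : ℕ) : ℝ) * (Real.log z / 2 ^ j)) with hR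
  have hR1 : R ≤ z ^ (12 * b + 18) := by
    rw [hR, ← Real.le_log_iff_exp_le (by positivity), Real.log_pow]
    have h0 := sum_div_two_pow_le b (r + 1)
    have e : ∑ j ∈ range (r + 1), ((2 * b + 1 + 2 * j : ℕ) : ℝ) * (Real.log z / 2 ^ j) =
        Real.log z * ∑ j ∈ range (r + 1), ((2 * b + 1 + 2 * j : ℕ) : ℝ) / 2 ^ j := by
      rw [Finset.mul_sum]
      exact sum_congr rfl fun j _ => by ring
    rw [e]
    have := mul_le_mul_of_nonneg_left h0 (show 0 ≤ Real.log z by linarith)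
    push_cast at this ⊢
    linarith
  have hr3 : ((r + 1 : ℕ) : ℝ) + 1 ≤ z ^ 4 := by
    have q1 : r + 1 ≤ 2 ^ r := Nat.lt_two_pow_self
    have q2 : ((r : ℝ) + 1) ≤ 2 ^ r := by exact_mod_cast q1
    have q3 : Real.log z ≤ z - 1 := Real.log_le_sub_one_of_pos (by linarith)
    have q4 : (2 : ℝ) ^ 3 ≤ z ^ 3 := pow_le_pow_left₀ (by norm_num) hz 3
    push_cast
    nlinarith
  have hRR : ((r + 1 : ℕ) + 1 : ℝ) * R ≤ z ^ (12 * b + 22) := by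
    calc _ ≤ z ^ 4 * z ^ (12 * b + 18) := by gcongr
      _ = _ := by rw [← pow_add]; ring_nf
  have hR0 : 0 < R := Real.exp_pos _
  have hRR' : R ≤ ((r + 1 : ℕ) + 1 : ℝ) * R := by
    have : (0 : ℝ) ≤ ((r + 1 : ℕ) : ℝ) := by positivity
    nlinarith
  have k1 := h1 ∅ (empty_subset _)
  have k2 := h2 ∅ (empty_subset _)
  simp only [prod_empty, mul_one, one_pow] at k1 k2
  have hS : ∑ n ∈ N with ∀ p ∈ P, ¬ p ∣ n, a n = ∑ n ∈ N, a n * ∏ p ∈ P, (1 - dvdInd n p) := by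
    simp only [hind2, mul_ite, mul_one, mul_zero]
    rw [← sum_filter]
  have up : ∑ n ∈ N, a n * ∏ p ∈ P, (1 - dvdInd n p) ≤ ∑ n ∈ N, a n * Fp n :=
    sum_le_sum fun n hn => mul_le_mul_of_nonneg_left (h4 n) (ha n hn)
  have lo : ∑ n ∈ N, a n * Fm n ≤ ∑ n ∈ N, a n * ∏ p ∈ P, (1 - dvdInd n p) :=
    sum_le_sum fun n hn => mul_le_mul_of_nonneg_left (h3 n) (ha n hn)
  have hER := mul_le_mul_of_nonneg_left hRR hE
  have hER' := mul_le_mul_of_nonneg_left hRR' hE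
  have m1 := mul_le_mul_of_nonneg_left h6 hX
  have m2 := mul_le_mul_of_nonneg_left h7 hX
  have m3 := mul_le_mul_of_nonneg_right hexp (mul_nonneg hX hV0)
  rw [hS]
  rw [abs_le] at k1 k2 ⊢
  constructor
  · linarith [k2.1]
  · linarith [k1.2]

/-- Abel's inequality for a nonincreasing weight. -/
theorem abs_sum_mul_le_of_antitone (A B : ℕ) (c h : ℕ → ℝ) (K : ℝ) (hK : 0 ≤ K)
    (hc : ∀ m, A < m → m ≤ B → |∑ n ∈ Ioc A m, c n| ≤ K) (hh : ∀ n, A < n → 0 ≤ h n)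
    (hanti : ∀ n, A < n → h (n + 1) ≤ h n) : |∑ n ∈ Ioc A B, c n * h n| ≤ K * h (A + 1) := by
  rcases Nat.lt_or_ge A B with hAB | hAB
  swap
  · rw [Ioc_eq_empty_of_le hAB]
    simpa using mul_nonneg hK (hh _ (Nat.lt_succ_self A))
  have key : ∀ m, A + 1 ≤ m → m ≤ B →
      |∑ n ∈ Ioc A m, c n * h n - (∑ n ∈ Ioc A m, c n) * h m| ≤ K * (h (A + 1) - h m) := by
    intro m hm
    induction m, hm using Nat.le_induction with
    | base => intro _; simp
    | succ m hm ih =>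
      intro hmB
      have h1 := ih (by omega)
      rw [sum_Ioc_succ_top (by omega), sum_Ioc_succ_top (by omega)]
      have e : ∑ n ∈ Ioc A m, c n * h n + c (m + 1) * h (m + 1) -
          (∑ n ∈ Ioc A m, c n + c (m + 1)) * h (m + 1) =
          (∑ n ∈ Ioc A m, c n * h n - (∑ n ∈ Ioc A m, c n) * h m) +
          (∑ n ∈ Ioc A m, c n) * (h m - h (m + 1)) := by ring
      rw [e]
      have h2 : |(∑ n ∈ Ioc A m, c n) * (h m - h (m + 1))| ≤ K * (h m - h (m + 1)) := by
        have h3 : 0 ≤ h m - h (m + 1) := by linarith [hanti m (by omega)]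
        rw [abs_mul, abs_of_nonneg h3]
        exact mul_le_mul_of_nonneg_right (hc m (by omega) (by omega)) h3
      refine (abs_add_le _ _).trans ?_
      linarith
  have h1 := key B hAB le_rfl
  have h2 : |(∑ n ∈ Ioc A B, c n) * h B| ≤ K * h B := by
    rw [abs_mul, abs_of_nonneg (hh B hAB)]
    exact mul_le_mul_of_nonneg_right (hc B hAB le_rfl) (hh B hAB)
  calc |∑ n ∈ Ioc A B, c n * h n|
      = |(∑ n ∈ Ioc A B, c n * h n - (∑ n ∈ Ioc A B, c n) * h B) +
        (∑ n ∈ Ioc A B, c n) * h B| := by ring_nf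
    _ ≤ _ := (abs_add_le _ _).trans (by linarith)

theorem abs_card_modEq_sub_le (A m D c : ℕ) (hD : 0 < D) (hm : A ≤ m) :
    |(#{n ∈ Ioc A m | n ≡ c [MOD D]} : ℝ) - (m - A) / D| ≤ 1 := by
  have h := Nat.Ioc_filter_modEq_card A m hD c
  have hD' : (0 : ℝ) < D := by exact_mod_cast hD
  have h1 : ((#{n ∈ Ioc A m | n ≡ c [MOD D]} : ℕ) : ℤ) =
      max (⌊((m : ℚ) - c) / D⌋ - ⌊((A : ℚ) - c) / D⌋) 0 := h
  have f1 := Int.floor_le (((m : ℚ) - c) / D)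
  have f2 := Int.lt_floor_add_one (((m : ℚ) - c) / D)
  have f3 := Int.floor_le (((A : ℚ) - c) / D)
  have f4 := Int.lt_floor_add_one (((A : ℚ) - c) / D)
  have hmono : ⌊((A : ℚ) - c) / D⌋ ≤ ⌊((m : ℚ) - c) / D⌋ := by
    apply Int.floor_mono
    gcongr
  rw [max_eq_left (by omega)] at h1
  have h2 : ((#{n ∈ Ioc A m | n ≡ c [MOD D]} : ℕ) : ℚ) =
      ⌊((m : ℚ) - c) / D⌋ - ⌊((A : ℚ) - c) / D⌋ := by exact_mod_cast congrArg (Int.cast : ℤ → ℚ) h1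
  have h3 : |((#{n ∈ Ioc A m | n ≡ c [MOD D]} : ℕ) : ℚ) - (m - A) / D| ≤ 1 := by
    rw [h2, abs_le]
    have e : ((m : ℚ) - A) / D = ((m : ℚ) - c) / D - ((A : ℚ) - c) / D := by ring
    rw [e]
    constructor <;> linarith
  have h4 := (Rat.cast_le (K := ℝ)).2 h3
  push_cast at h4
  exact h4

/-- The sum of a nonincreasing function over a residue class. -/
theorem abs_sum_modEq_sub_le (A B D c : ℕ) (hD : 0 < D) (h : ℕ → ℝ) (hh : ∀ n, A < n → 0 ≤ h n)
    (hanti : ∀ n, A < n → h (n + 1) ≤ h n) :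
    |∑ n ∈ Ioc A B with n ≡ c [MOD D], h n - (∑ n ∈ Ioc A B, h n) / D| ≤ h (A + 1) := by
  have key := abs_sum_mul_le_of_antitone A B
    (fun n => (if n ≡ c [MOD D] then 1 else 0) - 1 / (D : ℝ)) h 1 zero_le_one ?_ hh hanti
  · rw [one_mul] at key
    refine le_trans (le_of_eq ?_) key
    congr 1
    simp_rw [sub_mul, ite_mul, one_mul, zero_mul]
    rw [sum_sub_distrib, sum_filter, ← mul_sum]
    ring
  · intro m hm _
    rw [sum_sub_distrib, sum_boole, sum_const, Nat.card_Ioc, nsmul_eq_mul, Nat.cast_sub hm.le]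
    have := abs_card_modEq_sub_le A m D c hD hm.le
    rwa [mul_one_div]

/-- The weight `log² n / n`. -/
noncomputable def logSq (n : ℕ) : ℝ := Real.log n ^ 2 / n

theorem logSq_nonneg (n : ℕ) : 0 ≤ logSq n := by unfold logSq; positivity

theorem logSq_succ_le {n : ℕ} (hn : 9 ≤ n) : logSq (n + 1) ≤ logSq n := by
  have e : ∀ m : ℕ, logSq m = (Real.log m / √m) ^ 2 := by
    intro m
    rw [div_pow, Real.sq_sqrt (by positivity)]
    rfl
  have he : Real.exp 2 ≤ n := by
    have h1 := Real.exp_one_lt_d9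
    have h2 : Real.exp 2 = Real.exp 1 ^ 2 := by rw [← Real.exp_nat_mul]; norm_num
    have h3 : (9 : ℝ) ≤ n := by exact_mod_cast hn
    have := Real.exp_pos 1
    nlinarith
  have h := Real.log_div_sqrt_antitoneOn (show Real.exp 2 ≤ (n : ℝ) from he)
    (show Real.exp 2 ≤ ((n + 1 : ℕ) : ℝ) by push_cast; linarith) (by push_cast; linarith)
  rw [e, e]
  refine pow_le_pow_left₀ ?_ h 2
  exact div_nonneg (Real.log_natCast_nonneg _) (Real.sqrt_nonneg _)

theorem sum_inv_Ioc_le {A B : ℕ} (hA : 1 ≤ A) (hAB : A ≤ B) :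
    ∑ n ∈ Ioc A B, (1 : ℝ) / n ≤ Real.log B - Real.log A := by
  induction B, hAB using Nat.le_induction with
  | base => simp
  | succ B hB ih =>
    rw [sum_Ioc_succ_top hB]
    have hB0 : (0 : ℝ) < B := by exact_mod_cast (by omega : 0 < B)
    have h1 := Real.one_sub_inv_le_log_of_pos (show 0 < ((B + 1 : ℕ) : ℝ) / B by positivity)
    rw [Real.log_div (by positivity) (by positivity)] at h1
    have h2 : 1 - (((B + 1 : ℕ) : ℝ) / B)⁻¹ = 1 / ((B + 1 : ℕ) : ℝ) := by
      push_cast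
      field_simp
      ring
    rw [h2] at h1
    linarith

/-- The indicator of the residue class `b`. -/
noncomputable def classInd {q : ℕ} (b : (ZMod q)ˣ) (n : ℕ) : ℝ :=
  if (n : ZMod q) = b then 1 else 0

theorem classInd_nonneg {q : ℕ} (b : (ZMod q)ˣ) (n : ℕ) : 0 ≤ classInd b n := by
  unfold classInd; split_ifs <;> norm_num

theorem classInd_le_one {q : ℕ} (b : (ZMod q)ˣ) (n : ℕ) : classInd b n ≤ 1 := by
  unfold classInd; split_ifs <;> norm_num

/-- The primes up to `z` not dividing `q`. -/
def sievePrimes (q z : ℕ) : Finset ℕ := {p ∈ Icc 1 z | p.Prime ∧ ¬ p ∣ q}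

theorem mem_sievePrimes {q z p : ℕ} : p ∈ sievePrimes q z ↔ p ≤ z ∧ p.Prime ∧ ¬ p ∣ q := by
  simp only [sievePrimes, mem_filter, mem_Icc]
  exact ⟨fun h => ⟨h.1.2, h.2⟩, fun h => ⟨⟨h.2.1.one_le, h.1⟩, h.2⟩⟩

theorem sieve_level_class {q : ℕ} (hq : 2 ≤ q) (b : (ZMod q)ˣ) (z A B : ℕ) (h : ℕ → ℝ)
    (hh : ∀ n, A < n → 0 ≤ h n) (hanti : ∀ n, A < n → h (n + 1) ≤ h n) (s : Finset ℕ)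
    (hs : s ⊆ sievePrimes q z) :
    |∑ n ∈ Ioc A B with ∀ p ∈ s, p ∣ n, classInd b n * h n -
      (∑ n ∈ Ioc A B, h n) / q * ∏ p ∈ s, (1 : ℝ) / p| ≤
      h (A + 1) * (∏ p ∈ s, (p : ℝ)) ^ 2 := by
  have hpr : ∀ p ∈ s, p.Prime := fun p hp => (mem_sievePrimes.1 (hs hp)).2.1
  set D := ∏ p ∈ s, p with hD
  have hD0 : 0 < D := prod_pos fun p hp => (hpr p hp).pos
  have hcop : Nat.Coprime q D := by
    refine Nat.Coprime.prod_right fun p hp => ?_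
    exact ((Nat.Prime.coprime_iff_not_dvd (hpr p hp)).2 (mem_sievePrimes.1 (hs hp)).2.2).symm
  have hdvd : ∀ n : ℕ, (∀ p ∈ s, p ∣ n) ↔ D ∣ n := by
    intro n
    constructor
    · intro hn
      exact Finset.prod_primes_dvd n (fun p hp => (hpr p hp).prime) hn
    · intro hn p hp
      exact (dvd_prod_of_mem _ hp).trans hn
  have : NeZero q := ⟨by omega⟩
  obtain ⟨c, hc1, hc2⟩ := Nat.chineseRemainder hcop (b : ZMod q).val 0
  have hcl : ∀ n : ℕ, ((n : ZMod q) = b ∧ D ∣ n) ↔ n ≡ c [MOD q * D] := by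
    intro n
    rw [← Nat.modEq_and_modEq_iff_modEq_mul hcop]
    have e1 : (n : ZMod q) = b ↔ n ≡ c [MOD q] := by
      rw [← ZMod.natCast_eq_natCast_iff, (ZMod.natCast_eq_natCast_iff _ _ _).2 hc1,
        ZMod.natCast_zmod_val]
    have e2 : D ∣ n ↔ n ≡ c [MOD D] := by
      rw [← Nat.modEq_zero_iff_dvd]
      exact ⟨fun h => h.trans hc2.symm, fun h => h.trans hc2⟩
    rw [e1, e2]
  have e3 : ∑ n ∈ Ioc A B with ∀ p ∈ s, p ∣ n, classInd b n * h n =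
      ∑ n ∈ Ioc A B with n ≡ c [MOD q * D], h n := by
    rw [sum_filter, sum_filter]
    refine sum_congr rfl fun n _ => ?_
    simp only [classInd, hdvd, ← hcl]
    split_ifs <;> simp_all
  have e4 : (∑ n ∈ Ioc A B, h n) / q * ∏ p ∈ s, (1 : ℝ) / p =
      (∑ n ∈ Ioc A B, h n) / ((q * D : ℕ) : ℝ) := by
    rw [prod_div_distrib, prod_const_one, hD]
    push_cast
    rw [div_mul_div_comm, mul_one]
  rw [e3, e4]
  refine (abs_sum_modEq_sub_le A B (q * D) c (Nat.mul_pos (by omega) hD0) h hh hanti).trans ?_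
  refine le_mul_of_one_le_right (hh _ (Nat.lt_succ_self A)) (one_le_pow₀ ?_)
  rw [← Nat.cast_prod]
  exact_mod_cast hD0

/-- The density of the integers coprime to `sievePrimes q z`. -/
noncomputable def sieveDensity (q z : ℕ) : ℝ := ∏ p ∈ sievePrimes q z, (1 - (1 : ℝ) / p)

theorem one_sub_inv_prime_bounds {p : ℕ} (hp : p.Prime) :
    (0 : ℝ) ≤ 1 / p ∧ (1 : ℝ) / p ≤ 1 / 2 := by
  have : (2 : ℝ) ≤ p := by exact_mod_cast hp.two_le
  exact ⟨by positivity, one_div_le_one_div_of_le (by norm_num) this⟩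

theorem sieveDensity_nonneg (q z : ℕ) : 0 ≤ sieveDensity q z :=
  prod_nonneg fun p hp => by
    have := one_sub_inv_prime_bounds (mem_sievePrimes.1 hp).2.1
    linarith

theorem sieveDensity_le {q N : ℕ} (hq : 2 ≤ q) (hN : q ≤ N) :
    sieveDensity q N ≤ q / (q.totient * Real.log N) := by
  have h1 := prod_one_sub_inv_primes_le N (hq.trans hN)
  have h2 : (Icc 1 N).filter Nat.Prime = sievePrimes q N ∪ q.primeFactors := by
    ext p
    simp only [mem_filter, mem_Icc, mem_union, mem_sievePrimes, Nat.mem_primeFactors]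
    constructor
    · rintro ⟨h, hp⟩
      by_cases hpq : p ∣ q
      · exact Or.inr ⟨hp, hpq, by omega⟩
      · exact Or.inl ⟨h.2, hp, hpq⟩
    · rintro (⟨h, hp, _⟩ | ⟨hp, hpq, _⟩)
      · exact ⟨⟨hp.one_le, h⟩, hp⟩
      · exact ⟨⟨hp.one_le, (Nat.le_of_dvd (by omega) hpq).trans hN⟩, hp⟩
  have h3 : Disjoint (sievePrimes q N) q.primeFactors := by
    rw [disjoint_left]
    intro p hp hp'
    exact (mem_sievePrimes.1 hp).2.2 (Nat.dvd_of_mem_primeFactors hp')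
  rw [h2, prod_union h3] at h1
  have h4 := Nat.totient_eq_mul_prod_factors q
  have h5 : (q.totient : ℝ) = q * ∏ p ∈ q.primeFactors, (1 - (1 : ℝ) / p) := by
    have := congrArg (Rat.cast : ℚ → ℝ) h4
    push_cast at this
    simpa [one_div] using this
  have hq0 : (0 : ℝ) < q := by exact_mod_cast (by omega : 0 < q)
  have hphi : (0 : ℝ) < q.totient := by exact_mod_cast Nat.totient_pos.2 (by omega)
  have hlog : 0 < Real.log N := Real.log_pos (by exact_mod_cast (by omega : 1 < N))
  have h6 : ∏ p ∈ q.primeFactors, (1 - (1 : ℝ) / p) = q.totient / q := by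
    rw [h5]; field_simp
  rw [h6] at h1
  change sieveDensity q N * _ ≤ _ at h1
  rw [le_div_iff₀ (by positivity)]
  rw [mul_div_assoc', div_le_div_iff₀ hq0 hlog] at h1
  linarith

theorem sum_inv_primes_le_of_le_pow (i : ℕ) (P : Finset ℕ) (hP : ∀ p ∈ P, p.Prime) (y : ℝ)
    (hy : 0 ≤ y) (h : ∀ p ∈ P, y < p ∧ (p : ℝ) ≤ y ^ 2 ^ i) : ∑ p ∈ P, (1 : ℝ) / p ≤ 26 * i := by
  induction i generalizing P with
  | zero =>
    have : P = ∅ := by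
      rw [eq_empty_iff_forall_notMem]
      intro p hp
      have := h p hp
      norm_num at this
      linarith
    simp [this]
  | succ i ih =>
    rw [← sum_filter_add_sum_filter_not P (fun p : ℕ => (p : ℝ) ≤ y ^ 2 ^ i)]
    have h1 := ih (P.filter (fun p : ℕ => (p : ℝ) ≤ y ^ 2 ^ i))
      (fun p hp => hP p (mem_filter.1 hp).1)
      (fun p hp => ⟨(h p (mem_filter.1 hp).1).1, (mem_filter.1 hp).2⟩)
    have h2 := sum_inv_primes_le (P.filter (fun p : ℕ => ¬ (p : ℝ) ≤ y ^ 2 ^ i))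
      (fun p hp => hP p (mem_filter.1 hp).1) (y ^ 2 ^ i) (y ^ 2 ^ (i + 1)) (by positivity)
      (by rw [← pow_mul, pow_succ])
      (fun p hp => ⟨not_le.1 (mem_filter.1 hp).2, (h p (mem_filter.1 hp).1).2⟩)
    push_cast
    linarith

theorem sieveDensity_le_of_pow (q : ℕ) (hq : 2 ≤ q) :
    sieveDensity q q ≤ Real.exp 312 * sieveDensity q (q ^ 64) := by
  have hsub : sievePrimes q q ⊆ sievePrimes q (q ^ 64) := by
    intro p hp
    rw [mem_sievePrimes] at hp ⊢
    exact ⟨hp.1.trans (Nat.le_self_pow (by norm_num) q), hp.2⟩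
  have h1 := exp_neg_le_prod_one_sub (sievePrimes q (q ^ 64) \ sievePrimes q q)
    (fun p => (1 : ℝ) / p) (fun p hp => by
      have := one_sub_inv_prime_bounds (mem_sievePrimes.1 (mem_sdiff.1 hp).1).2.1
      exact ⟨this.1, this.2.trans (by norm_num)⟩) (26 * (6 : ℕ))
    (sum_inv_primes_le_of_le_pow 6 _ (fun p hp => (mem_sievePrimes.1 (mem_sdiff.1 hp).1).2.1) q
      (by positivity) fun p hp => by
        rw [mem_sdiff, mem_sievePrimes, mem_sievePrimes] at hp
        refine ⟨?_, ?_⟩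
        · by_contra! hh
          exact hp.2 ⟨by exact_mod_cast hh, hp.1.2⟩
        · exact_mod_cast hp.1.1)
  have h2 : sieveDensity q (q ^ 64) =
      (∏ p ∈ sievePrimes q (q ^ 64) \ sievePrimes q q, (1 - (1 : ℝ) / p)) * sieveDensity q q :=
    (prod_sdiff hsub).symm
  rw [h2]
  have h3 := sieveDensity_nonneg q q
  have h4 := mul_le_mul_of_nonneg_left (mul_le_mul_of_nonneg_right h1 h3)
    (Real.exp_pos 312).le
  refine le_trans (le_of_eq ?_) h4
  rw [← mul_assoc, ← Real.exp_add]
  norm_num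

/-- The prime factors of `n` all exceed `Q`. -/
def Rough (Q n : ℕ) : Prop := ∀ p : ℕ, p.Prime → p ∣ n → Q < p

open Classical in
/-- The indicator of the integers whose prime factors all exceed `Q`. -/
noncomputable def roughInd (Q n : ℕ) : ℝ := if Rough Q n then 1 else 0

theorem roughInd_nonneg (Q n : ℕ) : 0 ≤ roughInd Q n := by
  unfold roughInd; split_ifs <;> norm_num

theorem roughInd_le_one (Q n : ℕ) : roughInd Q n ≤ 1 := by
  unfold roughInd; split_ifs <;> norm_num

theorem Rough.lt_of_one_lt {Q n : ℕ} (h : Rough Q n) (hn : 0 < n) (hn1 : n ≠ 1) : Q < n :=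
  (h _ (Nat.minFac_prime hn1) (Nat.minFac_dvd n)).trans_le (Nat.minFac_le hn)

theorem rough_iff_of_coprime {q Q n : ℕ} (hn : Nat.Coprime n q) :
    Rough Q n ↔ ∀ p ∈ sievePrimes q Q, ¬ p ∣ n := by
  constructor
  · intro h p hp hpn
    rw [mem_sievePrimes] at hp
    exact absurd (h p hp.2.1 hpn) (by omega)
  · intro h p hp hpn
    by_contra! hpQ
    exact h p (mem_sievePrimes.2 ⟨hpQ, hp, fun hpq =>
      Nat.not_coprime_of_dvd_of_dvd hp.one_lt hpn hpq hn⟩) hpn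

theorem coprime_of_natCast_eq_unit {q : ℕ} {b : (ZMod q)ˣ} {n : ℕ} (hb : (n : ZMod q) = b) :
    Nat.Coprime n q := by
  rw [← ZMod.isUnit_iff_coprime, hb]
  exact b.isUnit

theorem classInd_mul_roughInd {q : ℕ} (b : (ZMod q)ˣ) (Q n : ℕ) :
    classInd b n * roughInd Q n =
      if ∀ p ∈ sievePrimes q Q, ¬ p ∣ n then classInd b n else 0 := by
  by_cases hb : (n : ZMod q) = b
  · simp only [roughInd, rough_iff_of_coprime (coprime_of_natCast_eq_unit hb), mul_ite, mul_one,
      mul_zero]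
  · simp [classInd, hb]

/-- The fundamental lemma for `log² n / n` on a residue class, sieving by the primes up to `z`. -/
theorem exists_sieve_logSq (t : ℝ) (ht : 2 ≤ t) : ∃ C : ℝ, 0 < C ∧ ∀ (q : ℕ), 2 ≤ q →
    ∀ (b : (ZMod q)ˣ) (A B z c : ℕ), 9 ≤ A → 2 ≤ z →
    |∑ n ∈ Ioc A B with ∀ p ∈ sievePrimes q z, ¬ p ∣ n, classInd b n * logSq n -
      (∑ n ∈ Ioc A B, logSq n) / q * sieveDensity q z| ≤
    C / t ^ (2 * c) * ((∑ n ∈ Ioc A B, logSq n) / q * sieveDensity q z) +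
      logSq A * z ^ (12 * c + 22) := by
  obtain ⟨C, hC, h⟩ := fundamental_lemma t ht
  refine ⟨C, hC, fun q hq b A B z c hA hz => ?_⟩
  refine h (Ioc A B) (fun n => classInd b n * logSq n) ((∑ n ∈ Ioc A B, logSq n) / q)
    (logSq A) (fun p => (1 : ℝ) / p) (sievePrimes q z) z c
    (fun n _ => mul_nonneg (classInd_nonneg b n) (logSq_nonneg n))
    (div_nonneg (sum_nonneg fun n _ => logSq_nonneg n) (by positivity)) (logSq_nonneg A)
    (by exact_mod_cast hz) (fun p hp => (mem_sievePrimes.1 hp).2.1)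
    (fun p hp => by exact_mod_cast (mem_sievePrimes.1 hp).1) (fun p hp => ?_) (fun p hp => ?_)
    (fun s hs => ?_)
  · have := one_sub_inv_prime_bounds (mem_sievePrimes.1 hp).2.1
    exact ⟨this.1, this.2.trans (by norm_num)⟩
  · gcongr; norm_num
  · refine (sieve_level_class hq b z A B logSq (fun n _ => logSq_nonneg n)
      (fun n hn => logSq_succ_le (by omega)) s hs).trans ?_
    gcongr
    exact logSq_succ_le hA

theorem sum_classInd_mul_roughInd {q : ℕ} (b : (ZMod q)ˣ) (Q : ℕ) (N : Finset ℕ) (h : ℕ → ℝ) :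
    ∑ n ∈ N, classInd b n * roughInd Q n * h n =
      ∑ n ∈ N with ∀ p ∈ sievePrimes q Q, ¬ p ∣ n, classInd b n * h n := by
  rw [sum_filter]
  refine sum_congr rfl fun n _ => ?_
  rw [classInd_mul_roughInd]
  split_ifs <;> simp

theorem sum_logSq_block_le {Q j B : ℕ} (hQ : 2 ≤ Q) (hB : Q ^ j ≤ B)
    (hB' : B ≤ Q ^ (j + 1)) :
    ∑ n ∈ Ioc (Q ^ j) B, logSq n ≤ (j + 1) ^ 2 * Real.log Q ^ 3 := by
  have hQj : 1 ≤ Q ^ j := Nat.one_le_pow _ _ (by omega)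
  have hlB : Real.log B ≤ (j + 1) * Real.log Q := by
    have : Real.log B ≤ Real.log ((Q ^ (j + 1) : ℕ) : ℝ) :=
      Real.log_le_log (by exact_mod_cast (by omega : 0 < B)) (by exact_mod_cast hB')
    rw [Nat.cast_pow, Real.log_pow] at this
    exact_mod_cast this
  have hlQ : 0 ≤ Real.log Q := Real.log_natCast_nonneg Q
  calc ∑ n ∈ Ioc (Q ^ j) B, logSq n
      ≤ ∑ n ∈ Ioc (Q ^ j) B, ((j + 1) * Real.log Q) ^ 2 * ((1 : ℝ) / n) := by
        refine sum_le_sum fun n hn => ?_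
        rw [mem_Ioc] at hn
        have h1 : Real.log n ≤ (j + 1) * Real.log Q :=
          (Real.log_le_log (by exact_mod_cast (by omega : 0 < n))
            (by exact_mod_cast hn.2)).trans hlB
        have h0 := Real.log_natCast_nonneg n
        rw [logSq, mul_one_div]
        gcongr
    _ ≤ ((j + 1) * Real.log Q) ^ 2 * Real.log Q := by
        rw [← mul_sum]
        refine mul_le_mul_of_nonneg_left ((sum_inv_Ioc_le hQj hB).trans ?_) (by positivity)
        rw [Nat.cast_pow, Real.log_pow]
        linarith
    _ = _ := by ring

theorem exists_rough_block_sub_le : ∃ C : ℝ, 0 < C ∧ ∀ q Q : ℕ, 2 ≤ q → Q = q ^ 64 →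
    ∀ (b b' : (ZMod q)ˣ) (j B : ℕ), 1 ≤ j → Q ^ j ≤ B → B ≤ Q ^ (j + 1) →
    |∑ n ∈ Ioc (Q ^ j) B, classInd b n * roughInd Q n * logSq n -
      ∑ n ∈ Ioc (Q ^ j) B, classInd b' n * roughInd Q n * logSq n| ≤
    C * ((j + 1) ^ 2 * Real.exp (-j)) * (Real.log Q ^ 2 / q.totient) := by
  obtain ⟨C, hC, h⟩ := exists_sieve_logSq (Real.exp 12) (by
    have := Real.add_one_le_exp (12 : ℝ); linarith)
  refine ⟨2 * (C * Real.exp 47 + 1) + 2 * ((C + 1) * Real.exp 312 + 1) * Real.exp 24,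
    by positivity, ?_⟩
  intro q Q hq hQ b b' j B hj hB hB'
  have hphi : (0 : ℝ) < q.totient := by exact_mod_cast Nat.totient_pos.2 (by omega)
  have hphiq : (q.totient : ℝ) ≤ q := by exact_mod_cast Nat.totient_le q
  have hq0 : (0 : ℝ) < q := by exact_mod_cast (by omega : 0 < q)
  have hqQ : q ≤ Q := hQ ▸ Nat.le_self_pow (by norm_num) q
  have hlQ : 0 < Real.log Q := Real.log_pos (by exact_mod_cast (by omega : 1 < Q))
  have hQ9 : 9 ≤ Q ^ j := by
    calc 9 ≤ 2 ^ 64 := by norm_num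
      _ ≤ Q := hQ ▸ Nat.pow_le_pow_left hq 64
      _ ≤ Q ^ j := Nat.le_self_pow (by omega) Q
  set Z : ℝ := Real.log Q ^ 2 / q.totient with hZ
  have hZ0 : 0 ≤ Z := by positivity
  have hXV : (∑ n ∈ Ioc (Q ^ j) B, logSq n) / q * sieveDensity q Q ≤ (j + 1) ^ 2 * Z := by
    calc (∑ n ∈ Ioc (Q ^ j) B, logSq n) / q * sieveDensity q Q
        ≤ ((j + 1) ^ 2 * Real.log Q ^ 3) / q * (q / (q.totient * Real.log Q)) := by
          gcongr
          · exact sieveDensity_nonneg q Q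
          · exact sum_logSq_block_le (by omega) hB hB'
          · exact sieveDensity_le hq hqQ
      _ = (j + 1) ^ 2 * Z := by rw [hZ]; field_simp
  have hX0 : 0 ≤ (∑ n ∈ Ioc (Q ^ j) B, logSq n) / q :=
    div_nonneg (sum_nonneg fun n _ => logSq_nonneg n) (by positivity)
  have hlog : logSq (Q ^ j) = j ^ 2 * Real.log Q ^ 2 / Q ^ j := by
    rw [logSq, Nat.cast_pow, Real.log_pow]; ring
  have hjj : (j : ℝ) ^ 2 ≤ (j + 1) ^ 2 := by gcongr; linarith
  rcases Nat.lt_or_ge j 24 with hj24 | hj24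
  · have hup : ∀ b : (ZMod q)ˣ, ∑ n ∈ Ioc (Q ^ j) B, classInd b n * roughInd Q n * logSq n ≤
        ((C + 1) * Real.exp 312 + 1) * ((j + 1) ^ 2 * Z) := by
      intro b
      have h1 := h q hq b (Q ^ j) B q 0 hQ9 hq
      rw [mul_zero, pow_zero, div_one, mul_zero, zero_add] at h1
      have h2 := (abs_le.1 h1).2
      have h3 : ∑ n ∈ Ioc (Q ^ j) B, classInd b n * roughInd Q n * logSq n ≤
          ∑ n ∈ Ioc (Q ^ j) B with ∀ p ∈ sievePrimes q q, ¬ p ∣ n, classInd b n * logSq n := by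
        rw [sum_classInd_mul_roughInd]
        refine sum_le_sum_of_subset_of_nonneg ?_ fun n _ _ =>
          mul_nonneg (classInd_nonneg b n) (logSq_nonneg n)
        intro n hn
        rw [mem_filter] at hn ⊢
        refine ⟨hn.1, fun p hp => hn.2 p ?_⟩
        rw [mem_sievePrimes] at hp ⊢
        exact ⟨hp.1.trans hqQ, hp.2⟩
      have h4 : (∑ n ∈ Ioc (Q ^ j) B, logSq n) / q * sieveDensity q q ≤
          Real.exp 312 * ((j + 1) ^ 2 * Z) := by
        calc _ ≤ (∑ n ∈ Ioc (Q ^ j) B, logSq n) / q * (Real.exp 312 * sieveDensity q Q) :=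
              mul_le_mul_of_nonneg_left (hQ ▸ sieveDensity_le_of_pow q hq) hX0
          _ = Real.exp 312 * ((∑ n ∈ Ioc (Q ^ j) B, logSq n) / q * sieveDensity q Q) := by ring
          _ ≤ _ := mul_le_mul_of_nonneg_left hXV (Real.exp_pos _).le
      have h5 : logSq (Q ^ j) * (q : ℝ) ^ 22 ≤ (j + 1) ^ 2 * Z := by
        have h6 : (q : ℝ) ^ 22 / Q ^ j ≤ 1 / q.totient := by
          have hQ0 : (0 : ℝ) < Q := by exact_mod_cast (by omega : 0 < Q)
          rw [div_le_div_iff₀ (by positivity) hphi, one_mul]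
          calc (q : ℝ) ^ 22 * q.totient ≤ (q : ℝ) ^ 22 * q := by gcongr
            _ = (q : ℝ) ^ 23 := by ring
            _ ≤ (q : ℝ) ^ 64 := pow_le_pow_right₀ (by exact_mod_cast (by omega : 1 ≤ q)) (by norm_num)
            _ = (Q : ℝ) := by rw [hQ]; push_cast; rfl
            _ ≤ Q ^ j := le_self_pow₀ (by exact_mod_cast (by omega : 1 ≤ Q)) (by omega)
        calc logSq (Q ^ j) * (q : ℝ) ^ 22
            = j ^ 2 * Real.log Q ^ 2 * ((q : ℝ) ^ 22 / Q ^ j) := by rw [hlog]; ring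
          _ ≤ (j + 1) ^ 2 * Real.log Q ^ 2 * (1 / q.totient) := by gcongr
          _ = _ := by rw [hZ]; ring
      have h6 := mul_le_mul_of_nonneg_left h4 (by positivity : 0 ≤ C + 1)
      linarith
    have hnn : ∀ b : (ZMod q)ˣ,
        0 ≤ ∑ n ∈ Ioc (Q ^ j) B, classInd b n * roughInd Q n * logSq n := fun b =>
      sum_nonneg fun n _ =>
        mul_nonneg (mul_nonneg (classInd_nonneg b n) (roughInd_nonneg Q n)) (logSq_nonneg n)
    have he : 1 ≤ Real.exp 24 * Real.exp (-j) := by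
      rw [← Real.exp_add]
      refine Real.one_le_exp ?_
      have : (j : ℝ) ≤ 24 := by exact_mod_cast hj24.le
      linarith
    have h7 : ((C + 1) * Real.exp 312 + 1) * ((j + 1) ^ 2 * Z) ≤
        ((C + 1) * Real.exp 312 + 1) * Real.exp 24 * ((j + 1) ^ 2 * Real.exp (-j)) * Z := by
      calc _ ≤ ((C + 1) * Real.exp 312 + 1) * ((j + 1) ^ 2 * Z) *
            (Real.exp 24 * Real.exp (-j)) := le_mul_of_one_le_right (by positivity) he
        _ = _ := by ring
    have h8 : 0 ≤ 2 * (C * Real.exp 47 + 1) * ((j + 1) ^ 2 * Real.exp (-j)) * Z := by positivity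
    rw [abs_le]
    constructor <;> nlinarith [hup b, hup b', hnn b, hnn b']
  · obtain ⟨c, m, hc, hm, hm1, hm2⟩ : ∃ c m : ℕ, j ≤ 24 * c + 47 ∧ 12 * c + 22 + (m + 1) = j ∧
        j ≤ 24 * m ∧ 1 ≤ m := ⟨j / 24 - 1, j - (12 * (j / 24 - 1) + 22) - 1,
          by omega, by omega, by omega, by omega⟩
    have hmain : ∀ b : (ZMod q)ˣ,
        |∑ n ∈ Ioc (Q ^ j) B, classInd b n * roughInd Q n * logSq n -
          (∑ n ∈ Ioc (Q ^ j) B, logSq n) / q * sieveDensity q Q| ≤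
        (C * Real.exp 47 + 1) * ((j + 1) ^ 2 * Real.exp (-j)) * Z := by
      intro b
      have h1 := h q hq b (Q ^ j) B Q c hQ9 (hq.trans hqQ)
      rw [← sum_classInd_mul_roughInd] at h1
      have h2 : C / Real.exp 12 ^ (2 * c) ≤ C * Real.exp 47 * Real.exp (-j) := by
        rw [div_eq_mul_inv, ← Real.exp_nat_mul, ← Real.exp_neg, mul_assoc, ← Real.exp_add]
        refine mul_le_mul_of_nonneg_left (Real.exp_le_exp.2 ?_) hC.le
        have : (j : ℝ) ≤ 24 * c + 47 := by exact_mod_cast hc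
        push_cast
        linarith
      have h3 : logSq (Q ^ j) * (Q : ℝ) ^ (12 * c + 22) ≤ ((j + 1) ^ 2 * Real.exp (-j)) * Z := by
        have hQ0 : (0 : ℝ) < Q := by exact_mod_cast (by omega : 0 < Q)
        have h4 : Real.exp j ≤ (Q : ℝ) ^ m := by
          calc Real.exp j = Real.exp 1 ^ j := by rw [← Real.exp_nat_mul, mul_one]
            _ ≤ 4 ^ j := by
                have := Real.exp_one_lt_d9
                gcongr; linarith
            _ = 2 ^ (2 * j) := by rw [pow_mul]; norm_num
            _ ≤ 2 ^ (64 * m) := pow_le_pow_right₀ (by norm_num) (by omega)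
            _ = (2 ^ 64) ^ m := by rw [pow_mul]
            _ ≤ (Q : ℝ) ^ m := by
                gcongr
                rw [hQ]
                exact_mod_cast Nat.pow_le_pow_left hq 64
        have h5 : (Q : ℝ) ^ (12 * c + 22) / Q ^ j ≤ Real.exp (-j) * (1 / q.totient) := by
          rw [← hm, pow_add _ (12 * c + 22), div_mul_eq_div_div, div_self (by positivity), hm,
            Real.exp_neg, ← one_div, div_mul_div_comm, one_mul, pow_succ]
          have hphiQ : (q.totient : ℝ) ≤ Q := hphiq.trans (by exact_mod_cast hqQ)
          refine one_div_le_one_div_of_le (by positivity) ?_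
          gcongr
        calc logSq (Q ^ j) * (Q : ℝ) ^ (12 * c + 22)
            = j ^ 2 * Real.log Q ^ 2 * ((Q : ℝ) ^ (12 * c + 22) / Q ^ j) := by rw [hlog]; ring
          _ ≤ (j + 1) ^ 2 * Real.log Q ^ 2 * (Real.exp (-j) * (1 / q.totient)) := by gcongr
          _ = _ := by rw [hZ]; ring
      refine h1.trans ?_
      have h6 : C / Real.exp 12 ^ (2 * c) *
          ((∑ n ∈ Ioc (Q ^ j) B, logSq n) / q * sieveDensity q Q) ≤
          C * Real.exp 47 * Real.exp (-j) * ((j + 1) ^ 2 * Z) :=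
        mul_le_mul h2 hXV (mul_nonneg hX0 (sieveDensity_nonneg q Q)) (by positivity)
      linarith
    have h8 : 0 ≤ 2 * ((C + 1) * Real.exp 312 + 1) * Real.exp 24 *
      ((j + 1) ^ 2 * Real.exp (-j)) * Z := by positivity
    have h9 := abs_le.1 (hmain b)
    have h10 := abs_le.1 (hmain b')
    rw [abs_le]
    constructor <;> nlinarith

/-- The sum of `log² e / e` over the rough `e ≤ y` in the class `b`. -/
noncomputable def roughLogSq {q : ℕ} (Q : ℕ) (b : (ZMod q)ˣ) (y : ℕ) : ℝ :=
  ∑ n ∈ Icc 1 y, classInd b n * roughInd Q n * logSq n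

theorem exists_roughLogSq_sub_le : ∃ C : ℝ, 0 < C ∧ ∀ q Q : ℕ, 2 ≤ q → Q = q ^ 64 →
    ∀ (b b' : (ZMod q)ˣ) (y : ℕ),
    |roughLogSq Q b y - roughLogSq Q b' y| ≤ C * (Real.log Q ^ 2 / q.totient) := by
  obtain ⟨C, hC, h⟩ := exists_rough_block_sub_le
  have hsum : Summable fun j : ℕ => ((j : ℝ) + 1) ^ 2 * Real.exp (-j) := by
    have h1 := ((summable_nat_add_iff 1).2
      (Real.summable_pow_mul_exp_neg_nat_mul 2 (r := 1) one_pos)).mul_left (Real.exp 1)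
    refine h1.congr fun j => ?_
    push_cast
    rw [show (-(j : ℝ)) = 1 + -1 * (j + 1) by ring, Real.exp_add]
    ring
  set S := ∑' j : ℕ, ((j : ℝ) + 1) ^ 2 * Real.exp (-j) with hS
  have hS0 : 0 ≤ S := tsum_nonneg fun j => by positivity
  refine ⟨C * S + 1, by positivity, ?_⟩
  intro q Q hq hQ b b' y
  set Z : ℝ := Real.log Q ^ 2 / q.totient with hZ
  have hZ0 : 0 ≤ Z := by positivity
  have hQ2 : 2 ≤ Q := hq.trans (hQ ▸ Nat.le_self_pow (by norm_num) q)
  have key : ∀ k y : ℕ, y ≤ Q ^ (k + 1) → |roughLogSq Q b y - roughLogSq Q b' y| ≤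
      C * (∑ j ∈ range (k + 1), ((j : ℝ) + 1) ^ 2 * Real.exp (-j)) * Z := by
    intro k
    induction k with
    | zero =>
      intro y hy
      have h0 : ∀ b : (ZMod q)ˣ, roughLogSq Q b y = 0 := by
        intro b
        refine sum_eq_zero fun n hn => ?_
        rw [mem_Icc] at hn
        by_cases hr : Rough Q n
        · have : n = 1 := by
            by_contra hn1
            have := hr.lt_of_one_lt (by omega) hn1
            simp at hy
            omega
          simp [this, logSq]
        · simp [roughInd, hr]
      rw [h0, h0, sub_self, abs_zero]
      exact mul_nonneg (mul_nonneg hC.le (sum_nonneg fun j _ => by positivity)) hZ0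
    | succ k ih =>
      intro y hy
      rw [sum_range_succ, mul_add, add_mul]
      rcases Nat.le_total y (Q ^ (k + 1)) with hyk | hyk
      · exact (ih y hyk).trans (le_add_of_nonneg_right (by positivity))
      · have hsplit : ∀ b : (ZMod q)ˣ, roughLogSq Q b y = roughLogSq Q b (Q ^ (k + 1)) +
            ∑ n ∈ Ioc (Q ^ (k + 1)) y, classInd b n * roughInd Q n * logSq n := by
          intro b
          have h1 : ∀ x : ℕ, Icc 1 x = Ioc 0 x := fun x => by ext; simp [Nat.lt_iff_add_one_le]
          rw [roughLogSq, roughLogSq, h1, h1]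
          exact (sum_Ioc_consecutive _ (Nat.zero_le _) hyk).symm
        rw [hsplit b, hsplit b', add_sub_add_comm]
        refine (abs_add_le _ _).trans (add_le_add (ih _ le_rfl) ?_)
        exact h q Q hq hQ b b' (k + 1) y (by omega) hyk hy
  obtain ⟨k, hk⟩ : ∃ k, y ≤ Q ^ (k + 1) :=
    ⟨y, ((Nat.lt_pow_self (by omega : 1 < Q)).le).trans (Nat.pow_le_pow_right (by omega) (by omega))⟩
  refine (key k y hk).trans ?_
  refine mul_le_mul_of_nonneg_right ?_ hZ0
  have := hsum.sum_le_tsum (range (k + 1)) fun j _ => by positivity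
  have h2 := mul_le_mul_of_nonneg_left this hC.le
  linarith

theorem pmul_log_mul (f g : ArithmeticFunction ℝ) :
    pmul ArithmeticFunction.log (f * g) = pmul ArithmeticFunction.log f * g + f * pmul ArithmeticFunction.log g := by
  ext n
  simp only [pmul_apply, mul_apply, ArithmeticFunction.add_apply, mul_sum, ← sum_add_distrib]
  refine sum_congr rfl fun p hp => ?_
  have h := Nat.mem_divisorsAntidiagonal.1 hp
  have h1 : (p.1 : ℝ) ≠ 0 := by
    have : p.1 ≠ 0 := fun h0 => h.2 (by rw [← h.1, h0, zero_mul])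
    exact_mod_cast this
  have h2 : (p.2 : ℝ) ≠ 0 := by
    have : p.2 ≠ 0 := fun h0 => h.2 (by rw [← h.1, h0, mul_zero])
    exact_mod_cast this
  rw [ArithmeticFunction.log_apply, ArithmeticFunction.log_apply,
    ArithmeticFunction.log_apply, ← h.1, Nat.cast_mul, Real.log_mul h1 h2]
  ring

/-- Selberg's identity `Λ log + Λ * Λ = μ * log²`. -/
theorem pmul_log_vonMangoldt_add :
    pmul ArithmeticFunction.log vonMangoldt + vonMangoldt * vonMangoldt =
      ((moebius : ArithmeticFunction ℤ) : ArithmeticFunction ℝ) * pmul ArithmeticFunction.log ArithmeticFunction.log := by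
  have h : ((zeta : ArithmeticFunction ℕ) : ArithmeticFunction ℝ) *
      (pmul ArithmeticFunction.log vonMangoldt + vonMangoldt * vonMangoldt) = pmul ArithmeticFunction.log ArithmeticFunction.log := by
    have h2 : pmul ArithmeticFunction.log ((zeta : ArithmeticFunction ℕ) : ArithmeticFunction ℝ) =
        ArithmeticFunction.log := by
      ext n
      rcases Nat.eq_zero_or_pos n with h0 | h0
      · simp [h0]
      · simp
    have h3 := pmul_log_mul vonMangoldt ((zeta : ArithmeticFunction ℕ) : ArithmeticFunction ℝ)
    have h4 : vonMangoldt * ArithmeticFunction.log = vonMangoldt *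
        (vonMangoldt * ((zeta : ArithmeticFunction ℕ) : ArithmeticFunction ℝ)) := by
      rw [vonMangoldt_mul_zeta]
    rw [vonMangoldt_mul_zeta, h2, h4] at h3
    rw [h3]
    ring
  rw [← h, ← mul_assoc, coe_moebius_mul_coe_zeta, one_mul]

/-- The pairs of positive integers with product at most `x`. -/
def prodPairs (x : ℕ) : Finset (ℕ × ℕ) := {p ∈ Icc 1 x ×ˢ Icc 1 x | p.1 * p.2 ≤ x}

theorem mem_prodPairs {x : ℕ} {p : ℕ × ℕ} :
    p ∈ prodPairs x ↔ 1 ≤ p.1 ∧ 1 ≤ p.2 ∧ p.1 * p.2 ≤ x := by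
  simp only [prodPairs, mem_filter, mem_product, mem_Icc]
  refine ⟨fun h => ⟨h.1.1.1, h.1.2.1, h.2⟩, fun h => ⟨⟨⟨h.1, ?_⟩, h.2.1, ?_⟩, h.2.2⟩⟩
  · exact (Nat.le_mul_of_pos_right _ h.2.1).trans h.2.2
  · exact (Nat.le_mul_of_pos_left _ h.1).trans h.2.2

theorem sum_divisorsAntidiagonal_eq_sum_prodPairs (x : ℕ) (F : ℕ × ℕ → ℝ) :
    ∑ n ∈ Icc 1 x, ∑ p ∈ n.divisorsAntidiagonal, F p = ∑ p ∈ prodPairs x, F p := by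
  rw [← sum_fiberwise_of_maps_to (s := prodPairs x) (t := Icc 1 x) (g := fun p => p.1 * p.2)]
  · refine sum_congr rfl fun n hn => sum_congr ?_ fun _ _ => rfl
    rw [mem_Icc] at hn
    ext p
    rw [Nat.mem_divisorsAntidiagonal, mem_filter, mem_prodPairs]
    constructor
    · rintro ⟨h, h0⟩
      have h1 : p.1 ≠ 0 := fun h' => h0 (by rw [← h, h', zero_mul])
      have h2 : p.2 ≠ 0 := fun h' => h0 (by rw [← h, h', mul_zero])
      exact ⟨⟨by omega, by omega, by omega⟩, h⟩
    · rintro ⟨_, h⟩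
      exact ⟨h, by omega⟩
  · intro p hp
    rw [mem_prodPairs] at hp
    exact mem_Icc.2 ⟨Nat.mul_pos hp.1 hp.2.1, hp.2.2⟩

theorem sum_prodPairs (x : ℕ) (F : ℕ × ℕ → ℝ) :
    ∑ p ∈ prodPairs x, F p = ∑ d ∈ Icc 1 x, ∑ e ∈ Icc 1 (x / d), F (d, e) := by
  rw [sum_sigma']
  symm
  refine sum_bij' (fun p _ => (p.1, p.2)) (fun p _ => ⟨p.1, p.2⟩) ?_ ?_ ?_ ?_ ?_
  · rintro ⟨d, e⟩ h
    simp only [mem_sigma, mem_Icc] at h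
    have := (Nat.le_div_iff_mul_le (by omega)).1 h.2.2
    exact mem_prodPairs.2 ⟨h.1.1, h.2.1, by rw [mul_comm]; exact this⟩
  · rintro ⟨d, e⟩ h
    have h1 := mem_prodPairs.1 h
    simp only [mem_sigma, mem_Icc]
    refine ⟨⟨h1.1, (Nat.le_mul_of_pos_right _ h1.2.1).trans h1.2.2⟩, h1.2.1, ?_⟩
    exact (Nat.le_div_iff_mul_le h1.1).2 (by rw [mul_comm]; exact h1.2.2)
  · intros; rfl
  · intros; rfl
  · intros; rfl

theorem rough_mul {Q m n : ℕ} : Rough Q (m * n) ↔ Rough Q m ∧ Rough Q n := by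
  constructor
  · exact fun h => ⟨fun p hp hd => h p hp (hd.mul_right n), fun p hp hd => h p hp (hd.mul_left m)⟩
  · rintro ⟨h1, h2⟩ p hp hd
    exact (hp.dvd_mul.1 hd).elim (h1 p hp) (h2 p hp)

theorem roughInd_mul (Q m n : ℕ) : roughInd Q (m * n) = roughInd Q m * roughInd Q n := by
  by_cases h1 : Rough Q m <;> by_cases h2 : Rough Q n <;> simp [roughInd, rough_mul, h1, h2]

theorem classInd_mul {q : ℕ} [NeZero q] (g : (ZMod q)ˣ) (m n : ℕ) :
    classInd g (m * n) = ∑ h : (ZMod q)ˣ, classInd h m * classInd (g * h⁻¹) n := by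
  simp only [classInd]
  by_cases hm : IsUnit (m : ZMod q)
  · obtain ⟨u, hu⟩ := hm
    rw [Fintype.sum_eq_single u]
    · rw [if_pos hu.symm, one_mul, Nat.cast_mul, ← hu]
      congr 1
      rw [eq_iff_iff]
      constructor
      · intro h
        rw [Units.val_mul, ← h]
        rw [mul_comm (u : ZMod q), mul_assoc, Units.mul_inv, mul_one]
      · intro h
        rw [h, ← Units.val_mul]
        congr 1
        rw [mul_comm g, mul_inv_cancel_left]
    · intro h hne
      rw [if_neg, zero_mul]
      rw [← hu]
      exact fun h' => hne (Units.ext h').symm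
  · rw [if_neg]
    · refine (sum_eq_zero fun h _ => ?_).symm
      rw [if_neg (fun h' : (m : ZMod q) = h => hm (h' ▸ h.isUnit)), zero_mul]
    · intro h
      rw [Nat.cast_mul] at h
      exact hm (isUnit_of_mul_isUnit_left (h ▸ g.isUnit))

/-- The sum of `(Λ log + Λ * Λ)(n) / n` over the rough `n ≤ x` in the class `g`. -/
noncomputable def selbergSum {q : ℕ} (Q : ℕ) (g : (ZMod q)ˣ) (x : ℕ) : ℝ :=
  ∑ n ∈ Icc 1 x, classInd g n * roughInd Q n / n *
    (pmul ArithmeticFunction.log vonMangoldt + vonMangoldt * vonMangoldt) n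

theorem sum_classInd_mul_convolution {q : ℕ} [NeZero q] (Q : ℕ) (g : (ZMod q)ˣ) (x : ℕ)
    (u v : ArithmeticFunction ℝ) :
    ∑ n ∈ Icc 1 x, classInd g n * roughInd Q n / n * (u * v) n =
      ∑ p ∈ prodPairs x, ∑ h : (ZMod q)ˣ, (classInd h p.1 * roughInd Q p.1 * u p.1 / p.1) *
        (classInd (g * h⁻¹) p.2 * roughInd Q p.2 * v p.2 / p.2) := by
  rw [← sum_divisorsAntidiagonal_eq_sum_prodPairs]
  refine sum_congr rfl fun n hn => ?_
  rw [mul_apply, mul_sum]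
  refine sum_congr rfl fun p hp => ?_
  have h := (Nat.mem_divisorsAntidiagonal.1 hp).1
  rw [← h, classInd_mul, roughInd_mul, sum_mul, sum_div, sum_mul, Nat.cast_mul]
  refine sum_congr rfl fun k _ => ?_
  ring

theorem selbergSum_eq {q : ℕ} [NeZero q] (Q : ℕ) (g : (ZMod q)ˣ) (x : ℕ) :
    selbergSum Q g x = ∑ d ∈ Icc 1 x, ∑ h : (ZMod q)ˣ,
      (classInd h d * roughInd Q d * (moebius d : ℝ) / d) * roughLogSq Q (g * h⁻¹) (x / d) := by
  rw [selbergSum, pmul_log_vonMangoldt_add, sum_classInd_mul_convolution, sum_prodPairs]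
  refine sum_congr rfl fun d _ => ?_
  rw [sum_comm]
  refine sum_congr rfl fun h _ => ?_
  rw [roughLogSq, mul_sum]
  refine sum_congr rfl fun e _ => ?_
  simp only [pmul_apply, log_apply, logSq, intCoe_apply]
  ring

theorem sum_classInd_le_one {q : ℕ} [NeZero q] (n : ℕ) :
    ∑ h : (ZMod q)ˣ, classInd h n ≤ 1 := by
  by_cases hn : IsUnit (n : ZMod q)
  · obtain ⟨u, hu⟩ := hn
    rw [Fintype.sum_eq_single u]
    · exact classInd_le_one u n
    · intro h hne
      rw [classInd, if_neg]
      rw [← hu]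
      exact fun h' => hne (Units.ext h').symm
  · refine (sum_eq_zero fun h _ => ?_).le.trans zero_le_one
    rw [classInd, if_neg (fun h' : (n : ZMod q) = h => hn (h' ▸ h.isUnit))]

theorem coprime_of_rough {Q d m : ℕ} (hd : Rough Q d) (hm0 : 0 < m) (hm : m ≤ Q) :
    Nat.Coprime d m :=
  Nat.coprime_of_dvd fun p hp hpd hpm =>
    absurd (hd p hp hpd) (not_lt.2 ((Nat.le_of_dvd hm0 hpm).trans hm))

theorem sum_roughInd_div_le {Q k : ℕ} (hQ : 3 ≤ Q) :
    ∑ d ∈ Icc 1 (Q ^ k - 1), roughInd Q d / d ≤ k + 2 := by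
  classical
  have hlQ : 1 ≤ Real.log Q := by
    rw [Real.le_log_iff_exp_le (by exact_mod_cast (by omega : 0 < Q))]
    have := Real.exp_one_lt_d9
    have : (3 : ℝ) ≤ Q := by exact_mod_cast hQ
    linarith
  have hharm : ∀ n : ℕ, (harmonic n : ℝ) = ∑ i ∈ Icc 1 n, (1 : ℝ) / i := by
    intro n
    rw [harmonic_eq_sum_Icc]
    push_cast
    simp
  set S : Finset ℕ := {d ∈ Icc 1 (Q ^ k - 1) | Rough Q d} with hS
  have h1 : ∑ d ∈ Icc 1 (Q ^ k - 1), roughInd Q d / d = ∑ d ∈ S, (1 : ℝ) / d := by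
    rw [hS, sum_filter]
    refine sum_congr rfl fun d _ => ?_
    simp only [roughInd]
    split_ifs <;> simp
  have h2 : (∑ d ∈ S, (1 : ℝ) / d) * ∑ m ∈ Icc 1 Q, (1 : ℝ) / m ≤
      ∑ n ∈ Icc 1 (Q ^ (k + 1)), (1 : ℝ) / n := by
    rw [sum_mul_sum, ← sum_product']
    have hinj : Set.InjOn (fun p : ℕ × ℕ => p.1 * p.2) (S ×ˢ Icc 1 Q : Finset (ℕ × ℕ)) := by
      rintro ⟨d, m⟩ h ⟨d', m'⟩ h' heq
      simp only [hS, coe_product, Set.mem_prod, mem_coe, mem_filter, mem_Icc] at h h'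
      simp only at heq
      have e1 : d ∣ d' := (coprime_of_rough h.1.2 (by omega) h'.2.2).dvd_of_dvd_mul_right
        (heq ▸ Dvd.intro _ rfl)
      have e2 : d' ∣ d := (coprime_of_rough h'.1.2 (by omega) h.2.2).dvd_of_dvd_mul_right
        (heq ▸ Dvd.intro _ rfl)
      have e3 := Nat.dvd_antisymm e1 e2
      subst e3
      have := Nat.eq_of_mul_eq_mul_left (by omega) heq
      rw [this]
    calc ∑ p ∈ S ×ˢ Icc 1 Q, (1 : ℝ) / p.1 * (1 / p.2)
        = ∑ n ∈ (S ×ˢ Icc 1 Q).image (fun p => p.1 * p.2), (1 : ℝ) / n := by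
          rw [sum_image hinj]
          refine sum_congr rfl fun p _ => ?_
          push_cast
          rw [div_mul_div_comm, one_mul]
      _ ≤ _ := by
          refine sum_le_sum_of_subset_of_nonneg ?_ fun _ _ _ => by positivity
          intro n hn
          obtain ⟨p, hp, rfl⟩ := mem_image.1 hn
          simp only [hS, mem_product, mem_filter, mem_Icc] at hp ⊢
          refine ⟨Nat.mul_pos hp.1.1.1 hp.2.1, ?_⟩
          rw [pow_succ]
          exact Nat.mul_le_mul (by omega) hp.2.2
  have h3 : Real.log Q ≤ ∑ m ∈ Icc 1 Q, (1 : ℝ) / m := by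
    rw [← hharm]
    refine le_trans (Real.log_le_log (by exact_mod_cast (by omega : 0 < Q)) ?_)
      (log_add_one_le_harmonic Q)
    push_cast; linarith
  have h4 : ∑ n ∈ Icc 1 (Q ^ (k + 1)), (1 : ℝ) / n ≤ 1 + (k + 1) * Real.log Q := by
    rw [← hharm]
    refine (harmonic_le_one_add_log _).trans ?_
    rw [Nat.cast_pow, Real.log_pow]
    push_cast; rfl
  rw [h1]
  have h5 : 0 ≤ ∑ d ∈ S, (1 : ℝ) / d := sum_nonneg fun d _ => by positivity
  have h6 := mul_le_mul_of_nonneg_left h3 h5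
  have h7 : (∑ d ∈ S, (1 : ℝ) / d) * Real.log Q ≤ (k + 2) * Real.log Q := by
    linarith
  exact le_of_mul_le_mul_right h7 (by linarith)

theorem exists_selbergSum_sub_le : ∃ C : ℝ, 0 < C ∧ ∀ q Q : ℕ, 2 ≤ q → Q = q ^ 64 →
    ∀ (g g' : (ZMod q)ˣ) (k : ℕ),
    |selbergSum Q g (Q ^ k - 1) - selbergSum Q g' (Q ^ k - 1)| ≤
      C * (k + 2) * (Real.log Q ^ 2 / q.totient) := by
  obtain ⟨C, hC, h⟩ := exists_roughLogSq_sub_le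
  refine ⟨C, hC, fun q Q hq hQ g g' k => ?_⟩
  have : NeZero q := ⟨by omega⟩
  have hQ3 : 3 ≤ Q := by
    calc 3 ≤ 2 ^ 64 := by norm_num
      _ ≤ Q := hQ ▸ Nat.pow_le_pow_left hq 64
  set Z : ℝ := Real.log Q ^ 2 / q.totient with hZ
  have hZ0 : 0 ≤ Z := by positivity
  rw [selbergSum_eq, selbergSum_eq, ← sum_sub_distrib]
  calc |_| ≤ ∑ d ∈ Icc 1 (Q ^ k - 1), ∑ t : (ZMod q)ˣ, classInd t d * (roughInd Q d / d * (C * Z))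
        := by
        refine (abs_sum_le_sum_abs _ _).trans (sum_le_sum fun d _ => ?_)
        rw [← sum_sub_distrib]
        refine (abs_sum_le_sum_abs _ _).trans (sum_le_sum fun t _ => ?_)
        rw [← mul_sub, abs_mul, ← mul_assoc]
        refine mul_le_mul ?_ (h q Q hq hQ _ _ _) (abs_nonneg _)
          (mul_nonneg (classInd_nonneg _ _) (div_nonneg (roughInd_nonneg _ _) (by positivity)))
        have hmu : |(moebius d : ℝ)| ≤ 1 := by exact_mod_cast abs_moebius_le_one
        rw [abs_div, abs_mul, abs_mul, abs_of_nonneg (classInd_nonneg t d),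
          abs_of_nonneg (roughInd_nonneg Q d), Nat.abs_cast, mul_div_assoc, mul_assoc]
        refine mul_le_mul_of_nonneg_left ?_ (classInd_nonneg t d)
        rw [mul_div_assoc']
        refine div_le_div_of_nonneg_right ?_ (by positivity)
        exact mul_le_of_le_one_right (roughInd_nonneg Q d) hmu
    _ ≤ ∑ d ∈ Icc 1 (Q ^ k - 1), roughInd Q d / d * (C * Z) := by
        refine sum_le_sum fun d _ => ?_
        rw [← sum_mul]
        exact mul_le_of_le_one_left (mul_nonneg (div_nonneg (roughInd_nonneg _ _) (by positivity))
          (by positivity)) (sum_classInd_le_one d)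
    _ ≤ (k + 2) * (C * Z) := by
        rw [← sum_mul]
        exact mul_le_mul_of_nonneg_right (sum_roughInd_div_le hQ3) (by positivity)
    _ = _ := by ring

theorem sum_pow_le_two_mul {r : ℝ} (h0 : 0 ≤ r) (h1 : r ≤ 1 / 2) (x : ℕ) :
    ∑ a ∈ Icc 1 x, r ^ a ≤ 2 * r := by
  have h2 : ∀ x : ℕ, ∑ a ∈ Icc 1 x, r ^ a ≤ 2 * r * (1 - r ^ x) := by
    intro x
    induction x with
    | zero => simp
    | succ x ih =>
      rw [sum_Icc_succ_top (by omega)]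
      have : 0 ≤ r ^ (x + 1) := by positivity
      rw [pow_succ] at this ⊢
      nlinarith
  refine (h2 x).trans ?_
  have : 0 ≤ r ^ x := by positivity
  nlinarith

theorem sum_vonMangoldt_not_rough_le {Q : ℕ} (hQ : 1 ≤ Q) (x : ℕ) :
    ∑ n ∈ Icc 1 x, (1 - roughInd Q n) * (vonMangoldt n / n) ≤ 2 * (Real.log Q + 6) := by
  classical
  set T := {p ∈ Icc 1 Q | p.Prime} with hT
  have hTp : ∀ p ∈ T, p.Prime := fun p hp => (mem_filter.1 hp).2
  have h1 : ∑ n ∈ Icc 1 x, (1 - roughInd Q n) * (vonMangoldt n / n) ≤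
      ∑ n ∈ (T ×ˢ Icc 1 x).image (fun p => p.1 ^ p.2), vonMangoldt n / n := by
    rw [← sum_subset (filter_subset
      (fun n => (1 - roughInd Q n) * (vonMangoldt n / n) ≠ 0) (Icc 1 x))]
    · calc _ ≤ ∑ n ∈ Icc 1 x with (1 - roughInd Q n) * (vonMangoldt n / n) ≠ 0,
            vonMangoldt n / n := by
            refine sum_le_sum fun n _ => ?_
            refine mul_le_of_le_one_left (div_nonneg vonMangoldt_nonneg (by positivity)) ?_
            linarith [roughInd_nonneg Q n]
        _ ≤ _ := by
            refine sum_le_sum_of_subset_of_nonneg ?_ fun _ _ _ =>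
              div_nonneg vonMangoldt_nonneg (by positivity)
            intro n hn
            rw [mem_filter, mem_Icc] at hn
            have hr : ¬ Rough Q n := fun h => hn.2 (by simp [roughInd, h])
            have hL : vonMangoldt n ≠ 0 := fun h => hn.2 (by simp [h])
            obtain ⟨p, a, hp, ha, rfl⟩ :=
              (isPrimePow_nat_iff n).1 (vonMangoldt_ne_zero_iff.1 hL)
            refine mem_image.2 ⟨(p, a), ?_, rfl⟩
            rw [mem_product, hT, mem_filter, mem_Icc, mem_Icc]
            refine ⟨⟨⟨hp.one_le, ?_⟩, hp⟩, ha, ((Nat.lt_pow_self hp.one_lt).le).trans hn.1.2⟩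
            by_contra! hpQ
            exact hr fun p' hp' hd =>
              ((Nat.prime_dvd_prime_iff_eq hp' hp).1 (hp'.dvd_of_dvd_pow hd)) ▸ hpQ
    · intro n hn hn'
      rw [mem_filter, not_and, not_not] at hn'
      exact hn' hn
  have hinj : Set.InjOn (fun p : ℕ × ℕ => p.1 ^ p.2) (T ×ˢ Icc 1 x : Finset (ℕ × ℕ)) := by
    rintro ⟨p, a⟩ h ⟨p', a'⟩ h' heq
    rw [mem_coe, mem_product, mem_Icc] at h h'
    simp only at heq h h'
    obtain ⟨e1, e2⟩ := (hTp p h.1).pow_inj' (hTp p' h'.1) (by omega) (by omega) heq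
    rw [e1, e2]
  rw [sum_image hinj, sum_product] at h1
  have h2 : ∀ p ∈ T, ∑ a ∈ Icc 1 x, vonMangoldt (p ^ a) / ((p ^ a : ℕ) : ℝ) ≤
      2 * (vonMangoldt p / p) := by
    intro p hp
    have h3 : ∀ a ∈ Icc 1 x, vonMangoldt (p ^ a) / ((p ^ a : ℕ) : ℝ) =
        vonMangoldt p * (1 / (p : ℝ)) ^ a := by
      intro a ha
      rw [mem_Icc] at ha
      rw [vonMangoldt_apply_pow (by omega), Nat.cast_pow, one_div_pow, mul_one_div]
    rw [sum_congr rfl h3, ← mul_sum]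
    have := one_sub_inv_prime_bounds (hTp p hp)
    calc _ ≤ vonMangoldt p * (2 * (1 / (p : ℝ))) :=
          mul_le_mul_of_nonneg_left (sum_pow_le_two_mul this.1 this.2 x) vonMangoldt_nonneg
      _ = _ := by ring
  calc _ ≤ _ := h1
    _ ≤ ∑ p ∈ T, 2 * (vonMangoldt p / p) := sum_le_sum h2
    _ ≤ ∑ n ∈ Icc 1 Q, 2 * (vonMangoldt n / n) :=
        sum_le_sum_of_subset_of_nonneg (filter_subset _ _) fun _ _ _ =>
          mul_nonneg zero_le_two (div_nonneg vonMangoldt_nonneg (by positivity))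
    _ ≤ _ := by
        rw [← mul_sum]
        have := (abs_le.1 (abs_sum_vonMangoldt_div_sub_log_le Q hQ)).2
        linarith

theorem sum_classInd_of_coprime {q : ℕ} [NeZero q] {n : ℕ} (hn : Nat.Coprime n q) :
    ∑ h : (ZMod q)ˣ, classInd h n = 1 := by
  rw [Fintype.sum_eq_single (ZMod.unitOfCoprime n hn)]
  · simp [classInd]
  · intro h hne
    rw [classInd, if_neg]
    intro hcast
    exact hne (Units.ext (by rw [ZMod.coe_unitOfCoprime, hcast]))

/-- The normalised weight of the rough prime powers in `[Q ^ j, Q ^ (j + 1))` in the class `g`. -/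
noncomputable def primeBlock {q : ℕ} (Q j : ℕ) (g : (ZMod q)ˣ) : ℝ :=
  q.totient / Real.log Q *
    ∑ n ∈ Ico (Q ^ j) (Q ^ (j + 1)), classInd g n * (roughInd Q n * vonMangoldt n / n)

theorem classInd_mul_rough_nonneg {q : ℕ} (Q : ℕ) (g : (ZMod q)ˣ) (n : ℕ) :
    0 ≤ classInd g n * (roughInd Q n * vonMangoldt n / n) :=
  mul_nonneg (classInd_nonneg g n)
    (div_nonneg (mul_nonneg (roughInd_nonneg Q n) vonMangoldt_nonneg) (by positivity))

theorem primeBlock_nonneg {q : ℕ} (Q j : ℕ) (g : (ZMod q)ˣ) : 0 ≤ primeBlock Q j g :=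
  mul_nonneg (div_nonneg (by positivity) (Real.log_natCast_nonneg Q))
    (sum_nonneg fun n _ => classInd_mul_rough_nonneg Q g n)

theorem primeBlock_zero {q : ℕ} (Q : ℕ) (g : (ZMod q)ˣ) : primeBlock Q 0 g = 0 := by
  rw [primeBlock, sum_eq_zero, mul_zero]
  intro n hn
  rw [pow_zero, zero_add, pow_one, mem_Ico] at hn
  by_cases hr : Rough Q n
  · have : n = 1 := by
      by_contra h1
      have := hr.lt_of_one_lt (by omega) h1
      omega
    simp [this]
  · simp [roughInd, hr]

theorem sum_Icc_pow_sub_one_eq {Q : ℕ} (hQ : 1 ≤ Q) (k : ℕ) (F : ℕ → ℝ) :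
    ∑ n ∈ Icc 1 (Q ^ k - 1), F n = ∑ j ∈ range k, ∑ n ∈ Ico (Q ^ j) (Q ^ (j + 1)), F n := by
  have h1 : ∀ k, Icc 1 (Q ^ k - 1) = Ico 1 (Q ^ k) := by
    intro k
    have := Nat.one_le_pow k Q hQ
    ext n
    rw [mem_Icc, mem_Ico]
    omega
  rw [h1]
  induction k with
  | zero => simp
  | succ k ih =>
    rw [sum_range_succ, ← ih, sum_Ico_consecutive _ (Nat.one_le_pow k Q hQ)
      (Nat.pow_le_pow_right hQ (Nat.le_succ k))]

theorem sum_expect_primeBlock {q Q : ℕ} [NeZero q] (hqQ : q ≤ Q) (hQ : 1 ≤ Q)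
    (k : ℕ) : ∑ j ∈ range k, 𝔼 g : (ZMod q)ˣ, primeBlock Q j g =
      (∑ n ∈ Icc 1 (Q ^ k - 1), roughInd Q n * vonMangoldt n / n) / Real.log Q := by
  rw [sum_Icc_pow_sub_one_eq hQ, sum_div]
  refine sum_congr rfl fun j _ => ?_
  have hphi : (q.totient : ℝ) ≠ 0 := by
    exact_mod_cast (Nat.totient_pos.2 (Nat.pos_of_ne_zero (NeZero.ne q))).ne'
  simp only [primeBlock]
  rw [Fintype.expect_eq_sum_div_card, ZMod.card_units_eq_totient, ← mul_sum, sum_comm,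
    mul_comm, mul_div_assoc, div_div_cancel_left' hphi, div_eq_mul_inv]
  congr 1
  refine sum_congr rfl fun n _ => ?_
  rw [← sum_mul]
  by_cases hr : Rough Q n
  · rw [sum_classInd_of_coprime (coprime_of_rough hr (Nat.pos_of_ne_zero (NeZero.ne q)) hqQ),
      one_mul]
  · simp [roughInd, hr]

theorem abs_sum_expect_primeBlock_sub_le {q Q : ℕ} [NeZero q] (hqQ : q ≤ Q) (hQ : 3 ≤ Q)
    (k : ℕ) : |∑ j ∈ range k, 𝔼 g : (ZMod q)ˣ, primeBlock Q j g - k| ≤ 21 := by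
  have hlQ : 1 ≤ Real.log Q := by
    rw [Real.le_log_iff_exp_le (by exact_mod_cast (by omega : 0 < Q))]
    have := Real.exp_one_lt_d9
    have : (3 : ℝ) ≤ Q := by exact_mod_cast hQ
    linarith
  rcases Nat.eq_zero_or_pos k with hk | hk
  · simp [hk]
  rw [sum_expect_primeBlock hqQ (by omega)]
  have hQk : 3 ≤ Q ^ k := hQ.trans (Nat.le_self_pow (by omega) Q)
  have h1 := abs_le.1 (abs_sum_vonMangoldt_div_sub_log_le (Q ^ k - 1) (by omega))
  have h2 := sum_vonMangoldt_not_rough_le (Q := Q) (by omega) (Q ^ k - 1)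
  have h3 : 0 ≤ ∑ n ∈ Icc 1 (Q ^ k - 1), (1 - roughInd Q n) * (vonMangoldt n / n) :=
    sum_nonneg fun n _ => mul_nonneg (by linarith [roughInd_le_one Q n])
      (div_nonneg vonMangoldt_nonneg (by positivity))
  have h4 : ∑ n ∈ Icc 1 (Q ^ k - 1), (1 - roughInd Q n) * (vonMangoldt n / n) =
      ∑ n ∈ Icc 1 (Q ^ k - 1), vonMangoldt n / n -
        ∑ n ∈ Icc 1 (Q ^ k - 1), roughInd Q n * vonMangoldt n / n := by
    rw [← sum_sub_distrib]
    exact sum_congr rfl fun n _ => by ring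
  have h5 : Real.log ((Q ^ k : ℕ) : ℝ) = k * Real.log Q := by rw [Nat.cast_pow, Real.log_pow]
  have hx0 : (0 : ℝ) < ((Q ^ k - 1 : ℕ) : ℝ) := by exact_mod_cast (by omega : 0 < Q ^ k - 1)
  have h6 : Real.log ((Q ^ k - 1 : ℕ) : ℝ) ≤ k * Real.log Q := by
    rw [← h5]
    exact Real.log_le_log hx0 (by exact_mod_cast Nat.sub_le _ _)
  have h7 : k * Real.log Q ≤ Real.log ((Q ^ k - 1 : ℕ) : ℝ) + 1 := by
    rw [← h5]
    have : Real.log ((Q ^ k : ℕ) : ℝ) ≤ Real.log (2 * ((Q ^ k - 1 : ℕ) : ℝ)) :=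
      Real.log_le_log (by exact_mod_cast (by omega : 0 < Q ^ k))
        (by exact_mod_cast (by omega : Q ^ k ≤ 2 * (Q ^ k - 1)))
    rw [Real.log_mul two_ne_zero hx0.ne'] at this
    have := Real.log_two_lt_d9
    linarith
  have h8 : ∀ S : ℝ, S / Real.log Q - k = (S - k * Real.log Q) / Real.log Q := by
    intro S
    field_simp
  rw [h8, abs_div, abs_of_pos (by linarith : 0 < Real.log Q), div_le_iff₀ (by linarith), abs_le]
  constructor <;> linarith

theorem abs_sum_mul_add_sum_antidiagonal_sub_le (F : ℕ → ℝ) (C : ℝ)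
    (hF : ∀ j, 0 ≤ F j) (h : ∀ k : ℕ, |∑ j ∈ range k, F j - k| ≤ C) (k : ℕ) :
    |∑ j ∈ range k, (j * F j + ∑ p ∈ antidiagonal j, F p.1 * F p.2) - (k : ℝ) ^ 2| ≤
      C * (2 * k + C) := by
  have hC : 0 ≤ C := (abs_nonneg _).trans (h 0)
  have h1 : ∀ k : ℕ, ∑ j ∈ range k, ∑ p ∈ antidiagonal j, F p.1 * F p.2 =
      ∑ i ∈ range k, F i * ∑ j ∈ range (k - i), F j := by
    intro k
    induction k with
    | zero => simp
    | succ k ih =>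
      rw [sum_range_succ, ih, sum_range_succ _ k, Nat.sum_antidiagonal_eq_sum_range_succ
        (fun i j => F i * F j), sum_range_succ, Nat.sub_self, Nat.add_sub_cancel_left,
        sum_range_one, ← add_assoc, ← sum_add_distrib]
      congr 1
      refine sum_congr rfl fun i hi => ?_
      rw [mem_range] at hi
      rw [← mul_add, Nat.sub_add_comm hi.le, sum_range_succ]
  rw [sum_add_distrib, h1, ← sum_add_distrib]
  set s := ∑ j ∈ range k, F j with hs
  have h2 : |∑ i ∈ range k, (i * F i + F i * ∑ j ∈ range (k - i), F j) - k * s| ≤ C * s := by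
    rw [hs, mul_sum, mul_sum, ← sum_sub_distrib]
    refine (abs_sum_le_sum_abs _ _).trans (sum_le_sum fun i hi => ?_)
    rw [mem_range] at hi
    have e : i * F i + F i * ∑ j ∈ range (k - i), F j - k * F i =
        F i * (∑ j ∈ range (k - i), F j - ((k - i : ℕ) : ℝ)) := by
      rw [Nat.cast_sub hi.le]; ring
    rw [e, abs_mul, abs_of_nonneg (hF i), mul_comm C]
    exact mul_le_mul_of_nonneg_left (h (k - i)) (hF i)
  have h3 := abs_le.1 (h k)
  rw [← hs] at h3
  have h4 := abs_le.1 h2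
  have hk : (0 : ℝ) ≤ k := by positivity
  rw [abs_le]
  constructor <;> nlinarith

theorem mem_Ico_pow_iff {Q j n : ℕ} (hQ : 1 < Q) (hn : 1 ≤ n) :
    n ∈ Ico (Q ^ j) (Q ^ (j + 1)) ↔ Nat.log Q n = j := by
  rw [mem_Ico, eq_comm, eq_comm (a := j), Nat.log_eq_iff (Or.inr ⟨hQ, by omega⟩)]

theorem sum_antidiagonal_blocks_eq {Q : ℕ} (hQ : 1 < Q) (k : ℕ) (F : ℕ × ℕ → ℝ) :
    ∑ j ∈ range k, ∑ p ∈ antidiagonal j, ∑ d ∈ Ico (Q ^ p.1) (Q ^ (p.1 + 1)),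
      ∑ e ∈ Ico (Q ^ p.2) (Q ^ (p.2 + 1)), F (d, e) =
    ∑ p ∈ (Ico 1 (Q ^ k) ×ˢ Ico 1 (Q ^ k)).filter
      (fun p : ℕ × ℕ => Nat.log Q p.1 + Nat.log Q p.2 < k), F p := by
  rw [← sum_fiberwise_of_maps_to (t := range k) 
    (g := fun p : ℕ × ℕ => Nat.log Q p.1 + Nat.log Q p.2)]
  swap
  · exact fun p hp => mem_range.2 (mem_filter.1 hp).2
  refine sum_congr rfl fun j hj => ?_
  refine Eq.trans ?_ (sum_fiberwise_of_maps_to (t := antidiagonal j)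
    (g := fun p : ℕ × ℕ => (Nat.log Q p.1, Nat.log Q p.2))
    (fun p hp => HasAntidiagonal.mem_antidiagonal.2 (mem_filter.1 hp).2) _)
  refine sum_congr rfl fun p hp => ?_
  rw [← sum_product']
  refine sum_congr ?_ fun _ _ => rfl
  rw [mem_range] at hj
  rw [HasAntidiagonal.mem_antidiagonal] at hp
  have hpos : ∀ i n, n ∈ Ico (Q ^ i) (Q ^ (i + 1)) → 1 ≤ n := fun i n h =>
    (Nat.one_le_pow i Q (by omega)).trans (mem_Ico.1 h).1
  have hlt : ∀ i n, i < k → n ∈ Ico (Q ^ i) (Q ^ (i + 1)) → n < Q ^ k := fun i n hi h =>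
    (mem_Ico.1 h).2.trans_le (Nat.pow_le_pow_right (by omega) hi)
  ext ⟨d, e⟩
  rw [mem_product, mem_filter, mem_filter, mem_filter, mem_product, Prod.ext_iff]
  simp only
  constructor
  · rintro ⟨h1, h2⟩
    have e1 := (mem_Ico_pow_iff hQ (hpos _ _ h1)).1 h1
    have e2 := (mem_Ico_pow_iff hQ (hpos _ _ h2)).1 h2
    rw [e1, e2]
    exact ⟨⟨⟨⟨mem_Ico.2 ⟨hpos _ _ h1, hlt _ _ (by omega) h1⟩,
      mem_Ico.2 ⟨hpos _ _ h2, hlt _ _ (by omega) h2⟩⟩, by omega⟩, hp⟩, rfl, rfl⟩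
  · rintro ⟨⟨⟨⟨h1, h2⟩, _⟩, _⟩, h3, h4⟩
    exact ⟨(mem_Ico_pow_iff hQ (mem_Ico.1 h1).1).2 h3, (mem_Ico_pow_iff hQ (mem_Ico.1 h2).1).2 h4⟩

theorem sum_prodPairs_le_blocks {Q : ℕ} (hQ : 1 < Q) (k : ℕ) (F : ℕ × ℕ → ℝ)
    (hF : ∀ p, 0 ≤ F p) :
    ∑ p ∈ prodPairs (Q ^ k - 1), F p ≤
      ∑ j ∈ range k, ∑ p ∈ antidiagonal j, ∑ d ∈ Ico (Q ^ p.1) (Q ^ (p.1 + 1)),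
        ∑ e ∈ Ico (Q ^ p.2) (Q ^ (p.2 + 1)), F (d, e) := by
  rw [sum_antidiagonal_blocks_eq hQ]
  refine sum_le_sum_of_subset_of_nonneg ?_ fun p _ _ => hF p
  rintro ⟨d, e⟩ h
  obtain ⟨h1, h2, h3⟩ := mem_prodPairs.1 h
  simp only at h1 h2 h3
  have hQk := Nat.one_le_pow k Q (by omega)
  have hd : d ≤ d * e := Nat.le_mul_of_pos_right _ h2
  have he : e ≤ d * e := Nat.le_mul_of_pos_left _ h1
  rw [mem_filter, mem_product, mem_Ico, mem_Ico]
  refine ⟨⟨⟨h1, by omega⟩, h2, by omega⟩, ?_⟩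
  have h4 := Nat.pow_log_le_self Q (show d ≠ 0 by omega)
  have h5 := Nat.pow_log_le_self Q (show e ≠ 0 by omega)
  have h6 : Q ^ (Nat.log Q d + Nat.log Q e) < Q ^ k := by
    rw [pow_add]
    exact (Nat.mul_le_mul h4 h5).trans_lt (by omega)
  exact (Nat.pow_lt_pow_iff_right hQ).1 h6

theorem blocks_le_sum_prodPairs {Q : ℕ} (hQ : 1 < Q) (k : ℕ) (F : ℕ × ℕ → ℝ)
    (hF : ∀ p, 0 ≤ F p) :
    ∑ j ∈ range k, ∑ p ∈ antidiagonal j, ∑ d ∈ Ico (Q ^ p.1) (Q ^ (p.1 + 1)),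
      ∑ e ∈ Ico (Q ^ p.2) (Q ^ (p.2 + 1)), F (d, e) ≤
    ∑ p ∈ prodPairs (Q ^ (k + 1) - 1), F p := by
  rw [sum_antidiagonal_blocks_eq hQ]
  refine sum_le_sum_of_subset_of_nonneg ?_ fun p _ _ => hF p
  rintro ⟨d, e⟩ h
  rw [mem_filter, mem_product, mem_Ico, mem_Ico] at h
  simp only at h
  refine mem_prodPairs.2 ⟨h.1.1.1, h.1.2.1, ?_⟩
  have h4 := Nat.lt_pow_succ_log_self hQ d
  have h5 := Nat.lt_pow_succ_log_self hQ e
  have h6 : d * e < Q ^ (k + 1) := by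
    calc d * e < Q ^ (Nat.log Q d).succ * Q ^ (Nat.log Q e).succ :=
          Nat.mul_lt_mul'' h4 h5
      _ = Q ^ ((Nat.log Q d).succ + (Nat.log Q e).succ) := (pow_add _ _ _).symm
      _ ≤ Q ^ (k + 1) := Nat.pow_le_pow_right (by omega) (by omega)
  simp only
  omega

/-- The logarithmic part of `selbergSum`. -/
noncomputable def selbergLog {q : ℕ} (Q : ℕ) (g : (ZMod q)ˣ) (x : ℕ) : ℝ :=
  ∑ n ∈ Icc 1 x, classInd g n * (roughInd Q n * vonMangoldt n / n) * Real.log n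

/-- The convolution part of `selbergSum`. -/
noncomputable def selbergConv {q : ℕ} [NeZero q] (Q : ℕ) (g : (ZMod q)ˣ) (x : ℕ) : ℝ :=
  ∑ p ∈ prodPairs x, ∑ h : (ZMod q)ˣ, (classInd h p.1 * (roughInd Q p.1 * vonMangoldt p.1 / p.1)) *
    (classInd (g * h⁻¹) p.2 * (roughInd Q p.2 * vonMangoldt p.2 / p.2))

theorem selbergSum_eq_add {q : ℕ} [NeZero q] (Q : ℕ) (g : (ZMod q)ˣ) (x : ℕ) :
    selbergSum Q g x = selbergLog Q g x + selbergConv Q g x := by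
  have h := sum_classInd_mul_convolution Q g x vonMangoldt vonMangoldt
  have h2 : selbergConv Q g x = ∑ n ∈ Icc 1 x, classInd g n * roughInd Q n / n *
      (vonMangoldt * vonMangoldt) n := by
    rw [h, selbergConv]
    refine sum_congr rfl fun p _ => sum_congr rfl fun t _ => ?_
    ring
  rw [h2, selbergLog, ← sum_add_distrib, selbergSum]
  refine sum_congr rfl fun n _ => ?_
  rw [ArithmeticFunction.add_apply, pmul_apply, ArithmeticFunction.log_apply]
  ring

theorem selbergConv_mono {q : ℕ} [NeZero q] (Q : ℕ) (g : (ZMod q)ˣ) {x y : ℕ} (hxy : x ≤ y) :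
    selbergConv Q g x ≤ selbergConv Q g y := by
  refine sum_le_sum_of_subset_of_nonneg ?_ fun p _ _ => sum_nonneg fun t _ =>
    mul_nonneg (classInd_mul_rough_nonneg Q _ _) (classInd_mul_rough_nonneg Q _ _)
  intro p hp
  rw [mem_prodPairs] at hp ⊢
  exact ⟨hp.1, hp.2.1, hp.2.2.trans hxy⟩

theorem sum_Ico_eq_primeBlock {q Q : ℕ} [NeZero q] (hQ : 1 < Q) (j : ℕ) (g : (ZMod q)ˣ) :
    ∑ n ∈ Ico (Q ^ j) (Q ^ (j + 1)), classInd g n * (roughInd Q n * vonMangoldt n / n) =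
      Real.log Q / q.totient * primeBlock Q j g := by
  have hphi : (q.totient : ℝ) ≠ 0 := by
    exact_mod_cast (Nat.totient_pos.2 (Nat.pos_of_ne_zero (NeZero.ne q))).ne'
  have hl : Real.log Q ≠ 0 := (Real.log_pos (by exact_mod_cast hQ)).ne'
  rw [primeBlock]
  field_simp

theorem selbergLog_block_bounds {q Q : ℕ} [NeZero q] (hQ : 1 < Q) (j : ℕ) (g : (ZMod q)ˣ) :
    Real.log Q ^ 2 / q.totient * (j * primeBlock Q j g) ≤
      ∑ n ∈ Ico (Q ^ j) (Q ^ (j + 1)),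
        classInd g n * (roughInd Q n * vonMangoldt n / n) * Real.log n ∧
    ∑ n ∈ Ico (Q ^ j) (Q ^ (j + 1)),
        classInd g n * (roughInd Q n * vonMangoldt n / n) * Real.log n ≤
      Real.log Q ^ 2 / q.totient * ((j + 1) * primeBlock Q j g) := by
  have e : ∀ c : ℝ, Real.log Q ^ 2 / q.totient * (c * primeBlock Q j g) =
      ∑ n ∈ Ico (Q ^ j) (Q ^ (j + 1)), classInd g n * (roughInd Q n * vonMangoldt n / n) *
        (c * Real.log Q) := by
    intro c
    rw [← sum_mul, sum_Ico_eq_primeBlock hQ]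
    ring
  rw [e, e]
  have hlog : ∀ n ∈ Ico (Q ^ j) (Q ^ (j + 1)),
      j * Real.log Q ≤ Real.log n ∧ Real.log n ≤ (j + 1) * Real.log Q := by
    intro n hn
    rw [mem_Ico] at hn
    have hn0 : 0 < Q ^ j := Nat.pow_pos (by omega)
    have h1 : Real.log ((Q ^ j : ℕ) : ℝ) ≤ Real.log n :=
      Real.log_le_log (by exact_mod_cast hn0) (by exact_mod_cast hn.1)
    have h2 : Real.log n ≤ Real.log ((Q ^ (j + 1) : ℕ) : ℝ) :=
      Real.log_le_log (by exact_mod_cast hn0.trans_le hn.1) (by exact_mod_cast hn.2.le)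
    rw [Nat.cast_pow, Real.log_pow] at h1 h2
    exact ⟨h1, by exact_mod_cast h2⟩
  exact ⟨sum_le_sum fun n hn =>
      mul_le_mul_of_nonneg_left (hlog n hn).1 (classInd_mul_rough_nonneg Q g n),
    sum_le_sum fun n hn =>
      mul_le_mul_of_nonneg_left (hlog n hn).2 (classInd_mul_rough_nonneg Q g n)⟩

theorem block_conv_eq {q Q : ℕ} [NeZero q] (hQ : 1 < Q) (g : (ZMod q)ˣ) (i j : ℕ) :
    ∑ d ∈ Ico (Q ^ i) (Q ^ (i + 1)), ∑ e ∈ Ico (Q ^ j) (Q ^ (j + 1)), ∑ h : (ZMod q)ˣ,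
      (classInd h d * (roughInd Q d * vonMangoldt d / d)) *
        (classInd (g * h⁻¹) e * (roughInd Q e * vonMangoldt e / e)) =
    Real.log Q ^ 2 / q.totient * 𝔼 h : (ZMod q)ˣ, primeBlock Q i h * primeBlock Q j (g * h⁻¹) := by
  have h1 : ∀ d, ∑ e ∈ Ico (Q ^ j) (Q ^ (j + 1)), ∑ h : (ZMod q)ˣ,
      (classInd h d * (roughInd Q d * vonMangoldt d / d)) *
        (classInd (g * h⁻¹) e * (roughInd Q e * vonMangoldt e / e)) =
      ∑ h : (ZMod q)ˣ, (classInd h d * (roughInd Q d * vonMangoldt d / d)) *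
        (Real.log Q / q.totient * primeBlock Q j (g * h⁻¹)) := by
    intro d
    rw [sum_comm]
    refine sum_congr rfl fun h _ => ?_
    rw [← mul_sum, sum_Ico_eq_primeBlock hQ]
  rw [sum_congr rfl fun d _ => h1 d, sum_comm, Fintype.expect_eq_sum_div_card,
    ZMod.card_units_eq_totient, mul_div_assoc', mul_sum, sum_div]
  refine sum_congr rfl fun h _ => ?_
  rw [← sum_mul, sum_Ico_eq_primeBlock hQ]
  ring

theorem expect_expect_mul_div {G : Type*} [CommGroup G] [Fintype G] (u v : G → ℝ) :
    𝔼 g, 𝔼 h, u h * v (g * h⁻¹) = (𝔼 h, u h) * 𝔼 h, v h := by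
  rw [expect_comm, expect_mul]
  refine expect_congr rfl fun h _ => ?_
  rw [← mul_expect]
  congr 1
  exact Fintype.expect_equiv (Equiv.mulRight h⁻¹) _ _ fun g => rfl

/-- Sandwich of `selbergSum` between weighted sums of the blocks. -/
theorem selbergSum_bounds {q Q : ℕ} [NeZero q] (hQ : 1 < Q) (k : ℕ) (g : (ZMod q)ˣ) :
    selbergSum Q g (Q ^ k - 1) ≤ Real.log Q ^ 2 / q.totient *
      ∑ j ∈ range k, ((j + 1) * primeBlock Q j g +
        ∑ p ∈ antidiagonal j, 𝔼 h, primeBlock Q p.1 h * primeBlock Q p.2 (g * h⁻¹)) ∧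
    Real.log Q ^ 2 / q.totient *
      (∑ j ∈ range (k + 1), j * primeBlock Q j g + ∑ j ∈ range k,
        ∑ p ∈ antidiagonal j, 𝔼 h, primeBlock Q p.1 h * primeBlock Q p.2 (g * h⁻¹)) ≤
      selbergSum Q g (Q ^ (k + 1) - 1) := by
  have hnn : ∀ p : ℕ × ℕ, 0 ≤ ∑ h : (ZMod q)ˣ,
      (classInd h p.1 * (roughInd Q p.1 * vonMangoldt p.1 / p.1)) *
        (classInd (g * h⁻¹) p.2 * (roughInd Q p.2 * vonMangoldt p.2 / p.2)) := fun p =>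
    sum_nonneg fun t _ =>
      mul_nonneg (classInd_mul_rough_nonneg Q _ _) (classInd_mul_rough_nonneg Q _ _)
  have h1 := sum_prodPairs_le_blocks hQ k _ hnn
  have h2 := blocks_le_sum_prodPairs hQ k _ hnn
  simp only [block_conv_eq hQ] at h1 h2
  rw [selbergSum_eq_add, selbergSum_eq_add, selbergLog, selbergLog,
    sum_Icc_pow_sub_one_eq (by omega), sum_Icc_pow_sub_one_eq (by omega), sum_add_distrib,
    mul_add, mul_add, mul_sum, mul_sum, mul_sum]
  simp only [← mul_sum] at h1 h2
  constructor
  · exact add_le_add (sum_le_sum fun j _ => (selbergLog_block_bounds hQ j g).2)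
      (by rw [← mul_sum]; exact h1)
  · exact add_le_add (sum_le_sum fun j _ => (selbergLog_block_bounds hQ j g).1)
      (by rw [← mul_sum]; exact h2)

theorem primeBlock_le_selbergSum_sub {q Q : ℕ} [NeZero q] (hQ : 1 < Q) (k : ℕ) (g : (ZMod q)ˣ) :
    Real.log Q ^ 2 / q.totient * (k * primeBlock Q k g) ≤
      selbergSum Q g (Q ^ (k + 1) - 1) - selbergSum Q g (Q ^ k - 1) := by
  have h1 := selbergConv_mono Q g (Nat.sub_le_sub_right
    (Nat.pow_le_pow_right (by omega : 0 < Q) (Nat.le_succ k)) 1)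
  have h2 := (selbergLog_block_bounds hQ k g).1
  rw [selbergSum_eq_add, selbergSum_eq_add, selbergLog, selbergLog,
    sum_Icc_pow_sub_one_eq (by omega), sum_Icc_pow_sub_one_eq (by omega), sum_range_succ]
  linarith

/-- The blocks satisfy Selberg's formula in every residue class, with bounded error. -/
theorem exists_primeBlock_bounds : ∃ C : ℝ, 0 < C ∧ ∀ q Q : ℕ, 2 ≤ q → Q = q ^ 64 →
    ∀ [NeZero q], (∀ j (g : (ZMod q)ˣ), primeBlock Q j g ≤ C) ∧
    (∀ k : ℕ, |∑ j ∈ range k, 𝔼 g : (ZMod q)ˣ, primeBlock Q j g - k| ≤ C) ∧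
    ∀ (k : ℕ) (g : (ZMod q)ˣ), |∑ j ∈ range k, (j * primeBlock Q j g +
      ∑ p ∈ antidiagonal j, 𝔼 h, primeBlock Q p.1 h * primeBlock Q p.2 (g * h⁻¹)) -
        (k : ℝ) ^ 2| ≤ C * (k + 1) := by
  obtain ⟨C, hC, hsub⟩ := exists_selbergSum_sub_le
  -- the bounds for the averages
  set C₂ : ℝ := 2000 + C with hC₂
  set C₃ : ℝ := 3 + 5 * (C₂ + C) with hC₃
  refine ⟨21 + C₂ + C + C₃ + 3 + 3 * C₂ + 3 * C + C₃ ^ 2, by positivity, ?_⟩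
  intro q Q hq hQq _
  have hqQ : q ≤ Q := hQq ▸ Nat.le_self_pow (by norm_num) q
  have hQ3 : 3 ≤ Q := by
    calc 3 ≤ 2 ^ 64 := by norm_num
      _ ≤ Q := hQq ▸ Nat.pow_le_pow_left hq 64
  have hQ1 : 1 < Q := by omega
  have hphi : (0 : ℝ) < q.totient := by exact_mod_cast Nat.totient_pos.2 (by omega)
  have hlQ : 0 < Real.log Q := Real.log_pos (by exact_mod_cast hQ1)
  set Z : ℝ := Real.log Q ^ 2 / q.totient with hZ
  have hZ0 : 0 < Z := by positivity
  set f : ℕ → (ZMod q)ˣ → ℝ := fun j g => primeBlock Q j g with hf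
  have hf0 : ∀ j g, 0 ≤ f j g := fun j g => primeBlock_nonneg Q j g
  set F : ℕ → ℝ := fun j => 𝔼 g, f j g with hF
  have hF0 : ∀ j, 0 ≤ F j := fun j => expect_nonneg fun g _ => hf0 j g
  have hH2 : ∀ k : ℕ, |∑ j ∈ range k, F j - k| ≤ 21 :=
    fun k => abs_sum_expect_primeBlock_sub_le hqQ hQ3 k
  have hF43 : ∀ j, F j ≤ 43 := by
    intro j
    have h1 := (abs_le.1 (hH2 (j + 1))).2
    have h2 := (abs_le.1 (hH2 j)).1
    rw [sum_range_succ] at h1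
    push_cast at h1
    linarith
  set cv : ℕ → (ZMod q)ˣ → ℝ :=
    fun j g => ∑ p ∈ antidiagonal j, 𝔼 h, f p.1 h * f p.2 (g * h⁻¹) with hcv
  have hcvE : ∀ j, 𝔼 g, cv j g = ∑ p ∈ antidiagonal j, F p.1 * F p.2 := by
    intro j
    rw [hcv, expect_sum_comm]
    exact sum_congr rfl fun p _ => expect_expect_mul_div _ _
  set u : ℕ → (ZMod q)ˣ → ℝ := fun k g => selbergSum Q g (Q ^ k - 1) / Z with hu
  have hup : ∀ k g, u k g ≤ ∑ j ∈ range k, ((j + 1) * f j g + cv j g) := by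
    intro k g
    rw [hu, div_le_iff₀ hZ0, mul_comm]
    exact (selbergSum_bounds hQ1 k g).1
  have hlo : ∀ k g, ∑ j ∈ range (k + 1), j * f j g + ∑ j ∈ range k, cv j g ≤ u (k + 1) g := by
    intro k g
    rw [hu, le_div_iff₀ hZ0, mul_comm]
    exact (selbergSum_bounds hQ1 k g).2
  have hinc : ∀ k g, k * f k g ≤ u (k + 1) g - u k g := by
    intro k g
    rw [hu, ← sub_div, le_div_iff₀ hZ0, mul_comm]
    exact primeBlock_le_selbergSum_sub hQ1 k g
  have husub : ∀ k g g', |u k g - u k g'| ≤ C * (k + 2) := by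
    intro k g g'
    rw [hu, ← sub_div, abs_div, abs_of_pos hZ0, div_le_iff₀ hZ0]
    exact hsub q Q hq hQq g g' k
  have hu0 : ∀ g, u 0 g = 0 := by
    intro g
    simp [hu, selbergSum]
  have hFsum : ∀ k : ℕ, |∑ j ∈ range k, (j * F j + ∑ p ∈ antidiagonal j, F p.1 * F p.2) -
      (k : ℝ) ^ 2| ≤ 42 * k + 441 := by
    intro k
    refine (abs_sum_mul_add_sum_antidiagonal_sub_le F 21 hF0 hH2 k).trans (le_of_eq ?_)
    ring
  have huE : ∀ k : ℕ, |𝔼 g, u k g - (k : ℝ) ^ 2| ≤ 2000 * (k + 1) := by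
    intro k
    rw [abs_le]
    constructor
    · rcases k with _ | k
      · simp [hu0]
      · have h1 : 𝔼 g, (∑ j ∈ range (k + 1), j * f j g + ∑ j ∈ range k, cv j g) ≤
            𝔼 g, u (k + 1) g := expect_le_expect fun g _ => hlo k g
        rw [expect_add_distrib, expect_sum_comm, expect_sum_comm] at h1
        simp only [← mul_expect, hcvE] at h1
        have h2 := (abs_le.1 (hFsum (k + 1))).1
        rw [sum_add_distrib, sum_range_succ (fun j => ∑ p ∈ antidiagonal j, F p.1 * F p.2)] at h2
        have h3 : ∑ p ∈ antidiagonal k, F p.1 * F p.2 ≤ 43 * (k + 22) := by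
          rw [Nat.sum_antidiagonal_eq_sum_range_succ (fun i j => F i * F j)]
          have h4 := (abs_le.1 (hH2 (k + 1))).2
          push_cast at h4
          calc _ ≤ ∑ i ∈ range (k + 1), F i * 43 :=
                sum_le_sum fun i _ => mul_le_mul_of_nonneg_left (hF43 _) (hF0 i)
            _ ≤ _ := by rw [← sum_mul]; linarith
        push_cast at h2 ⊢
        have hk : (0 : ℝ) ≤ k := by positivity
        change ∑ j ∈ range (k + 1), j * F j + _ ≤ _ at h1
        linarith
    · have h1 : 𝔼 g, u k g ≤ 𝔼 g, ∑ j ∈ range k, ((j + 1) * f j g + cv j g) :=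
        expect_le_expect fun g _ => hup k g
      rw [expect_sum_comm] at h1
      simp only [expect_add_distrib, ← mul_expect, hcvE] at h1
      have h2 := (abs_le.1 (hFsum k)).2
      have h3 := (abs_le.1 (hH2 k)).2
      have h4 : ∑ j ∈ range k, ((j + 1) * 𝔼 g, f j g + ∑ p ∈ antidiagonal j, F p.1 * F p.2) =
          ∑ j ∈ range k, (j * F j + ∑ p ∈ antidiagonal j, F p.1 * F p.2) +
            ∑ j ∈ range k, F j := by
        rw [← sum_add_distrib]
        refine sum_congr rfl fun j _ => ?_
        simp only [hF]
        ring
      rw [h4] at h1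
      have hk : (0 : ℝ) ≤ k := by positivity
      linarith
  have huk : ∀ (k : ℕ) g, |u k g - (k : ℝ) ^ 2| ≤ (C₂ + C) * (k + 1) := by
    intro k g
    have h1 : |u k g - 𝔼 g', u k g'| ≤ C * (k + 2) := by
      have h2 : u k g - 𝔼 g', u k g' = 𝔼 g', (u k g - u k g') := by
        rw [expect_sub_distrib, Fintype.expect_const]
      rw [h2]
      refine (abs_expect_le _ _).trans ?_
      exact (expect_le_expect fun g' _ => husub k g g').trans (Fintype.expect_const _).le
    have h3 := huE k
    have h4 := abs_add_le (u k g - 𝔼 g', u k g') (𝔼 g', u k g' - (k : ℝ) ^ 2)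
    rw [sub_add_sub_cancel] at h4
    have hk : (0 : ℝ) ≤ k := by positivity
    nlinarith
  have hC₂0 : 0 < C₂ + C := by positivity
  have hC₃0 : 0 < C₃ := by positivity
  have hf3 : ∀ j g, f j g ≤ C₃ := by
    intro j g
    rcases Nat.eq_zero_or_pos j with hj | hj
    · simp only [hf, hj, primeBlock_zero]
      exact hC₃0.le
    · have h1 := hinc j g
      have h2 := (abs_le.1 (huk (j + 1) g)).2
      have h3 := (abs_le.1 (huk j g)).1
      have hj1 : (1 : ℝ) ≤ j := by exact_mod_cast hj
      push_cast at h2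
      have h5 : (C₂ + C) * 1 ≤ (C₂ + C) * j := mul_le_mul_of_nonneg_left hj1 hC₂0.le
      have h4 : j * f j g ≤ j * C₃ := by
        rw [hC₃]
        nlinarith
      exact le_of_mul_le_mul_left h4 (by linarith)
  refine ⟨fun j g => (hf3 j g).trans ?_, fun k => (hH2 k).trans ?_, fun k g => ?_⟩
  · nlinarith
  · nlinarith
  · change |∑ j ∈ range k, (j * f j g + cv j g) - (k : ℝ) ^ 2| ≤ _
    have hk : (0 : ℝ) ≤ k := by positivity
    rw [abs_le]
    constructor
    · have h1 := hup k g
      have h2 := (abs_le.1 (huk k g)).1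
      have h3 : ∑ j ∈ range k, ((j + 1) * f j g + cv j g) ≤
          ∑ j ∈ range k, (j * f j g + cv j g) + k * C₃ := by
        have : ∀ j ∈ range k, (j + 1) * f j g + cv j g ≤ (j * f j g + cv j g) + C₃ :=
          fun j _ => by linarith [hf3 j g]
        refine (sum_le_sum this).trans (le_of_eq ?_)
        rw [sum_add_distrib, sum_const, card_range, nsmul_eq_mul]
      nlinarith [sq_nonneg C₃]
    · rcases k with _ | k
      · simp
        positivity
      · have h1 := hlo k g
        have h2 := (abs_le.1 (huk (k + 1) g)).2
        have h3 : cv k g ≤ (k + 1) * C₃ ^ 2 := by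
          rw [hcv]
          calc _ ≤ ∑ p ∈ antidiagonal k, C₃ ^ 2 := by
                refine sum_le_sum fun p _ => ?_
                refine (expect_le_expect fun h _ => ?_).trans (Fintype.expect_const _).le
                rw [sq]
                exact mul_le_mul (hf3 _ _) (hf3 _ _) (hf0 _ _) hC₃0.le
            _ = _ := by rw [sum_const, Nat.card_antidiagonal, nsmul_eq_mul]; push_cast; ring
        rw [sum_add_distrib, sum_range_succ (fun j => cv j g)]
        push_cast at h2 ⊢
        nlinarith [sq_nonneg C₃]

section Character

variable {G : Type*} [CommGroup G] [Fintype G]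

theorem expect_mul_left (h : G) (F : G → ℝ) : 𝔼 v, F (h * v) = 𝔼 v, F v :=
  Fintype.expect_equiv (Equiv.mulLeft h) _ _ fun _ => rfl

theorem expect_mul_right (h : G) (F : G → ℝ) : 𝔼 v, F (v * h) = 𝔼 v, F v :=
  Fintype.expect_equiv (Equiv.mulRight h) _ _ fun _ => rfl

theorem expect_inv (F : G → ℝ) : 𝔼 v, F v⁻¹ = 𝔼 v, F v :=
  Fintype.expect_equiv (Equiv.inv G) _ _ fun _ => rfl

theorem expect_sub_mul_sq (P : G → ℝ) (h : G) {s : ℝ} (hs : s ^ 2 = 1) :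
    𝔼 v, (P (h * v) - s * P v) ^ 2 = 2 * 𝔼 v, P v ^ 2 - 2 * (s * 𝔼 v, P (h * v) * P v) := by
  have h1 := expect_mul_left h fun v => P v ^ 2
  have h2 : 𝔼 v, (P (h * v) - s * P v) ^ 2 =
      𝔼 v, (P (h * v) ^ 2 + P v ^ 2 - 2 * (s * (P (h * v) * P v))) :=
    expect_congr rfl fun v _ => by linear_combination (P v) ^ 2 * hs
  rw [h2, expect_sub_distrib, expect_add_distrib, h1, ← mul_expect, ← mul_expect]
  ring

theorem mul_autocorrelation_mul_ge (P : G → ℝ) (hP : ∀ g, P g ^ 2 ≤ 1) (h₁ h₂ : G) {s₁ s₂ : ℝ}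
    (hs₁ : s₁ ^ 2 = 1) (hs₂ : s₂ ^ 2 = 1) :
    𝔼 v, P v ^ 2 - 2 * (1 - s₁ * 𝔼 v, P (h₁ * v) * P v) - 2 * (1 - s₂ * 𝔼 v, P (h₂ * v) * P v) ≤
      s₁ * s₂ * 𝔼 v, P (h₁ * h₂ * v) * P v := by
  have h0 := expect_sub_mul_sq P (h₁ * h₂) (s := s₁ * s₂) (by rw [mul_pow, hs₁, hs₂, one_mul])
  have h1 := expect_sub_mul_sq P h₁ hs₁
  have h2 := expect_sub_mul_sq P h₂ hs₂
  have h3 := expect_mul_left h₂ fun v => (P (h₁ * v) - s₁ * P v) ^ 2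
  have hE : 𝔼 v, P v ^ 2 ≤ 1 := expect_le univ_nonempty fun g _ => hP g
  have h4 : 𝔼 v, (P (h₁ * h₂ * v) - s₁ * s₂ * P v) ^ 2 ≤
      𝔼 v, (2 * (P (h₁ * (h₂ * v)) - s₁ * P (h₂ * v)) ^ 2 + 2 * (P (h₂ * v) - s₂ * P v) ^ 2) := by
    refine expect_le_expect fun v _ => ?_
    rw [mul_assoc h₁]
    have e : (s₁ * (P (h₂ * v) - s₂ * P v)) ^ 2 = (P (h₂ * v) - s₂ * P v) ^ 2 := by
      rw [mul_pow, hs₁, one_mul]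
    nlinarith [sq_nonneg ((P (h₁ * (h₂ * v)) - s₁ * P (h₂ * v)) -
      s₁ * (P (h₂ * v) - s₂ * P v))]
  rw [expect_add_distrib, ← mul_expect, ← mul_expect, h3] at h4
  linarith

theorem exists_character_of_autocorrelation (P : G → ℝ) (hP : ∀ g, P g ^ 2 ≤ 1) {ε : ℝ}
    (hε : ε < 1 / 21) (h₁ : 1 - ε ≤ 𝔼 v, P v ^ 2)
    (h₂ : 𝔼 h, (1 - |𝔼 v, P (h * v) * P v|) ≤ ε) :
    ∃ χ : G → ℝ, (∀ g, χ g = 1 ∨ χ g = -1) ∧ (∀ g h, χ (g * h) = χ g * χ h) ∧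
      (∀ h, χ h * (𝔼 v, P (h * v) * P v) = |𝔼 v, P (h * v) * P v|) ∧
      1 - ε ≤ (𝔼 g, χ g * P g) ^ 2 := by
  set Q : G → ℝ := fun h => 𝔼 v, P (h * v) * P v with hQ
  set χ : G → ℝ := fun h => if 0 ≤ Q h then 1 else -1 with hχ
  have hχ1 : ∀ g, χ g = 1 ∨ χ g = -1 := fun g => by
    simp only [hχ]; split_ifs <;> simp
  have hχ2 : ∀ g, χ g ^ 2 = 1 := fun g => by rcases hχ1 g with h | h <;> rw [h] <;> norm_num
  have hχQ : ∀ g, χ g * Q g = |Q g| := fun g => by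
    simp only [hχ]
    split_ifs with h
    · rw [abs_of_nonneg h, one_mul]
    · rw [abs_of_neg (not_le.1 h), neg_one_mul]
  have key : ∀ x y, 1 - ε - 2 * (1 - |Q x|) - 2 * (1 - |Q y|) ≤ χ x * χ y * Q (x * y) := by
    intro x y
    have := mul_autocorrelation_mul_ge P hP x y (hχ2 x) (hχ2 y)
    have e1 := hχQ x
    have e2 := hχQ y
    simp only [hQ] at e1 e2 ⊢
    rw [e1, e2] at this
    linarith
  have hle : ∀ x y, χ x * χ y * Q (x * y) ≤ |Q (x * y)| := fun x y => by
    rcases hχ1 x with h | h <;> rcases hχ1 y with h' | h' <;> rw [h, h'] <;>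
      simp [le_abs_self, neg_le_abs]
  have hbig : ∀ g, 1 - 5 * ε ≤ |Q g| := by
    intro g
    have h3 : 𝔼 x, ((1 - |Q x|) + (1 - |Q (g * x⁻¹)|)) ≤ 2 * ε := by
      rw [expect_add_distrib]
      have := (expect_inv fun x => 1 - |Q (g * x)|).trans (expect_mul_left g fun x => 1 - |Q x|)
      linarith
    obtain ⟨x, -, hx⟩ := exists_le_of_expect_le univ_nonempty h3
    have h4 := key x (g * x⁻¹)
    have h5 := hle x (g * x⁻¹)
    rw [mul_inv_cancel_comm_assoc] at h4 h5
    linarith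
  have hpos : ∀ x y, 0 < χ x * χ y * Q (x * y) := fun x y => by
    have := key x y
    have := hbig x
    have := hbig y
    linarith
  have hmul : ∀ g h, χ (g * h) = χ g * χ h := by
    intro g h
    have h3 := hpos g h
    rcases hχ1 g with e | e <;> rcases hχ1 h with e' | e' <;> rw [e, e'] at h3 ⊢ <;>
      simp only [hχ] <;> split_ifs with hh <;> linarith
  refine ⟨χ, hχ1, hmul, hχQ, ?_⟩
  have h6 : 𝔼 h, χ h * Q h = (𝔼 g, χ g * P g) ^ 2 := by
    simp only [hQ, mul_expect]
    rw [expect_comm, sq, expect_mul]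
    refine expect_congr rfl fun v _ => ?_
    have : ∀ h, χ h * (P (h * v) * P v) = χ v * P v * (χ (h * v) * P (h * v)) := fun h => by
      rw [hmul]
      linear_combination -(χ h * P (h * v) * P v) * hχ2 v
    simp only [this]
    rw [← mul_expect, expect_mul_right v fun h => χ h * P h]
  rw [← h6]
  simp only [hχQ]
  rw [expect_sub_distrib, expect_const univ_nonempty] at h₂
  linarith

end Character

section TimeConv

variable {G : Type*} [CommGroup G] [Fintype G]

/-- The convolution of two sequences of functions on `G`, both in time and on the group. -/
noncomputable def timeConv (f g : ℕ → G → ℝ) (m : ℕ) (x : G) : ℝ :=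
  ∑ z ∈ antidiagonal m, 𝔼 h, f z.1 h * g z.2 (x * h⁻¹)

/-- The average failure of `p (i + l) (h * v) * α i h * p l v` to be equal to `-1`. -/
noncomputable def tripleDefect (p α : ℕ → G → ℝ) (i l : ℕ) : ℝ :=
  𝔼 h, 𝔼 v, (1 + p (i + l) (h * v) * α i h * p l v)

theorem abs_mul_le_one {x y : ℝ} (hx : |x| ≤ 1) (hy : |y| ≤ 1) : |x * y| ≤ 1 := by
  rw [abs_mul]; exact mul_le_one₀ hx (abs_nonneg _) hy

theorem tripleDefect_nonneg {p α : ℕ → G → ℝ} (hp : ∀ m g, |p m g| ≤ 1) (hα : ∀ m g, |α m g| ≤ 1)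
    (i l : ℕ) : 0 ≤ tripleDefect p α i l :=
  expect_nonneg fun h _ => expect_nonneg fun v _ => by
    have := (abs_le.1 (abs_mul_le_one (abs_mul_le_one (hp (i + l) (h * v)) (hα i h)) (hp l v))).1
    linarith

theorem sum_antidiagonal_tripleDefect (p α : ℕ → G → ℝ) (m : ℕ) :
    ∑ z ∈ antidiagonal m, tripleDefect p α z.1 z.2 =
      (m + 1) + 𝔼 g, p m g * timeConv α p m g := by
  have h1 : ∀ z ∈ antidiagonal m, tripleDefect p α z.1 z.2 =
      1 + 𝔼 g, 𝔼 h, p m g * (α z.1 h * p z.2 (g * h⁻¹)) := by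
    intro z hz
    rw [HasAntidiagonal.mem_antidiagonal] at hz
    rw [tripleDefect, hz, expect_comm (f := fun g h => p m g * (α z.1 h * p z.2 (g * h⁻¹)))]
    have : ∀ h : G, 𝔼 v, (1 + p m (h * v) * α z.1 h * p z.2 v) =
        1 + 𝔼 g, p m g * (α z.1 h * p z.2 (g * h⁻¹)) := fun h => by
      rw [← expect_mul_left h fun g => p m g * (α z.1 h * p z.2 (g * h⁻¹)), expect_add_distrib,
        expect_const univ_nonempty]
      congr 1
      refine expect_congr rfl fun v _ => ?_
      rw [mul_inv_cancel_comm, mul_assoc]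
    simp only [this]
    rw [expect_add_distrib, expect_const univ_nonempty]
  rw [sum_congr rfl h1, sum_add_distrib]
  simp only [timeConv, mul_sum, mul_expect]
  rw [expect_sum_comm]
  simp

theorem sum_tripleDefect_le {p α : ℕ → G → ℝ} (hp : ∀ m g, |p m g| ≤ 1) {k : ℕ} {η : ℝ}
    (hη : 1 ≤ η * k) (hconv : ∀ m < k, ∀ g, |m * p m g + timeConv α p m g| ≤ η * k)
    (hsq : ∑ m ∈ range k, 𝔼 g, (1 - p m g ^ 2) ≤ 2 * (η * k)) :
    ∑ i ∈ range k, ∑ l ∈ range (k - i), tripleDefect p α i l ≤ 4 * η * k ^ 2 := by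
  rw [← sum_range_diag_flip]
  have h1 : ∀ m ∈ range k, ∑ i ∈ range (m + 1), tripleDefect p α i (m - i) ≤
      1 + η * k + k * 𝔼 g, (1 - p m g ^ 2) := by
    intro m hm
    rw [mem_range] at hm
    have hm' : (m : ℝ) ≤ k := by exact_mod_cast hm.le
    rw [← Nat.sum_antidiagonal_eq_sum_range_succ, sum_antidiagonal_tripleDefect]
    have h2 : 𝔼 g, p m g * timeConv α p m g ≤ 𝔼 g, (η * k - m + k * (1 - p m g ^ 2)) := by
      refine expect_le_expect fun g _ => ?_
      have h3 := hconv m hm g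
      have h4 : p m g * (m * p m g + timeConv α p m g) ≤ η * k := by
        refine (le_abs_self _).trans ?_
        rw [abs_mul]
        exact (mul_le_of_le_one_left (abs_nonneg _) (hp m g)).trans h3
      have h5 : p m g ^ 2 ≤ 1 := (sq_le_one_iff_abs_le_one _).2 (hp m g)
      nlinarith
    rw [expect_add_distrib, expect_const univ_nonempty, ← mul_expect] at h2
    linarith
  refine (sum_le_sum h1).trans ?_
  rw [sum_add_distrib, sum_const, card_range, nsmul_eq_mul, ← mul_sum]
  have hk : (0 : ℝ) ≤ k := Nat.cast_nonneg k
  nlinarith [mul_le_mul_of_nonneg_left hsq hk]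

/-- The average failure of `p m (h * v) * p n (v * h⁻¹)` to be equal to `1`. -/
noncomputable def pairDefect (p : ℕ → G → ℝ) (m n : ℕ) : ℝ :=
  𝔼 h, 𝔼 v, (1 - p m (h * v) * p n (v * h⁻¹))

theorem pairDefect_nonneg {p : ℕ → G → ℝ} (hp : ∀ m g, |p m g| ≤ 1) (m n : ℕ) :
    0 ≤ pairDefect p m n :=
  expect_nonneg fun h _ => expect_nonneg fun v _ => by
    have := (abs_le.1 (abs_mul_le_one (hp m (h * v)) (hp n (v * h⁻¹)))).2
    linarith

theorem pairDefect_comm (p : ℕ → G → ℝ) (m n : ℕ) : pairDefect p m n = pairDefect p n m := by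
  rw [pairDefect, ← expect_inv]
  refine expect_congr rfl fun h _ => expect_congr rfl fun v _ => ?_
  rw [inv_inv, mul_comm h⁻¹, mul_comm v h]
  ring

theorem pairDefect_le {p α : ℕ → G → ℝ} (hp : ∀ m g, |p m g| ≤ 1) (hα : ∀ m g, |α m g| ≤ 1)
    (n i : ℕ) : pairDefect p (n + 2 * i) n ≤
      tripleDefect p α i (n + i) + tripleDefect p α i n + 𝔼 g, (1 - p (n + i) g ^ 2) := by
  have h1 : tripleDefect p α i n =
      𝔼 h, 𝔼 v, (1 + p (n + i) v * α i h * p n (v * h⁻¹)) := by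
    rw [tripleDefect]
    refine expect_congr rfl fun h _ => ?_
    rw [← expect_mul_left h fun v => 1 + p (n + i) v * α i h * p n (v * h⁻¹)]
    simp only [mul_inv_cancel_comm, add_comm n i]
  have h2 : 𝔼 g, (1 - p (n + i) g ^ 2) = 𝔼 _h : G, 𝔼 v, (1 - p (n + i) v ^ 2) :=
    (expect_const univ_nonempty _).symm
  rw [h1, h2, tripleDefect, ← expect_add_distrib, ← expect_add_distrib]
  refine expect_le_expect fun h _ => ?_
  rw [← expect_add_distrib, ← expect_add_distrib]
  refine expect_le_expect fun v _ => ?_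
  rw [show i + (n + i) = n + 2 * i by ring]
  have a1 := abs_le.1 (hp (n + 2 * i) (h * v))
  have a2 := abs_le.1 (hp n (v * h⁻¹))
  have a3 := abs_le.1 (hp (n + i) v)
  have a4 := abs_le.1 (hα i h)
  set x := p (n + 2 * i) (h * v)
  set y := p n (v * h⁻¹)
  set z := p (n + i) v
  set c := α i h
  have b1 := abs_le.1 (abs_mul_le_one (hp (n + 2 * i) (h * v)) (hp (n + i) v))
  have b2 := abs_le.1 (abs_mul_le_one (hp n (v * h⁻¹)) (hp (n + i) v))
  have b3 := abs_le.1 (abs_mul_le_one (hp (n + 2 * i) (h * v)) (hp n (v * h⁻¹)))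
  have c1 : 1 - (x * z) * (y * z) ≤ 2 + c * (x * z + y * z) := by
    have d1 : 0 ≤ (1 + c) * ((1 + x * z) * (1 + y * z)) :=
      mul_nonneg (by linarith) (mul_nonneg (by linarith) (by linarith))
    have d2 : 0 ≤ (1 - c) * ((1 - x * z) * (1 - y * z)) :=
      mul_nonneg (by linarith) (mul_nonneg (by linarith) (by linarith))
    nlinarith
  have c2 : 0 ≤ (1 + x * y) * (1 - z ^ 2) :=
    mul_nonneg (by linarith) (by nlinarith)
  nlinarith

theorem sum_range_half_le (F : ℕ → ℝ) (hF : ∀ i, 0 ≤ F i) (N : ℕ) :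
    ∑ d ∈ range N, F (d / 2) ≤ 2 * ∑ i ∈ range ((N + 1) / 2), F i := by
  have h : ∀ M, ∑ d ∈ range (2 * M), F (d / 2) = 2 * ∑ i ∈ range M, F i := by
    intro M
    induction M with
    | zero => simp
    | succ M ih =>
      rw [show 2 * (M + 1) = 2 * M + 1 + 1 by ring, sum_range_succ, sum_range_succ, ih,
        sum_range_succ _ M, show (2 * M + 1) / 2 = M by omega, show 2 * M / 2 = M by omega]
      ring
  rw [← h]
  exact sum_le_sum_of_subset_of_nonneg (range_subset_range.2 (by omega)) fun i _ _ => hF _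

theorem pairDefect_succ_le {p : ℕ → G → ℝ} (hp : ∀ m g, |p m g| ≤ 1) {η : ℝ}
    (hlip : ∀ m g, |p (m + 1) g - p m g| ≤ η) (m n : ℕ) :
    pairDefect p (m + 1) n ≤ pairDefect p m n + η := by
  have : η = 𝔼 _h : G, 𝔼 _v : G, η := by simp [expect_const univ_nonempty]
  rw [this, pairDefect, pairDefect, ← expect_add_distrib]
  refine expect_le_expect fun h _ => ?_
  rw [← expect_add_distrib]
  refine expect_le_expect fun v _ => ?_
  have h1 : |(p (m + 1) (h * v) - p m (h * v)) * p n (v * h⁻¹)| ≤ η := by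
    rw [abs_mul]
    exact (mul_le_of_le_one_right (abs_nonneg _) (hp _ _)).trans (hlip _ _)
  have := (abs_le.1 h1).1
  linarith

theorem sum_pairDefect_le {p α : ℕ → G → ℝ} (hp : ∀ m g, |p m g| ≤ 1)
    (hα : ∀ m g, |α m g| ≤ 1) {k : ℕ} {η : ℝ} (hη : 0 ≤ η)
    (hlip : ∀ m g, |p (m + 1) g - p m g| ≤ η)
    (hsq : ∑ m ∈ range k, 𝔼 g, (1 - p m g ^ 2) ≤ 2 * (η * k))
    (hT : ∑ i ∈ range k, ∑ l ∈ range (k - i), tripleDefect p α i l ≤ 4 * η * k ^ 2) :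
    ∑ m ∈ range k, ∑ n ∈ range k, pairDefect p m n ≤ 42 * η * k ^ 2 := by
  set e : ℕ → ℝ := fun l => 𝔼 g, (1 - p l g ^ 2) with he
  have he0 : ∀ l, 0 ≤ e l := fun l => expect_nonneg fun g _ => by
    have := (sq_le_one_iff_abs_le_one _).2 (hp l g)
    linarith
  have hD := tripleDefect_nonneg hp hα
  set U : ℕ → ℕ → ℝ := fun n i =>
    tripleDefect p α i (n + i) + tripleDefect p α i n + e (n + i) with hU
  have hU0 : ∀ n i, 0 ≤ U n i := fun n i => by
    have := hD i (n + i)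
    have := hD i n
    have := he0 (n + i)
    simp only [hU]
    linarith
  have hkk : (0 : ℝ) ≤ k := Nat.cast_nonneg k
  -- the pairs with `n ≤ m`
  have hle : ∀ n d, pairDefect p (n + d) n ≤ U n (d / 2) + η := by
    intro n d
    rcases Nat.even_or_odd' d with ⟨i, rfl | rfl⟩
    · rw [show 2 * i / 2 = i by omega]
      have := pairDefect_le hp hα n i
      simp only [hU, he]
      linarith
    · rw [show (2 * i + 1) / 2 = i by omega]
      have h1 := pairDefect_le hp hα n i
      have h2 := pairDefect_succ_le hp hlip (n + 2 * i) n
      rw [show n + (2 * i + 1) = n + 2 * i + 1 by ring]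
      simp only [hU, he]
      linarith
  have hUsum : ∑ n ∈ range k, ∑ i ∈ range ((k - n + 1) / 2), U n i ≤ 10 * η * k ^ 2 := by
    have hswap : ∑ n ∈ range k, ∑ i ∈ range ((k - n + 1) / 2), U n i =
        ∑ i ∈ range k, ∑ n ∈ range (k - 2 * i), U n i := by
      refine sum_comm' fun n i => ?_
      simp only [mem_range]
      omega
    rw [hswap]
    have h1 : ∀ i ∈ range k, ∑ n ∈ range (k - 2 * i), U n i ≤
        ∑ l ∈ range (k - i), tripleDefect p α i l + ∑ l ∈ range (k - i), tripleDefect p α i l +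
          ∑ l ∈ range k, e l := by
      intro i _
      simp only [hU]
      rw [sum_add_distrib, sum_add_distrib]
      have hshift : ∀ (F : ℕ → ℝ) (N : ℕ), (∀ l, 0 ≤ F l) → k - 2 * i + i ≤ N ∨ k ≤ 2 * i →
          ∑ n ∈ range (k - 2 * i), F (n + i) ≤ ∑ l ∈ range N, F l := by
        intro F N hF hN
        rcases hN with hN | hN
        · have hmap := sum_map (range (k - 2 * i)) (addRightEmbedding i) F
          simp only [addRightEmbedding_apply] at hmap
          rw [← hmap]
          refine sum_le_sum_of_subset_of_nonneg ?_ fun l _ _ => hF l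
          intro l hl
          simp only [mem_map, mem_range, addRightEmbedding_apply] at hl ⊢
          omega
        · rw [show k - 2 * i = 0 by omega, range_zero, sum_empty]
          exact sum_nonneg fun l _ => hF l
      refine add_le_add (add_le_add (hshift (fun l => tripleDefect p α i l) _ (hD i) (by omega))
        ?_) (hshift e _ he0 (by omega))
      exact sum_le_sum_of_subset_of_nonneg (range_subset_range.2 (by omega)) fun l _ _ => hD i l
    refine (sum_le_sum h1).trans ?_
    rw [sum_add_distrib, sum_add_distrib, sum_const, card_range, nsmul_eq_mul]
    nlinarith [mul_le_mul_of_nonneg_left hsq hkk]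
  have hS : ∑ n ∈ range k, ∑ d ∈ range (k - n), pairDefect p (n + d) n ≤ 21 * η * k ^ 2 := by
    have h1 : ∀ n ∈ range k, ∑ d ∈ range (k - n), pairDefect p (n + d) n ≤
        2 * ∑ i ∈ range ((k - n + 1) / 2), U n i + k * η := by
      intro n _
      refine (sum_le_sum fun d _ => hle n d).trans ?_
      rw [sum_add_distrib, sum_const, card_range, nsmul_eq_mul]
      refine add_le_add (sum_range_half_le _ (hU0 n) _) ?_
      refine mul_le_mul_of_nonneg_right ?_ hη
      exact_mod_cast Nat.sub_le k n
    refine (sum_le_sum h1).trans ?_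
    rw [sum_add_distrib, ← mul_sum, sum_const, card_range, nsmul_eq_mul]
    linarith
  have hS' : ∑ n ∈ range k, ∑ d ∈ range (k - n), pairDefect p (n + d) n =
      ∑ n ∈ range k, ∑ m ∈ range k, if n ≤ m then pairDefect p m n else 0 := by
    refine sum_congr rfl fun n _ => ?_
    rw [← sum_filter, show (range k).filter (fun m => n ≤ m) = Ico n k by
      ext m; simp only [mem_filter, mem_range, mem_Ico]; omega, sum_Ico_eq_sum_range]
  have hfin : ∑ m ∈ range k, ∑ n ∈ range k, pairDefect p m n ≤
      ∑ m ∈ range k, ∑ n ∈ range k, ((if n ≤ m then pairDefect p m n else 0) +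
        if m ≤ n then pairDefect p n m else 0) := by
    refine sum_le_sum fun m _ => sum_le_sum fun n _ => ?_
    have h1 := pairDefect_nonneg hp m n
    rw [pairDefect_comm p n m]
    split_ifs <;> linarith
  simp only [sum_add_distrib] at hfin
  rw [sum_comm (f := fun m n => if n ≤ m then pairDefect p m n else 0)] at hfin
  linarith

end TimeConv

section Character

variable {G : Type*} [CommGroup G] [Fintype G]

theorem sum_antidiagonal_add (F : ℕ → ℝ) (k : ℕ) :
    ∑ z ∈ antidiagonal k, (F z.1 + F z.2) = 2 * ∑ i ∈ range (k + 1), F i := by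
  have h1 : ∑ z ∈ antidiagonal k, F z.1 = ∑ i ∈ range (k + 1), F i :=
    Nat.sum_antidiagonal_eq_sum_range_succ (fun i _ => F i) k
  have h2 : ∑ z ∈ antidiagonal k, F z.2 = ∑ z ∈ antidiagonal k, F z.1 :=
    Nat.sum_antidiagonal_swap (f := fun z => F z.1)
  rw [sum_add_distrib, h2, h1, two_mul]

theorem sum_range_cast_eq (k : ℕ) : ∑ i ∈ range k, (i : ℝ) = k * (k - 1) / 2 := by
  induction k with
  | zero => simp
  | succ k ih => rw [sum_range_succ, ih]; push_cast; ring

theorem timeConv_self_le (p : ℕ → G → ℝ) (k : ℕ) (a : G) (F : ℕ → ℝ) (c : ℕ → G → ℝ)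
    (hF : ∀ i, 𝔼 h, c i h = F i) (hp : ∀ i l h, p i h * p l (a * h⁻¹) ≤ c i h + c l (a * h⁻¹)) :
    timeConv p p k a ≤ 2 * ∑ i ∈ range (k + 1), F i := by
  rw [← sum_antidiagonal_add]
  refine sum_le_sum fun z _ => ?_
  rw [← hF, ← hF, ← expect_mul_left a (c z.2), ← expect_inv fun h => c z.2 (a * h),
    ← expect_add_distrib]
  exact expect_le_expect fun h _ => hp _ _ _

theorem sum_expect_one_sub_sq_le {p : ℕ → G → ℝ} (hp : ∀ m g, |p m g| ≤ 1) {k : ℕ} {η : ℝ}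
    (hk : 1 ≤ η * k) {a : G} (hrefl : (1 - η) * k ≤ timeConv p p k a) :
    ∑ m ∈ range k, 𝔼 g, (1 - p m g ^ 2) ≤ 2 * (η * k) := by
  have h1 := timeConv_self_le p k a (fun i => 𝔼 g, p i g ^ 2 / 2) (fun i g => p i g ^ 2 / 2)
    (fun _ => rfl) fun i l h => by nlinarith [sq_nonneg (p i h - p l (a * h⁻¹))]
  rw [sum_range_succ] at h1
  have h2 : 𝔼 g, p k g ^ 2 / 2 ≤ 1 / 2 := expect_le univ_nonempty fun g _ => by
    have := (sq_le_one_iff_abs_le_one _).2 (hp k g)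
    linarith
  have h3 : ∑ m ∈ range k, 𝔼 g, (1 - p m g ^ 2) = (k : ℝ) - 2 * ∑ m ∈ range k, 𝔼 g, p m g ^ 2 / 2 := by
    rw [mul_sum]
    have : ∀ m, 𝔼 g, (1 - p m g ^ 2) = 1 - 2 * 𝔼 g, p m g ^ 2 / 2 := fun m => by
      rw [expect_sub_distrib, expect_const univ_nonempty, mul_expect]
      congr 1
      exact expect_congr rfl fun g _ => by ring
    simp only [this]
    simp
  linarith

theorem expect_sq_average_ge {p : ℕ → G → ℝ} {k : ℕ} (hk : 0 < k) {η : ℝ}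
    (hH : ∑ m ∈ range k, ∑ n ∈ range k, pairDefect p m n ≤ η * k ^ 2) :
    1 - η ≤ 𝔼 g, ((∑ m ∈ range k, p m g) / k) ^ 2 := by
  have hk' : (0 : ℝ) < k := by exact_mod_cast hk
  set P : G → ℝ := fun g => (∑ m ∈ range k, p m g) / k with hP
  have hPs : ∀ g, ∑ m ∈ range k, p m g = k * P g := fun g => by
    simp only [hP]; field_simp
  have h1 : ∑ m ∈ range k, ∑ n ∈ range k, pairDefect p m n =
      k ^ 2 * (1 - 𝔼 h, 𝔼 v, P (h * v) * P (v * h⁻¹)) := by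
    have e1 : ∀ m n, pairDefect p m n = 1 - 𝔼 h, 𝔼 v, p m (h * v) * p n (v * h⁻¹) := fun m n => by
      simp only [pairDefect, expect_sub_distrib, expect_const univ_nonempty]
    have e2 : ∑ m ∈ range k, ∑ n ∈ range k, 𝔼 h, 𝔼 v, p m (h * v) * p n (v * h⁻¹) =
        k ^ 2 * 𝔼 h, 𝔼 v, P (h * v) * P (v * h⁻¹) := by
      simp only [← expect_sum_comm, mul_expect]
      refine expect_congr rfl fun h _ => expect_congr rfl fun v _ => ?_
      rw [← sum_mul_sum, hPs, hPs]
      ring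
    simp only [e1, sum_sub_distrib, e2]
    simp
    ring
  have h2 : 𝔼 h, 𝔼 v, P (h * v) * P (v * h⁻¹) ≤ 𝔼 _h : G, 𝔼 v, P v ^ 2 := by
    refine expect_le_expect fun h _ => ?_
    have e1 := expect_mul_left h fun v => P v ^ 2
    have e2 := expect_mul_right h⁻¹ fun v => P v ^ 2
    have : 𝔼 v, P (h * v) * P (v * h⁻¹) ≤ 𝔼 v, (P (h * v) ^ 2 + P (v * h⁻¹) ^ 2) / 2 :=
      expect_le_expect fun v _ => by nlinarith [sq_nonneg (P (h * v) - P (v * h⁻¹))]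
    rw [← expect_div, expect_add_distrib, e1, e2] at this
    linarith
  rw [expect_const univ_nonempty] at h2
  rw [h1, mul_comm] at hH
  have := le_of_mul_le_mul_right hH (by positivity)
  linarith

set_option maxHeartbeats 800000 in
theorem exists_character_of_timeConv {p α : ℕ → G → ℝ} (hp : ∀ m g, |p m g| ≤ 1)
    (hα : ∀ m g, |α m g| ≤ 1) {k : ℕ} {s : ℝ} (hs0 : 0 < s) (hs : s ≤ 1 / 20000)
    (hk : 1 ≤ s ^ 2 * k) (hlip : ∀ m g, |p (m + 1) g - p m g| ≤ s ^ 2)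
    (hconv : ∀ m < k, ∀ g, |m * p m g + timeConv α p m g| ≤ s ^ 2 * k) {a : G}
    (hrefl : (1 - s ^ 2) * k ≤ timeConv p p k a) :
    ∃ χ : G → ℝ, (∀ g, χ g = 1 ∨ χ g = -1) ∧ (∀ g h, χ (g * h) = χ g * χ h) ∧ χ a = 1 ∧
      ∑ i ∈ range k, ((k : ℝ) - i) * 𝔼 h, (1 + α i h * χ h) ≤ 132 * s * k ^ 2 := by
  have hkpos : 0 < k := by
    rcases Nat.eq_zero_or_pos k with rfl | h
    · norm_num at hk
    · exact h
  have hk' : (0 : ℝ) < k := by exact_mod_cast hkpos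
  have hsq := sum_expect_one_sub_sq_le hp hk hrefl
  have hT := sum_tripleDefect_le (α := α) hp hk hconv hsq
  have hH := sum_pairDefect_le hp hα (sq_nonneg s) hlip hsq hT
  have hP2 := expect_sq_average_ge hkpos hH
  set P : G → ℝ := fun g => (∑ m ∈ range k, p m g) / k with hP
  have hPs : ∀ g, ∑ m ∈ range k, p m g = k * P g := fun g => by
    simp only [hP]; field_simp
  change 1 - 42 * s ^ 2 ≤ 𝔼 g, P g ^ 2 at hP2
  have hP1 : ∀ g, |P g| ≤ 1 := fun g => by
    simp only [hP]
    rw [abs_div, abs_of_pos hk', div_le_one hk']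
    refine (abs_sum_le_sum_abs _ _).trans ((sum_le_sum fun m _ => hp m g).trans (by simp))
  have hPsq : ∀ g, P g ^ 2 ≤ 1 := fun g => (sq_le_one_iff_abs_le_one _).2 (hP1 g)
  have hvar : ∑ m ∈ range k, 𝔼 g, (p m g - P g) ^ 2 ≤ 42 * s ^ 2 * k := by
    rw [← expect_sum_comm]
    have h1 : 𝔼 g, ∑ m ∈ range k, (p m g - P g) ^ 2 ≤ 𝔼 g, (k * (1 - P g ^ 2)) := by
      refine expect_le_expect fun g _ => ?_
      have h2 : ∀ m ∈ range k, (p m g - P g) ^ 2 ≤ 1 - 2 * P g * p m g + P g ^ 2 := fun m _ => by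
        have := (sq_le_one_iff_abs_le_one _).2 (hp m g)
        nlinarith
      refine (sum_le_sum h2).trans ?_
      rw [sum_add_distrib, sum_sub_distrib, ← mul_sum, hPs]
      simp
      apply le_of_eq
      ring
    rw [← mul_expect, expect_sub_distrib, expect_const univ_nonempty] at h1
    nlinarith
  set r : ℕ → ℝ := fun m => 𝔼 g, |p m g - P g| with hr
  have hr0 : ∀ m, 0 ≤ r m := fun m => expect_nonneg fun g _ => abs_nonneg _
  have hrsum : ∑ m ∈ range k, r m ≤ 43 / 2 * s * k := by
    have h1 : ∀ m ∈ range k, r m ≤ (𝔼 g, (p m g - P g) ^ 2) / (2 * s) + s / 2 := by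
      intro m _
      have : r m ≤ 𝔼 g, ((p m g - P g) ^ 2 / (2 * s) + s / 2) := by
        refine expect_le_expect fun g _ => ?_
        rw [← sq_abs, div_add_div _ _ (by positivity) (by positivity), le_div_iff₀ (by positivity)]
        nlinarith [sq_nonneg (|p m g - P g| - s)]
      rwa [expect_add_distrib, expect_const univ_nonempty, ← expect_div] at this
    refine (sum_le_sum h1).trans ?_
    rw [sum_add_distrib, ← sum_div, sum_const, card_range, nsmul_eq_mul]
    have : (∑ m ∈ range k, 𝔼 g, (p m g - P g) ^ 2) / (2 * s) ≤ 21 * s * k := by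
      rw [div_le_iff₀ (by positivity)]
      linarith
    linarith
  set Q : G → ℝ := fun h => 𝔼 v, P (h * v) * P v with hQ
  have hQ1 : ∀ h, |Q h| ≤ 1 := fun h =>
    (abs_expect_le _ _).trans (expect_le univ_nonempty fun v _ => abs_mul_le_one (hP1 _) (hP1 _))
  have hA : ∀ i l, 𝔼 h, (1 + α i h * Q h) ≤ tripleDefect p α i l + r (i + l) + r l := by
    intro i l
    have e1 : r (i + l) = 𝔼 h, 𝔼 v, |p (i + l) (h * v) - P (h * v)| := by
      have : ∀ h : G, 𝔼 v, |p (i + l) (h * v) - P (h * v)| = r (i + l) := fun h =>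
        expect_mul_left h fun v => |p (i + l) v - P v|
      simp only [this, expect_const univ_nonempty]
    have e2 : r l = 𝔼 _h : G, 𝔼 v, |p l v - P v| := (expect_const univ_nonempty _).symm
    rw [e1, e2, tripleDefect, ← expect_add_distrib, ← expect_add_distrib]
    refine expect_le_expect fun h _ => ?_
    have e3 : 1 + α i h * Q h = 𝔼 v, (1 + α i h * (P (h * v) * P v)) := by
      rw [expect_add_distrib, expect_const univ_nonempty, ← mul_expect]
    rw [e3, ← expect_add_distrib, ← expect_add_distrib]
    refine expect_le_expect fun v _ => ?_
    have b1 : |(p (i + l) (h * v) - P (h * v)) * (α i h * p l v)| ≤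
        |p (i + l) (h * v) - P (h * v)| := by
      rw [abs_mul]
      exact mul_le_of_le_one_right (abs_nonneg _) (abs_mul_le_one (hα _ _) (hp _ _))
    have b2 : |(p l v - P v) * (α i h * P (h * v))| ≤ |p l v - P v| := by
      rw [abs_mul]
      exact mul_le_of_le_one_right (abs_nonneg _) (abs_mul_le_one (hα _ _) (hP1 _))
    have b1' := (abs_le.1 b1).1
    have b2' := (abs_le.1 b2).1
    linarith
  have hTQ : ∑ i ∈ range k, ((k : ℝ) - i) * 𝔼 h, (1 + α i h * Q h) ≤ 44 * s * k ^ 2 := by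
    have h1 : ∀ i ∈ range k, ((k : ℝ) - i) * 𝔼 h, (1 + α i h * Q h) ≤
        ∑ l ∈ range (k - i), tripleDefect p α i l + 43 * s * k := by
      intro i hi
      rw [mem_range] at hi
      have h2 : ((k : ℝ) - i) * 𝔼 h, (1 + α i h * Q h) =
          ∑ _l ∈ range (k - i), 𝔼 h, (1 + α i h * Q h) := by
        rw [sum_const, card_range, nsmul_eq_mul, Nat.cast_sub hi.le]
      rw [h2]
      refine (sum_le_sum fun l _ => hA i l).trans ?_
      rw [sum_add_distrib, sum_add_distrib]
      have h3 : ∑ l ∈ range (k - i), r l ≤ ∑ l ∈ range k, r l :=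
        sum_le_sum_of_subset_of_nonneg (range_subset_range.2 (by omega)) fun l _ _ => hr0 l
      have h4 : ∑ l ∈ range (k - i), r (i + l) ≤ ∑ l ∈ range k, r l := by
        rw [← sum_Ico_eq_sum_range]
        refine sum_le_sum_of_subset_of_nonneg (fun l => ?_) fun l _ _ => hr0 l
        simp only [mem_Ico, mem_range]
        omega
      linarith
    refine (sum_le_sum h1).trans ?_
    rw [sum_add_distrib, sum_const, card_range, nsmul_eq_mul]
    have : s ^ 2 * k ^ 2 ≤ s / 4 * k ^ 2 := by
      refine mul_le_mul_of_nonneg_right ?_ (by positivity)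
      nlinarith
    nlinarith
  have hwsum : ∑ i ∈ range k, ((k : ℝ) - i) = k * (k + 1) / 2 := by
    rw [sum_sub_distrib, sum_range_cast_eq]
    simp
    ring
  have hw0 : ∀ i ∈ range k, (0 : ℝ) ≤ (k : ℝ) - i := fun i hi => by
    have : (i : ℝ) ≤ k := by exact_mod_cast (mem_range.1 hi).le
    linarith
  have hQε : 𝔼 h, (1 - |Q h|) ≤ 88 * s := by
    have h1 : ∀ i ∈ range k, ((k : ℝ) - i) * 𝔼 h, (1 - |Q h|) ≤
        ((k : ℝ) - i) * 𝔼 h, (1 + α i h * Q h) := by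
      refine fun i hi => mul_le_mul_of_nonneg_left (expect_le_expect fun h _ => ?_) (hw0 i hi)
      have : |α i h * Q h| ≤ |Q h| := by
        rw [abs_mul]
        exact mul_le_of_le_one_left (abs_nonneg _) (hα i h)
      have := (abs_le.1 this).1
      linarith
    have h2 := (sum_le_sum h1).trans hTQ
    rw [← sum_mul, hwsum] at h2
    have h3 : 0 ≤ 𝔼 h, (1 - |Q h|) := expect_nonneg fun h _ => by linarith [hQ1 h]
    have h4 : (k : ℝ) ^ 2 / 2 * 𝔼 h, (1 - |Q h|) ≤ (k : ℝ) ^ 2 / 2 * (88 * s) := by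
      have : (k : ℝ) ^ 2 / 2 * 𝔼 h, (1 - |Q h|) ≤ k * (k + 1) / 2 * 𝔼 h, (1 - |Q h|) :=
        mul_le_mul_of_nonneg_right (by nlinarith) h3
      linarith
    exact le_of_mul_le_mul_left h4 (by positivity)
  obtain ⟨χ, hχ1, hχm, hχQ, hκ⟩ := exists_character_of_autocorrelation P hPsq (ε := 88 * s)
    (by linarith) (by nlinarith) hQε
  change ∀ h, χ h * Q h = |Q h| at hχQ
  have hχ2 : ∀ g, χ g ^ 2 = 1 := fun g => by rcases hχ1 g with h | h <;> rw [h] <;> norm_num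
  refine ⟨χ, hχ1, hχm, ?_, ?_⟩
  · by_contra hne
    have hχa : χ a = -1 := (hχ1 a).resolve_left hne
    have hχinv : ∀ h, χ (a * h⁻¹) = - χ h := fun h => by
      have h1 : χ (a * h⁻¹) * χ h = -1 := by rw [← hχm, inv_mul_cancel_right, hχa]
      linear_combination χ h * h1 - χ (a * h⁻¹) * hχ2 h
    set κ := 𝔼 g, χ g * P g with hκdef
    have hPκ : 𝔼 g, (P g - κ * χ g) ^ 2 = 𝔼 g, P g ^ 2 - κ ^ 2 := by
      have : ∀ g, (P g - κ * χ g) ^ 2 = P g ^ 2 - 2 * κ * (χ g * P g) + κ ^ 2 := fun g => by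
        linear_combination κ ^ 2 * hχ2 g
      simp only [this]
      rw [expect_add_distrib, expect_sub_distrib, ← mul_expect, expect_const univ_nonempty,
        ← hκdef]
      ring
    have hPle : 𝔼 g, P g ^ 2 ≤ 1 := expect_le univ_nonempty fun g _ => hPsq g
    have hκ1 : κ ^ 2 ≤ 1 := by
      have : 0 ≤ 𝔼 g, (P g - κ * χ g) ^ 2 := expect_nonneg fun g _ => sq_nonneg _
      linarith
    have h1 := timeConv_self_le p k a (fun i => 𝔼 g, (p i g - κ * χ g) ^ 2)
      (fun i g => (p i g - κ * χ g) ^ 2) (fun _ => rfl) fun i l h => by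
        rw [hχinv]
        nlinarith [sq_nonneg ((p i h - κ * χ h) - (p l (a * h⁻¹) - κ * -χ h)),
          sq_nonneg (p i h), sq_nonneg (p l (a * h⁻¹))]
    rw [sum_range_succ] at h1
    have h2 : 𝔼 g, (p k g - κ * χ g) ^ 2 ≤ 4 := expect_le univ_nonempty fun g _ => by
      have e1 := (sq_le_one_iff_abs_le_one _).2 (hp k g)
      have e2 : (κ * χ g) ^ 2 ≤ 1 := by rw [mul_pow, hχ2, mul_one]; exact hκ1
      nlinarith [sq_nonneg (p k g + κ * χ g)]
    have h3 : ∑ i ∈ range k, 𝔼 g, (p i g - κ * χ g) ^ 2 ≤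
        2 * (42 * s ^ 2 * k) + k * (176 * s) := by
      have : ∀ i ∈ range k, 𝔼 g, (p i g - κ * χ g) ^ 2 ≤
          2 * 𝔼 g, (p i g - P g) ^ 2 + 176 * s := by
        intro i _
        have : 𝔼 g, (p i g - κ * χ g) ^ 2 ≤
            𝔼 g, (2 * (p i g - P g) ^ 2 + 2 * (P g - κ * χ g) ^ 2) :=
          expect_le_expect fun g _ => by
            nlinarith [sq_nonneg ((p i g - P g) - (P g - κ * χ g))]
        rw [expect_add_distrib, ← mul_expect, ← mul_expect, hPκ] at this
        linarith
      refine (sum_le_sum this).trans ?_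
      rw [sum_add_distrib, ← mul_sum, sum_const, card_range, nsmul_eq_mul]
      linarith
    have h4 : s ^ 2 * k ≤ s / 20000 * k := by
      refine mul_le_mul_of_nonneg_right ?_ hk'.le
      nlinarith
    have h5 : s * k ≤ 1 / 20000 * k := mul_le_mul_of_nonneg_right hs hk'.le
    linarith
  · have h1 : ∀ i ∈ range k, ((k : ℝ) - i) * 𝔼 h, (1 + α i h * χ h) ≤
        ((k : ℝ) - i) * 𝔼 h, (1 + α i h * Q h) + ((k : ℝ) - i) * (88 * s) := by
      intro i hi
      rw [← mul_add]
      refine mul_le_mul_of_nonneg_left ?_ (hw0 i hi)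
      refine le_trans ?_ (add_le_add_right hQε _)
      rw [← expect_add_distrib]
      refine expect_le_expect fun h _ => ?_
      have e1 : |χ h - Q h| = 1 - |Q h| := by
        rw [← hχQ]
        have := hQ1 h
        rw [← hχQ] at this
        rcases hχ1 h with e | e <;> rw [e] at this ⊢
        · rw [abs_of_nonneg] <;> linarith
        · rw [abs_of_nonpos] <;> linarith
      have e2 : |α i h * (χ h - Q h)| ≤ |χ h - Q h| := by
        rw [abs_mul]
        exact mul_le_of_le_one_left (abs_nonneg _) (hα i h)
      have := (abs_le.1 e2).2
      linarith
    refine (sum_le_sum h1).trans ?_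
    rw [sum_add_distrib, ← sum_mul, hwsum]
    have : (k : ℝ) * (k + 1) / 2 ≤ k ^ 2 := by
      have : (1 : ℝ) ≤ k := by exact_mod_cast hkpos
      nlinarith
    linarith [mul_le_mul_of_nonneg_right this hs0.le]

end Character

section WindowAvg

variable {G : Type*}

/-- The average of a sequence over the window `[m, m + w)`. -/
noncomputable def windowAvg (f : ℕ → G → ℝ) (w m : ℕ) (g : G) : ℝ :=
  (∑ s ∈ range w, f (m + s) g) / w

theorem windowAvg_nonneg {f : ℕ → G → ℝ} (hf : ∀ m g, 0 ≤ f m g) (w m : ℕ) (g : G) :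
    0 ≤ windowAvg f w m g :=
  div_nonneg (sum_nonneg fun _ _ => hf _ _) (Nat.cast_nonneg _)

theorem windowAvg_le {f : ℕ → G → ℝ} {C : ℝ} (hfC : ∀ m g, f m g ≤ C) {w : ℕ} (hw : 0 < w)
    (m : ℕ) (g : G) : windowAvg f w m g ≤ C := by
  have hw' : (0 : ℝ) < w := by exact_mod_cast hw
  rw [windowAvg, div_le_iff₀ hw']
  refine (sum_le_sum fun s _ => hfC (m + s) g).trans ?_
  rw [sum_const, card_range, nsmul_eq_mul, mul_comm]

theorem abs_windowAvg_succ_sub_le {f : ℕ → G → ℝ} {C : ℝ} (hf : ∀ m g, 0 ≤ f m g)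
    (hfC : ∀ m g, f m g ≤ C) (w m : ℕ) (g : G) :
    |windowAvg f w (m + 1) g - windowAvg f w m g| ≤ C / w := by
  have h1 : ∑ s ∈ range w, f (m + 1 + s) g - ∑ s ∈ range w, f (m + s) g = f (m + w) g - f m g := by
    have e1 := sum_range_succ (fun s => f (m + s) g) w
    have e2 := sum_range_succ' (fun s => f (m + s) g) w
    simp only [add_zero] at e2
    have : ∀ s, f (m + 1 + s) g = f (m + (s + 1)) g := fun s => by rw [add_right_comm, add_assoc]
    simp only [this]
    linarith
  rw [windowAvg, windowAvg, ← sub_div, h1, abs_div, Nat.abs_cast]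
  refine div_le_div_of_nonneg_right ?_ (Nat.cast_nonneg _)
  rw [abs_le]
  constructor <;> linarith [hf m g, hf (m + w) g, hfC m g, hfC (m + w) g]

theorem abs_windowAvg_add_sub_le {f : ℕ → G → ℝ} {C : ℝ} (hf : ∀ m g, 0 ≤ f m g)
    (hfC : ∀ m g, f m g ≤ C) (w m s : ℕ) (g : G) :
    |windowAvg f w (m + s) g - windowAvg f w m g| ≤ C * s / w := by
  induction s with
  | zero => simp
  | succ s ih =>
    have h1 := abs_windowAvg_succ_sub_le hf hfC w (m + s) g
    rw [← add_assoc]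
    have := abs_add_le (windowAvg f w (m + s + 1) g - windowAvg f w (m + s) g)
      (windowAvg f w (m + s) g - windowAvg f w m g)
    rw [sub_add_sub_cancel] at this
    push_cast
    rw [mul_add, mul_one, add_div]
    linarith

theorem sum_le_sum_windowAvg {f : ℕ → G → ℝ} {C : ℝ} (hf : ∀ m g, 0 ≤ f m g)
    (hfC : ∀ m g, f m g ≤ C) {w : ℕ} (hw : 0 < w) (N : ℕ) (g : G) :
    ∑ j ∈ range N, f j g ≤ ∑ i ∈ range N, windowAvg f w i g + w * C := by
  have hw' : (0 : ℝ) < w := by exact_mod_cast hw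
  have hC : 0 ≤ C := (hf 0 g).trans (hfC 0 g)
  have h1 : ∀ s ∈ range w, ∑ j ∈ range N, f j g - w * C ≤ ∑ i ∈ range N, f (i + s) g := by
    intro s hs
    have e1 := sum_range_add (fun j => f j g) s N
    have e2 := sum_range_add (fun j => f j g) N s
    rw [add_comm N s] at e2
    have e3 : 0 ≤ ∑ x ∈ range s, f (N + x) g := sum_nonneg fun _ _ => hf _ _
    have e4 : ∑ x ∈ range s, f x g ≤ w * C := by
      refine (sum_le_sum fun x _ => hfC x g).trans ?_
      rw [sum_const, card_range, nsmul_eq_mul]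
      exact mul_le_mul_of_nonneg_right (by exact_mod_cast (mem_range.1 hs).le) hC
    simp only [add_comm _ s]
    linarith
  have h2 := sum_le_sum h1
  rw [sum_const, card_range, nsmul_eq_mul, sum_comm] at h2
  simp only [windowAvg]
  rw [← sum_div, ← sub_le_iff_le_add, le_div_iff₀ hw']
  linarith

theorem abs_expect_windowAvg_sub_one_le [Fintype G] {f : ℕ → G → ℝ} {C : ℝ}
    (hmean : ∀ k : ℕ, |∑ j ∈ range k, 𝔼 g, f j g - k| ≤ C) {w : ℕ} (hw : 0 < w) (m : ℕ) :
    |𝔼 g, windowAvg f w m g - 1| ≤ 2 * C / w := by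
  have hw' : (0 : ℝ) < w := by exact_mod_cast hw
  have h1 := hmean m
  have h2 := hmean (m + w)
  rw [sum_range_add] at h2
  simp only [windowAvg]
  rw [← expect_div, expect_sum_comm, div_sub_one hw'.ne', abs_div, Nat.abs_cast]
  refine div_le_div_of_nonneg_right ?_ hw'.le
  push_cast at h2
  rw [abs_le] at h1 h2 ⊢
  constructor <;> linarith

variable [CommGroup G] [Fintype G]

theorem timeConv_comm (f g : ℕ → G → ℝ) (m : ℕ) (x : G) : timeConv f g m x = timeConv g f m x := by
  rw [timeConv, ← Nat.sum_antidiagonal_swap, timeConv]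
  refine sum_congr rfl fun z _ => ?_
  simp only [Prod.fst_swap, Prod.snd_swap]
  rw [← expect_mul_left x, ← expect_inv]
  refine expect_congr rfl fun h _ => ?_
  rw [mul_comm]
  congr 2
  simp

theorem timeConv_nonneg {f g : ℕ → G → ℝ} (hf : ∀ m x, 0 ≤ f m x) (hg : ∀ m x, 0 ≤ g m x)
    (m : ℕ) (x : G) : 0 ≤ timeConv f g m x :=
  sum_nonneg fun _ _ => expect_nonneg fun _ _ => mul_nonneg (hf _ _) (hg _ _)

theorem abs_timeConv_le {f g : ℕ → G → ℝ} (hf : ∀ m x, |f m x| ≤ 1) (hg : ∀ m x, |g m x| ≤ 1)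
    (m : ℕ) (x : G) : |timeConv f g m x| ≤ m + 1 := by
  refine (abs_sum_le_sum_abs _ _).trans ((sum_le_sum fun z _ => (abs_expect_le _ _).trans
    (expect_le univ_nonempty fun h _ => abs_mul_le_one (hf _ _) (hg _ _))).trans ?_)
  simp

theorem abs_timeConv_windowAvg_sub_le {F B : ℕ → G → ℝ} {C : ℝ} (hF : ∀ m g, 0 ≤ F m g)
    (hFC : ∀ m g, F m g ≤ C) (hB : ∀ m g, 0 ≤ B m g) (hBC : ∀ m g, B m g ≤ C) {w : ℕ}
    (hw : 0 < w) (m : ℕ) (g : G) :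
    |timeConv (windowAvg F w) B m g - (∑ s ∈ range w, timeConv F B (m + s) g) / w| ≤
      C ^ 2 * w := by
  have hw' : (0 : ℝ) < w := by exact_mod_cast hw
  have hC : 0 ≤ C := (hF 0 g).trans (hFC 0 g)
  set φ : ℕ → ℕ → ℝ := fun i l => 𝔼 h, F i h * B l (g * h⁻¹) with hφ
  have hφ0 : ∀ i l, 0 ≤ φ i l := fun i l =>
    expect_nonneg fun h _ => mul_nonneg (hF _ _) (hB _ _)
  have hφC : ∀ i l, φ i l ≤ C ^ 2 := fun i l =>
    expect_le univ_nonempty fun h _ => by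
      rw [sq]; exact mul_le_mul (hFC _ _) (hBC _ _) (hB _ _) hC
  have h1 : timeConv (windowAvg F w) B m g =
      (∑ s ∈ range w, ∑ i ∈ range (m + 1), φ (i + s) (m - i)) / w := by
    rw [sum_comm, timeConv,
      Nat.sum_antidiagonal_eq_sum_range_succ (fun i l => 𝔼 h, windowAvg F w i h * B l (g * h⁻¹)),
      sum_div]
    refine sum_congr rfl fun i _ => ?_
    simp only [hφ]
    rw [← expect_sum_comm, expect_div]
    refine expect_congr rfl fun h _ => ?_
    rw [windowAvg, div_mul_eq_mul_div, sum_mul]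
  have h2 : ∀ s, timeConv F B (m + s) g =
      ∑ i ∈ range s, φ i (m + s - i) + ∑ i ∈ range (m + 1), φ (i + s) (m - i) := by
    intro s
    rw [timeConv, Nat.sum_antidiagonal_eq_sum_range_succ φ, show (m + s).succ = s + (m + 1) by
      rw [Nat.succ_eq_add_one]; ring, sum_range_add]
    congr 1
    refine sum_congr rfl fun i _ => ?_
    rw [add_comm s i, show m + s - (i + s) = m - i by omega]
  rw [h1, ← sub_div, abs_div, Nat.abs_cast, div_le_iff₀ hw', ← sum_sub_distrib]
  refine (abs_sum_le_sum_abs _ _).trans ?_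
  have h3 : ∀ s ∈ range w, |∑ i ∈ range (m + 1), φ (i + s) (m - i) - timeConv F B (m + s) g| ≤
      C ^ 2 * w := by
    intro s hs
    rw [h2, sub_add_cancel_right, abs_neg, abs_of_nonneg (sum_nonneg fun i _ => hφ0 _ _)]
    refine (sum_le_sum fun i _ => hφC _ _).trans ?_
    rw [sum_const, card_range, nsmul_eq_mul, mul_comm]
    exact mul_le_mul_of_nonneg_left (by exact_mod_cast (mem_range.1 hs).le) (sq_nonneg C)
  refine (sum_le_sum h3).trans ?_
  rw [sum_const, card_range, nsmul_eq_mul, mul_comm]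

theorem abs_mul_windowAvg_add_timeConv_sub_le {f : ℕ → G → ℝ} {C : ℝ} (hC : 1 ≤ C)
    (hf : ∀ m g, 0 ≤ f m g) (hfC : ∀ m g, f m g ≤ C)
    (hsel : ∀ (k : ℕ) g, |∑ j ∈ range k, (j * f j g + timeConv f f j g) - (k : ℝ) ^ 2| ≤
      C * (k + 1)) {w m : ℕ} (hw : 0 < w) (hm : w ^ 2 ≤ m) (g : G) :
    |m * windowAvg f w m g + timeConv f (windowAvg f w) m g - 2 * m| ≤ 8 * C ^ 2 * m / w := by
  have hw' : (1 : ℝ) ≤ w := by exact_mod_cast hw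
  have hm' : (w : ℝ) ^ 2 ≤ m := by exact_mod_cast hm
  have h0 := abs_timeConv_windowAvg_sub_le hf hfC hf hfC hw m g
  rw [timeConv_comm f]
  set T := timeConv (windowAvg f w) f m g
  set S := ∑ s ∈ range w, timeConv f f (m + s) g
  have h1 := hsel m g
  have h2 := hsel (m + w) g
  rw [sum_range_add] at h2
  have h3 : ∑ x ∈ range w, (((m + x : ℕ) : ℝ) * f (m + x) g + timeConv f f (m + x) g) =
      w * (m * windowAvg f w m g) + ∑ x ∈ range w, x * f (m + x) g + S := by
    rw [sum_add_distrib]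
    congr 1
    rw [windowAvg, mul_left_comm, mul_div_cancel₀ _ (by positivity), mul_sum, ← sum_add_distrib]
    refine sum_congr rfl fun x _ => ?_
    push_cast
    ring
  rw [h3] at h2
  have h4 : 0 ≤ ∑ x ∈ range w, x * f (m + x) g :=
    sum_nonneg fun x _ => mul_nonneg (Nat.cast_nonneg _) (hf _ _)
  have h5 : ∑ x ∈ range w, x * f (m + x) g ≤ C * w ^ 2 := by
    have : ∀ x ∈ range w, (x : ℝ) * f (m + x) g ≤ w * C := fun x hx =>
      mul_le_mul (by exact_mod_cast (mem_range.1 hx).le) (hfC _ _) (hf _ _) (by positivity)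
    refine (sum_le_sum this).trans ?_
    rw [sum_const, card_range, nsmul_eq_mul]
    apply le_of_eq
    ring
  have h6 : |w * T - S| ≤ C ^ 2 * w ^ 2 := by
    have : w * T - S = w * (T - S / w) := by field_simp
    rw [this, abs_mul, Nat.abs_cast]
    nlinarith
  push_cast at h2
  rw [le_div_iff₀ (by positivity), ← abs_of_nonneg (show (0 : ℝ) ≤ w by positivity), ← abs_mul]
  rw [abs_le] at h1 h2 h6
  have hCC : C ≤ C ^ 2 := by nlinarith
  have hwm : (w : ℝ) ≤ m := by nlinarith
  have e1 : C * w ≤ C ^ 2 * m := mul_le_mul hCC hwm (by positivity) (by positivity)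
  have e2 : C * w ^ 2 ≤ C ^ 2 * m := mul_le_mul hCC hm' (by positivity) (by positivity)
  have e3 : C ^ 2 * w ^ 2 ≤ C ^ 2 * m := mul_le_mul_of_nonneg_left hm' (by positivity)
  have e4 : C * m ≤ C ^ 2 * m := mul_le_mul_of_nonneg_right hCC (by positivity)
  have e5 : (w : ℝ) ^ 2 ≤ C * w ^ 2 := le_mul_of_one_le_left (by positivity) hC
  have e6 : C ≤ C * w := le_mul_of_one_le_right (by positivity) hw'
  rw [abs_le]
  constructor <;> nlinarith

theorem windowAvg_le_two_add {f : ℕ → G → ℝ} {C : ℝ} (hC : 1 ≤ C)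
    (hf : ∀ m g, 0 ≤ f m g) (hfC : ∀ m g, f m g ≤ C)
    (hsel : ∀ (k : ℕ) g, |∑ j ∈ range k, (j * f j g + timeConv f f j g) - (k : ℝ) ^ 2| ≤
      C * (k + 1)) {w m : ℕ} (hw : 0 < w) (hm : w ^ 2 ≤ m) (g : G) :
    windowAvg f w m g ≤ 2 + 8 * C ^ 2 / w := by
  have hm0 : (0 : ℝ) < m := by exact_mod_cast (pow_pos hw 2).trans_le hm
  have h1 := (abs_le.1 (abs_mul_windowAvg_add_timeConv_sub_le hC hf hfC hsel hw hm g)).2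
  have h2 := timeConv_nonneg hf (windowAvg_nonneg hf w) m g
  have h3 : (m : ℝ) * windowAvg f w m g ≤ m * (2 + 8 * C ^ 2 / w) := by
    have : (m : ℝ) * (2 + 8 * C ^ 2 / w) = 2 * m + 8 * C ^ 2 * m / w := by ring
    linarith
  exact le_of_mul_le_mul_left h3 hm0

theorem abs_timeConv_windowAvg_windowAvg_sub_le {f : ℕ → G → ℝ} {C : ℝ} (hC : 1 ≤ C)
    (hf : ∀ m g, 0 ≤ f m g) (hfC : ∀ m g, f m g ≤ C)
    (hsel : ∀ (k : ℕ) g, |∑ j ∈ range k, (j * f j g + timeConv f f j g) - (k : ℝ) ^ 2| ≤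
      C * (k + 1)) {v m : ℕ} (hv : 0 < v) (hm : v ^ 4 ≤ m) (g : G) :
    |timeConv (windowAvg f v) (windowAvg f (v ^ 2)) m g - 2 * m +
      m * windowAvg f (v ^ 2) m g| ≤ 21 * C ^ 2 * m / v := by
  have hv' : (1 : ℝ) ≤ v := by exact_mod_cast hv
  have hm' : (v : ℝ) ^ 4 ≤ m := by exact_mod_cast hm
  have hw : 0 < v ^ 2 := by positivity
  set A := windowAvg f (v ^ 2) with hA
  have hA0 : ∀ m g, 0 ≤ A m g := windowAvg_nonneg hf _
  have hAC : ∀ m g, A m g ≤ C := windowAvg_le hfC hw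
  have h0 := abs_timeConv_windowAvg_sub_le hf hfC hA0 hAC hv m g
  have hCC : C ≤ C ^ 2 := by nlinarith
  have hvm : (v : ℝ) ^ 2 ≤ m := le_trans (by nlinarith [sq_nonneg ((v : ℝ) ^ 2 - 1)]) hm'
  have hmv : (v : ℝ) ≤ m / v := by
    rw [le_div_iff₀ (by positivity)]
    linarith
  have hs : ∀ s ∈ range v, |timeConv f A (m + s) g - (2 * m - m * A m g)| ≤
      20 * C ^ 2 * m / v := by
    intro s hs
    have hsv : (s : ℝ) ≤ v := by exact_mod_cast (mem_range.1 hs).le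
    have h1 := abs_mul_windowAvg_add_timeConv_sub_le hC hf hfC hsel hw
      (m := m + s) (by rw [← pow_mul]; exact hm.trans (Nat.le_add_right _ _)) g
    have h2 := abs_windowAvg_add_sub_le hf hfC (v ^ 2) m s g
    rw [← hA] at h1 h2
    push_cast at h1 h2
    have hsm : (s : ℝ) ≤ m := by nlinarith
    have h3 : 8 * C ^ 2 * (m + s) / (v : ℝ) ^ 2 ≤ 16 * C ^ 2 * (m / v) := by
      rw [div_le_iff₀ (by positivity)]
      have : 16 * C ^ 2 * (m / v) * (v : ℝ) ^ 2 = 16 * C ^ 2 * (m * v) := by field_simp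
      rw [this]
      have : (m : ℝ) + s ≤ 2 * (m * v) := by nlinarith
      nlinarith [mul_le_mul_of_nonneg_left this (by positivity : 0 ≤ 8 * C ^ 2)]
    have h4 : (m : ℝ) * (C * s / (v : ℝ) ^ 2) ≤ C ^ 2 * (m / v) := by
      have : C * s / (v : ℝ) ^ 2 ≤ C ^ 2 / v := by
        rw [div_le_div_iff₀ (by positivity) (by positivity)]
        have : C * s ≤ C ^ 2 * v := mul_le_mul hCC hsv (by positivity) (by positivity)
        nlinarith
      calc (m : ℝ) * (C * s / (v : ℝ) ^ 2) ≤ m * (C ^ 2 / v) :=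
            mul_le_mul_of_nonneg_left this (by positivity)
        _ = _ := by ring
    have h5 : |(m : ℝ) * (A (m + s) g - A m g)| ≤ C ^ 2 * (m / v) := by
      rw [abs_mul, Nat.abs_cast]
      exact (mul_le_mul_of_nonneg_left h2 (by positivity)).trans h4
    have h6 : (s : ℝ) ≤ m / v := hsv.trans hmv
    have h7 : (s : ℝ) * A (m + s) g ≤ C ^ 2 * (m / v) := by
      rw [mul_comm]
      exact mul_le_mul ((hAC _ _).trans hCC) h6 (by positivity) (by positivity)
    have h8 : 0 ≤ (s : ℝ) * A (m + s) g := mul_nonneg (by positivity) (hA0 _ _)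
    have h9 : (m : ℝ) / v ≤ C ^ 2 * (m / v) :=
      le_mul_of_one_le_left (by positivity) (hC.trans hCC)
    rw [show 20 * C ^ 2 * m / v = 20 * (C ^ 2 * (m / v)) by ring]
    rw [abs_le] at h1 h5 ⊢
    have hs0 : (0 : ℝ) ≤ s := Nat.cast_nonneg s
    constructor <;> linarith
  have h10 : |(∑ s ∈ range v, timeConv f A (m + s) g) / v - (2 * m - m * A m g)| ≤
      20 * C ^ 2 * m / v := by
    have e : (∑ s ∈ range v, timeConv f A (m + s) g) / v - (2 * m - m * A m g) =
        (∑ s ∈ range v, (timeConv f A (m + s) g - (2 * m - m * A m g))) / v := by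
      rw [sum_sub_distrib, sum_const, card_range, nsmul_eq_mul]
      field_simp
    rw [e, abs_div, Nat.abs_cast, div_le_iff₀ (by positivity)]
    refine (abs_sum_le_sum_abs _ _).trans ((sum_le_sum hs).trans ?_)
    rw [sum_const, card_range, nsmul_eq_mul, mul_comm]
  have h11 : C ^ 2 * v ≤ C ^ 2 * m / v := by
    rw [mul_div_assoc]
    exact mul_le_mul_of_nonneg_left hmv (by positivity)
  rw [show 21 * C ^ 2 * m / v = 20 * C ^ 2 * m / v + C ^ 2 * m / v by ring]
  rw [abs_le] at h0 h10 ⊢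
  constructor <;> linarith

end WindowAvg

section Clip

variable {G : Type*}

/-- The deviation of a sequence from `1`, truncated above at `1`. -/
noncomputable def clipDev (X : ℕ → G → ℝ) (m : ℕ) (g : G) : ℝ := min (X m g - 1) 1

theorem abs_clipDev_le {X : ℕ → G → ℝ} (hX : ∀ m g, 0 ≤ X m g) (m : ℕ) (g : G) :
    |clipDev X m g| ≤ 1 :=
  abs_le.2 ⟨le_min (by linarith [hX m g]) (by norm_num), min_le_right _ _⟩

theorem clipDev_le (X : ℕ → G → ℝ) (m : ℕ) (g : G) : clipDev X m g ≤ X m g - 1 := min_le_left _ _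

theorem sub_one_sub_clipDev_le {X : ℕ → G → ℝ} {C ε : ℝ} {M : ℕ} (hC : 0 ≤ C) (hε : 0 ≤ ε)
    (hXC : ∀ m g, X m g ≤ C) (hXM : ∀ m, M ≤ m → ∀ g, X m g ≤ 2 + ε) (m : ℕ) (g : G) :
    X m g - 1 - clipDev X m g ≤ ε + if m < M then C else 0 := by
  have h1 := hXC m g
  rw [clipDev]
  split_ifs with h
  · rcases min_cases (X m g - 1) 1 with h2 | h2 <;> linarith [h2.1]
  · have := hXM m (not_lt.1 h) g
    rcases min_cases (X m g - 1) 1 with h2 | h2 <;> linarith [h2.1]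

theorem sum_range_ite_lt_le {C : ℝ} (hC : 0 ≤ C) (N M : ℕ) :
    ∑ i ∈ range N, (if i < M then C else 0) ≤ M * C := by
  rw [← sum_filter, sum_const, nsmul_eq_mul]
  refine mul_le_mul_of_nonneg_right ?_ hC
  have : #{i ∈ range N | i < M} ≤ #(range M) := card_le_card fun i hi => by
    rw [mem_filter] at hi
    exact mem_range.2 hi.2
  rw [card_range] at this
  exact_mod_cast this

variable [CommGroup G] [Fintype G]

theorem abs_timeConv_clipDev_sub_le {X Y : ℕ → G → ℝ} {C ε ε' : ℝ} {M : ℕ} (hC : 1 ≤ C)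
    (hε : 0 ≤ ε) (hX : ∀ m g, 0 ≤ X m g) (hXC : ∀ m g, X m g ≤ C) (hY : ∀ m g, 0 ≤ Y m g)
    (hYC : ∀ m g, Y m g ≤ C) (hXM : ∀ m, M ≤ m → ∀ g, X m g ≤ 2 + ε)
    (hYM : ∀ m, M ≤ m → ∀ g, Y m g ≤ 2 + ε) (hXE : ∀ m, |𝔼 g, X m g - 1| ≤ ε')
    (hYE : ∀ m, |𝔼 g, Y m g - 1| ≤ ε') (m : ℕ) (g : G) :
    |timeConv (clipDev X) (clipDev Y) m g - timeConv X Y m g + (m + 1)| ≤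
      (m + 1) * (2 * ε' + (1 + C) * ε) + (1 + C) * C * M := by
  set e : ℕ → ℝ := fun i => ε + if i < M then C else 0 with he
  have hC0 : 0 ≤ C := by linarith
  have he0 : ∀ i, 0 ≤ e i := fun i => by simp only [he]; split_ifs <;> linarith
  have hz : ∀ z ∈ antidiagonal m, |(𝔼 h, clipDev X z.1 h * clipDev Y z.2 (g * h⁻¹)) -
      (𝔼 h, X z.1 h * Y z.2 (g * h⁻¹)) + 1| ≤ 2 * ε' + (e z.2 * C + e z.1) := by
    intro z _
    have hYs : 𝔼 h, Y z.2 (g * h⁻¹) = 𝔼 h, Y z.2 h := by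
      rw [← expect_mul_left g (Y z.2), ← expect_inv fun h => Y z.2 (g * h)]
    have h1 : (𝔼 h, clipDev X z.1 h * clipDev Y z.2 (g * h⁻¹)) -
        (𝔼 h, X z.1 h * Y z.2 (g * h⁻¹)) + 1 =
        (𝔼 h, (clipDev X z.1 h * clipDev Y z.2 (g * h⁻¹) -
          (X z.1 h - 1) * (Y z.2 (g * h⁻¹) - 1))) -
            (𝔼 h, X z.1 h - 1) - (𝔼 h, Y z.2 h - 1) := by
      have : ∀ h, clipDev X z.1 h * clipDev Y z.2 (g * h⁻¹) -
          (X z.1 h - 1) * (Y z.2 (g * h⁻¹) - 1) =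
          clipDev X z.1 h * clipDev Y z.2 (g * h⁻¹) - X z.1 h * Y z.2 (g * h⁻¹) + X z.1 h +
            Y z.2 (g * h⁻¹) - 1 := fun h => by ring
      simp only [this]
      rw [expect_sub_distrib, expect_add_distrib, expect_add_distrib, expect_sub_distrib,
        expect_const univ_nonempty, hYs]
      ring
    have h2 : |𝔼 h, (clipDev X z.1 h * clipDev Y z.2 (g * h⁻¹) -
        (X z.1 h - 1) * (Y z.2 (g * h⁻¹) - 1))| ≤ e z.2 * C + e z.1 := by
      refine (abs_expect_le _ _).trans (expect_le univ_nonempty fun h _ => ?_)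
      have a1 := sub_one_sub_clipDev_le hC0 hε hXC hXM z.1 h
      have a2 := sub_one_sub_clipDev_le hC0 hε hYC hYM z.2 (g * h⁻¹)
      have a3 := clipDev_le X z.1 h
      have a4 := clipDev_le Y z.2 (g * h⁻¹)
      have b1 : |(X z.1 h - 1 - clipDev X z.1 h) * clipDev Y z.2 (g * h⁻¹)| ≤ e z.1 := by
        rw [abs_mul, abs_of_nonneg (by linarith)]
        exact (mul_le_of_le_one_right (by linarith) (abs_clipDev_le hY _ _)).trans a1
      have b2 : |(Y z.2 (g * h⁻¹) - 1 - clipDev Y z.2 (g * h⁻¹)) * (X z.1 h - 1)| ≤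
          e z.2 * C := by
        rw [abs_mul, abs_of_nonneg (by linarith)]
        refine mul_le_mul a2 ?_ (abs_nonneg _) (he0 _)
        have := hX z.1 h
        have := hXC z.1 h
        rw [abs_le]
        constructor <;> linarith
      rw [abs_le] at b1 b2 ⊢
      constructor <;> nlinarith
    rw [h1]
    have h3 := hXE z.1
    have h4 := hYE z.2
    rw [abs_le] at h2 h3 h4 ⊢
    constructor <;> linarith
  have hsum : timeConv (clipDev X) (clipDev Y) m g - timeConv X Y m g + (m + 1) =
      ∑ z ∈ antidiagonal m, ((𝔼 h, clipDev X z.1 h * clipDev Y z.2 (g * h⁻¹)) -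
        (𝔼 h, X z.1 h * Y z.2 (g * h⁻¹)) + 1) := by
    rw [sum_add_distrib, sum_sub_distrib]
    simp [timeConv]
  rw [hsum]
  refine (abs_sum_le_sum_abs _ _).trans ((sum_le_sum hz).trans ?_)
  have h5 : ∑ i ∈ range (m + 1), e i ≤ (m + 1) * ε + M * C := by
    simp only [he]
    rw [sum_add_distrib, sum_const, card_range, nsmul_eq_mul]
    push_cast
    linarith [sum_range_ite_lt_le hC0 (m + 1) M]
  have h6 : ∑ z ∈ antidiagonal m, e z.1 = ∑ i ∈ range (m + 1), e i :=
    Nat.sum_antidiagonal_eq_sum_range_succ (fun i _ => e i) m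
  have h7 : ∑ z ∈ antidiagonal m, e z.2 = ∑ z ∈ antidiagonal m, e z.1 :=
    Nat.sum_antidiagonal_swap (f := fun z => e z.1)
  have h8 : ∑ z ∈ antidiagonal m, e z.2 * C = (∑ z ∈ antidiagonal m, e z.2) * C :=
    (sum_mul _ _ _).symm
  rw [sum_add_distrib, sum_add_distrib, h8, h7, h6]
  simp only [sum_const, Nat.card_antidiagonal, nsmul_eq_mul]
  push_cast
  nlinarith [mul_le_mul_of_nonneg_right h5 hC0]

theorem expect_character_eq_zero {χ : G → ℝ} (hmul : ∀ g h, χ (g * h) = χ g * χ h)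
    (hne : ∃ g, χ g ≠ 1) : 𝔼 g, χ g = 0 := by
  obtain ⟨g, hg⟩ := hne
  have h1 := expect_mul_left g χ
  simp only [hmul] at h1
  rw [← mul_expect] at h1
  by_contra h
  exact hg (mul_right_cancel₀ h (h1.trans (one_mul _).symm))

end Clip

section Sparse

variable {G : Type*} [CommGroup G] [Fintype G] {f : ℕ → G → ℝ} {C : ℝ}

theorem clip_error_le (hC : 2 ≤ C) {v : ℝ} (hv : 0 < v) :
    2 * (2 * C / v) + (1 + C) * (8 * C ^ 2 / v) ≤ 13 * C ^ 3 / v := by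
  have : 2 * (2 * C / v) + (1 + C) * (8 * C ^ 2 / v) = (4 * C + (1 + C) * (8 * C ^ 2)) / v := by
    ring
  rw [this]
  refine div_le_div_of_nonneg_right ?_ hv.le
  nlinarith [mul_nonneg (sub_nonneg.2 hC) (sq_nonneg C), mul_nonneg (sub_nonneg.2 hC)
    (by linarith : 0 ≤ C)]

theorem windowAvg_sq_le_two_add (hC : 2 ≤ C) (hf : ∀ m g, 0 ≤ f m g) (hfC : ∀ m g, f m g ≤ C)
    (hsel : ∀ (k : ℕ) g, |∑ j ∈ range k, (j * f j g + timeConv f f j g) - (k : ℝ) ^ 2| ≤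
      C * (k + 1)) {v m : ℕ} (hv : 0 < v) (hm : v ^ 4 ≤ m) (g : G) :
    windowAvg f (v ^ 2) m g ≤ 2 + 8 * C ^ 2 / v := by
  have hv' : (1 : ℝ) ≤ v := by exact_mod_cast hv
  refine (windowAvg_le_two_add (by linarith) hf hfC hsel (w := v ^ 2) (by positivity)
    (by rwa [← pow_mul]) g).trans ?_
  push_cast
  gcongr
  nlinarith

omit [CommGroup G] in
theorem abs_expect_windowAvg_sq_sub_one_le (hC : 2 ≤ C)
    (hmean : ∀ k : ℕ, |∑ j ∈ range k, 𝔼 g, f j g - k| ≤ C) {v : ℕ} (hv : 0 < v) (m : ℕ) :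
    |𝔼 g, windowAvg f (v ^ 2) m g - 1| ≤ 2 * C / v := by
  have hv' : (1 : ℝ) ≤ v := by exact_mod_cast hv
  refine (abs_expect_windowAvg_sub_one_le hmean (w := v ^ 2) (by positivity) m).trans ?_
  push_cast
  gcongr
  nlinarith

theorem abs_mul_clipDev_add_timeConv_le (hC : 2 ≤ C) (hf : ∀ m g, 0 ≤ f m g)
    (hfC : ∀ m g, f m g ≤ C) (hmean : ∀ k : ℕ, |∑ j ∈ range k, 𝔼 g, f j g - k| ≤ C)
    (hsel : ∀ (k : ℕ) g, |∑ j ∈ range k, (j * f j g + timeConv f f j g) - (k : ℝ) ^ 2| ≤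
      C * (k + 1)) {v : ℕ} (hv : 0 < v) (m : ℕ) (g : G) :
    |m * clipDev (windowAvg f (v ^ 2)) m g +
      timeConv (clipDev (windowAvg f v)) (clipDev (windowAvg f (v ^ 2))) m g| ≤
        41 * C ^ 3 * m / v + 2 * C ^ 2 * v ^ 4 := by
  have hv' : (1 : ℝ) ≤ v := by exact_mod_cast hv
  have hv0 : (0 : ℝ) < v := by linarith
  have hw : 0 < v ^ 2 := by positivity
  have hC1 : 1 ≤ C := by linarith
  have hv4 : (1 : ℝ) ≤ (v : ℝ) ^ 4 := one_le_pow₀ hv'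
  have hC2 : 4 ≤ C ^ 2 := by nlinarith
  have hA := windowAvg_nonneg hf (v ^ 2)
  have hB := windowAvg_nonneg hf v
  rcases lt_or_ge m (v ^ 4) with hm | hm
  · have hm' : (m : ℝ) ≤ (v : ℝ) ^ 4 := by exact_mod_cast hm.le
    have h1 := abs_timeConv_le (abs_clipDev_le hB) (abs_clipDev_le hA) m g
    have h2 := abs_clipDev_le hA m g
    have h3 : |(m : ℝ) * clipDev (windowAvg f (v ^ 2)) m g| ≤ m := by
      rw [abs_mul, Nat.abs_cast]
      exact mul_le_of_le_one_right (Nat.cast_nonneg _) h2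
    have h4 : (0 : ℝ) ≤ 41 * C ^ 3 * m / v := by positivity
    refine (abs_add_le _ _).trans ?_
    nlinarith
  · have hm' : (v : ℝ) ^ 4 ≤ m := by exact_mod_cast hm
    have hm1 : (1 : ℝ) ≤ m := hv4.trans hm'
    have hvm : v ^ 2 ≤ v ^ 4 := Nat.pow_le_pow_right hv (by norm_num)
    have hε : (0 : ℝ) ≤ 8 * C ^ 2 / v := by positivity
    have h1 := abs_timeConv_clipDev_sub_le (M := v ^ 4) hC1 hε hB (windowAvg_le hfC hv) hA
      (windowAvg_le hfC hw)
      (fun m hm g => windowAvg_le_two_add hC1 hf hfC hsel hv (hvm.trans hm) g)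
      (fun m hm g => windowAvg_sq_le_two_add hC hf hfC hsel hv hm g)
      (abs_expect_windowAvg_sub_one_le hmean hv)
      (abs_expect_windowAvg_sq_sub_one_le hC hmean hv) m g
    have h2 := abs_timeConv_windowAvg_windowAvg_sub_le hC1 hf hfC hsel hv hm g
    have h3 := sub_one_sub_clipDev_le (by linarith) hε (windowAvg_le hfC hw)
      (fun m hm g => windowAvg_sq_le_two_add hC hf hfC hsel hv hm g) m g
    rw [if_neg (not_lt.2 hm), add_zero] at h3
    have h4 := clipDev_le (windowAvg f (v ^ 2)) m g
    have h5 := mul_le_mul_of_nonneg_left (clip_error_le hC hv0) (by linarith : (0 : ℝ) ≤ m + 1)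
    have h6 : (m + 1) * (13 * C ^ 3 / v) ≤ 26 * C ^ 3 * m / v := by
      rw [mul_div_assoc', div_le_div_iff_of_pos_right hv0]
      nlinarith [pow_pos (by linarith : 0 < C) 3]
    have h7 : 8 * C ^ 2 / v * m + 21 * C ^ 2 * m / v + 26 * C ^ 3 * m / v ≤
        41 * C ^ 3 * m / v := by
      rw [div_mul_eq_mul_div, ← add_div, ← add_div, div_le_div_iff_of_pos_right hv0]
      nlinarith [mul_nonneg (mul_nonneg (sub_nonneg.2 hC) (sq_nonneg C))
        (by linarith : (0 : ℝ) ≤ m)]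
    have h8 : (1 + C) * C * (v : ℝ) ^ 4 + 1 ≤ 2 * C ^ 2 * (v : ℝ) ^ 4 := by
      have e1 : (1 + C) * C + 1 ≤ 2 * C ^ 2 := by nlinarith
      linarith [mul_le_mul_of_nonneg_right e1 (by linarith : (0 : ℝ) ≤ (v : ℝ) ^ 4)]
    have h9 := mul_le_mul_of_nonneg_right h3 (by linarith : (0 : ℝ) ≤ m)
    have h10 := mul_le_mul_of_nonneg_right h4 (by linarith : (0 : ℝ) ≤ m)
    push_cast at h1
    rw [abs_le] at h1 h2 ⊢
    constructor <;> nlinarith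

theorem le_timeConv_clipDev (hC : 2 ≤ C) (hf : ∀ m g, 0 ≤ f m g)
    (hfC : ∀ m g, f m g ≤ C) (hmean : ∀ k : ℕ, |∑ j ∈ range k, 𝔼 g, f j g - k| ≤ C)
    (hsel : ∀ (k : ℕ) g, |∑ j ∈ range k, (j * f j g + timeConv f f j g) - (k : ℝ) ^ 2| ≤
      C * (k + 1)) {v n : ℕ} (hv : 0 < v) (hvC : 9 * C ^ 2 ≤ v) (hn : v ^ 4 ≤ n) {a : G}
    (ha : ∑ j ∈ Ico n (n + 2 * v ^ 2), f j a ≤ 1) :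
    n - (35 * C ^ 3 * n / v + 3 * C ^ 2 * v ^ 4) ≤
      timeConv (clipDev (windowAvg f (v ^ 2))) (clipDev (windowAvg f (v ^ 2))) n a := by
  have hv' : (1 : ℝ) ≤ v := by exact_mod_cast hv
  have hv0 : (0 : ℝ) < v := by linarith
  have hw : 0 < v ^ 2 := by positivity
  have hC1 : 1 ≤ C := by linarith
  have hv4 : (1 : ℝ) ≤ (v : ℝ) ^ 4 := one_le_pow₀ hv'
  have hC2 : 4 ≤ C ^ 2 := by nlinarith
  have hn' : (v : ℝ) ^ 4 ≤ n := by exact_mod_cast hn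
  have hn1 : (1 : ℝ) ≤ n := hv4.trans hn'
  have hA := windowAvg_nonneg hf (v ^ 2)
  have hε : (0 : ℝ) ≤ 8 * C ^ 2 / v := by positivity
  have h1 := abs_timeConv_clipDev_sub_le (M := v ^ 4) hC1 hε hA (windowAvg_le hfC hw) hA
    (windowAvg_le hfC hw)
    (fun m hm g => windowAvg_sq_le_two_add hC hf hfC hsel hv hm g)
    (fun m hm g => windowAvg_sq_le_two_add hC hf hfC hsel hv hm g)
    (abs_expect_windowAvg_sq_sub_one_le hC hmean hv)
    (abs_expect_windowAvg_sq_sub_one_le hC hmean hv) n a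
  have h2 := abs_timeConv_windowAvg_sub_le hf hfC hA (windowAvg_le hfC hw) hw n a
  have hw0 : (0 : ℝ) < ((v ^ 2 : ℕ) : ℝ) := by exact_mod_cast hw
  have h3 : n * (2 - 9 * C ^ 2 / v) ≤
      (∑ s ∈ range (v ^ 2), timeConv f (windowAvg f (v ^ 2)) (n + s) a) / (v ^ 2 : ℕ) := by
    rw [le_div_iff₀ hw0]
    have : ∑ _s ∈ range (v ^ 2), (n * (2 - 9 * C ^ 2 / v) : ℝ) =
        n * (2 - 9 * C ^ 2 / v) * (v ^ 2 : ℕ) := by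
      rw [sum_const, card_range, nsmul_eq_mul, mul_comm]
    rw [← this]
    refine sum_le_sum fun s hs => ?_
    rw [mem_range] at hs
    have e1 := (abs_le.1 (abs_mul_windowAvg_add_timeConv_sub_le hC1 hf hfC hsel hw
      (m := n + s) (by rw [← pow_mul]; exact Nat.le_add_right_of_le hn) a)).1
    have e2 : windowAvg f (v ^ 2) (n + s) a ≤ 1 / v := by
      have e3 : windowAvg f (v ^ 2) (n + s) a ≤ 1 / (v ^ 2 : ℕ) := by
        rw [windowAvg]
        refine div_le_div_of_nonneg_right (le_trans ?_ ha) hw0.le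
        have e4 := sum_Ico_eq_sum_range (fun j => f j a) (n + s) (n + s + v ^ 2)
        rw [Nat.add_sub_cancel_left] at e4
        rw [← e4]
        exact sum_le_sum_of_subset_of_nonneg (Ico_subset_Ico (by omega) (by omega))
          fun _ _ _ => hf _ _
      refine e3.trans ?_
      push_cast
      gcongr
      nlinarith
    have e4 : 8 * C ^ 2 * ((n + s : ℕ) : ℝ) / (v ^ 2 : ℕ) ≤ 8 * C ^ 2 / v * (n + s : ℕ) := by
      rw [div_mul_eq_mul_div]
      push_cast
      gcongr
      nlinarith
    have e5 := mul_le_mul_of_nonneg_left e2 (Nat.cast_nonneg (α := ℝ) (n + s))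
    have e6 : (1 : ℝ) / v ≤ C ^ 2 / v := by gcongr; linarith
    have e7 : 9 * C ^ 2 / v ≤ 1 := by rwa [div_le_one hv0]
    have e8 : ((n + s : ℕ) : ℝ) * (2 - 9 * C ^ 2 / v) ≤
        timeConv f (windowAvg f (v ^ 2)) (n + s) a := by
      have e9 := mul_le_mul_of_nonneg_left e6 (Nat.cast_nonneg (α := ℝ) (n + s))
      have e10 : 9 * C ^ 2 / v = 8 * C ^ 2 / v + C ^ 2 / v := by ring
      rw [e10]
      nlinarith
    refine le_trans ?_ e8
    refine mul_le_mul_of_nonneg_right ?_ (by linarith)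
    push_cast
    linarith [Nat.cast_nonneg (α := ℝ) s]
  have h5 := mul_le_mul_of_nonneg_left (clip_error_le hC hv0) (by linarith : (0 : ℝ) ≤ n + 1)
  have h6 : (n + 1) * (13 * C ^ 3 / v) ≤ 26 * C ^ 3 * n / v := by
    rw [mul_div_assoc', div_le_div_iff_of_pos_right hv0]
    nlinarith [pow_pos (by linarith : 0 < C) 3]
  have h7 : n * (9 * C ^ 2 / v) + 26 * C ^ 3 * n / v ≤ 35 * C ^ 3 * n / v := by
    rw [mul_div_assoc', ← add_div, div_le_div_iff_of_pos_right hv0]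
    nlinarith [mul_nonneg (mul_nonneg (by linarith : 0 ≤ C - 1) (sq_nonneg C))
      (by linarith : (0 : ℝ) ≤ n)]
  have h8 : (1 + C) * C * (v : ℝ) ^ 4 + 1 + C ^ 2 * (v : ℝ) ^ 2 ≤ 3 * C ^ 2 * (v : ℝ) ^ 4 := by
    have : (v : ℝ) ^ 2 ≤ (v : ℝ) ^ 4 := pow_le_pow_right₀ hv' (by norm_num)
    have e1 : (1 + C) * C + 1 ≤ 2 * C ^ 2 := by nlinarith
    linarith [mul_le_mul_of_nonneg_right e1 (by linarith : (0 : ℝ) ≤ (v : ℝ) ^ 4),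
      mul_le_mul_of_nonneg_left this (sq_nonneg C)]
  push_cast at h1 h2 h3
  rw [abs_le] at h1 h2
  nlinarith

omit [CommGroup G] in
theorem exists_expect_character_ne_one_of_sum_le (hC : 2 ≤ C) (hf : ∀ m g, 0 ≤ f m g)
    (hfC : ∀ m g, f m g ≤ C) (hmean : ∀ k : ℕ, |∑ j ∈ range k, 𝔼 g, f j g - k| ≤ C)
    {v n : ℕ} (hvC : 4 * C ≤ v) (hn : 0 < n) {s : ℝ}
    (hs : 264 * C * s < 1) {χ : G → ℝ} (hχ : ∑ i ∈ range n, ((n : ℝ) - i) *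
      𝔼 h, (1 + clipDev (windowAvg f v) i h * χ h) ≤ 132 * s * n ^ 2) : ∃ g, χ g ≠ 1 := by
  by_contra! hone
  have hv0 : (0 : ℝ) < v := by linarith
  have hv : 0 < v := by exact_mod_cast hv0
  have hn0 : (0 : ℝ) < n := by exact_mod_cast hn
  have hC0 : 0 < C := by linarith
  have h1 : ∀ i ∈ range n, ((n : ℝ) - i) * (1 / C) ≤
      ((n : ℝ) - i) * 𝔼 h, (1 + clipDev (windowAvg f v) i h * χ h) := by
    intro i hi
    have hi' : (i : ℝ) ≤ n := by exact_mod_cast (mem_range.1 hi).le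
    refine mul_le_mul_of_nonneg_left ?_ (by linarith)
    have e1 : 𝔼 h, (2 / C) * windowAvg f v i h ≤
        𝔼 h, (1 + clipDev (windowAvg f v) i h * χ h) := by
      refine expect_le_expect fun h _ => ?_
      rw [hone, mul_one, clipDev]
      have e2 := windowAvg_nonneg hf v i h
      have e3 := windowAvg_le hfC hv i h
      have e4 : 2 / C * windowAvg f v i h ≤ windowAvg f v i h :=
        mul_le_of_le_one_left e2 (by rwa [div_le_one hC0])
      have e5 : 2 / C * windowAvg f v i h ≤ 2 := by
        rw [div_mul_eq_mul_div, div_le_iff₀ hC0]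
        linarith
      rcases min_cases (windowAvg f v i h - 1) 1 with e6 | e6 <;> linarith [e6.1]
    refine le_trans ?_ e1
    rw [← mul_expect]
    have e7 := (abs_le.1 (abs_expect_windowAvg_sub_one_le hmean hv i)).1
    have e8 : 2 * C / v ≤ 1 / 2 := by
      rw [div_le_iff₀ hv0]
      linarith
    calc 1 / C = 2 / C * (1 / 2) := by ring
      _ ≤ _ := mul_le_mul_of_nonneg_left (by linarith) (by positivity)
  have h2 := (sum_le_sum h1).trans hχ
  rw [← sum_mul, sum_sub_distrib, sum_range_cast_eq, sum_const, card_range, nsmul_eq_mul,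
    mul_one_div, div_le_iff₀ hC0] at h2
  nlinarith [mul_pos hn0 hn0, mul_pos (mul_pos hn0 hn0) (sub_pos.2 hs)]

theorem sum_expect_mul_one_add_character_le (hC : 2 ≤ C) (hf : ∀ m g, 0 ≤ f m g)
    (hfC : ∀ m g, f m g ≤ C) (hmean : ∀ k : ℕ, |∑ j ∈ range k, 𝔼 g, f j g - k| ≤ C)
    (hsel : ∀ (k : ℕ) g, |∑ j ∈ range k, (j * f j g + timeConv f f j g) - (k : ℝ) ^ 2| ≤
      C * (k + 1)) {v : ℕ} (hv : 0 < v) {χ : G → ℝ} (hχ : ∀ g, χ g = 1 ∨ χ g = -1)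
    (hmul : ∀ g h, χ (g * h) = χ g * χ h) (hne : ∃ g, χ g ≠ 1) (N : ℕ) :
    ∑ j ∈ range N, 𝔼 g, f j g * (1 + χ g) ≤
      ∑ i ∈ range N, 𝔼 h, (1 + clipDev (windowAvg f v) i h * χ h) +
        18 * C ^ 2 * N / v + 3 * C * v ^ 4 := by
  have hv' : (1 : ℝ) ≤ v := by exact_mod_cast hv
  have hv0 : (0 : ℝ) < v := by linarith
  have hC0 : 0 < C := by linarith
  have hε : (0 : ℝ) ≤ 8 * C ^ 2 / v := by positivity
  have hχ0 : 𝔼 g, χ g = 0 := expect_character_eq_zero hmul hne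
  have hχb : ∀ g, 0 ≤ 1 + χ g ∧ 1 + χ g ≤ 2 := fun g => by
    rcases hχ g with h | h <;> rw [h] <;> norm_num
  have h1 : ∑ j ∈ range N, 𝔼 g, f j g * (1 + χ g) ≤
      ∑ i ∈ range N, 𝔼 g, windowAvg f v i g * (1 + χ g) + v * C := by
    rw [← expect_sum_comm, ← expect_sum_comm]
    have : ∀ g ∈ univ, ∑ j ∈ range N, f j g * (1 + χ g) ≤
        ∑ i ∈ range N, windowAvg f v i g * (1 + χ g) + v * C * (1 + χ g) := by
      intro g _
      rw [← sum_mul, ← sum_mul, ← add_mul]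
      exact mul_le_mul_of_nonneg_right (sum_le_sum_windowAvg hf hfC hv N g) (hχb g).1
    refine (expect_le_expect this).trans ?_
    rw [expect_add_distrib, ← mul_expect, expect_add_distrib, hχ0, expect_const univ_nonempty]
    linarith
  have h2 : ∀ i ∈ range N, 𝔼 g, windowAvg f v i g * (1 + χ g) ≤
      𝔼 h, (1 + clipDev (windowAvg f v) i h * χ h) + (18 * C ^ 2 / v +
        2 * if i < v ^ 2 then C else 0) := by
    intro i _
    have e1 : ∀ g ∈ univ, windowAvg f v i g * (1 + χ g) ≤
        (1 + clipDev (windowAvg f v) i g * χ g) + (windowAvg f v i g - 1) + χ g +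
          2 * (8 * C ^ 2 / v + if i < v ^ 2 then C else 0) := by
      intro g _
      have e2 := sub_one_sub_clipDev_le hC0.le hε (windowAvg_le hfC hv)
        (fun m hm g => windowAvg_le_two_add (by linarith) hf hfC hsel hv hm g) i g
      have e3 := clipDev_le (windowAvg f v) i g
      have e4 := hχb g
      nlinarith
    refine (expect_le_expect e1).trans ?_
    rw [expect_add_distrib, expect_add_distrib, expect_add_distrib, expect_sub_distrib,
      expect_const univ_nonempty, expect_const univ_nonempty, hχ0]
    have e5 := (abs_le.1 (abs_expect_windowAvg_sub_one_le hmean hv i)).2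
    have e6 : 2 * C / v + 2 * (8 * C ^ 2 / v) ≤ 18 * C ^ 2 / v := by
      rw [mul_div_assoc', ← add_div, div_le_div_iff_of_pos_right hv0]
      nlinarith
    linarith
  have h3 := sum_le_sum h2
  rw [sum_add_distrib, sum_add_distrib, sum_const, card_range, nsmul_eq_mul, ← mul_sum] at h3
  have h4 := sum_range_ite_lt_le hC0.le N (v ^ 2)
  have h5 : (N : ℝ) * (18 * C ^ 2 / v) = 18 * C ^ 2 * N / v := by ring
  have h6 : (v : ℝ) ≤ (v : ℝ) ^ 4 := le_self_pow₀ hv' (by norm_num)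
  have h7 : (v : ℝ) ^ 2 ≤ (v : ℝ) ^ 4 := pow_le_pow_right₀ hv' (by norm_num)
  have h8 := mul_le_mul_of_nonneg_right h6 hC0.le
  have h9 := mul_le_mul_of_nonneg_right h7 hC0.le
  push_cast at h4
  linarith

end Sparse

set_option maxHeartbeats 1000000 in
/-- If a sequence of functions satisfying a Selberg-type formula is nearly zero at `a` on a long
window, then it concentrates on the nonresidues of some nontrivial quadratic character. -/
theorem exists_quadratic_character_of_sparse (C : ℝ) {δ : ℝ} (hδ : 0 < δ) :
    ∃ W K : ℕ, ∀ (G : Type) [CommGroup G] [Fintype G] (f : ℕ → G → ℝ), (∀ m g, 0 ≤ f m g) →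
      (∀ m g, f m g ≤ C) → (∀ k : ℕ, |∑ j ∈ range k, 𝔼 g, f j g - k| ≤ C) →
      (∀ (k : ℕ) g, |∑ j ∈ range k, (j * f j g + timeConv f f j g) - (k : ℝ) ^ 2| ≤
        C * (k + 1)) → ∀ k, K ≤ k → ∀ a, ∑ j ∈ Ico (k - W) k, f j a ≤ 1 →
      ∃ χ : G → ℝ, (∀ g, χ g = 1 ∨ χ g = -1) ∧ (∀ g h, χ (g * h) = χ g * χ h) ∧ χ a = 1 ∧
        (∃ g, χ g ≠ 1) ∧ ∑ j ∈ range (k / 2), 𝔼 g, f j g * (1 + χ g) ≤ δ * k := by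
  wlog hC : 2 ≤ C generalizing C
  · obtain ⟨W, K, h⟩ := this (max C 2) (le_max_right _ _)
    refine ⟨W, K, fun G _ _ f h1 h2 h3 h4 => h G f h1 (fun m g => (h2 m g).trans (le_max_left _ _))
      (fun k => (h3 k).trans (le_max_left _ _)) fun k g => (h4 k g).trans ?_⟩
    exact mul_le_mul_of_nonneg_right (le_max_left _ _) (by positivity)
  have hC0 : 0 < C := by linarith
  set s : ℝ := min (1 / 20000) (min (δ / 530) (1 / (265 * C))) with hs
  have hs0 : 0 < s := by positivity
  have hs1 : s ≤ 1 / 20000 := min_le_left _ _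
  have hs2 : s ≤ δ / 530 := (min_le_right _ _).trans (min_le_left _ _)
  have hs3 : s ≤ 1 / (265 * C) := (min_le_right _ _).trans (min_le_right _ _)
  have hsC : 264 * C * s < 1 := by
    rw [le_div_iff₀ (by positivity)] at hs3
    nlinarith [mul_pos hC0 hs0]
  have hη : 0 < s ^ 2 := by positivity
  have hηs : s ^ 2 ≤ s := by nlinarith
  have hη1 : s ^ 2 ≤ 1 / 20000 := by linarith
  obtain ⟨v, hv⟩ := exists_nat_ge (100 * C ^ 3 / s ^ 2)
  rw [div_le_iff₀ hη] at hv
  have hC3 : 8 ≤ C ^ 3 := by nlinarith [sq_nonneg C]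
  have hv1 : 100 * C ^ 3 ≤ v := by
    nlinarith [Nat.cast_nonneg (α := ℝ) v]
  have hv0 : (0 : ℝ) < v := by linarith
  have hvp : 0 < v := by exact_mod_cast hv0
  obtain ⟨L, hL⟩ := exists_nat_ge (8 * C ^ 2 * v ^ 4 / s ^ 2)
  rw [div_le_iff₀ hη] at hL
  refine ⟨2 * v ^ 2, L + v ^ 4 + 8 * v ^ 2, fun G _ _ f hf hfC hmean hsel k hk a ha => ?_⟩
  set n : ℕ := k - 2 * v ^ 2 with hn
  have hkn : k = n + 2 * v ^ 2 := by omega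
  have hnv : v ^ 4 ≤ n := by omega
  have hnL : (L : ℝ) ≤ n := by exact_mod_cast (by omega : L ≤ n)
  have hn0 : 0 < n := by have := pow_pos hvp 4; omega
  have hk8 : (8 * v ^ 2 : ℝ) ≤ k := by exact_mod_cast (by omega : 8 * v ^ 2 ≤ k)
  have hkn' : (k : ℝ) = n + 2 * v ^ 2 := by rw [hkn]; push_cast; ring
  have hnk : (n : ℝ) ≤ k := by exact_mod_cast (by omega : n ≤ k)
  have hLn : 8 * C ^ 2 * (v : ℝ) ^ 4 ≤ s ^ 2 * n := by
    linarith [mul_le_mul_of_nonneg_left hnL hη.le]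
  have hv4 : (1 : ℝ) ≤ (v : ℝ) ^ 4 := one_le_pow₀ (by exact_mod_cast hvp)
  have hmain : 41 * C ^ 3 * n / v ≤ 41 / 100 * s ^ 2 * n := by
    rw [div_le_iff₀ hv0]
    nlinarith [mul_le_mul_of_nonneg_right hv (Nat.cast_nonneg (α := ℝ) n)]
  have hn0' : (0 : ℝ) < n := by exact_mod_cast hn0
  have hC4 : 4 ≤ C ^ 2 := by nlinarith
  have hCC : C ^ 2 ≤ C ^ 3 := by nlinarith [sq_nonneg C]
  have hB := windowAvg_nonneg hf v
  have hA := windowAvg_nonneg hf (v ^ 2)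
  rw [hkn] at ha
  have hlip : ∀ m g, |clipDev (windowAvg f (v ^ 2)) (m + 1) g -
      clipDev (windowAvg f (v ^ 2)) m g| ≤ s ^ 2 := by
    intro m g
    rw [clipDev, clipDev]
    refine (abs_min_sub_min_le_max _ _ _ _).trans ?_
    rw [sub_self, abs_zero, sub_sub_sub_cancel_right]
    refine max_le ((abs_windowAvg_succ_sub_le hf hfC _ _ _).trans ?_) hη.le
    push_cast
    rw [div_le_iff₀ (by positivity)]
    have e1 : C ≤ C ^ 2 := by nlinarith
    have e2 : (v : ℝ) ≤ (v : ℝ) ^ 2 := le_self_pow₀ (by exact_mod_cast hvp) (by norm_num)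
    linarith [mul_le_mul_of_nonneg_left e2 hη.le]
  have hconv : ∀ m < n, ∀ g, |m * clipDev (windowAvg f (v ^ 2)) m g + timeConv
      (clipDev (windowAvg f v)) (clipDev (windowAvg f (v ^ 2))) m g| ≤ s ^ 2 * n := by
    intro m hm g
    refine (abs_mul_clipDev_add_timeConv_le hC hf hfC hmean hsel hvp m g).trans ?_
    have hm' : (m : ℝ) ≤ n := by exact_mod_cast hm.le
    have : 41 * C ^ 3 * m / v ≤ 41 * C ^ 3 * n / v := by gcongr
    linarith [mul_pos hη hn0']
  have hrefl : (1 - s ^ 2) * n ≤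
      timeConv (clipDev (windowAvg f (v ^ 2))) (clipDev (windowAvg f (v ^ 2))) n a := by
    refine le_trans ?_ (le_timeConv_clipDev hC hf hfC hmean hsel hvp (by linarith) hnv ha)
    have : 35 * C ^ 3 * n / v ≤ 41 * C ^ 3 * n / v := by gcongr; norm_num
    linarith [mul_pos hη hn0']
  have hn1 : 1 ≤ s ^ 2 * n :=
    hLn.trans' (by linarith [mul_le_mul_of_nonneg_right hC4 (by linarith : (0 : ℝ) ≤ v ^ 4)])
  obtain ⟨χ, h1, h2, h3, h4⟩ := exists_character_of_timeConv (abs_clipDev_le hA)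
    (abs_clipDev_le hB) hs0 hs1 hn1 hlip hconv hrefl
  have hne := exists_expect_character_ne_one_of_sum_le hC hf hfC hmean (v := v)
    (by nlinarith) hn0 hsC h4
  refine ⟨χ, h1, h2, h3, hne, ?_⟩
  refine (sum_expect_mul_one_add_character_le hC hf hfC hmean hsel hvp h1 h2 hne _).trans ?_
  have hnn : ∀ i, 0 ≤ 𝔼 h, (1 + clipDev (windowAvg f v) i h * χ h) := fun i =>
    expect_nonneg fun h _ => by
      have := abs_le.1 (abs_clipDev_le hB i h)
      rcases h1 h with e | e <;> rw [e] <;> linarith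
  have hk2 : k / 2 ≤ n := by omega
  have hk2' : ((k / 2 : ℕ) : ℝ) ≤ k / 2 := Nat.cast_div_le
  have h5 : (k / 4 : ℝ) * ∑ i ∈ range (k / 2),
      𝔼 h, (1 + clipDev (windowAvg f v) i h * χ h) ≤ 132 * s * k ^ 2 := by
    rw [mul_sum]
    refine (le_trans ?_ h4).trans ?_
    · refine le_trans (sum_le_sum fun i hi => ?_) (sum_le_sum_of_subset_of_nonneg
        (range_subset_range.2 hk2) fun i hi _ => mul_nonneg ?_ (hnn i))
      · refine mul_le_mul_of_nonneg_right ?_ (hnn i)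
        have : (i : ℝ) ≤ (k / 2 : ℕ) := by exact_mod_cast (mem_range.1 hi).le
        linarith
      · have : (i : ℝ) ≤ n := by exact_mod_cast (mem_range.1 hi).le
        linarith
    · gcongr
  have hk0 : (0 : ℝ) < k := by rw [hkn']; positivity
  have h6 : ∑ i ∈ range (k / 2), 𝔼 h, (1 + clipDev (windowAvg f v) i h * χ h) ≤
      528 * s * k := by
    have : (k / 4 : ℝ) * ∑ i ∈ range (k / 2),
      𝔼 h, (1 + clipDev (windowAvg f v) i h * χ h) ≤ (k / 4) * (528 * s * k) := by
      linarith
    exact le_of_mul_le_mul_left this (by positivity)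
  have h7 : 18 * C ^ 2 * (k / 2 : ℕ) / v ≤ s * k := by
    rw [div_le_iff₀ hv0]
    have e1 : 9 * C ^ 2 ≤ s * v := by
      linarith [mul_le_mul_of_nonneg_right hηs hv0.le]
    linarith [mul_le_mul_of_nonneg_right e1 hk0.le, mul_le_mul_of_nonneg_left hk2'
      (by positivity : 0 ≤ 18 * C ^ 2)]
  have h8 : 3 * C * (v : ℝ) ^ 4 ≤ s * k := by
    have e1 : 3 * C ≤ 8 * C ^ 2 := by nlinarith
    have e2 := mul_le_mul_of_nonneg_right e1 (by linarith : (0 : ℝ) ≤ (v : ℝ) ^ 4)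
    have e3 : s ^ 2 * n ≤ s * k := mul_le_mul hηs hnk hn0'.le hs0.le
    linarith
  have h9 : 530 * s * k ≤ δ * k := mul_le_mul_of_nonneg_right (by linarith) hk0.le
  linarith

section Character

variable {q : ℕ} [NeZero q] {χ : DirichletCharacter ℝ q}

theorem sum_range_character_eq_zero (hχ : χ ≠ 1) : ∑ c ∈ range q, χ c = 0 := by
  rw [← MulChar.sum_eq_zero_of_ne_one hχ]
  refine sum_nbij' (fun c => (c : ZMod q)) ZMod.val (fun _ _ => mem_univ _)
    (fun x _ => mem_range.2 (ZMod.val_lt x))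
    (fun c hc => ZMod.val_cast_of_lt (mem_range.1 hc))
    (fun x _ => ZMod.natCast_zmod_val x) fun _ _ => rfl

omit [NeZero q] in
theorem abs_character_le_one (hχ : χ.IsQuadratic) (x : ZMod q) : |χ x| ≤ 1 := by
  rcases hχ x with h | h | h <;> simp [h]

theorem abs_sum_Ioc_character_le (hq : χ.IsQuadratic) (hχ : χ ≠ 1) (A B : ℕ) :
    |∑ n ∈ Ioc A B, χ n| ≤ q := by
  rcases le_total B A with h | h
  · simp [Ioc_eq_empty_of_le h]
  have hq0 : 0 < q := NeZero.pos q
  have h1 : ∑ n ∈ Ioc A B, χ n =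
      ∑ c ∈ range q, χ c * ((#{n ∈ Ioc A B | n ≡ c [MOD q]} : ℝ) - (B - A) / q) := by
    simp only [mul_sub]
    rw [sum_sub_distrib, ← sum_mul, sum_range_character_eq_zero hχ, zero_mul, sub_zero,
      ← sum_fiberwise_of_maps_to (t := range q) (g := fun n => n % q)
      fun n _ => mem_range.2 (Nat.mod_lt _ hq0)]
    refine sum_congr rfl fun c hc => ?_
    have : {n ∈ Ioc A B | n % q = c} = {n ∈ Ioc A B | n ≡ c [MOD q]} := by
      refine filter_congr fun n _ => ?_
      rw [Nat.ModEq, Nat.mod_eq_of_lt (mem_range.1 hc)]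
    rw [this, ← nsmul_eq_mul', ← sum_const]
    refine sum_congr rfl fun n hn => ?_
    rw [(ZMod.natCast_eq_natCast_iff _ _ _).2 (mem_filter.1 hn).2]
  rw [h1]
  refine (abs_sum_le_sum_abs _ _).trans ((sum_le_sum fun c _ => ?_).trans (?_ :
    ∑ c ∈ range q, (1 : ℝ) ≤ q))
  · rw [abs_mul]
    exact mul_le_one₀ (abs_character_le_one hq _) (abs_nonneg _) (abs_card_modEq_sub_le A B q c hq0 h)
  · simp

theorem abs_sum_character_mul_le (hq : χ.IsQuadratic) (hχ : χ ≠ 1) (A B : ℕ) (h : ℕ → ℝ)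
    (hh : ∀ n, A < n → 0 ≤ h n) (hanti : ∀ n, A < n → h (n + 1) ≤ h n) :
    |∑ n ∈ Ioc A B, χ n * h n| ≤ q * h (A + 1) :=
  abs_sum_mul_le_of_antitone A B (fun n => χ n) h q (Nat.cast_nonneg _)
    (fun m _ _ => abs_sum_Ioc_character_le hq hχ A m) hh hanti

theorem exists_sum_character_div_sub_le (hq : χ.IsQuadratic) (hχ : χ ≠ 1) :
    ∃ L : ℝ, ∀ N : ℕ, |∑ n ∈ Icc 1 N, χ n / n - L| ≤ q / (N + 1) := by
  set s : ℕ → ℝ := fun N => ∑ n ∈ Icc 1 N, χ n / n with hs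
  have h1 : ∀ N M, N ≤ M → |s M - s N| ≤ q / (N + 1) := by
    intro N M hNM
    have e1 : s M - s N = ∑ n ∈ Ioc N M, χ n * (1 / n) := by
      rw [sub_eq_iff_eq_add, add_comm]
      simp only [hs, mul_one_div]
      have : ∀ K, Icc 1 K = Ioc 0 K := fun K => rfl
      rw [this, this, sum_Ioc_consecutive _ (Nat.zero_le _) hNM]
    rw [e1]
    refine (abs_sum_character_mul_le hq hχ N M (fun n => 1 / n) (fun n _ => by positivity)
      fun n hn => ?_).trans ?_
    · have : (0 : ℝ) < n := by exact_mod_cast Nat.zero_lt_of_lt hn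
      push_cast
      gcongr
      linarith
    · push_cast
      rw [mul_one_div]
  have h2 : Filter.Tendsto (fun N : ℕ => (q : ℝ) / (N + 1)) Filter.atTop (nhds 0) :=
    tendsto_const_div_atTop_nhds_zero_nat (q : ℝ) |>.comp (Filter.tendsto_add_atTop_nat 1)
      |>.congr fun N => by simp
  obtain ⟨L, hL⟩ := cauchySeq_tendsto_of_complete (cauchySeq_of_le_tendsto_0' (s := s) _
    (fun N M hNM => by rw [dist_comm, Real.dist_eq]; exact h1 N M hNM) h2)
  refine ⟨L, fun N => ?_⟩
  rw [abs_sub_comm]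
  refine le_of_tendsto ((hL.sub_const (s N)).abs) ?_
  filter_upwards [Filter.eventually_ge_atTop N] with M hM using h1 N M hM

end Character

section Convolution

variable {q : ℕ} {χ : DirichletCharacter ℝ q}

/-- The convolution of `1` with a Dirichlet character. -/
noncomputable def charConv (χ : DirichletCharacter ℝ q) : ArithmeticFunction ℝ :=
  (zeta : ArithmeticFunction ℝ) * toArithmeticFunction (fun n => χ n)

theorem charConv_isMultiplicative (χ : DirichletCharacter ℝ q) :
    (charConv χ).IsMultiplicative :=
  isMultiplicative_zeta.natCast.mul (DirichletCharacter.isMultiplicative_toArithmeticFunction χ)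

theorem charConv_apply (χ : DirichletCharacter ℝ q) (n : ℕ) :
    charConv χ n = ∑ d ∈ n.divisors, χ d := by
  rw [charConv, coe_zeta_mul_apply]
  refine sum_congr rfl fun d hd => ?_
  simp [toArithmeticFunction, (Nat.pos_of_mem_divisors hd).ne']

theorem charConv_prime_pow (χ : DirichletCharacter ℝ q) {p : ℕ} (hp : p.Prime) (k : ℕ) :
    charConv χ (p ^ k) = ∑ i ∈ range (k + 1), χ p ^ i := by
  rw [charConv_apply, Nat.sum_divisors_prime_pow hp]
  simp

theorem charConv_prime_pow_nonneg (hq : χ.IsQuadratic) {p : ℕ} (hp : p.Prime) (k : ℕ) :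
    0 ≤ charConv χ (p ^ k) := by
  rw [charConv_prime_pow χ hp]
  rcases hq p with h | h | h
  · exact sum_nonneg fun i _ => by simp [h]
  · exact sum_nonneg fun i _ => by simp [h]
  · rw [h, neg_one_geom_sum]
    split_ifs <;> norm_num

theorem one_le_charConv_prime_pow (hq : χ.IsQuadratic) {p : ℕ} (hp : p.Prime) (k : ℕ) :
    1 ≤ charConv χ (p ^ (2 * k)) := by
  rw [charConv_prime_pow χ hp]
  rcases hq p with h | h | h
  · rw [sum_range_succ']
    simp [h]
  · rw [h]
    simp
  · rw [h, neg_one_geom_sum, if_neg (by simp)]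

theorem charConv_nonneg (hq : χ.IsQuadratic) (n : ℕ) : 0 ≤ charConv χ n := by
  rcases eq_or_ne n 0 with rfl | hn
  · simp
  · rw [(charConv_isMultiplicative χ).multiplicative_factorization _ hn]
    exact prod_nonneg fun p hp => charConv_prime_pow_nonneg hq (Nat.prime_of_mem_primeFactors hp) _

theorem one_le_charConv_sq (hq : χ.IsQuadratic) {n : ℕ} (hn : n ≠ 0) : 1 ≤ charConv χ (n ^ 2) := by
  rw [(charConv_isMultiplicative χ).multiplicative_factorization _ (pow_ne_zero 2 hn),
    Nat.factorization_pow]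
  have h1 : ∀ p ∈ (2 • n.factorization).support,
      1 ≤ charConv χ (p ^ (2 • n.factorization) p) := fun p hp => by
    have hp' : p ∈ n.factorization.support := Finsupp.support_smul hp
    exact one_le_charConv_prime_pow hq (Nat.prime_of_mem_primeFactors hp') _
  calc (1 : ℝ) = ∏ p ∈ (2 • n.factorization).support, (1 : ℝ) := by simp
    _ ≤ _ := prod_le_prod (fun _ _ => zero_le_one) h1

theorem charConv_prime_mul (χ : DirichletCharacter ℝ q) {p m : ℕ} (hp : p.Prime) (hm : m ≠ 0) :
    charConv χ (p * m) =
      (1 + χ p) * charConv χ m - if p ∣ m then χ p * charConv χ (m / p) else 0 := by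
  obtain ⟨k, m', hm', rfl⟩ := Nat.exists_eq_pow_mul_and_not_dvd hm p hp.ne_one
  have hcop : ∀ i, Nat.Coprime (p ^ i) m' := fun i =>
    ((Nat.Prime.coprime_iff_not_dvd hp).2 hm').pow_left i
  have hM := charConv_isMultiplicative χ
  rw [← mul_assoc, ← pow_succ', hM.map_mul_of_coprime (hcop _), hM.map_mul_of_coprime (hcop _)]
  have h1 : charConv χ (p ^ (k + 1)) = 1 + χ p * charConv χ (p ^ k) := by
    rw [charConv_prime_pow χ hp, charConv_prime_pow χ hp, sum_range_succ', mul_sum]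
    simp [pow_succ', add_comm]
  rcases k with _ | k
  · have : ¬ p ∣ p ^ 0 * m' := by simpa using hm'
    rw [if_neg this, h1]
    simp [hM.map_one]
  · have h2 : p ∣ p ^ (k + 1) * m' := (dvd_pow_self p k.succ_ne_zero).mul_right _
    have h3 : p ^ (k + 1) * m' / p = p ^ k * m' := by
      rw [pow_succ', mul_assoc, Nat.mul_div_cancel_left _ hp.pos]
    rw [if_pos h2, h3, hM.map_mul_of_coprime (hcop _), h1]
    have h4 : charConv χ (p ^ (k + 1)) = charConv χ (p ^ k) + χ p ^ (k + 1) := by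
      rw [charConv_prime_pow χ hp, charConv_prime_pow χ hp, sum_range_succ]
    have h5 : charConv χ (p ^ (k + 1)) = 1 + χ p * charConv χ (p ^ k) := by
      rw [charConv_prime_pow χ hp, charConv_prime_pow χ hp, sum_range_succ', mul_sum]
      simp [pow_succ', add_comm]
    rw [h5]
    ring

end Convolution

section LowerBound

theorem sum_sub_mul_eq {N d : ℕ} (hd : 0 < d) :
    ∑ e ∈ Icc 1 (N / d), ((N : ℝ) - d * e) =
      N ^ 2 / (2 * d) - N / 2 + (N % d : ℕ) * (d - (N % d : ℕ)) / (2 * d) := by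
  have h1 : ∀ m : ℕ, ∑ e ∈ Icc 1 m, ((N : ℝ) - d * e) = N * m - d * (m * (m + 1) / 2) := by
    intro m
    induction m with
    | zero => simp
    | succ m ih =>
      rw [sum_Icc_succ_top (by omega), ih]
      push_cast
      ring
  have h2 : (N : ℝ) = d * (N / d : ℕ) + (N % d : ℕ) := by exact_mod_cast (Nat.div_add_mod N d).symm
  have h3 : (d : ℝ) ≠ 0 := by exact_mod_cast hd.ne'
  rw [h1]
  generalize ((N % d : ℕ) : ℝ) = r at *
  generalize ((N / d : ℕ) : ℝ) = m at *
  rw [h2]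
  field_simp
  ring

theorem sum_sub_mul_error_bounds {N d : ℕ} (hd : 0 < d) :
    0 ≤ ((N % d : ℕ) : ℝ) * (d - (N % d : ℕ)) / (2 * d) ∧
      ((N % d : ℕ) : ℝ) * (d - (N % d : ℕ)) / (2 * d) ≤ d / 8 := by
  have h1 : ((N % d : ℕ) : ℝ) ≤ d := by exact_mod_cast (Nat.mod_lt N hd).le
  have h2 : (0 : ℝ) ≤ (N % d : ℕ) := Nat.cast_nonneg _
  have h3 : (0 : ℝ) < d := by exact_mod_cast hd
  generalize ((N % d : ℕ) : ℝ) = r at *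
  constructor
  · exact div_nonneg (mul_nonneg h2 (sub_nonneg.2 h1)) (by positivity)
  · rw [div_le_iff₀ (by positivity)]
    nlinarith [sq_nonneg ((d : ℝ) - 2 * r)]

theorem sum_sub_mul_le {N d : ℕ} (hd : 0 < d) (hdN : d ≤ N) :
    ∑ e ∈ Icc 1 (N / d), ((N : ℝ) - d * e) ≤ N ^ 2 / (2 * d) := by
  rw [sum_sub_mul_eq hd]
  have h1 := (sum_sub_mul_error_bounds (N := N) hd).2
  have h2 : (d : ℝ) ≤ N := by exact_mod_cast hdN
  have h3 : (0 : ℝ) ≤ d := by positivity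
  linarith

theorem mul_le_of_mem_Icc_div {N d e : ℕ} (he : e ∈ Icc 1 (N / d)) : (d : ℝ) * e ≤ N := by
  rcases Nat.eq_zero_or_pos d with rfl | hd
  · simp
  · have := (Nat.le_div_iff_mul_le hd).1 (mem_Icc.1 he).2
    rw [mul_comm]
    exact_mod_cast this

variable {q : ℕ} [NeZero q] {χ : DirichletCharacter ℝ q}

omit [NeZero q] in
theorem sum_charConv_mul_sub (χ : DirichletCharacter ℝ q) (N : ℕ) :
    ∑ n ∈ Icc 1 N, charConv χ n * ((N : ℝ) - n) =
      ∑ d ∈ Icc 1 N, χ d * ∑ e ∈ Icc 1 (N / d), ((N : ℝ) - d * e) := by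
  simp only [mul_sum]
  rw [← sum_prodPairs N fun p => χ p.1 * ((N : ℝ) - p.1 * p.2),
    ← sum_divisorsAntidiagonal_eq_sum_prodPairs]
  refine sum_congr rfl fun n hn => ?_
  rw [charConv_apply, ← Nat.sum_divisorsAntidiagonal (fun d _ => χ d), sum_mul]
  refine sum_congr rfl fun p hp => ?_
  rw [← Nat.cast_mul, (Nat.mem_divisorsAntidiagonal.1 hp).1]

theorem sum_charConv_mul_sub_le (hq : χ.IsQuadratic) (hχ : χ ≠ 1) {L : ℝ}
    (hL : ∀ N : ℕ, |∑ n ∈ Icc 1 N, χ n / n - L| ≤ q / (N + 1)) {D N : ℕ} (hD : 1 ≤ D)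
    (hDN : D < N) :
    ∑ n ∈ Icc 1 N, charConv χ n * ((N : ℝ) - n) ≤
      N ^ 2 * L / 2 + N ^ 2 * q / D + N * q / 2 + D ^ 2 / 8 := by
  have hD' : (0 : ℝ) < D := by exact_mod_cast hD
  rw [sum_charConv_mul_sub]
  set t : ℕ → ℝ := fun d => ∑ e ∈ Icc 1 (N / d), ((N : ℝ) - d * e) with ht
  have hsplit : ∑ d ∈ Icc 1 N, χ d * t d =
      ∑ d ∈ Icc 1 D, χ d * t d + ∑ d ∈ Ioc D N, χ d * t d := by
    have : ∀ K, Icc 1 K = Ioc 0 K := fun K => rfl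
    rw [this, this, sum_Ioc_consecutive _ (Nat.zero_le _) hDN.le]
  have htail : |∑ d ∈ Ioc D N, χ d * t d| ≤ q * (N ^ 2 / (2 * D)) := by
    refine (abs_sum_character_mul_le hq hχ D N t (fun n _ => sum_nonneg fun e he => ?_)
      fun n hn => ?_).trans ?_
    · exact sub_nonneg.2 (mul_le_of_mem_Icc_div he)
    · refine (sum_le_sum (g := fun e : ℕ => (N : ℝ) - n * e) fun e _ => ?_).trans
        (sum_le_sum_of_subset_of_nonneg (Icc_subset_Icc_right
          (Nat.div_le_div_left (Nat.le_succ n) (by omega)))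
          fun e he _ => sub_nonneg.2 (mul_le_of_mem_Icc_div he))
      push_cast
      nlinarith [(Nat.cast_nonneg e : (0 : ℝ) ≤ e)]
    · gcongr
      refine (sum_sub_mul_le (Nat.succ_pos D) hDN).trans ?_
      push_cast
      gcongr
      linarith
  have hmain : |∑ d ∈ Icc 1 D, χ d * t d - (N : ℝ) ^ 2 * L / 2| ≤
      (N : ℝ) ^ 2 / 2 * (q / D) + N / 2 * q + (D : ℝ) ^ 2 / 8 := by
    have e1 : ∑ d ∈ Icc 1 D, χ d * t d - N ^ 2 * L / 2 =
        N ^ 2 / 2 * (∑ d ∈ Icc 1 D, χ d / d - L) - N / 2 * ∑ d ∈ Icc 1 D, χ d +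
          ∑ d ∈ Icc 1 D, χ d * (((N % d : ℕ) : ℝ) * (d - (N % d : ℕ)) / (2 * d)) := by
      have : ∑ d ∈ Icc 1 D, χ d * t d = ∑ d ∈ Icc 1 D, (N ^ 2 / 2 * (χ d / d) - N / 2 * χ d +
          χ d * (((N % d : ℕ) : ℝ) * (d - (N % d : ℕ)) / (2 * d))) := by
        refine sum_congr rfl fun d hd => ?_
        simp only [ht]
        rw [sum_sub_mul_eq (mem_Icc.1 hd).1]
        have : (d : ℝ) ≠ 0 := by exact_mod_cast (Nat.pos_of_ne_zero fun h => by simp [h] at hd).ne'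
        field_simp
      rw [this, sum_add_distrib, sum_sub_distrib, ← mul_sum, ← mul_sum]
      ring
    have b1 : |∑ d ∈ Icc 1 D, χ d / d - L| ≤ q / D := (hL D).trans (by gcongr; linarith)
    have b2 : |∑ d ∈ Icc 1 D, χ d| ≤ q := abs_sum_Ioc_character_le hq hχ 0 D
    have b3 : |∑ d ∈ Icc 1 D, χ d * (((N % d : ℕ) : ℝ) * (d - (N % d : ℕ)) / (2 * d))| ≤
        D ^ 2 / 8 := by
      refine (abs_sum_le_sum_abs _ _).trans ((sum_le_sum fun d hd => ?_).trans (?_ :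
        ∑ d ∈ Icc 1 D, (D : ℝ) / 8 ≤ D ^ 2 / 8))
      · have hd' := mem_Icc.1 hd
        obtain ⟨h1, h2⟩ := sum_sub_mul_error_bounds (N := N) hd'.1
        have h3 : (d : ℝ) ≤ D := by exact_mod_cast hd'.2
        rw [abs_mul, abs_of_nonneg h1]
        refine (mul_le_of_le_one_left h1 (abs_character_le_one hq _)).trans (h2.trans ?_)
        linarith
      · rw [sum_const, Nat.card_Icc, nsmul_eq_mul]
        simp only [Nat.add_sub_cancel]
        apply le_of_eq
        ring
    rw [e1]
    refine (abs_add_le _ _).trans (add_le_add ((abs_sub _ _).trans (add_le_add ?_ ?_)) b3)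
    · rw [abs_mul, abs_of_nonneg (by positivity : (0 : ℝ) ≤ N ^ 2 / 2)]
      gcongr
    · rw [abs_mul, abs_of_nonneg (by positivity : (0 : ℝ) ≤ N / 2)]
      gcongr
  rw [hsplit]
  have h1 := (abs_le.1 htail).2
  have h2 := (abs_le.1 hmain).2
  have h3 : (q : ℝ) * (N ^ 2 / (2 * D)) + N ^ 2 / 2 * (q / D) = N ^ 2 * q / D := by
    field_simp
    ring
  linarith

omit [NeZero q] in
theorem le_sum_charConv_mul_sub (hq : χ.IsQuadratic) {M : ℕ} (hM : 2 ≤ M) :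
    (M : ℝ) ^ 3 / 3 ≤ ∑ n ∈ Icc 1 (M ^ 2), charConv χ n * (((M ^ 2 : ℕ) : ℝ) - n) := by
  have h1 : ∑ m ∈ Icc 1 M, ((M : ℝ) ^ 2 - m ^ 2) ≤
      ∑ n ∈ Icc 1 (M ^ 2), charConv χ n * (((M ^ 2 : ℕ) : ℝ) - n) := by
    have hinj : Set.InjOn (fun m : ℕ => m ^ 2) (Icc 1 M : Set ℕ) := fun a _ b _ h =>
      Nat.pow_left_injective two_ne_zero h
    have hle : ∀ n ∈ Icc 1 (M ^ 2), 0 ≤ charConv χ n * (((M ^ 2 : ℕ) : ℝ) - n) := fun n hn =>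
      mul_nonneg (charConv_nonneg hq n) (sub_nonneg.2 (by exact_mod_cast (mem_Icc.1 hn).2))
    refine le_trans ?_ (sum_le_sum_of_subset_of_nonneg
      (s := (Icc 1 M).image fun m => m ^ 2) ?_ fun n hn _ => hle n hn)
    · rw [sum_image hinj]
      refine sum_le_sum fun m hm => ?_
      have hm' := mem_Icc.1 hm
      push_cast
      refine le_mul_of_one_le_left (sub_nonneg.2 ?_) (one_le_charConv_sq hq (by omega))
      have : (m : ℝ) ≤ M := by exact_mod_cast hm'.2
      gcongr
    · intro n hn
      obtain ⟨m, hm, rfl⟩ := mem_image.1 hn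
      have hm' := mem_Icc.1 hm
      exact mem_Icc.2 ⟨Nat.one_le_pow _ _ hm'.1, Nat.pow_le_pow_left hm'.2 2⟩
  refine le_trans ?_ h1
  have h2 : ∀ K : ℕ, ∑ m ∈ Icc 1 K, ((M : ℝ) ^ 2 - m ^ 2) =
      K * (M : ℝ) ^ 2 - K * (K + 1) * (2 * K + 1) / 6 := by
    intro K
    induction K with
    | zero => simp
    | succ K ih =>
      rw [sum_Icc_succ_top (by omega), ih]
      push_cast
      ring
  have hM' : (2 : ℝ) ≤ M := by exact_mod_cast hM
  rw [h2]
  nlinarith [mul_nonneg (by linarith : (0 : ℝ) ≤ M) (mul_nonneg (by linarith : (0 : ℝ) ≤ M - 2)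
    (by linarith : (0 : ℝ) ≤ 2 * M + 1))]

/-- A lower bound for `L(1, χ)`, which is the limit `L` of the partial sums. -/
theorem le_of_sum_character_div (hq : χ.IsQuadratic) (hχ : χ ≠ 1) {L : ℝ}
    (hL : ∀ N : ℕ, |∑ n ∈ Icc 1 N, χ n / n - L| ≤ q / (N + 1)) :
    1 / (864 * (q : ℝ) ^ 2) ≤ L := by
  have hq0 : 0 < q := NeZero.pos q
  have hq1 : (1 : ℝ) ≤ q := by exact_mod_cast hq0
  have h1 := le_sum_charConv_mul_sub hq (M := 144 * q ^ 2) (by nlinarith)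
  have h2 := sum_charConv_mul_sub_le hq hχ hL (D := 1728 * q ^ 3) (N := (144 * q ^ 2) ^ 2)
    (by nlinarith [pow_pos hq0 3]) (by
      have : q ^ 3 ≤ q ^ 4 := Nat.pow_le_pow_right hq0 (by norm_num)
      have : 0 < q ^ 3 := by positivity
      have e : (144 * q ^ 2) ^ 2 = 20736 * q ^ 4 := by ring
      omega)
  have h3 := h1.trans h2
  push_cast at h3
  have h4 : ((144 * (q : ℝ) ^ 2) ^ 2) ^ 2 * q / (1728 * (q : ℝ) ^ 3) = 248832 * (q : ℝ) ^ 6 := by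
    field_simp
    norm_num
  rw [h4] at h3
  have h5 : (q : ℝ) ^ 5 ≤ (q : ℝ) ^ 6 := pow_le_pow_right₀ hq1 (by norm_num)
  have h6 : (0 : ℝ) < (q : ℝ) ^ 6 := by positivity
  rw [div_le_iff₀ (by positivity)]
  have h7 : 214990848 * (q : ℝ) ^ 6 * 1 ≤ 214990848 * (q : ℝ) ^ 6 * (L * (864 * (q : ℝ) ^ 2)) := by
    nlinarith
  exact le_of_mul_le_mul_left h7 (by positivity)

end LowerBound

section LevelDistribution

variable {q : ℕ} [NeZero q] {χ : DirichletCharacter ℝ q}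

theorem classInd_mul_of_eq (b u : (ZMod q)ˣ) {m : ℕ} (hu : (m : ZMod q) = u) (n : ℕ) :
    classInd b (m * n) = classInd (b * u⁻¹) n := by
  rw [classInd_mul, Fintype.sum_eq_single u]
  · rw [classInd, if_pos hu, one_mul]
  · intro v hv
    rw [classInd, if_neg fun h => hv (Units.ext (h.symm.trans hu)), zero_mul]

theorem abs_sum_classInd_sub_le (b : (ZMod q)ˣ) (M : ℕ) :
    |∑ e ∈ Icc 1 M, classInd b e - (M : ℝ) / q| ≤ 1 := by
  have h := abs_card_modEq_sub_le 0 M q (b : ZMod q).val (NeZero.pos q) (Nat.zero_le M)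
  rw [Nat.cast_zero, sub_zero] at h
  convert h using 3
  rw [card_filter, Nat.cast_sum]
  refine sum_congr rfl fun e _ => ?_
  rw [classInd, Nat.cast_ite, Nat.cast_one, Nat.cast_zero]
  congr 1
  rw [← ZMod.natCast_eq_natCast_iff, ZMod.natCast_zmod_val]

theorem abs_character_mul_sum_classInd_sub_le (hq : χ.IsQuadratic) (b : (ZMod q)ˣ) (d M : ℕ) :
    |χ d * ∑ e ∈ Icc 1 M, classInd b (d * e) - χ d * ((M : ℝ) / q)| ≤ 1 := by
  by_cases hd : IsUnit (d : ZMod q)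
  · obtain ⟨u, hu⟩ := hd
    rw [← mul_sub, abs_mul]
    refine mul_le_one₀ (abs_character_le_one hq _) (abs_nonneg _) ?_
    simp only [classInd_mul_of_eq b u hu.symm]
    exact abs_sum_classInd_sub_le _ _
  · rw [χ.map_nonunit hd]
    simp

omit [NeZero q] in
theorem classInd_mul_character_eq (hq : χ.IsQuadratic) (b : (ZMod q)ˣ) (d e : ℕ) :
    classInd b (d * e) * χ d = χ b * (classInd b (d * e) * χ e) := by
  rw [classInd]
  split_ifs with h
  · rw [← h, Nat.cast_mul, map_mul]
    have h2 : IsUnit ((e : ZMod q)) := isUnit_of_mul_isUnit_right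
      (x := (d : ZMod q)) (by rw [← Nat.cast_mul, h]; exact b.isUnit)
    rcases hq e with h3 | h3 | h3
    · exact absurd h3 (h2.map χ).ne_zero
    · simp [h3]
    · simp [h3]
  · simp

theorem sum_prodPairs_filter_fst_le {N D : ℕ} (hD : D ≤ N) (F : ℕ → ℕ → ℝ) :
    ∑ p ∈ prodPairs N with p.1 ≤ D, F p.1 p.2 = ∑ d ∈ Icc 1 D, ∑ e ∈ Icc 1 (N / d), F d e := by
  rw [sum_filter, sum_prodPairs N fun p => if p.1 ≤ D then F p.1 p.2 else 0,
    ← sum_subset (Icc_subset_Icc_right hD)]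
  · refine sum_congr rfl fun d hd => sum_congr rfl fun e _ => ?_
    rw [if_pos (mem_Icc.1 hd).2]
  · intro d hd hd'
    refine sum_eq_zero fun e _ => if_neg fun h => hd' (mem_Icc.2 ⟨(mem_Icc.1 hd).1, h⟩)

/-- Dirichlet's hyperbola method for sums over `prodPairs`. -/
theorem sum_prodPairs_hyperbola (N : ℕ) (F : ℕ → ℕ → ℝ) :
    ∑ p ∈ prodPairs N, F p.1 p.2 =
      ∑ d ∈ Icc 1 N.sqrt, ∑ e ∈ Icc 1 (N / d), F d e +
        ∑ d ∈ Icc 1 N.sqrt, ∑ e ∈ Icc 1 (N / d), F e d -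
          ∑ d ∈ Icc 1 N.sqrt, ∑ e ∈ Icc 1 N.sqrt, F d e := by
  have h1 : ∑ p ∈ prodPairs N with p.2 ≤ N.sqrt, F p.1 p.2 =
      ∑ p ∈ prodPairs N with p.1 ≤ N.sqrt, F p.2 p.1 := by
    refine sum_nbij' Prod.swap Prod.swap ?_ ?_ (fun _ _ => rfl) (fun _ _ => rfl) fun _ _ => rfl
    all_goals
      intro p
      simp only [mem_filter, mem_prodPairs, Prod.fst_swap, Prod.snd_swap]
      rintro ⟨⟨h1, h2, h3⟩, h4⟩
      exact ⟨⟨h2, h1, by rwa [mul_comm]⟩, h4⟩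
  have h2 : ∑ p ∈ prodPairs N with (p.1 ≤ N.sqrt ∧ p.2 ≤ N.sqrt), F p.1 p.2 =
      ∑ d ∈ Icc 1 N.sqrt, ∑ e ∈ Icc 1 N.sqrt, F d e := by
    rw [← sum_product' (f := F)]
    refine sum_congr ?_ fun _ _ => rfl
    ext p
    simp only [mem_filter, mem_prodPairs, mem_product, mem_Icc]
    refine ⟨fun h => ⟨⟨h.1.1, h.2.1⟩, h.1.2.1, h.2.2⟩, fun h => ⟨⟨h.1.1, h.2.1, ?_⟩, h.1.2, h.2.2⟩⟩
    exact (Nat.mul_le_mul h.1.2 h.2.2).trans (Nat.sqrt_le N)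
  have h3 := sum_prodPairs_filter_fst_le (Nat.sqrt_le_self N) F
  have h4 := sum_prodPairs_filter_fst_le (Nat.sqrt_le_self N) fun d e => F e d
  rw [← h3, ← h4, ← h1, ← h2, sum_filter, sum_filter, sum_filter, ← sum_add_distrib,
    ← sum_sub_distrib]
  refine sum_congr rfl fun p hp => ?_
  by_cases c1 : p.1 ≤ N.sqrt
  · by_cases c2 : p.2 ≤ N.sqrt <;> simp [c1, c2]
  · by_cases c2 : p.2 ≤ N.sqrt
    · simp [c1, c2]
    · have := (mem_prodPairs.1 hp).2.2
      have := Nat.mul_le_mul (Nat.lt_of_not_le c1) (Nat.lt_of_not_le c2)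
      have := Nat.lt_succ_sqrt N
      simp only [Nat.succ_eq_add_one] at *
      omega

theorem abs_sum_classInd_charConv_nat_sub_le (hq : χ.IsQuadratic) (hχ : χ ≠ 1) {L : ℝ}
    (hL : ∀ N : ℕ, |∑ n ∈ Icc 1 N, χ n / n - L| ≤ q / (N + 1)) (b : (ZMod q)ˣ) (N : ℕ) :
    |∑ n ∈ Icc 1 N, classInd b n * charConv χ n - (1 + χ b) * (N / q * L)| ≤ 10 * √N := by
  have hq0 : (0 : ℝ) < q := by exact_mod_cast NeZero.pos q
  have hq1 : (1 : ℝ) ≤ q := by exact_mod_cast NeZero.pos q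
  set D := N.sqrt with hD
  set S := ∑ d ∈ Icc 1 D, χ d * ∑ e ∈ Icc 1 (N / d), classInd b (d * e) with hS
  set T := ∑ d ∈ Icc 1 D, χ d * ∑ e ∈ Icc 1 D, classInd b (d * e) with hT
  have h1 : ∑ n ∈ Icc 1 N, classInd b n * charConv χ n = (1 + χ b) * S - T := by
    have e1 : ∑ n ∈ Icc 1 N, classInd b n * charConv χ n =
        ∑ p ∈ prodPairs N, classInd b (p.1 * p.2) * χ p.1 := by
      rw [← sum_divisorsAntidiagonal_eq_sum_prodPairs N
        fun p => classInd b (p.1 * p.2) * χ p.1]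
      refine sum_congr rfl fun n _ => ?_
      rw [charConv_apply, ← Nat.sum_divisorsAntidiagonal (fun d _ => χ d), mul_sum]
      refine sum_congr rfl fun p hp => ?_
      rw [(Nat.mem_divisorsAntidiagonal.1 hp).1]
    rw [e1, sum_prodPairs_hyperbola N fun d e => classInd b (d * e) * χ d, hS, hT, add_mul, one_mul,
      mul_sum]
    congr 1
    · congr 1
      · refine sum_congr rfl fun d _ => ?_
        rw [mul_comm, sum_mul]
      · refine sum_congr rfl fun d _ => ?_
        rw [mul_sum, mul_sum]
        refine sum_congr rfl fun e _ => ?_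
        rw [classInd_mul_character_eq hq, mul_comm e d]
        ring
    · refine sum_congr rfl fun d _ => ?_
      rw [mul_comm, sum_mul]
  have hN : (N : ℝ) ≤ D * D + D + D := by exact_mod_cast Nat.sqrt_le_add N
  have hS' : |S - N / q * L| ≤ 4 * D := by
    have e1 : S - N / q * L = ∑ d ∈ Icc 1 D, (χ d * ∑ e ∈ Icc 1 (N / d), classInd b (d * e) -
        χ d * (((N / d : ℕ) : ℝ) / q)) + ∑ d ∈ Icc 1 D, χ d * ((((N / d : ℕ) : ℝ) - N / d) / q) +
        N / q * (∑ d ∈ Icc 1 D, χ d / d - L) := by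
      rw [← sum_add_distrib, mul_sub, mul_sum, ← add_sub_assoc, ← sum_add_distrib, hS]
      congr 1
      refine sum_congr rfl fun d _ => ?_
      ring
    have b1 : |∑ d ∈ Icc 1 D, (χ d * ∑ e ∈ Icc 1 (N / d), classInd b (d * e) -
        χ d * (((N / d : ℕ) : ℝ) / q))| ≤ D :=
      (abs_sum_le_sum_abs _ _).trans ((sum_le_sum fun d _ =>
        abs_character_mul_sum_classInd_sub_le hq b d (N / d)).trans (by simp))
    have b2 : |∑ d ∈ Icc 1 D, χ d * ((((N / d : ℕ) : ℝ) - N / d) / q)| ≤ D := by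
      refine (abs_sum_le_sum_abs _ _).trans ((sum_le_sum (g := fun _ => (1 : ℝ)) fun d hd => ?_).trans
        (by simp))
      rw [abs_mul]
      refine mul_le_one₀ (abs_character_le_one hq _) (abs_nonneg _) ?_
      have h3 : ((N / d : ℕ) : ℝ) ≤ N / d := Nat.cast_div_le
      have h4 : (N : ℝ) / d < (N / d : ℕ) + 1 := by
        rw [← Nat.floor_div_eq_div (K := ℝ)]
        exact Nat.lt_floor_add_one _
      rw [abs_div, abs_of_pos hq0, div_le_one hq0, abs_of_nonpos (by linarith)]
      linarith
    have b3 : |N / q * (∑ d ∈ Icc 1 D, χ d / d - L)| ≤ 2 * D := by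
      rw [abs_mul, abs_of_nonneg (by positivity : (0 : ℝ) ≤ N / q)]
      refine (mul_le_mul_of_nonneg_left (hL D) (by positivity)).trans ?_
      rw [div_mul_div_cancel₀ hq0.ne', div_le_iff₀ (by positivity)]
      nlinarith [sq_nonneg (D : ℝ)]
    rw [e1]
    refine (abs_add_three _ _ _).trans ?_
    linarith
  have hT' : |T| ≤ 2 * D := by
    have e1 : T = ∑ d ∈ Icc 1 D, (χ d * ∑ e ∈ Icc 1 D, classInd b (d * e) - χ d * ((D : ℝ) / q)) +
        (D / q) * ∑ d ∈ Icc 1 D, χ d := by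
      rw [mul_sum, ← sum_add_distrib, hT]
      refine sum_congr rfl fun d _ => ?_
      ring
    have b1 : |∑ d ∈ Icc 1 D, (χ d * ∑ e ∈ Icc 1 D, classInd b (d * e) - χ d * ((D : ℝ) / q))| ≤ D :=
      (abs_sum_le_sum_abs _ _).trans ((sum_le_sum fun d _ =>
        abs_character_mul_sum_classInd_sub_le hq b d D).trans (by simp))
    have b2 : |D / q * ∑ d ∈ Icc 1 D, χ d| ≤ D := by
      rw [abs_mul, abs_of_nonneg (by positivity : (0 : ℝ) ≤ D / q)]
      refine (mul_le_mul_of_nonneg_left (abs_sum_Ioc_character_le hq hχ 0 D) (by positivity)).trans ?_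
      rw [div_mul_cancel₀ _ hq0.ne']
    rw [e1]
    refine (abs_add_le _ _).trans ?_
    linarith
  have hD' : (D : ℝ) ≤ √N := Real.nat_sqrt_le_real_sqrt
  rw [h1, show (1 + χ b) * S - T - (1 + χ b) * (N / q * L) = (1 + χ b) * (S - N / q * L) - T by ring]
  refine (abs_sub _ _).trans ?_
  have h5 : |1 + χ b| ≤ 2 := by
    have := abs_le.1 (abs_character_le_one hq (b : ZMod q))
    rw [abs_le]
    constructor <;> linarith
  have h6 : |(1 + χ b) * (S - N / q * L)| ≤ 2 * (4 * D) := by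
    rw [abs_mul]
    exact mul_le_mul h5 hS' (abs_nonneg _) zero_le_two
  linarith

theorem abs_sum_classInd_charConv_sub_le (hq : χ.IsQuadratic) (hχ : χ ≠ 1) {L : ℝ}
    (hL : ∀ N : ℕ, |∑ n ∈ Icc 1 N, χ n / n - L| ≤ q / (N + 1)) (b : (ZMod q)ˣ) {y : ℝ}
    (hy : 0 ≤ y) :
    |∑ n ∈ Icc 1 ⌊y⌋₊, classInd b n * charConv χ n - (1 + χ b) * (y / q * L)| ≤ 12 * √y := by
  have hq0 : (0 : ℝ) < q := by exact_mod_cast NeZero.pos q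
  have h1 := abs_sum_classInd_charConv_nat_sub_le hq hχ hL b ⌊y⌋₊
  have h2 : √(⌊y⌋₊ : ℝ) ≤ √y := Real.sqrt_le_sqrt (Nat.floor_le hy)
  have h3 : |(1 + χ b) * ((⌊y⌋₊ - y) / q * L)| ≤ 2 * √y := by
    have h5 : |1 + χ b| ≤ 2 := by
      have := abs_le.1 (abs_character_le_one hq (b : ZMod q))
      rw [abs_le]
      constructor <;> linarith
    have hL0 : |L| ≤ q := by simpa using hL 0
    have h6 : |(⌊y⌋₊ : ℝ) - y| ≤ √y := by
      rw [abs_sub_comm, abs_of_nonneg (sub_nonneg.2 (Nat.floor_le hy))]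
      rcases le_total y 1 with h | h
      · refine (sub_le_self _ (Nat.cast_nonneg _)).trans (Real.le_sqrt_of_sq_le ?_)
        nlinarith
      · have := Nat.lt_floor_add_one y
        have := Real.one_le_sqrt.2 h
        linarith
    rw [abs_mul]
    refine mul_le_mul h5 ?_ (abs_nonneg _) zero_le_two
    rw [div_mul_eq_mul_div, abs_div, abs_mul, abs_of_pos hq0, div_le_iff₀ hq0]
    exact mul_le_mul h6 hL0 (abs_nonneg _) (Real.sqrt_nonneg _)
  rw [show ∑ n ∈ Icc 1 ⌊y⌋₊, classInd b n * charConv χ n - (1 + χ b) * (y / q * L) =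
    ∑ n ∈ Icc 1 ⌊y⌋₊, classInd b n * charConv χ n - (1 + χ b) * (⌊y⌋₊ / q * L) +
      (1 + χ b) * ((⌊y⌋₊ - y) / q * L) by ring]
  refine (abs_add_le _ _).trans ?_
  linarith

theorem sum_filter_insert_dvd {p : ℕ} (hp : p.Prime) {s : Finset ℕ} (hs : ∀ r ∈ s, r.Prime)
    (hps : p ∉ s) (M : ℕ) (F : ℕ → ℝ) :
    ∑ n ∈ Icc 1 M with ∀ r ∈ insert p s, r ∣ n, F n =
      ∑ m ∈ Icc 1 (M / p) with ∀ r ∈ s, r ∣ m, F (p * m) := by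
  symm
  refine sum_nbij' (fun m => p * m) (fun n => n / p) ?_ ?_ ?_ ?_ fun _ _ => rfl
  · intro m hm
    simp only [mem_filter, mem_Icc] at hm ⊢
    refine ⟨⟨Nat.mul_pos hp.pos hm.1.1, ?_⟩, fun r hr => ?_⟩
    · rw [mul_comm]
      exact (Nat.le_div_iff_mul_le hp.pos).1 hm.1.2
    · rcases mem_insert.1 hr with rfl | hr
      · exact dvd_mul_right _ _
      · exact (hm.2 r hr).mul_left p
  · intro n hn
    simp only [mem_filter, mem_Icc] at hn ⊢
    obtain ⟨m, rfl⟩ := hn.2 p (mem_insert_self _ _)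
    rw [Nat.mul_div_cancel_left _ hp.pos]
    refine ⟨⟨Nat.pos_of_ne_zero fun h => by simp [h] at hn, ?_⟩, fun r hr => ?_⟩
    · rw [Nat.le_div_iff_mul_le hp.pos, mul_comm]
      exact hn.1.2
    · refine (((Nat.coprime_primes (hs r hr) hp).2 ?_).dvd_mul_left).1
        (hn.2 r (mem_insert_of_mem hr))
      rintro rfl
      exact hps hr
  · intro m _
    exact Nat.mul_div_cancel_left _ hp.pos
  · intro n hn
    exact Nat.mul_div_cancel' ((mem_filter.1 hn).2 p (mem_insert_self _ _))

/-- The local density at `p` of `charConv χ`. -/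
noncomputable def charDensity (χ : DirichletCharacter ℝ q) (p : ℕ) : ℝ :=
  (1 + χ p) / p - χ p / p ^ 2

theorem sum_classInd_charConv_insert (b : (ZMod q)ˣ) {p : ℕ} (hp : p.Prime)
    {u : (ZMod q)ˣ} (hu : (p : ZMod q) = u) {s : Finset ℕ} (hs : ∀ r ∈ s, r.Prime)
    (hps : p ∉ s) (M : ℕ) :
    ∑ n ∈ Icc 1 M with ∀ r ∈ insert p s, r ∣ n, classInd b n * charConv χ n =
      (1 + χ p) * ∑ m ∈ Icc 1 (M / p) with ∀ r ∈ s, r ∣ m, classInd (b * u⁻¹) m * charConv χ m -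
        χ p * ∑ m ∈ Icc 1 (M / p / p) with ∀ r ∈ s, r ∣ m,
          classInd (b * u⁻¹ * u⁻¹) m * charConv χ m := by
  have h1 : ∑ m ∈ Icc 1 (M / p / p) with ∀ r ∈ s, r ∣ m,
      classInd (b * u⁻¹ * u⁻¹) m * charConv χ m = ∑ m ∈ Icc 1 (M / p) with ∀ r ∈ s, r ∣ m,
        if p ∣ m then classInd (b * u⁻¹) m * charConv χ (m / p) else 0 := by
    rw [← sum_filter, filter_filter]
    have h2 := sum_filter_insert_dvd hp hs hps (M / p)
      fun m => classInd (b * u⁻¹) m * charConv χ (m / p)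
    simp only [Nat.mul_div_cancel_left _ hp.pos, classInd_mul_of_eq (b * u⁻¹) u hu] at h2
    rw [← h2]
    refine sum_congr (filter_congr fun m _ => ?_) fun _ _ => rfl
    simp only [forall_mem_insert, and_comm]
  rw [h1, sum_filter_insert_dvd hp hs hps, mul_sum, mul_sum, ← sum_sub_distrib]
  refine sum_congr rfl fun m hm => ?_
  rw [classInd_mul_of_eq b u hu, charConv_prime_mul χ hp
    (Nat.pos_iff_ne_zero.1 (mem_Icc.1 (mem_filter.1 hm).1).1)]
  split_ifs <;> ring

theorem abs_sum_dvd_classInd_charConv_sub_le (hq : χ.IsQuadratic) (hχ : χ ≠ 1) {L : ℝ}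
    (hL : ∀ N : ℕ, |∑ n ∈ Icc 1 N, χ n / n - L| ≤ q / (N + 1)) (s : Finset ℕ)
    (hs : ∀ p ∈ s, p.Prime ∧ ¬ p ∣ q) :
    ∀ (b : (ZMod q)ˣ) (y : ℝ), 0 ≤ y →
      |∑ n ∈ Icc 1 ⌊y⌋₊ with ∀ p ∈ s, p ∣ n, classInd b n * charConv χ n -
        (1 + χ b) * (y / q * L) * ∏ p ∈ s, charDensity χ p| ≤ 12 * 3 ^ #s * √y := by
  induction s using Finset.induction_on with
  | empty =>
    intro b y hy
    simpa using abs_sum_classInd_charConv_sub_le hq hχ hL b hy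
  | insert p s hps ih =>
    intro b y hy
    obtain ⟨hp, hpq⟩ := hs p (mem_insert_self _ _)
    have hs' : ∀ r ∈ s, r.Prime ∧ ¬ r ∣ q := fun r hr => hs r (mem_insert_of_mem hr)
    obtain ⟨u, hu⟩ : IsUnit (p : ZMod q) :=
      (ZMod.isUnit_iff_coprime p q).2 ((Nat.Prime.coprime_iff_not_dvd hp).2 hpq)
    have hp0 : (0 : ℝ) < p := by exact_mod_cast hp.pos
    have hp1 : (1 : ℝ) ≤ p := by exact_mod_cast hp.one_le
    have hχp : χ p = 1 ∨ χ p = -1 := (hq p).resolve_left (by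
      rw [← hu]; exact (u.isUnit.map χ).ne_zero)
    have hχu : χ ((u⁻¹ : (ZMod q)ˣ) : ZMod q) = χ p := by
      have : χ ((u⁻¹ : (ZMod q)ˣ) : ZMod q) * χ p = 1 := by
        rw [← hu, ← map_mul, Units.inv_mul, map_one]
      rcases hχp with h | h <;> rw [h] at this ⊢ <;> linarith
    rw [sum_classInd_charConv_insert b hp hu.symm (fun r hr => (hs' r hr).1) hps, prod_insert hps,
      card_insert_of_notMem hps, ← Nat.floor_div_natCast, ← Nat.floor_div_natCast]
    have h1 := ih hs' (b * u⁻¹) (y / p) (by positivity)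
    have h2 := ih hs' (b * u⁻¹ * u⁻¹) (y / p / p) (by positivity)
    set R1 := ∑ n ∈ Icc 1 ⌊y / p⌋₊ with ∀ p ∈ s, p ∣ n, classInd (b * u⁻¹) n * charConv χ n
    set R2 := ∑ n ∈ Icc 1 ⌊y / p / p⌋₊ with ∀ p ∈ s, p ∣ n,
      classInd (b * u⁻¹ * u⁻¹) n * charConv χ n
    set G := ∏ p ∈ s, charDensity χ p
    rw [Units.val_mul, map_mul, hχu] at h1
    rw [Units.val_mul, Units.val_mul, map_mul, map_mul, hχu] at h2
    have h3 : √(y / p / p) ≤ √(y / p) := Real.sqrt_le_sqrt (div_le_self (by positivity) hp1)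
    have h4 : √(y / p) ≤ √y := Real.sqrt_le_sqrt (div_le_self hy hp1)
    set E := (12 : ℝ) * 3 ^ #s with hE
    have hE0 : 0 ≤ E := by positivity
    have h5 : E * √(y / p) ≤ E * √y := mul_le_mul_of_nonneg_left h4 hE0
    have h6 : E * √(y / p / p) ≤ E * √y := mul_le_mul_of_nonneg_left (h3.trans h4) hE0
    have h7 : (12 : ℝ) * 3 ^ (#s + 1) * √y = 3 * (E * √y) := by
      rw [hE]
      ring
    rw [h7, charDensity]
    rw [abs_le] at h1 h2 ⊢
    have h8 : y / p / p = y / p ^ 2 := by rw [div_div, sq]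
    rw [h8] at h2 h6
    rcases hχp with h | h <;> rw [h] at h1 h2 ⊢
    · have e1 : (1 + χ b) * (y / q * L) * (((1 + 1) / p - 1 / p ^ 2) * G) =
          2 * ((1 + χ b * 1) * (y / p / q * L) * G) -
            (1 + χ b * 1 * 1) * (y / p ^ 2 / q * L) * G := by ring
      rw [e1]
      constructor <;> linarith [h1.1, h1.2, h2.1, h2.2]
    · have e1 : (1 + χ b) * (y / q * L) * (((1 + -1) / p - -1 / p ^ 2) * G) =
          (1 + χ b * -1 * -1) * (y / p ^ 2 / q * L) * G := by ring
      rw [e1]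
      have := mul_nonneg hE0 (Real.sqrt_nonneg y)
      constructor <;> linarith [h1.1, h1.2, h2.1, h2.2]

end LevelDistribution

section PrimeSums

variable {q : ℕ} [NeZero q] {χ : DirichletCharacter ℝ q}

theorem abs_sum_character_mul_log_div_le (hq : χ.IsQuadratic) (hχ : χ ≠ 1) (x : ℕ) :
    |∑ n ∈ Icc 1 x, χ n * (Real.log n / n)| ≤ q + 3 := by
  have hsplit : ∑ n ∈ Icc 1 x, χ n * (Real.log n / n) =
      ∑ n ∈ Icc 1 (min 3 x), χ n * (Real.log n / n) + ∑ n ∈ Ioc 3 x, χ n * (Real.log n / n) := by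
    have : ∀ K, Icc 1 K = Ioc 0 K := fun K => rfl
    rcases le_total 3 x with h | h
    · rw [min_eq_left h, this, this, sum_Ioc_consecutive _ (by norm_num) h]
    · rw [min_eq_right h, Ioc_eq_empty_of_le h, sum_empty, add_zero]
  have h1 : |∑ n ∈ Icc 1 (min 3 x), χ n * (Real.log n / n)| ≤ 3 := by
    refine (abs_sum_le_sum_abs _ _).trans ((sum_le_sum (g := fun _ => (1 : ℝ)) fun n hn => ?_).trans
      ?_)
    · rw [abs_mul]
      refine mul_le_one₀ (abs_character_le_one hq _) (abs_nonneg _) ?_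
      rw [abs_of_nonneg (div_nonneg (Real.log_natCast_nonneg n) (Nat.cast_nonneg n))]
      exact div_le_one_of_le₀ (Real.log_le_self (Nat.cast_nonneg n)) (Nat.cast_nonneg n)
    · simp
  have h2 : |∑ n ∈ Ioc 3 x, χ n * (Real.log n / n)| ≤ q := by
    refine (abs_sum_character_mul_le hq hχ 3 x (fun n => Real.log n / n) (fun n _ =>
      div_nonneg (Real.log_natCast_nonneg n) (Nat.cast_nonneg n)) fun n hn => ?_).trans ?_
    · have h3 : Real.exp 1 ≤ (n : ℝ) := by
        have := Real.exp_one_lt_d9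
        have : (3 : ℝ) < n := by exact_mod_cast hn
        linarith
      refine Real.log_div_self_antitoneOn h3 ?_ (by push_cast; linarith)
      push_cast
      change Real.exp 1 ≤ (n : ℝ) + 1
      linarith
    · refine mul_le_of_le_one_right (Nat.cast_nonneg q) ?_
      exact div_le_one_of_le₀ (Real.log_le_self (Nat.cast_nonneg _)) (Nat.cast_nonneg _)
  rw [hsplit]
  exact (abs_add_le _ _).trans (by linarith)

theorem abs_sum_character_mul_vonMangoldt_div_le (hq : χ.IsQuadratic) (hχ : χ ≠ 1) (x : ℕ) :
    |∑ n ∈ Icc 1 x, χ n * (vonMangoldt n / n)| ≤ 8640 * (q : ℝ) ^ 3 := by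
  have hq1 : (1 : ℝ) ≤ q := by exact_mod_cast NeZero.pos q
  obtain ⟨L, hL⟩ := exists_sum_character_div_sub_le hq hχ
  have hL0 := le_of_sum_character_div hq hχ hL
  have h1 : ∑ n ∈ Icc 1 x, χ n * (Real.log n / n) =
      ∑ d ∈ Icc 1 x, χ d * (vonMangoldt d / d) * ∑ e ∈ Icc 1 (x / d), χ e / e := by
    simp only [mul_sum]
    rw [← sum_prodPairs x fun p => χ p.1 * (vonMangoldt p.1 / p.1) * (χ p.2 / p.2),
      ← sum_divisorsAntidiagonal_eq_sum_prodPairs]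
    refine sum_congr rfl fun n hn => ?_
    rw [← vonMangoldt_sum, ← Nat.sum_divisorsAntidiagonal (fun d _ => vonMangoldt d), sum_div,
      mul_sum]
    refine sum_congr rfl fun p hp => ?_
    rw [← (Nat.mem_divisorsAntidiagonal.1 hp).1, Nat.cast_mul, Nat.cast_mul, map_mul]
    ring
  have h2 : L * ∑ d ∈ Icc 1 x, χ d * (vonMangoldt d / d) =
      ∑ n ∈ Icc 1 x, χ n * (Real.log n / n) -
        ∑ d ∈ Icc 1 x, χ d * (vonMangoldt d / d) * (∑ e ∈ Icc 1 (x / d), χ e / e - L) := by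
    rw [h1, ← sum_sub_distrib, mul_sum]
    exact sum_congr rfl fun d _ => by ring
  have h3 : |∑ d ∈ Icc 1 x, χ d * (vonMangoldt d / d) * (∑ e ∈ Icc 1 (x / d), χ e / e - L)| ≤
      6 * q := by
    rcases Nat.eq_zero_or_pos x with rfl | hx
    · simp
    have hx0 : (0 : ℝ) < x := by exact_mod_cast hx
    refine (abs_sum_le_sum_abs _ _).trans ((sum_le_sum
      (g := fun d : ℕ => (q : ℝ) / x * vonMangoldt d) fun d hd => ?_).trans ?_)
    · have hd0 : (0 : ℝ) < d := by exact_mod_cast (mem_Icc.1 hd).1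
      have h4 : (x : ℝ) / d < (x / d : ℕ) + 1 := by
        rw [← Nat.floor_div_eq_div (K := ℝ)]
        exact Nat.lt_floor_add_one _
      have h5 : (q : ℝ) / ((x / d : ℕ) + 1) ≤ q / (x / d) := by gcongr
      have h6 : (0 : ℝ) ≤ vonMangoldt d / d := div_nonneg vonMangoldt_nonneg hd0.le
      rw [abs_mul, abs_mul, abs_of_nonneg h6]
      calc _ ≤ 1 * (vonMangoldt d / d) * (q / (x / d)) := by
            gcongr
            · exact abs_character_le_one hq _
            · exact (hL _).trans h5
        _ = (q : ℝ) / x * vonMangoldt d := by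
            field_simp
    · rw [← mul_sum]
      refine (mul_le_mul_of_nonneg_left (sum_vonMangoldt_le x) (by positivity)).trans (le_of_eq ?_)
      field_simp
  have h4 := abs_sum_character_mul_log_div_le hq hχ x
  set S := ∑ n ∈ Icc 1 x, χ n * (vonMangoldt n / n)
  have h5 : |L * S| ≤ 10 * q := by
    rw [h2]
    exact (abs_sub _ _).trans (by linarith)
  have hL1 : 0 < L := lt_of_lt_of_le (by positivity) hL0
  rw [abs_mul, abs_of_pos hL1] at h5
  have h6 : 1 / (864 * (q : ℝ) ^ 2) * |S| ≤ 10 * q :=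
    (mul_le_mul_of_nonneg_right hL0 (abs_nonneg S)).trans h5
  rw [one_div_mul_eq_div, div_le_iff₀ (by positivity)] at h6
  refine h6.trans (le_of_eq ?_)
  ring

theorem sum_expect_primeBlock_mul_character (χ : DirichletCharacter ℝ q) {Q : ℕ} (hqQ : q ≤ Q)
    (hQ : 1 ≤ Q) (k : ℕ) :
    ∑ j ∈ range k, 𝔼 g : (ZMod q)ˣ, primeBlock Q j g * (1 + χ g) =
      (∑ n ∈ Icc 1 (Q ^ k - 1), roughInd Q n * (vonMangoldt n / n) * (1 + χ n)) / Real.log Q := by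
  rw [sum_Icc_pow_sub_one_eq hQ, sum_div]
  refine sum_congr rfl fun j _ => ?_
  have hphi : (q.totient : ℝ) ≠ 0 := by
    exact_mod_cast (Nat.totient_pos.2 (NeZero.pos q)).ne'
  simp only [primeBlock, mul_assoc, sum_mul]
  rw [Fintype.expect_eq_sum_div_card, ZMod.card_units_eq_totient, ← mul_sum, sum_comm,
    mul_comm, mul_div_assoc, div_div_cancel_left' hphi, div_eq_mul_inv]
  congr 1
  refine sum_congr rfl fun n _ => ?_
  by_cases hr : Rough Q n
  · have h1 : ∀ g : (ZMod q)ˣ, classInd g n * (roughInd Q n * vonMangoldt n / n * (1 + χ g)) =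
        classInd g n * (roughInd Q n * (vonMangoldt n / n * (1 + χ n))) := by
      intro g
      rw [classInd]
      split_ifs with h
      · rw [h]
        ring
      · simp
    simp only [h1]
    rw [← sum_mul, sum_classInd_of_coprime (coprime_of_rough hr (NeZero.pos q) hqQ), one_mul]
  · simp [roughInd, hr]

theorem mul_log_le_of_sparse (hq : χ.IsQuadratic) (hχ : χ ≠ 1) {Q : ℕ} (hqQ : q ≤ Q)
    (hQ : 3 ≤ Q) {δ : ℝ} (hδ : δ ≤ 1 / 8) {m : ℕ} (hm : 92 ≤ m)
    (h : ∑ j ∈ range m, 𝔼 g : (ZMod q)ˣ, primeBlock Q j g * (1 + χ g) ≤ δ * (2 * m)) :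
    m * Real.log Q ≤ 17304 * (q : ℝ) ^ 3 := by
  have hq1 : (1 : ℝ) ≤ q := by exact_mod_cast NeZero.pos q
  have hq3 : (1 : ℝ) ≤ (q : ℝ) ^ 3 := one_le_pow₀ hq1
  have hl : 0 < Real.log Q := Real.log_pos (by exact_mod_cast (by omega : 1 < Q))
  have hm' : (92 : ℝ) ≤ m := by exact_mod_cast hm
  rw [sum_expect_primeBlock_mul_character χ hqQ (by omega), div_le_iff₀ hl] at h
  have h1 := (abs_le.1 (abs_sum_expect_primeBlock_sub_le hqQ hQ m)).1
  rw [sum_expect_primeBlock hqQ (by omega), le_sub_iff_add_le, le_div_iff₀ hl] at h1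
  have h2 := (abs_le.1 (abs_sum_character_mul_vonMangoldt_div_le hq hχ (Q ^ m - 1))).1
  have h3 := sum_vonMangoldt_not_rough_le (Q := Q) (by omega) (Q ^ m - 1)
  have h4 : ∑ n ∈ Icc 1 (Q ^ m - 1), roughInd Q n * vonMangoldt n / n +
      ∑ n ∈ Icc 1 (Q ^ m - 1), χ n * (vonMangoldt n / n) ≤
      ∑ n ∈ Icc 1 (Q ^ m - 1), roughInd Q n * (vonMangoldt n / n) * (1 + χ n) +
        ∑ n ∈ Icc 1 (Q ^ m - 1), (1 - roughInd Q n) * (vonMangoldt n / n) := by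
    rw [← sum_add_distrib, ← sum_add_distrib]
    refine sum_le_sum fun n _ => ?_
    have h5 : (0 : ℝ) ≤ vonMangoldt n / n := div_nonneg vonMangoldt_nonneg (Nat.cast_nonneg n)
    have h6 := (abs_le.1 (abs_character_le_one hq (n : ZMod q))).2
    have h7 : 0 ≤ (1 - roughInd Q n) * (vonMangoldt n / n) * (1 - χ n) :=
      mul_nonneg (mul_nonneg (sub_nonneg.2 (roughInd_le_one Q n)) h5) (sub_nonneg.2 h6)
    have h8 : roughInd Q n * vonMangoldt n / n = roughInd Q n * (vonMangoldt n / n) := by ring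
    rw [h8]
    linarith
  have h5 : δ * (2 * m) * Real.log Q ≤ 1 / 8 * (2 * m) * Real.log Q := by gcongr
  have h6 : 46 * Real.log Q ≤ m / 2 * Real.log Q := by
    gcongr
    linarith
  nlinarith

theorem sum_inv_le_of_sparse (hq : χ.IsQuadratic) {Q : ℕ} (hqQ : q ≤ Q) (hQ : 3 ≤ Q) {δ : ℝ} {m : ℕ}
    (h : ∑ j ∈ range m, 𝔼 g : (ZMod q)ˣ, primeBlock Q j g * (1 + χ g) ≤ δ * (2 * m)) {z : ℝ}
    (hz : 1 < z) (P : Finset ℕ)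
    (hP : ∀ p ∈ P, p.Prime ∧ Q < p ∧ z ≤ p ∧ p < Q ^ m ∧ χ p = 1) :
    ∑ p ∈ P, (1 : ℝ) / p ≤ δ * (m * Real.log Q) / Real.log z := by
  have hl : 0 < Real.log Q := Real.log_pos (by exact_mod_cast (by omega : 1 < Q))
  have hlz : 0 < Real.log z := Real.log_pos hz
  rw [sum_expect_primeBlock_mul_character χ hqQ (by omega), div_le_iff₀ hl] at h
  rw [le_div_iff₀ hlz, sum_mul]
  have h1 : ∑ p ∈ P, (1 : ℝ) / p * Real.log z * 2 ≤
      ∑ n ∈ Icc 1 (Q ^ m - 1), roughInd Q n * (vonMangoldt n / n) * (1 + χ n) := by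
    refine (sum_le_sum fun p hp => ?_).trans (sum_le_sum_of_subset_of_nonneg
      (f := fun n : ℕ => roughInd Q n * (vonMangoldt n / n) * (1 + χ n)) (fun p hp => ?_)
      fun n _ _ => ?_)
    · obtain ⟨hp1, hp2, hp3, -, hp5⟩ := hP p hp
      have hr : Rough Q p := fun r hr hrp => by
        rwa [(Nat.prime_dvd_prime_iff_eq hr hp1).1 hrp]
      rw [hp5, roughInd, if_pos hr, vonMangoldt_apply_prime hp1]
      have : Real.log z ≤ Real.log p := Real.log_le_log (by linarith) hp3
      have hp0 : (0 : ℝ) < p := by exact_mod_cast hp1.pos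
      rw [one_mul, one_div_mul_eq_div, show (1 + 1 : ℝ) = 2 by norm_num]
      gcongr
    · obtain ⟨hp1, hp2, -, hp4, -⟩ := hP p hp
      have := hp1.pos
      exact mem_Icc.2 ⟨by omega, by omega⟩
    · have := (abs_le.1 (abs_character_le_one hq (n : ZMod q))).1
      exact mul_nonneg (mul_nonneg (roughInd_nonneg Q n)
        (div_nonneg vonMangoldt_nonneg (Nat.cast_nonneg n))) (by linarith)
  rw [← sum_mul] at h1
  linarith

end PrimeSums

section Sifting

variable {q : ℕ} [NeZero q] {χ : DirichletCharacter ℝ q}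

/-- The sum of `charConv χ` over the integers up to `M` in the class `b` without prime factors up
to `z`. -/
noncomputable def siftSum (χ : DirichletCharacter ℝ q) (b : (ZMod q)ˣ) (z M : ℕ) : ℝ :=
  ∑ n ∈ Icc 1 M with ∀ p ∈ sievePrimes q z, ¬ p ∣ n, classInd b n * charConv χ n

/-- The expected proportion of `siftSum`. -/
noncomputable def siftDensity (χ : DirichletCharacter ℝ q) (z : ℕ) : ℝ :=
  ∏ p ∈ sievePrimes q z, (1 - charDensity χ p)

omit [NeZero q] in
theorem charDensity_bounds (hq : χ.IsQuadratic) {p : ℕ} (hp : p.Prime) :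
    0 ≤ charDensity χ p ∧ charDensity χ p ≤ 3 / 4 ∧ charDensity χ p ≤ 2 / p := by
  have hp2 : (2 : ℝ) ≤ p := by exact_mod_cast hp.two_le
  set x : ℝ := 1 / p with hx
  have hx0 : 0 < x := by positivity
  have hx1 : x ≤ 1 / 2 := one_div_le_one_div_of_le two_pos hp2
  have h1 : charDensity χ p = (1 + χ p) * x - χ p * x ^ 2 := by
    rw [charDensity, hx]
    ring
  have h2 : (2 : ℝ) / p = 2 * x := by
    rw [hx]
    ring
  rw [h1, h2]
  rcases hq p with h | h | h <;> rw [h] <;> refine ⟨?_, ?_, ?_⟩ <;> nlinarith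

omit [NeZero q] in
theorem siftDensity_nonneg (hq : χ.IsQuadratic) (z : ℕ) : 0 ≤ siftDensity χ z :=
  prod_nonneg fun p hp => by
    have := (charDensity_bounds hq (mem_sievePrimes.1 hp).2.1).2.1
    linarith

omit [NeZero q] in
theorem le_siftDensity (hq : χ.IsQuadratic) {z : ℕ} (hz : 2 ≤ z) :
    Real.exp (-4) * (4 * Real.log z) ^ (-(160 : ℝ)) ≤ siftDensity χ z :=
  le_prod_one_sub _ (fun _ hp => (mem_sievePrimes.1 hp).2.1) z (by exact_mod_cast hz)
    (fun _ hp => by exact_mod_cast (mem_sievePrimes.1 hp).1) _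
    (fun _ hp => (charDensity_bounds hq (mem_sievePrimes.1 hp).2.1).1)
    (fun _ hp => (charDensity_bounds hq (mem_sievePrimes.1 hp).2.1).2.1)
    fun _ hp => (charDensity_bounds hq (mem_sievePrimes.1 hp).2.1).2.2

theorem three_pow_card_le_prod_sq {s : Finset ℕ} (hs : ∀ p ∈ s, p.Prime) :
    (3 : ℝ) ^ #s ≤ (∏ p ∈ s, (p : ℝ)) ^ 2 := by
  rw [← prod_pow, ← prod_const]
  refine prod_le_prod (fun _ _ => by norm_num) fun p hp => ?_
  have : (2 : ℝ) ≤ p := by exact_mod_cast (hs p hp).two_le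
  nlinarith

omit [NeZero q] in
theorem one_add_character_nonneg (hq : χ.IsQuadratic) (x : ZMod q) : 0 ≤ 1 + χ x := by
  have := (abs_le.1 (abs_character_le_one hq x)).1
  linarith

theorem exists_abs_siftSum_sub_le : ∃ B : ℕ, 1 ≤ B ∧ ∀ (q : ℕ) [NeZero q]
    (χ : DirichletCharacter ℝ q) (L : ℝ), χ.IsQuadratic → χ ≠ 1 →
    (∀ N : ℕ, |∑ n ∈ Icc 1 N, χ n / n - L| ≤ q / (N + 1)) →
    ∀ (b : (ZMod q)ˣ) (z : ℕ) (y : ℝ), 2 ≤ z → 0 ≤ y →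
    |siftSum χ b z ⌊y⌋₊ - (1 + χ b) * (y / q * L) * siftDensity χ z| ≤
      1 / 4 * ((1 + χ b) * (y / q * L) * siftDensity χ z) + 12 * √y * z ^ B := by
  obtain ⟨C, hC, hfund⟩ := fundamental_lemma 2 le_rfl
  obtain ⟨β, hβ⟩ : ∃ β : ℕ, 4 * C < ((2 : ℝ) ^ 2) ^ β :=
    pow_unbounded_of_one_lt _ (by norm_num)
  refine ⟨12 * β + 22, by omega, ?_⟩
  intro q _ χ L hq hχ hL b z y hz hy
  have hL0 : 0 ≤ L := le_trans (by positivity) (le_of_sum_character_div hq hχ hL)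
  have hX : 0 ≤ (1 + χ b) * (y / q * L) :=
    mul_nonneg (one_add_character_nonneg hq _) (by positivity)
  have hV := siftDensity_nonneg hq z
  refine (hfund (Icc 1 ⌊y⌋₊) (fun n => classInd b n * charConv χ n) ((1 + χ b) * (y / q * L))
    (12 * √y) (charDensity χ) (sievePrimes q z) z β
    (fun n _ => mul_nonneg (classInd_nonneg b n) (charConv_nonneg hq n)) hX (by positivity)
    (by exact_mod_cast hz) (fun _ hp => (mem_sievePrimes.1 hp).2.1)
    (fun _ hp => by exact_mod_cast (mem_sievePrimes.1 hp).1)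
    (fun _ hp => ⟨(charDensity_bounds hq (mem_sievePrimes.1 hp).2.1).1,
      (charDensity_bounds hq (mem_sievePrimes.1 hp).2.1).2.1⟩)
    (fun _ hp => (charDensity_bounds hq (mem_sievePrimes.1 hp).2.1).2.2)
    fun s hs => ?_).trans ?_
  · have hs' : ∀ p ∈ s, p.Prime ∧ ¬ p ∣ q := fun p hp => (mem_sievePrimes.1 (hs hp)).2
    refine (abs_sum_dvd_classInd_charConv_sub_le hq hχ hL s hs' b y hy).trans ?_
    have := three_pow_card_le_prod_sq fun p hp => (hs' p hp).1
    nlinarith [Real.sqrt_nonneg y]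
  · change C / 2 ^ (2 * β) * ((1 + χ b) * (y / q * L) * siftDensity χ z) + _ ≤ _
    have h1 : C / 2 ^ (2 * β) ≤ 1 / 4 := by
      rw [pow_mul, div_le_iff₀ (by positivity)]
      generalize ((2 : ℝ) ^ 2) ^ β = T at hβ ⊢
      linarith
    have := mul_le_mul_of_nonneg_right h1 (mul_nonneg hX hV)
    linarith

theorem sum_sifted_dvd_eq (b u : (ZMod q)ˣ) {p z : ℕ} (hp : p.Prime) (hpz : z < p)
    (hu : (p : ZMod q) = u) (M : ℕ) :
    ∑ n ∈ Icc 1 M with (∀ r ∈ sievePrimes q z, ¬ r ∣ n) ∧ p ∣ n, classInd b n * charConv χ n =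
      ∑ m ∈ Icc 1 (M / p) with ∀ r ∈ sievePrimes q z, ¬ r ∣ m,
        classInd (b * u⁻¹) m * charConv χ (p * m) := by
  symm
  have hdvd : ∀ r ∈ sievePrimes q z, ∀ m, r ∣ p * m → r ∣ m := fun r hr m h => by
    rw [mem_sievePrimes] at hr
    refine (((Nat.coprime_primes hr.2.1 hp).2 ?_).dvd_mul_left).1 h
    omega
  refine sum_nbij' (fun m => p * m) (fun n => n / p) ?_ ?_ ?_ ?_ ?_
  · intro m hm
    simp only [mem_filter, mem_Icc] at hm ⊢
    refine ⟨⟨Nat.mul_pos hp.pos hm.1.1, ?_⟩, fun r hr h => hm.2 r hr (hdvd r hr m h),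
      dvd_mul_right _ _⟩
    rw [mul_comm]
    exact (Nat.le_div_iff_mul_le hp.pos).1 hm.1.2
  · intro n hn
    simp only [mem_filter, mem_Icc] at hn ⊢
    obtain ⟨m, rfl⟩ := hn.2.2
    rw [Nat.mul_div_cancel_left _ hp.pos]
    refine ⟨⟨Nat.pos_of_ne_zero fun h => by simp [h] at hn, ?_⟩,
      fun r hr h => hn.2.1 r hr (h.mul_left p)⟩
    rw [Nat.le_div_iff_mul_le hp.pos, mul_comm]
    exact hn.1.2
  · intro m _
    exact Nat.mul_div_cancel_left _ hp.pos
  · intro n hn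
    exact Nat.mul_div_cancel' (mem_filter.1 hn).2.2
  · intro m _
    rw [classInd_mul_of_eq b u hu]

theorem sum_sifted_dvd_le_of_eq_one (hq : χ.IsQuadratic) (b u : (ZMod q)ˣ) {p z : ℕ}
    (hp : p.Prime) (hpz : z < p) (hu : (p : ZMod q) = u) (hχp : χ p = 1) (M : ℕ) :
    ∑ n ∈ Icc 1 M with (∀ r ∈ sievePrimes q z, ¬ r ∣ n) ∧ p ∣ n, classInd b n * charConv χ n ≤
      2 * siftSum χ (b * u⁻¹) z (M / p) := by
  rw [sum_sifted_dvd_eq b u hp hpz hu, siftSum, mul_sum]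
  refine sum_le_sum fun m hm => ?_
  have hm0 : m ≠ 0 := Nat.pos_iff_ne_zero.1 (mem_Icc.1 (mem_filter.1 hm).1).1
  have h1 : charConv χ (p * m) ≤ 2 * charConv χ m := by
    rw [charConv_prime_mul χ hp hm0, hχp]
    have h2 := charConv_nonneg hq (m / p)
    split_ifs <;> linarith
  have := mul_le_mul_of_nonneg_left h1 (classInd_nonneg (b * u⁻¹) m)
  linarith

theorem sum_sifted_dvd_le_of_eq_neg_one (hq : χ.IsQuadratic) (b u : (ZMod q)ˣ) {p : ℕ} (z : ℕ)
    (hp : p.Prime) (hu : (p : ZMod q) = u) (hχp : χ p = -1) (M : ℕ) :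
    ∑ n ∈ Icc 1 M with (∀ r ∈ sievePrimes q z, ¬ r ∣ n) ∧ p ∣ n, classInd b n * charConv χ n ≤
      ∑ m ∈ Icc 1 (M / p / p), classInd (b * u⁻¹ * u⁻¹) m * charConv χ m := by
  have h := sum_classInd_charConv_insert (χ := χ) b hp hu (s := ∅) (by simp) (by simp) M
  rw [hχp] at h
  simp only [add_neg_cancel, zero_mul, zero_sub, neg_mul, one_mul, neg_neg] at h
  simp only [insert_empty_eq, mem_singleton, forall_eq, notMem_empty, false_imp_iff,
    implies_true, filter_true] at h
  rw [← h]
  refine sum_le_sum_of_subset_of_nonneg (fun n hn => ?_) fun n _ _ =>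
    mul_nonneg (classInd_nonneg b n) (charConv_nonneg hq n)
  simp only [mem_filter] at hn ⊢
  exact ⟨hn.1, hn.2.2⟩

end Sifting

section Counting

variable {q : ℕ} [NeZero q] {χ : DirichletCharacter ℝ q}

/-- The number of primes up to `N` in the residue class `a`. -/
noncomputable def primeCount (a : (ZMod q)ˣ) (N : ℕ) : ℕ :=
  #((Icc 1 N).filter fun p : ℕ => p.Prime ∧ (p : ZMod q) = a)

omit [NeZero q] in
theorem siftSum_le_add_sum (hq : χ.IsQuadratic) (a : (ZMod q)ˣ) (z : ℕ) {H : ℕ}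
    (hH : ¬ H.Prime) :
    siftSum χ a z (H ^ 2) ≤ 1 + 2 * primeCount a (H ^ 2) +
      ∑ p ∈ Ioo z H with p.Prime ∧ ¬ p ∣ q,
        ∑ n ∈ Icc 1 (H ^ 2) with (∀ r ∈ sievePrimes q z, ¬ r ∣ n) ∧ p ∣ n,
          classInd a n * charConv χ n := by
  set w : ℕ → ℝ := fun n => classInd a n * charConv χ n with hw
  have hw0 : ∀ n, 0 ≤ w n := fun n => mul_nonneg (classInd_nonneg a n) (charConv_nonneg hq n)
  set T := {p ∈ Ioo z H | p.Prime ∧ ¬ p ∣ q} with hT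
  set S := {n ∈ Icc 1 (H ^ 2) | ∀ r ∈ sievePrimes q z, ¬ r ∣ n} with hS
  have hpt : ∀ n ∈ S, w n ≤ (if n = 1 then 1 else 0) +
      2 * (if n.Prime ∧ (n : ZMod q) = a then 1 else 0) +
      ∑ p ∈ T, if p ∣ n then w n else 0 := by
    intro n hn
    have hn' := mem_filter.1 hn
    have hsum : 0 ≤ ∑ p ∈ T, if p ∣ n then w n else 0 :=
      sum_nonneg fun p _ => by split_ifs <;> [exact hw0 n; exact le_rfl]
    have hind : (0 : ℝ) ≤ if n.Prime ∧ (n : ZMod q) = a then 1 else 0 := by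
      split_ifs <;> norm_num
    have hind1 : (0 : ℝ) ≤ if n = 1 then 1 else 0 := by split_ifs <;> norm_num
    by_cases ha : (n : ZMod q) = a
    swap
    · have : w n = 0 := by simp [hw, classInd, ha]
      rw [this] at hsum ⊢
      linarith
    have hwn : w n = charConv χ n := by simp [hw, classInd, ha]
    by_cases h1 : n = 1
    · have : w n = 1 := by rw [hwn, h1, (charConv_isMultiplicative χ).map_one]
      rw [this] at hsum ⊢
      rw [if_pos h1]
      linarith
    by_cases hp : n.Prime
    · have : w n ≤ 2 := by
        have h2 := charConv_prime_pow χ hp 1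
        rw [pow_one, sum_range_succ, sum_range_one, pow_zero, pow_one] at h2
        rw [hwn, h2]
        have := (abs_le.1 (abs_character_le_one hq (n : ZMod q))).2
        linarith
      rw [if_pos (c := n.Prime ∧ _) ⟨hp, ha⟩]
      linarith
    · have hn0 : 0 < n := (mem_Icc.1 hn'.1).1
      have hpr := Nat.minFac_prime h1
      have hdvd := Nat.minFac_dvd n
      have hpq : ¬ n.minFac ∣ q := by
        have hc := coprime_of_natCast_eq_unit ha
        intro h
        exact hpr.one_lt.ne' (Nat.dvd_one.1 (hc ▸ Nat.dvd_gcd hdvd h))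
      have hmem : n.minFac ∈ T := by
        refine mem_filter.2 ⟨mem_Ioo.2 ⟨?_, ?_⟩, hpr, hpq⟩
        · by_contra! hle
          exact hn'.2 _ (mem_sievePrimes.2 ⟨hle, hpr, hpq⟩) hdvd
        · have h2 := Nat.minFac_sq_le_self hn0 hp
          have h3 : n.minFac ≤ H :=
            (Nat.pow_le_pow_iff_left two_ne_zero).1 (h2.trans (mem_Icc.1 hn'.1).2)
          refine lt_of_le_of_ne h3 fun h => hH (h ▸ hpr)
      have h4 := single_le_sum (f := fun p => if p ∣ n then w n else 0)
        (fun p _ => by split_ifs <;> [exact hw0 n; exact le_rfl]) hmem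
      simp only [if_pos hdvd] at h4
      linarith
  refine (sum_le_sum hpt).trans ?_
  rw [sum_add_distrib, sum_add_distrib, ← mul_sum, sum_comm]
  refine add_le_add (add_le_add ?_ ?_) (sum_le_sum fun p _ => ?_)
  · rw [sum_ite_eq']
    split_ifs <;> norm_num
  · rw [sum_boole, primeCount]
    gcongr
    exact filter_subset _ _
  · rw [← sum_filter, hS, filter_filter]

theorem primeCount_ge_of_sieve (hq : χ.IsQuadratic) (hχ : χ ≠ 1) {L : ℝ}
    (hL : ∀ N : ℕ, |∑ n ∈ Icc 1 N, χ n / n - L| ≤ q / (N + 1)) {B z H : ℕ} (hB : 1 ≤ B)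
    (hz : 2 ≤ z) (hzH : z ^ (4 * B) ≤ H) (hH : ¬ H.Prime)
    (hsieve : ∀ (b : (ZMod q)ˣ) (y : ℝ), 0 ≤ y →
      |siftSum χ b z ⌊y⌋₊ - (1 + χ b) * (y / q * L) * siftDensity χ z| ≤
        1 / 4 * ((1 + χ b) * (y / q * L) * siftDensity χ z) + 12 * √y * z ^ B)
    {a : (ZMod q)ˣ} (ha : χ a = 1)
    (hsum : ∑ p ∈ Ioo z H with (p.Prime ∧ ¬ p ∣ q) ∧ χ p = 1, (1 : ℝ) / p ≤ 1 / 20)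
    (hlarge : 116 * ((H : ℝ) ^ 2 / z) ≤ (H : ℝ) ^ 2 / q * L * siftDensity χ z) :
    (H : ℝ) ^ 2 / q * L * siftDensity χ z / 2 ≤ primeCount a (H ^ 2) := by
  set V := siftDensity χ z with hV
  set Y := (H : ℝ) ^ 2 / q * L * V with hY
  have hV0 : 0 ≤ V := siftDensity_nonneg hq z
  have hq1 : (1 : ℝ) ≤ q := by exact_mod_cast NeZero.pos q
  have hq0 : (0 : ℝ) < q := by linarith
  have hL0 : 0 ≤ L := le_trans (by positivity) (le_of_sum_character_div hq hχ hL)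
  have hLq : L ≤ q := by
    have := hL 0
    simp only [Nat.cast_zero, zero_add, div_one] at this
    rw [Icc_eq_empty (by norm_num), sum_empty, zero_sub, abs_neg] at this
    exact (le_abs_self L).trans this
  have hY0 : 0 ≤ Y := by positivity
  have hz0 : (0 : ℝ) < z := by positivity
  have hz1 : (1 : ℝ) ≤ z := by exact_mod_cast (by omega : 1 ≤ z)
  have hzz : (z : ℝ) ^ B * z ≤ √H := by
    refine Real.le_sqrt_of_sq_le ?_
    calc ((z : ℝ) ^ B * z) ^ 2 = (z : ℝ) ^ (2 * B + 2) := by ring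
      _ ≤ (z : ℝ) ^ (4 * B) := pow_le_pow_right₀ hz1 (by omega)
      _ ≤ H := by exact_mod_cast hzH
  have hzH' : z ≤ H := (Nat.le_self_pow (by omega) z).trans hzH
  have hzHr : (z : ℝ) ≤ H := by exact_mod_cast hzH'
  have hH1 : (1 : ℝ) ≤ H := hz1.trans hzHr
  have hsqrtH : √(H : ℝ) ≤ H := by
    rw [Real.sqrt_le_left (by linarith)]
    nlinarith
  set E := (H : ℝ) ^ 2 / z with hE
  have hE1 : 1 ≤ E := by
    rw [hE, le_div_iff₀ hz0]
    nlinarith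
  have hE0 : 0 ≤ E := by linarith
  have hmain : 3 / 2 * Y - 12 * E ≤ siftSum χ a z (H ^ 2) := by
    have h1 := (abs_le.1 (hsieve a ((H ^ 2 : ℕ) : ℝ) (Nat.cast_nonneg _))).1
    rw [Nat.floor_natCast, ha] at h1
    push_cast at h1
    rw [Real.sqrt_sq (by linarith)] at h1
    have h2 : (1 + 1) * ((H : ℝ) ^ 2 / q * L) * V = 2 * Y := by rw [hY]; ring
    rw [h2] at h1
    have h3 : (H : ℝ) * z ^ B ≤ E := by
      rw [hE, le_div_iff₀ hz0]
      nlinarith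
    nlinarith
  have hbad : ∀ p ∈ {p ∈ Ioo z H | p.Prime ∧ ¬ p ∣ q},
      ∑ n ∈ Icc 1 (H ^ 2) with (∀ r ∈ sievePrimes q z, ¬ r ∣ n) ∧ p ∣ n,
        classInd a n * charConv χ n ≤
      (if χ p = 1 then (5 * Y + 24 * E) * (1 / p) else 0) + 14 * (H : ℝ) ^ 2 * (1 / (p : ℝ) ^ 2) := by
    intro p hp
    obtain ⟨hp1, hp, hpq⟩ := mem_filter.1 hp
    rw [mem_Ioo] at hp1
    have hp0 : (0 : ℝ) < p := by exact_mod_cast hp.pos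
    have hpH : (p : ℝ) ≤ H := by exact_mod_cast hp1.2.le
    obtain ⟨u, hu⟩ : IsUnit (p : ZMod q) :=
      (ZMod.isUnit_iff_coprime p q).2 ((Nat.Prime.coprime_iff_not_dvd hp).2 hpq)
    have hpos : 0 ≤ 14 * (H : ℝ) ^ 2 * (1 / (p : ℝ) ^ 2) := by positivity
    rcases hq (p : ZMod q) with h | h | h
    · exact absurd h (by
        rw [← hu]
        exact (u.isUnit.map χ).ne_zero)
    · rw [if_pos h]
      refine (sum_sifted_dvd_le_of_eq_one hq a u hp hp1.1 hu.symm h _).trans ?_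
      have h1 := (abs_le.1 (hsieve (a * u⁻¹) ((H ^ 2 : ℕ) / p : ℝ) (by positivity))).2
      rw [Nat.floor_div_natCast, Nat.floor_natCast] at h1
      have h2 : χ (a * u⁻¹ : (ZMod q)ˣ) ≤ 1 :=
        (abs_le.1 (abs_character_le_one hq _)).2
      have h3 : (1 + χ (a * u⁻¹ : (ZMod q)ˣ)) * (((H ^ 2 : ℕ) / p : ℝ) / q * L) * V ≤
          2 * (Y * (1 / p)) := by
        calc _ ≤ (1 + 1) * (((H ^ 2 : ℕ) / p : ℝ) / q * L) * V := by gcongr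
          _ = _ := by
            rw [hY]
            push_cast
            ring
      have h4 : √((H ^ 2 : ℕ) / p : ℝ) * (z : ℝ) ^ B ≤ E * (1 / p) := by
        push_cast
        rw [Real.sqrt_div (by positivity), Real.sqrt_sq (by linarith)]
        have h5 : (H : ℝ) / √p = H * √p * (1 / p) := by
          rw [mul_assoc, mul_one_div, Real.sqrt_div_self']
          ring
        rw [h5, mul_right_comm]
        refine mul_le_mul_of_nonneg_right ?_ (by positivity)
        rw [hE, le_div_iff₀ hz0]
        have h6 : √(p : ℝ) ≤ √H := Real.sqrt_le_sqrt hpH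
        calc (H : ℝ) * √p * z ^ B * z = H * (√p * (z ^ B * z)) := by ring
          _ ≤ H * (√H * √H) := by gcongr
          _ = H ^ 2 := by
            rw [Real.mul_self_sqrt (by linarith)]
            ring
      linarith
    · rw [if_neg (by rw [h]; norm_num), zero_add]
      refine (sum_sifted_dvd_le_of_eq_neg_one hq a u z hp hu.symm h _).trans ?_
      have h1 := (abs_le.1 (abs_sum_classInd_charConv_sub_le hq hχ hL (a * u⁻¹ * u⁻¹)
        (y := ((H ^ 2 : ℕ) / p / p : ℝ)) (by positivity))).2
      rw [Nat.floor_div_natCast, Nat.floor_div_natCast, Nat.floor_natCast] at h1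
      have h2 : χ (a * u⁻¹ * u⁻¹ : (ZMod q)ˣ) ≤ 1 :=
        (abs_le.1 (abs_character_le_one hq _)).2
      have e1 : ((H ^ 2 : ℕ) / p / p : ℝ) = (H / p : ℝ) ^ 2 := by
        push_cast
        field_simp
      rw [e1, Real.sqrt_sq (by positivity)] at h1
      have h3 : (1 + χ (a * u⁻¹ * u⁻¹ : (ZMod q)ˣ)) * ((H / p : ℝ) ^ 2 / q * L) ≤
          2 * (H / p : ℝ) ^ 2 := by
        calc _ ≤ (1 + 1) * ((H / p : ℝ) ^ 2 / q * q) := by gcongr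
          _ = _ := by
            field_simp
            norm_num
      have h4 : (H / p : ℝ) ≤ (H / p : ℝ) ^ 2 := by
        have : 1 ≤ (H / p : ℝ) := (one_le_div hp0).2 hpH
        nlinarith
      have e2 : 14 * (H : ℝ) ^ 2 * (1 / (p : ℝ) ^ 2) = 14 * (H / p : ℝ) ^ 2 := by ring
      rw [e2]
      linarith
  have hsq : ∑ p ∈ Ioo z H with p.Prime ∧ ¬ p ∣ q, (1 : ℝ) / (p : ℝ) ^ 2 ≤ 1 / z := by
    have h1 := sum_Ioc_inv_sq_le_sub (α := ℝ) (k := z) (n := H) (by omega) hzH'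
    calc _ ≤ ∑ p ∈ Ioc z H, (1 : ℝ) / (p : ℝ) ^ 2 :=
          sum_le_sum_of_subset_of_nonneg
            ((filter_subset _ _).trans Ioo_subset_Ioc_self) fun _ _ _ => by positivity
      _ = ∑ p ∈ Ioc z H, ((p : ℝ) ^ 2)⁻¹ := by simp only [one_div]
      _ ≤ (z : ℝ)⁻¹ - (H : ℝ)⁻¹ := h1
      _ ≤ 1 / z := by
        rw [one_div]
        have : (0 : ℝ) ≤ (H : ℝ)⁻¹ := by positivity
        linarith
  have htot := (siftSum_le_add_sum hq a z hH).trans (add_le_add_right (sum_le_sum hbad) _)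
  rw [sum_add_distrib, ← sum_filter, filter_filter, ← mul_sum, ← mul_sum] at htot
  have h5 : (5 * Y + 24 * E) *
      ∑ p ∈ Ioo z H with (p.Prime ∧ ¬ p ∣ q) ∧ χ p = 1, (1 : ℝ) / p ≤
      (5 * Y + 24 * E) * (1 / 20) := mul_le_mul_of_nonneg_left hsum (by positivity)
  have h6 : 14 * (H : ℝ) ^ 2 * ∑ p ∈ Ioo z H with p.Prime ∧ ¬ p ∣ q, (1 : ℝ) / (p : ℝ) ^ 2 ≤
      14 * E := by
    calc _ ≤ 14 * (H : ℝ) ^ 2 * (1 / z) := by gcongr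
      _ = 14 * E := by rw [hE]; ring
  linarith

end Counting

theorem zpow_le_siftDensity {q : ℕ} {χ : DirichletCharacter ℝ q} (hq : χ.IsQuadratic)
    (h2 : 2 ≤ q) {z : ℕ} (hz : 2 ≤ z) (hlog : Real.log z ≤ 17304 * (q : ℝ) ^ 3) :
    ((q : ℝ) ^ 3207)⁻¹ ≤ siftDensity χ z := by
  have hq2 : (2 : ℝ) ≤ q := by exact_mod_cast h2
  have hq0 : (0 : ℝ) < q := by linarith
  have hl : 0 < 4 * Real.log z :=
    mul_pos (by norm_num) (Real.log_pos (by exact_mod_cast (by omega : 1 < z)))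
  have h17 : (2 : ℝ) ^ 17 ≤ (q : ℝ) ^ 17 := by gcongr
  have h1 : 4 * Real.log z ≤ (q : ℝ) ^ 20 := by
    have : (q : ℝ) ^ 20 = (q : ℝ) ^ 17 * (q : ℝ) ^ 3 := by ring
    have h3 : 0 < (q : ℝ) ^ 3 := by positivity
    rw [this]
    nlinarith
  have h3 : ((q : ℝ) ^ 3200)⁻¹ ≤ (4 * Real.log z) ^ (-(160 : ℝ)) := by
    refine le_trans (le_of_eq ?_) (Real.rpow_le_rpow_of_nonpos hl h1 (by norm_num))
    rw [Real.rpow_neg (by positivity), show (160 : ℝ) = ((160 : ℕ) : ℝ) by norm_num,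
      Real.rpow_natCast, ← pow_mul]
  have h4 : ((q : ℝ) ^ 7)⁻¹ ≤ Real.exp (-4) := by
    rw [Real.exp_neg]
    gcongr
    calc Real.exp 4 = Real.exp 1 ^ 4 := by rw [← Real.exp_nat_mul]; norm_num
      _ ≤ 3 ^ 4 := by
        gcongr
        exact Real.exp_one_lt_three.le
      _ ≤ 2 ^ 7 := by norm_num
      _ ≤ (q : ℝ) ^ 7 := by gcongr
  refine le_trans ?_ (le_siftDensity hq hz)
  calc ((q : ℝ) ^ 3207)⁻¹ = ((q : ℝ) ^ 7)⁻¹ * ((q : ℝ) ^ 3200)⁻¹ := by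
        rw [← mul_inv, ← pow_add]
    _ ≤ _ := by gcongr

theorem exists_pow_le_primeCount_of_sparse : ∃ (δ : ℝ) (M : ℕ), 0 < δ ∧ ∀ (q Q : ℕ) [NeZero q]
    (χ : DirichletCharacter ℝ q) (a : (ZMod q)ˣ) (m : ℕ), 2 ≤ q → Q = q ^ 64 → χ.IsQuadratic →
    χ ≠ 1 → χ a = 1 → M ≤ m →
    ∑ j ∈ range m, 𝔼 g : (ZMod q)ˣ, primeBlock Q j g * (1 + χ g) ≤ δ * (2 * m) →
    (Q : ℝ) ^ (2 * m) ≤ (Q : ℝ) ^ 51 * primeCount a (Q ^ (2 * m)) := by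
  obtain ⟨B, hB, hsieve⟩ := exists_abs_siftSum_sub_le
  have hB' : (1 : ℝ) ≤ B := by exact_mod_cast hB
  refine ⟨1 / (160 * B), 204 * B, by positivity, ?_⟩
  intro q Q _ χ a m h2 hQ hq hχ ha hm h
  have hq2 : (2 : ℝ) ≤ q := by exact_mod_cast h2
  have hq0 : (0 : ℝ) < q := by linarith
  have hqQ : q ≤ Q := hQ ▸ Nat.le_self_pow (by norm_num) q
  have hQ3 : 3 ≤ Q := by
    have := Nat.pow_le_pow_left h2 64
    omega
  have hQ1 : (1 : ℝ) ≤ Q := by exact_mod_cast (by omega : 1 ≤ Q)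
  obtain ⟨L, hL⟩ := exists_sum_character_div_sub_le hq hχ
  have hlQ : 0 < Real.log Q := Real.log_pos (by exact_mod_cast (by omega : 1 < Q))
  set j := m / (4 * B) with hj
  have hj51 : 51 ≤ j := by
    rw [hj, Nat.le_div_iff_mul_le (by omega)]
    omega
  have hjm : 4 * B * j ≤ m := Nat.mul_div_le m (4 * B)
  have hmj : m < 8 * B * j := by
    have := Nat.lt_mul_div_succ m (by omega : 0 < 4 * B)
    rw [← hj] at this
    nlinarith
  have hj_le : j ≤ m := by nlinarith
  set z := Q ^ j with hz
  have hQz : Q ≤ z := Nat.le_self_pow (by omega) Q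
  have hlogz : Real.log z = j * Real.log Q := by rw [hz, Nat.cast_pow, Real.log_pow]
  have hδ : 1 / (160 * (B : ℝ)) ≤ 1 / 8 :=
    one_div_le_one_div_of_le (by norm_num) (by linarith)
  have hmlog := mul_log_le_of_sparse hq hχ hqQ hQ3 hδ (by omega) h
  have hV := zpow_le_siftDensity hq h2 (z := z) (by omega) (by
    refine le_trans ?_ hmlog
    rw [hlogz]
    gcongr)
  have hLlow : ((q : ℝ) ^ 12)⁻¹ ≤ L := by
    refine le_trans ?_ (le_of_sum_character_div hq hχ hL)
    rw [← one_div]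
    refine one_div_le_one_div_of_le (by positivity) ?_
    have : (2 : ℝ) ^ 10 ≤ (q : ℝ) ^ 10 := by gcongr
    have h3 : (q : ℝ) ^ 12 = (q : ℝ) ^ 10 * (q : ℝ) ^ 2 := by ring
    rw [h3]
    gcongr
    linarith
  have hL0 : 0 ≤ L := le_trans (by positivity) hLlow
  have hLV : ((q : ℝ) ^ 3220)⁻¹ ≤ 1 / q * L * siftDensity χ z := by
    calc ((q : ℝ) ^ 3220)⁻¹ = 1 / q * ((q : ℝ) ^ 12)⁻¹ * ((q : ℝ) ^ 3207)⁻¹ := by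
          rw [one_div, ← mul_inv, ← mul_inv, ← pow_succ', ← pow_add]
      _ ≤ _ := by gcongr
  have hzq : (q : ℝ) ^ 3264 ≤ z := by
    have h3 : q ^ 3264 ≤ z := by
      rw [hz, hQ, ← pow_mul]
      exact Nat.pow_le_pow_right (by omega) (by omega)
    rw [← Nat.cast_pow]
    exact Nat.cast_le.2 h3
  have hH2 : (0 : ℝ) < ((Q ^ m : ℕ) : ℝ) ^ 2 := by
    have : 0 < Q ^ m := by positivity
    positivity
  have key := primeCount_ge_of_sieve hq hχ hL hB (by omega : 2 ≤ z) (H := Q ^ m)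
    (by rw [hz, ← pow_mul]
        exact Nat.pow_le_pow_right (by omega) (by linarith))
    (Nat.Prime.not_prime_pow (by omega)) (fun b y hy => hsieve q χ L hq hχ hL b z y (by omega) hy)
    ha ?_ ?_
  · rw [← pow_mul, mul_comm m 2] at key
    have h3 : ((Q ^ m : ℕ) : ℝ) ^ 2 = (Q : ℝ) ^ (2 * m) := by
      push_cast
      ring
    have h4 : ((q : ℝ) ^ 3220)⁻¹ * (Q : ℝ) ^ (2 * m) ≤ 2 * primeCount a (Q ^ (2 * m)) := by
      have := mul_le_mul_of_nonneg_right hLV (by positivity : 0 ≤ (Q : ℝ) ^ (2 * m))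
      refine this.trans ?_
      rw [h3] at key
      have e : 1 / q * L * siftDensity χ z * (Q : ℝ) ^ (2 * m) =
        (Q : ℝ) ^ (2 * m) / q * L * siftDensity χ z := by ring
      linarith
    rw [inv_mul_le_iff₀ (by positivity)] at h4
    refine h4.trans ?_
    rw [← mul_assoc]
    gcongr
    calc (q : ℝ) ^ 3220 * 2 ≤ (q : ℝ) ^ 3220 * (q : ℝ) ^ 44 := by
          gcongr
          exact hq2.trans (le_self_pow₀ (by linarith) (by norm_num))
      _ = (Q : ℝ) ^ 51 := by
        rw [hQ, Nat.cast_pow, ← pow_mul, ← pow_add]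
  · have hz1 : (1 : ℝ) < z := by exact_mod_cast (by omega : 1 < z)
    refine (sum_inv_le_of_sparse hq hqQ hQ3 h hz1 _ fun p hp => ?_).trans ?_
    · simp only [mem_filter, mem_Ioo] at hp
      exact ⟨hp.2.1.1, by omega, by exact_mod_cast hp.1.1.le, hp.1.2, hp.2.2⟩
    · have hj0 : (0 : ℝ) < j := by exact_mod_cast (by omega : 0 < j)
      rw [hlogz, ← mul_assoc, mul_div_mul_right _ _ hlQ.ne', div_le_iff₀ hj0, one_div,
        inv_mul_le_iff₀ (by positivity)]
      have : (m : ℝ) ≤ 8 * B * j := by exact_mod_cast hmj.le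
      linarith
  · have h3 : 116 * (1 / (z : ℝ)) ≤ ((q : ℝ) ^ 3220)⁻¹ := by
      rw [mul_one_div, div_le_iff₀ (by linarith [pow_pos hq0 3264]), ← div_eq_inv_mul,
        le_div_iff₀ (by positivity)]
      refine le_trans ?_ hzq
      have h4 : (2 : ℝ) ^ 7 ≤ (q : ℝ) ^ 7 := by gcongr
      calc 116 * (q : ℝ) ^ 3220 ≤ (q : ℝ) ^ 7 * (q : ℝ) ^ 3220 := by
            gcongr
            linarith
        _ = (q : ℝ) ^ 3227 := by rw [← pow_add]
        _ ≤ (q : ℝ) ^ 3264 := pow_le_pow_right₀ (by linarith) (by norm_num)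
    have h4 := mul_le_mul_of_nonneg_left (h3.trans hLV) hH2.le
    calc _ = ((Q ^ m : ℕ) : ℝ) ^ 2 * (116 * (1 / z)) := by ring
      _ ≤ _ := h4
      _ = _ := by ring

theorem log_div_sq_le_sub (n : ℕ) (hn : 1 ≤ n) :
    Real.log (n + 1 : ℕ) / ((n + 1 : ℕ) : ℝ) ^ 2 ≤
      (Real.log n + 2) / n - (Real.log (n + 1 : ℕ) + 2) / (n + 1 : ℕ) := by
  have hn' : (1 : ℝ) ≤ n := by exact_mod_cast hn
  have hn0 : (0 : ℝ) < n := by linarith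
  have h1 : Real.log (n + 1) ≤ Real.log n + 1 / n := by
    have := Real.log_le_sub_one_of_pos (show 0 < ((n : ℝ) + 1) / n by positivity)
    rw [Real.log_div (by positivity) (by positivity), add_div, div_self hn0.ne'] at this
    linarith
  have h2 : 0 ≤ Real.log ((n : ℝ) + 1) := Real.log_nonneg (by linarith)
  push_cast
  have h3 : (Real.log n + 2) / n - (Real.log (n + 1) + 2) / (n + 1) =
      ((n + 1) * Real.log n - n * Real.log (n + 1) + 2) / (n * (n + 1)) := by
    field_simp
    ring
  rw [h3]
  calc Real.log (n + 1) / ((n : ℝ) + 1) ^ 2 ≤ Real.log (n + 1) / (n * (n + 1)) := by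
        gcongr
        nlinarith
    _ ≤ _ := by
        gcongr
        have h4 : ((n : ℝ) + 1) * Real.log (n + 1) ≤ (n + 1) * (Real.log n + 1 / n) := by gcongr
        have h5 : ((n : ℝ) + 1) * (1 / n) ≤ 2 := by
          rw [mul_one_div, div_le_iff₀ hn0]
          linarith
        linarith

theorem sum_log_div_sq_le {Q : ℕ} (hQ : 1 ≤ Q) (x : ℕ) :
    ∑ n ∈ Ioc Q x, Real.log n / (n : ℝ) ^ 2 ≤ (Real.log Q + 2) / Q := by
  have h1 : ∀ k : ℕ, ∑ n ∈ Ioc Q (Q + k), Real.log n / (n : ℝ) ^ 2 ≤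
      (Real.log Q + 2) / Q - (Real.log (Q + k : ℕ) + 2) / (Q + k : ℕ) := by
    intro k
    induction k with
    | zero => simp
    | succ k ih =>
      rw [← add_assoc, sum_Ioc_succ_top (by omega)]
      have := log_div_sq_le_sub (Q + k) (by omega)
      linarith
  have h2 : ∀ k : ℕ, ∑ n ∈ Ioc Q (Q + k), Real.log n / (n : ℝ) ^ 2 ≤ (Real.log Q + 2) / Q := by
    intro k
    have h3 : 0 ≤ (Real.log (Q + k : ℕ) + 2) / (Q + k : ℕ) :=
      div_nonneg (add_nonneg (Real.log_natCast_nonneg _) (by norm_num)) (by positivity)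
    linarith [h1 k]
  rcases le_total Q x with h | h
  · simpa [Nat.add_sub_cancel' h] using h2 (x - Q)
  · rw [Ioc_eq_empty (by omega)]
    simpa using h2 0

theorem sum_rough_vonMangoldt_not_prime_le {Q : ℕ} (hQ : 1 ≤ Q) (x : ℕ) :
    ∑ n ∈ Icc 1 x with ¬ n.Prime, roughInd Q n * (vonMangoldt n / n) ≤
      2 * ((Real.log Q + 2) / Q) := by
  classical
  set T := {p ∈ Ioc Q x | p.Prime} with hT
  have hTp : ∀ p ∈ T, p.Prime := fun p hp => (mem_filter.1 hp).2
  have h1 : ∑ n ∈ Icc 1 x with ¬ n.Prime, roughInd Q n * (vonMangoldt n / n) ≤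
      ∑ n ∈ (T ×ˢ Icc 1 x).image (fun p => p.1 ^ (p.2 + 1)), vonMangoldt n / n := by
    rw [← sum_filter_add_sum_filter_not _ (fun n => roughInd Q n * (vonMangoldt n / n) ≠ 0)]
    rw [add_eq_left.2 (sum_eq_zero fun n hn => not_not.1 (mem_filter.1 hn).2)]
    refine (sum_le_sum fun n _ => mul_le_of_le_one_left
      (div_nonneg vonMangoldt_nonneg (by positivity)) (roughInd_le_one Q n)).trans
      (sum_le_sum_of_subset_of_nonneg ?_ fun _ _ _ =>
        div_nonneg vonMangoldt_nonneg (by positivity))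
    intro n hn
    rw [mem_filter, mem_filter, mem_Icc] at hn
    have hr : Rough Q n := by
      by_contra h
      exact hn.2 (by simp [roughInd, h])
    have hL : vonMangoldt n ≠ 0 := fun h => hn.2 (by simp [h])
    obtain ⟨p, a, hp, ha, rfl⟩ := (isPrimePow_nat_iff n).1 (vonMangoldt_ne_zero_iff.1 hL)
    have ha1 : a ≠ 1 := fun h => hn.1.2 (by rwa [h, pow_one])
    have hax : a ≤ x := ((Nat.lt_pow_self hp.one_lt).le).trans hn.1.1.2
    refine mem_image.2 ⟨(p, a - 1), ?_, by rw [Nat.sub_add_cancel (by omega)]⟩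
    rw [mem_product, hT, mem_filter, mem_Ioc, mem_Icc]
    exact ⟨⟨⟨hr p hp (dvd_pow_self p (by omega)),
      (Nat.le_self_pow (by omega) p).trans hn.1.1.2⟩, hp⟩, by omega, by omega⟩
  have hinj : Set.InjOn (fun p : ℕ × ℕ => p.1 ^ (p.2 + 1)) (T ×ˢ Icc 1 x : Finset (ℕ × ℕ)) := by
    rintro ⟨p, a⟩ h ⟨p', a'⟩ h' heq
    rw [mem_coe, mem_product, mem_Icc] at h h'
    simp only at heq h h'
    obtain ⟨e1, e2⟩ := (hTp p h.1).pow_inj' (hTp p' h'.1) (by omega) (by omega) heq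
    rw [e1, Nat.succ_injective e2]
  rw [sum_image hinj, sum_product] at h1
  have h2 : ∀ p ∈ T, ∑ a ∈ Icc 1 x, vonMangoldt (p ^ (a + 1)) / ((p ^ (a + 1) : ℕ) : ℝ) ≤
      2 * (Real.log p / (p : ℝ) ^ 2) := by
    intro p hp
    have hp' := hTp p hp
    have hp2 : (2 : ℝ) ≤ p := by exact_mod_cast hp'.two_le
    have h3 := sum_pow_le_two_mul (r := 1 / p) (by positivity)
      (one_div_le_one_div_of_le two_pos hp2) x
    calc _ = Real.log p / p * ∑ a ∈ Icc 1 x, (1 / (p : ℝ)) ^ a := by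
          rw [mul_sum]
          refine sum_congr rfl fun a _ => ?_
          rw [vonMangoldt_apply_pow (by omega), vonMangoldt_apply_prime hp', Nat.cast_pow, pow_succ,
            one_div, inv_pow]
          field_simp
      _ ≤ Real.log p / p * (2 * (1 / p)) :=
          mul_le_mul_of_nonneg_left h3 (div_nonneg (Real.log_natCast_nonneg p) (by positivity))
      _ = _ := by ring
  refine h1.trans ((sum_le_sum h2).trans ?_)
  rw [← mul_sum]
  refine mul_le_mul_of_nonneg_left (le_trans ?_ (sum_log_div_sq_le hQ x)) (by norm_num)
  exact sum_le_sum_of_subset_of_nonneg (filter_subset _ _) fun n _ _ =>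
    div_nonneg (Real.log_natCast_nonneg n) (by positivity)

theorem sum_Ico_pow_eq {Q : ℕ} (hQ : 1 ≤ Q) {c k : ℕ} (hck : c ≤ k) (F : ℕ → ℝ) :
    ∑ j ∈ Ico c k, ∑ n ∈ Ico (Q ^ j) (Q ^ (j + 1)), F n = ∑ n ∈ Ico (Q ^ c) (Q ^ k), F n := by
  induction k, hck using Nat.le_induction with
  | base => simp
  | succ k hck ih =>
    rw [sum_Ico_succ_top hck, ih, sum_Ico_consecutive _ (Nat.pow_le_pow_right hQ hck)
      (Nat.pow_le_pow_right hQ (Nat.le_succ k))]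

theorem pow_le_primeCount_of_one_lt {q Q : ℕ} [NeZero q] (h2 : 2 ≤ q) (hQ : Q = q ^ 64)
    (a : (ZMod q)ˣ) (W k : ℕ) (h : 1 < ∑ j ∈ Ico (k - W) k, primeBlock Q j a) :
    (Q : ℝ) ^ k ≤ k * (Q : ℝ) ^ (W + 1) * primeCount a (Q ^ k) := by
  have hq2 : (2 : ℝ) ≤ q := by exact_mod_cast h2
  have hqQ : (q : ℝ) * 2 ^ 63 ≤ Q := by
    have : q * 2 ^ 63 ≤ Q := by
      rw [hQ, pow_succ' q 63]
      exact Nat.mul_le_mul_left _ (Nat.pow_le_pow_left h2 63)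
    exact_mod_cast this
  have hQ2 : 2 ≤ Q := by
    have := Nat.le_self_pow (n := 64) (by norm_num) q
    omega
  have hQ1 : (1 : ℝ) ≤ Q := by exact_mod_cast (by omega : 1 ≤ Q)
  have hQ0 : (0 : ℝ) < Q := by linarith
  have hl : 0 < Real.log Q := Real.log_pos (by exact_mod_cast (by omega : 1 < Q))
  have hl1 : 1 / 2 ≤ Real.log Q := by
    have h3 : Real.log 2 ≤ Real.log Q := Real.log_le_log two_pos (by exact_mod_cast hQ2)
    have := Real.log_two_gt_d9
    linarith
  have hphi0 : (0 : ℝ) < q.totient := by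
    exact_mod_cast Nat.totient_pos.2 (by omega)
  have hphi : (q.totient : ℝ) ≤ q := by exact_mod_cast Nat.totient_le q
  set A : ℝ := (Q : ℝ) ^ (k - W) with hA
  have hA0 : 0 < A := by positivity
  have e1 : ∑ j ∈ Ico (k - W) k, primeBlock Q j a = q.totient / Real.log Q *
      ∑ n ∈ Ico (Q ^ (k - W)) (Q ^ k), classInd a n * (roughInd Q n * vonMangoldt n / n) := by
    rw [← sum_Ico_pow_eq (by omega) (Nat.sub_le k W), mul_sum]
    rfl
  have hpt : ∀ n ∈ Ico (Q ^ (k - W)) (Q ^ k),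
      classInd a n * (roughInd Q n * vonMangoldt n / n) ≤
        k * Real.log Q / A * (if n.Prime ∧ (n : ZMod q) = a then 1 else 0) +
          if ¬ n.Prime then roughInd Q n * (vonMangoldt n / n) else 0 := by
    intro n hn
    rw [mem_Ico] at hn
    have hn1 : A ≤ n := by
      rw [hA]
      exact_mod_cast hn.1
    have hn0 : (0 : ℝ) < n := hA0.trans_le hn1
    have hw : (0 : ℝ) ≤ vonMangoldt n / n := div_nonneg vonMangoldt_nonneg hn0.le
    have hr := roughInd_nonneg Q n
    have hr1 := roughInd_le_one Q n
    rw [mul_div_assoc]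
    by_cases hp : n.Prime
    · by_cases ha : (n : ZMod q) = a
      · rw [if_pos ⟨hp, ha⟩, if_neg (not_not.2 hp), mul_one, add_zero]
        have hlog : vonMangoldt n ≤ k * Real.log Q := by
          rw [vonMangoldt_apply_prime hp, ← Real.log_pow]
          exact Real.log_le_log hn0 (by exact_mod_cast hn.2.le)
        calc classInd a n * (roughInd Q n * (vonMangoldt n / n)) ≤
              1 * (1 * (vonMangoldt n / n)) := by
              gcongr
              exact classInd_le_one a n
          _ ≤ k * Real.log Q / A := by
              rw [one_mul, one_mul]
              gcongr
      · simp [classInd, ha, hp]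
    · rw [if_neg (fun h => hp h.1), if_pos hp, mul_zero, zero_add]
      exact mul_le_of_le_one_left (mul_nonneg hr hw) (classInd_le_one a n)
  have e2 : ∑ n ∈ Ico (Q ^ (k - W)) (Q ^ k), classInd a n * (roughInd Q n * vonMangoldt n / n) ≤
      k * Real.log Q / A * primeCount a (Q ^ k) + 2 * ((Real.log Q + 2) / Q) := by
    have hsub : Ico (Q ^ (k - W)) (Q ^ k) ⊆ Icc 1 (Q ^ k) := fun n hn => by
      rw [mem_Ico] at hn
      have : 0 < Q ^ (k - W) := by positivity
      exact mem_Icc.2 ⟨by omega, hn.2.le⟩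
    refine (sum_le_sum hpt).trans ?_
    rw [sum_add_distrib, ← mul_sum, sum_boole, ← sum_filter]
    refine add_le_add ?_ ((sum_le_sum_of_subset_of_nonneg (filter_subset_filter _ hsub)
      fun n _ _ => ?_).trans (sum_rough_vonMangoldt_not_prime_le (by omega) (Q ^ k)))
    · rw [primeCount]
      gcongr
    · exact mul_nonneg (roughInd_nonneg Q n) (div_nonneg vonMangoldt_nonneg (by positivity))
  have e3 : (1 : ℝ) < q * k / A * primeCount a (Q ^ k) + 1 / 2 := by
    rw [e1] at h
    calc (1 : ℝ) < q.totient / Real.log Q *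
          (k * Real.log Q / A * primeCount a (Q ^ k) + 2 * ((Real.log Q + 2) / Q)) :=
          h.trans_le (by gcongr)
      _ = q.totient * k / A * primeCount a (Q ^ k) +
          q.totient * 2 * (1 + 2 / Real.log Q) / Q := by
        field_simp
      _ ≤ q * k / A * primeCount a (Q ^ k) + q * 2 * (1 + 4) / Q := by
        gcongr
        rw [div_le_iff₀ hl]
        linarith
      _ ≤ _ := by
        refine add_le_add le_rfl ?_
        rw [div_le_iff₀ hQ0]
        linarith
  have e4 : A ≤ k * Q * primeCount a (Q ^ k) := by
    have e5 : q * k / A * primeCount a (Q ^ k) = (q * k * primeCount a (Q ^ k) : ℝ) / A := by ring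
    have e6 : 1 / 2 < (q * k * primeCount a (Q ^ k) : ℝ) / A := by linarith
    rw [lt_div_iff₀ hA0] at e6
    have e7 : (2 * q : ℝ) * (k * primeCount a (Q ^ k)) ≤ Q * (k * primeCount a (Q ^ k)) := by
      gcongr
      linarith
    linarith
  calc (Q : ℝ) ^ k ≤ (Q : ℝ) ^ (W + (k - W)) := pow_le_pow_right₀ hQ1 (by omega)
    _ = (Q : ℝ) ^ W * A := by rw [pow_add]
    _ ≤ (Q : ℝ) ^ W * (k * Q * primeCount a (Q ^ k)) := by gcongr
    _ = _ := by ring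

theorem exists_dirichletCharacter_of_real {q : ℕ} [NeZero q] {χ : (ZMod q)ˣ → ℝ}
    (h1 : ∀ g, χ g = 1 ∨ χ g = -1) (hmul : ∀ g h, χ (g * h) = χ g * χ h) (hne : ∃ g, χ g ≠ 1) :
    ∃ ψ : DirichletCharacter ℝ q, ψ.IsQuadratic ∧ ψ ≠ 1 ∧ ∀ g : (ZMod q)ˣ, ψ g = χ g := by
  have hone : χ 1 = 1 := by
    have h2 := hmul 1 1
    rw [one_mul] at h2
    rcases h1 1 with h | h
    · exact h
    · rw [h] at h2
      norm_num at h2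
  let f : (ZMod q)ˣ →* ℝ := ⟨⟨χ, hone⟩, hmul⟩
  refine ⟨MulChar.ofUnitHom f.toHomUnits, ?_, ?_, fun g => ?_⟩
  · intro x
    by_cases hx : IsUnit x
    · obtain ⟨u, rfl⟩ := hx
      rw [MulChar.ofUnitHom_coe, MonoidHom.coe_toHomUnits]
      exact Or.inr (h1 u)
    · exact Or.inl (MulChar.map_nonunit _ hx)
  · obtain ⟨g, hg⟩ := hne
    intro h
    have h2 := congrArg (fun ψ : DirichletCharacter ℝ q => ψ g) h
    simp only [MulChar.ofUnitHom_coe, MonoidHom.coe_toHomUnits, MulChar.one_apply_coe] at h2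
    exact hg h2
  · rw [MulChar.ofUnitHom_coe, MonoidHom.coe_toHomUnits]
    rfl

theorem exists_pow_le_primeCount : ∃ W K : ℕ, ∀ (q Q : ℕ) [NeZero q], 2 ≤ q → Q = q ^ 64 →
    ∀ (a : (ZMod q)ˣ) (m : ℕ), K ≤ m →
      Q ^ (2 * m) ≤ 2 * m * Q ^ W * primeCount a (Q ^ (2 * m)) := by
  obtain ⟨C, -, hblock⟩ := exists_primeBlock_bounds
  obtain ⟨δ, M, hδ, hsparse⟩ := exists_pow_le_primeCount_of_sparse
  obtain ⟨W, K, hchar⟩ := exists_quadratic_character_of_sparse C hδ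
  refine ⟨max (W + 1) 51, max K M + 1, ?_⟩
  intro q Q _ h2 hQ a m hm
  have hQ1 : (1 : ℝ) ≤ Q := by
    exact_mod_cast hQ ▸ Nat.one_le_pow _ _ (by omega)
  have hm1 : (1 : ℝ) ≤ m := by exact_mod_cast (by omega : 1 ≤ m)
  suffices (Q : ℝ) ^ (2 * m) ≤
      2 * m * (Q : ℝ) ^ max (W + 1) 51 * primeCount a (Q ^ (2 * m)) by exact_mod_cast this
  by_cases hwin : ∑ j ∈ Ico (2 * m - W) (2 * m), primeBlock Q j a ≤ 1
  · obtain ⟨hb1, hb2, hb3⟩ := hblock q Q h2 hQ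
    obtain ⟨χ, hχ1, hχmul, hχa, hχne, hχ⟩ := hchar (ZMod q)ˣ (fun j g => primeBlock Q j g)
      (primeBlock_nonneg Q) hb1 hb2 hb3 (2 * m) (by omega) a hwin
    obtain ⟨ψ, hψ, hψ1, hψχ⟩ := exists_dirichletCharacter_of_real hχ1 hχmul hχne
    rw [Nat.mul_div_cancel_left _ two_pos] at hχ
    refine (hsparse q Q ψ a m h2 hQ hψ hψ1 ((hψχ a).trans hχa) (by omega) ?_).trans ?_
    · simp only [hψχ]
      exact_mod_cast hχ
    · gcongr
      calc (Q : ℝ) ^ 51 ≤ 1 * (Q : ℝ) ^ max (W + 1) 51 := by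
            rw [one_mul]
            exact pow_le_pow_right₀ hQ1 (le_max_right _ _)
        _ ≤ _ := by
          gcongr
          linarith
  · refine (pow_le_primeCount_of_one_lt h2 hQ a W (2 * m) (not_le.1 hwin)).trans ?_
    push_cast
    gcongr
    exact le_max_left _ _

/-- A bound for the prime of index `n` in a residue class. -/
theorem exists_nth_prime_le : ∃ D : ℕ, ∀ q : ℕ, 2 ≤ q → ∀ (a : (ZMod q)ˣ) (n : ℕ), 1 ≤ n →
    Nat.nth (fun p : ℕ => p.Prime ∧ (p : ZMod q) = a) (n - 1) ≤
      (q ^ 64) ^ D * (n * (Nat.log 2 n + 1)) := by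
  obtain ⟨W, K, hcount⟩ := exists_pow_le_primeCount
  refine ⟨2 * W + 2 * K + 6, ?_⟩
  intro q h2 a n hn
  have : NeZero q := ⟨by omega⟩
  set Q := q ^ 64 with hQ
  have hQ4 : 4 ≤ Q := by
    have h3 := Nat.pow_le_pow_left h2 64
    omega
  set l := Nat.log 2 n with hl
  set y := n * (l + 1) with hy
  have hy0 : y ≠ 0 := by positivity
  set r := Nat.log Q y with hr
  have hry : Q ^ r ≤ y := Nat.pow_log_le_self Q hy0
  have hyr : y < Q ^ (r + 1) := Nat.lt_pow_succ_log_self (by omega) y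
  have hrl : r ≤ 2 * (l + 1) := by
    have h3 : 2 ^ l ≤ n := Nat.pow_log_le_self 2 (by omega)
    have h4 : n < 2 ^ (l + 1) := Nat.lt_pow_succ_log_self (by norm_num) n
    have h5 : l + 1 ≤ 2 ^ (l + 1) := (Nat.lt_two_pow_self).le
    have h6 : 2 ^ r ≤ 2 ^ (2 * (l + 1)) := by
      calc 2 ^ r ≤ Q ^ r := Nat.pow_le_pow_left (by omega) r
        _ ≤ y := hry
        _ ≤ 2 ^ (l + 1) * 2 ^ (l + 1) := Nat.mul_le_mul h4.le h5
        _ = 2 ^ (2 * (l + 1)) := by rw [← pow_add]; ring_nf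
    exact (Nat.pow_le_pow_iff_right (by norm_num)).1 h6
  set u := W + 2 * K + 4 with hu
  -- an even exponent slightly larger than `r + W + u`
  obtain ⟨m, hm⟩ : ∃ m, r + 1 + W + u ≤ 2 * m ∧ 2 * m ≤ r + 2 + W + u :=
    ⟨(r + 2 + W + u) / 2, by omega, by omega⟩
  have hc := hcount q Q h2 hQ a m (by omega)
  have hkn : 2 * m * n * Q ^ W ≤ Q ^ (2 * m) := by
    have h3 : 2 * m ≤ Q ^ u * (l + 1) := by
      have h4 : 2 * u + 2 ≤ Q ^ u := by
        have h5 : u + 1 ≤ 2 ^ u := Nat.lt_two_pow_self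
        have h6 : 2 ≤ 2 ^ u := Nat.le_self_pow (by omega) 2
        calc 2 * u + 2 = 2 * (u + 1) := by ring
          _ ≤ 2 ^ u * 2 ^ u := Nat.mul_le_mul h6 h5
          _ = 4 ^ u := by rw [← mul_pow]; norm_num
          _ ≤ Q ^ u := Nat.pow_le_pow_left hQ4 u
      calc 2 * m ≤ 2 * (l + 1) + 2 * u := by omega
        _ ≤ (2 * u + 2) * (l + 1) := by nlinarith
        _ ≤ Q ^ u * (l + 1) := Nat.mul_le_mul_right _ h4
    calc 2 * m * n * Q ^ W ≤ Q ^ u * (l + 1) * n * Q ^ W := by gcongr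
      _ = Q ^ (u + W) * y := by rw [hy, pow_add]; ring
      _ ≤ Q ^ (u + W) * Q ^ (r + 1) := by gcongr
      _ = Q ^ (u + W + (r + 1)) := by rw [← pow_add]
      _ ≤ Q ^ (2 * m) := Nat.pow_le_pow_right (by omega) (by omega)
  have hn_le : n ≤ primeCount a (Q ^ (2 * m)) := by
    have h3 : 0 < 2 * m * Q ^ W := by
      have : 0 < Q ^ W := by positivity
      have : 0 < m := by omega
      positivity
    refine Nat.le_of_mul_le_mul_left ?_ h3
    calc 2 * m * Q ^ W * n = 2 * m * n * Q ^ W := by ring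
      _ ≤ _ := hkn.trans hc
  have hnth : Nat.nth (fun p : ℕ => p.Prime ∧ (p : ZMod q) = a) (n - 1) < Q ^ (2 * m) + 1 := by
    classical
    refine Nat.nth_lt_of_lt_count ?_
    rw [Nat.count_eq_card_filter_range]
    refine lt_of_lt_of_le (by omega : n - 1 < n) (hn_le.trans ?_)
    rw [primeCount]
    refine card_le_card fun p hp => ?_
    rw [mem_filter, mem_Icc] at hp
    rw [mem_filter, mem_range]
    exact ⟨by omega, hp.2⟩
  calc _ ≤ Q ^ (2 * m) := Nat.lt_succ_iff.1 hnth
    _ ≤ Q ^ (r + (2 * W + 2 * K + 6)) := Nat.pow_le_pow_right (by omega) (by omega)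
    _ = Q ^ (2 * W + 2 * K + 6) * Q ^ r := by rw [add_comm, pow_add]
    _ ≤ _ := Nat.mul_le_mul_left _ hry

end Linnik

/-- **Linnik's theorem.** There is an absolute constant `L > 0` such that for all coprime
integers `a` and `q` with `q ≥ 2`, the `n`-th smallest prime `p ≡ a (mod q)` exists and
satisfies `p ≤ q^L · n·log(2n)`. -/
theorem linnik_nth_prime_in_arithmetic_progression :
    ∃ L : ℝ, 0 < L ∧
      ∀ a q : ℤ, 2 ≤ q → IsCoprime a q →
        {p : ℕ | p.Prime ∧ (p : ℤ) ≡ a [ZMOD q]}.Infinite ∧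
        ∀ n : ℕ, 1 ≤ n →
          (Nat.nth (fun p : ℕ => p.Prime ∧ (p : ℤ) ≡ a [ZMOD q]) (n - 1) : ℝ)
            ≤ (q : ℝ) ^ L * ((n : ℝ) * Real.log (2 * n)) := by
  obtain ⟨D, hD⟩ := Linnik.exists_nth_prime_le
  refine ⟨((64 * D + 2 : ℕ) : ℝ), by positivity, ?_⟩
  intro a q hq hcop
  obtain ⟨q, rfl⟩ := Int.eq_ofNat_of_zero_le (by omega : 0 ≤ q)
  have hq2 : 2 ≤ q := by exact_mod_cast hq
  have : NeZero q := ⟨by omega⟩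
  obtain ⟨u, hu⟩ : IsUnit (a : ZMod q) := (ZMod.coe_int_isUnit_iff_isCoprime a q).2 hcop.symm
  have hmod : ∀ p : ℕ, (p : ℤ) ≡ a [ZMOD q] ↔ (p : ZMod q) = u := by
    intro p
    rw [← ZMod.intCast_eq_intCast_iff, Int.cast_natCast, hu]
  simp only [hmod]
  refine ⟨Nat.infinite_setOfPred_prime_and_eq_mod u.isUnit, fun n hn => ?_⟩
  have hn' : (1 : ℝ) ≤ n := by exact_mod_cast hn
  have h1 : ((Nat.log 2 n + 1 : ℕ) : ℝ) ≤ 2 * Real.log (2 * n) := by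
    have h2 : (2 : ℝ) ^ (Nat.log 2 n + 1) ≤ 2 * n := by
      have h3 : 2 ^ Nat.log 2 n ≤ n := Nat.pow_log_le_self 2 (by omega)
      rw [pow_succ']
      exact_mod_cast Nat.mul_le_mul_left 2 h3
    have h3 := Real.log_le_log (by positivity) h2
    rw [Real.log_pow] at h3
    have h4 := Real.log_two_gt_d9
    have h5 : (0 : ℝ) ≤ ((Nat.log 2 n + 1 : ℕ) : ℝ) := Nat.cast_nonneg _
    nlinarith
  have hq2' : (2 : ℝ) ≤ q := by exact_mod_cast hq2
  have hlog : 0 ≤ Real.log (2 * n) := Real.log_nonneg (by linarith)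
  calc (Nat.nth (fun p : ℕ => p.Prime ∧ (p : ZMod q) = u) (n - 1) : ℝ) ≤
        (((q ^ 64) ^ D * (n * (Nat.log 2 n + 1)) : ℕ) : ℝ) := Nat.cast_le.2 (hD q hq2 u n hn)
    _ = (q : ℝ) ^ (64 * D) * (n * ((Nat.log 2 n + 1 : ℕ) : ℝ)) := by
        push_cast
        rw [pow_mul]
    _ ≤ (q : ℝ) ^ (64 * D) * (n * (2 * Real.log (2 * n))) := by gcongr
    _ = (q : ℝ) ^ (64 * D) * 2 * (n * Real.log (2 * n)) := by ring
    _ ≤ (q : ℝ) ^ (64 * D) * (q : ℝ) ^ 2 * (n * Real.log (2 * n)) := by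
        gcongr
        nlinarith
    _ = ((q : ℤ) : ℝ) ^ ((64 * D + 2 : ℕ) : ℝ) * (n * Real.log (2 * n)) := by
        rw [Real.rpow_natCast, pow_add, Int.cast_natCast]
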